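/- For every ε > 0 there exists a constant C = C(ε) > 0 such that the following holds. Let q be an odd positive integer, let q₀ be a positive divisor of q, let 1 ≤ T₀ ≤ T be real numbers, and let χ be a primitive Dirichlet character of conductor q. Then ∫_T^{T+T₀} Σ_{ψ mod q₀} |L(1/2 + it, χ·ψ)|² dt ≤ C (qT)^ε (T₀ + T₀^{-1/2} T^{1/2}) (q₀ + q₀^{-1/2} q^{1/2}), where the sum runs over all Dirichlet characters ψ modulo q₀ and L(s, χ·ψ) is the Dirichlet L-function of the character χ·ψ modulo q. -/

import Mathlib

open Polynomial in
/-- If the power sums of a finite family of complex numbers grow at most like `A ^ s`, then every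
member of the family has absolute value at most `A`. -/
theorem norm_le_of_powerSum_le {ι : Type*} [Fintype ι] (l : ι → ℂ) (A K : ℝ) (hA : 0 < A)
    (h : ∀ s : ℕ, 1 ≤ s → ‖∑ i, l i ^ s‖ ≤ K * A ^ s) (i₀ : ι) : ‖l i₀‖ ≤ A := by
  classical
  set P : ℂ[X] := ∏ z ∈ (Finset.univ.image l).erase (l i₀), (X - C z) with hP
  have hP0 : P.eval (l i₀) ≠ 0 := by
    rw [hP, eval_prod, Finset.prod_ne_zero_iff]
    intro z hz
    simpa [sub_eq_zero] using (Finset.mem_erase.1 hz).1.symm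
  have hP1 : ∀ i, l i ≠ l i₀ → P.eval (l i) = 0 := by
    intro i hi
    rw [hP, eval_prod]
    refine Finset.prod_eq_zero (i := l i) (by simp [hi]) (by simp)
  set m := (Finset.univ.filter fun i => l i = l i₀).card with hm
  have hm1 : 1 ≤ m := Finset.card_pos.2 ⟨i₀, by simp⟩
  have hsum : ∀ s, ∑ i, l i ^ s * P.eval (l i) = m * (l i₀ ^ s * P.eval (l i₀)) := by
    intro s
    rw [← Finset.sum_filter_add_sum_filter_not Finset.univ (fun i => l i = l i₀),
      Finset.sum_eq_zero (s := Finset.univ.filter fun i => ¬ l i = l i₀)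
        (fun i hi => by rw [hP1 i (Finset.mem_filter.1 hi).2, mul_zero]), add_zero,
      Finset.sum_congr rfl (g := fun _ => l i₀ ^ s * P.eval (l i₀))
        (fun i hi => by rw [(Finset.mem_filter.1 hi).2])]
    simp [hm]
  have hsum2 : ∀ s, ∑ i, l i ^ s * P.eval (l i) =
      ∑ j ∈ Finset.range (P.natDegree + 1), P.coeff j * ∑ i, l i ^ (s + j) := by
    intro s
    simp only [eval_eq_sum_range, Finset.mul_sum]
    rw [Finset.sum_comm]
    refine Finset.sum_congr rfl fun i _ => Finset.sum_congr rfl fun j _ => ?_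
    rw [pow_add]; ring
  set K' := ∑ j ∈ Finset.range (P.natDegree + 1), ‖P.coeff j‖ * (K * A ^ j)
  have hbound : ∀ s : ℕ, 1 ≤ s → ‖l i₀‖ ^ s * ‖P.eval (l i₀)‖ ≤ K' * A ^ s := by
    intro s hs
    have h1 : ‖l i₀‖ ^ s * ‖P.eval (l i₀)‖ ≤ ‖∑ i, l i ^ s * P.eval (l i)‖ := by
      rw [hsum, norm_mul, norm_mul, norm_pow, Complex.norm_natCast]
      have : (1 : ℝ) ≤ m := by exact_mod_cast hm1
      nlinarith [mul_nonneg (pow_nonneg (norm_nonneg (l i₀)) s) (norm_nonneg (P.eval (l i₀)))]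
    refine h1.trans ?_
    rw [hsum2, Finset.sum_mul]
    refine norm_sum_le_of_le _ fun j _ => ?_
    rw [norm_mul, mul_assoc]
    refine mul_le_mul_of_nonneg_left ((h _ (by omega)).trans (le_of_eq ?_)) (norm_nonneg _)
    rw [pow_add]; ring
  by_contra! hcon
  have hr : 1 < ‖l i₀‖ / A := (one_lt_div hA).2 hcon
  have hPpos : 0 < ‖P.eval (l i₀)‖ := norm_pos_iff.2 hP0
  obtain ⟨s, hs⟩ := pow_unbounded_of_one_lt (K' / ‖P.eval (l i₀)‖) hr
  have hlt := hs.trans_le (pow_le_pow_right₀ hr.le (Nat.le_succ s))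
  have := hbound (s + 1) (by omega)
  rw [div_lt_iff₀ hPpos, div_pow, div_mul_eq_mul_div, lt_div_iff₀ (pow_pos hA _)] at hlt
  exact absurd this (not_le.2 hlt)

open Polynomial in
/-- The monic polynomial of degree `m` with prescribed lower coefficients. -/
noncomputable def monicOfCoeffs {k : Type*} [Field k] {m : ℕ} (v : Fin m → k) : k[X] :=
  X ^ m + ∑ i : Fin m, C (v i) * X ^ (i : ℕ)

open Polynomial in
theorem degree_sum_coeffs_lt {k : Type*} [Field k] {m : ℕ} (v : Fin m → k) :
    (∑ i : Fin m, C (v i) * X ^ (i : ℕ)).degree < (m : WithBot ℕ) := by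
  refine (degree_sum_le _ _).trans_lt ?_
  rw [Finset.sup_lt_iff (by exact WithBot.bot_lt_coe m)]
  intro t _
  refine (degree_C_mul_X_pow_le _ _).trans_lt ?_
  exact_mod_cast t.2

open Polynomial in
theorem monicOfCoeffs_monic {k : Type*} [Field k] {m : ℕ} (v : Fin m → k) :
    (monicOfCoeffs v).Monic := by
  rw [monicOfCoeffs]
  exact monic_X_pow_add (degree_sum_coeffs_lt v)

open Polynomial in
theorem monicOfCoeffs_natDegree {k : Type*} [Field k] {m : ℕ} (v : Fin m → k) :
    (monicOfCoeffs v).natDegree = m := by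
  rw [monicOfCoeffs]
  refine natDegree_eq_of_degree_eq_some ?_
  rw [degree_add_eq_left_of_degree_lt, degree_X_pow]
  rw [degree_X_pow]; exact degree_sum_coeffs_lt v

open Polynomial in
theorem monicOfCoeffs_coeff {k : Type*} [Field k] {m : ℕ} (v : Fin m → k) (i : Fin m) :
    (monicOfCoeffs v).coeff i = v i := by
  have hi : (i : ℕ) ≠ m := i.2.ne
  simp only [monicOfCoeffs, coeff_add, finsetSum_coeff, coeff_C_mul, coeff_X_pow, hi, if_false,
    zero_add]
  rw [Finset.sum_eq_single i]
  · simp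
  · intro b _ hb
    have : (i : ℕ) ≠ b := fun h => hb (Fin.ext h.symm)
    simp [this]
  · simp

open Polynomial in
theorem monicOfCoeffs_injective {k : Type*} [Field k] {m : ℕ} :
    Function.Injective (monicOfCoeffs : (Fin m → k) → k[X]) := by
  intro v w h
  ext i
  rw [← monicOfCoeffs_coeff v i, h, monicOfCoeffs_coeff]

open Polynomial Classical in
/-- The monic polynomials of degree `m` over a finite field. -/
noncomputable def monicsOfDegree (k : Type*) [Field k] [Fintype k] (m : ℕ) : Finset k[X] :=
  (Finset.univ : Finset (Fin m → k)).image monicOfCoeffs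

open Polynomial in
theorem mem_monicsOfDegree {k : Type*} [Field k] [Fintype k] {m : ℕ} {P : k[X]} :
    P ∈ monicsOfDegree k m ↔ P.Monic ∧ P.natDegree = m := by
  simp only [monicsOfDegree, Finset.mem_image, Finset.mem_univ, true_and]
  constructor
  · rintro ⟨v, rfl⟩
    exact ⟨monicOfCoeffs_monic v, monicOfCoeffs_natDegree v⟩
  · rintro ⟨h1, rfl⟩
    refine ⟨fun i => P.coeff i, ?_⟩
    ext i
    rcases lt_trichotomy i P.natDegree with h | h | h
    · exact monicOfCoeffs_coeff (fun i : Fin P.natDegree => P.coeff i) ⟨i, h⟩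
    · have h2 := monicOfCoeffs_monic (fun i : Fin P.natDegree => P.coeff i)
      rw [h, h1.coeff_natDegree]
      rwa [Monic, leadingCoeff, monicOfCoeffs_natDegree] at h2
    · rw [coeff_eq_zero_of_natDegree_lt h, coeff_eq_zero_of_natDegree_lt]
      rwa [monicOfCoeffs_natDegree]

open Polynomial Classical in
theorem sum_monicsOfDegree {k : Type*} [Field k] [Fintype k] (m : ℕ) (F : k[X] → ℂ) :
    ∑ P ∈ monicsOfDegree k m, F P = ∑ v : Fin m → k, F (monicOfCoeffs v) := by
  rw [monicsOfDegree, Finset.sum_image (fun a _ b _ h => monicOfCoeffs_injective h)]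

open Polynomial Classical in
/-- The monic irreducible polynomials of degree `m` over a finite field. -/
noncomputable def irredsOfDegree (k : Type*) [Field k] [Fintype k] (m : ℕ) : Finset k[X] :=
  (monicsOfDegree k m).filter Irreducible

open Polynomial in
/-- The power sums attached to a function on monic irreducible polynomials. -/
noncomputable def irredPowerSum {k : Type*} [Field k] [Fintype k] (F : k[X] → ℂ) (j : ℕ) : ℂ :=
  ∑ d ∈ j.divisors, ∑ P ∈ irredsOfDegree k d, (d : ℂ) * F P ^ (j / d)

open Polynomial Classical in
/-- The degree of a monic polynomial counted through the prime powers dividing it. -/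
theorem sum_irreds_dvd_eq_natDegree {k : Type*} [Field k] [Fintype k] (m : ℕ) {P : k[X]}
    (hP : P ∈ monicsOfDegree k m) :
    ∑ j ∈ Finset.Icc 1 m, ∑ d ∈ j.divisors, ∑ π ∈ irredsOfDegree k d,
      (if π ^ (j / d) ∣ P then d else 0) = m := by
  obtain ⟨hmon, hdeg⟩ := mem_monicsOfDegree.1 hP
  have hP0 := hmon.ne_zero
  set S := UniqueFactorizationMonoid.normalizedFactors P with hS
  have hfac : (S.map natDegree).sum = m := by
    have h1 : S.prod = P := by
      rw [hS, UniqueFactorizationMonoid.prod_normalizedFactors_eq hP0, hmon.normalize_eq_self]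
    rw [← hdeg, ← h1, natDegree_multiset_prod]
    exact UniqueFactorizationMonoid.zero_notMem_normalizedFactors P
  have hmem : ∀ π, π ∈ S ↔ π.Monic ∧ Irreducible π ∧ π ∣ P := by
    intro π
    rw [hS, UniqueFactorizationMonoid.mem_normalizedFactors_iff' hP0]
    constructor
    · rintro ⟨h1, h2, h3⟩
      exact ⟨h2 ▸ monic_normalize h1.ne_zero, h1, h3⟩
    · rintro ⟨h1, h2, h3⟩
      exact ⟨h2, h1.normalize_eq_self, h3⟩
  have hpow : ∀ π, π.Monic → Irreducible π → ∀ e, π ^ e ∣ P ↔ e ≤ S.count π := by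
    intro π h1 h2 e
    rw [pow_dvd_iff_le_emultiplicity,
      UniqueFactorizationMonoid.emultiplicity_eq_count_normalizedFactors h2 hP0,
      h1.normalize_eq_self]
    exact_mod_cast Iff.rfl
  have hcount : ∀ π ∈ S, S.count π * π.natDegree ≤ m := by
    intro π hπ
    obtain ⟨h1, h2, -⟩ := (hmem π).1 hπ
    have := natDegree_le_of_dvd ((hpow π h1 h2 _).2 le_rfl) hP0
    rwa [natDegree_pow, hdeg] at this
  have hrhs : m = ∑ π ∈ S.toFinset, ∑ e ∈ Finset.Icc 1 (S.count π), π.natDegree := by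
    rw [← hfac, Finset.sum_multiset_map_count]
    simp
  conv_rhs => rw [hrhs]
  rw [Finset.sum_sigma' S.toFinset]
  simp_rw [Finset.sum_sigma', ← Finset.sum_filter]
  symm
  refine Finset.sum_bij' (fun x _ => ⟨x.2 * x.1.natDegree, x.1.natDegree, x.1⟩)
    (fun y _ => ⟨y.2.2, y.1 / y.2.1⟩) ?_ ?_ ?_ ?_ ?_
  · rintro ⟨π, e⟩ hx
    simp only [Finset.mem_sigma, Multiset.mem_toFinset, Finset.mem_Icc] at hx
    obtain ⟨h1, h2, h3⟩ := (hmem π).1 hx.1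
    have hpos : 0 < π.natDegree := h2.natDegree_pos
    have h4 := hcount π hx.1
    have h5 : e * π.natDegree ≤ S.count π * π.natDegree := Nat.mul_le_mul_right _ hx.2.2
    have h6 : 1 * 1 ≤ e * π.natDegree := Nat.mul_le_mul hx.2.1 hpos
    simp only [Finset.mem_filter, Finset.mem_sigma, Finset.mem_Icc, Nat.mem_divisors,
      irredsOfDegree, mem_monicsOfDegree]
    refine ⟨⟨⟨by omega, by omega⟩, ⟨Dvd.intro_left _ rfl, by omega⟩, ⟨h1, trivial⟩, h2⟩, ?_⟩
    rw [Nat.mul_div_cancel _ hpos]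
    exact (hpow π h1 h2 _).2 hx.2.2
  · rintro ⟨j, d, π⟩ hy
    simp only [Finset.mem_filter, Finset.mem_sigma, Finset.mem_Icc, Nat.mem_divisors,
      irredsOfDegree, mem_monicsOfDegree] at hy
    obtain ⟨⟨⟨hj1, hj2⟩, ⟨⟨e, he⟩, hj0⟩, ⟨h1, h1'⟩, h2⟩, h3⟩ := hy
    have hd : 0 < d := Nat.pos_of_ne_zero (by rintro rfl; simp at he; omega)
    have he0 : 0 < e := Nat.pos_of_ne_zero (by rintro rfl; simp at he; omega)
    have hje : j / d = e := by rw [he, Nat.mul_div_cancel_left _ hd]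
    simp only [Finset.mem_sigma, Multiset.mem_toFinset, Finset.mem_Icc]
    rw [hje] at h3 ⊢
    refine ⟨(hmem π).2 ⟨h1, h2, (dvd_pow_self π he0.ne').trans h3⟩, he0, (hpow π h1 h2 e).1 h3⟩
  · rintro ⟨π, e⟩ hx
    simp only [Finset.mem_sigma, Multiset.mem_toFinset, Finset.mem_Icc] at hx
    obtain ⟨h1, h2, h3⟩ := (hmem π).1 hx.1
    simp [Nat.mul_div_cancel _ h2.natDegree_pos]
  · rintro ⟨j, d, π⟩ hy
    simp only [Finset.mem_filter, Finset.mem_sigma, Finset.mem_Icc, Nat.mem_divisors,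
      irredsOfDegree, mem_monicsOfDegree] at hy
    obtain ⟨⟨⟨hj1, hj2⟩, ⟨hdj, hj0⟩, ⟨h1, h1'⟩, h2⟩, h3⟩ := hy
    simp [h1', Nat.div_mul_cancel hdj]
  · rintro ⟨π, e⟩ hx
    rfl

open Polynomial Classical in
/-- Newton's identities for the `L`-function of a completely multiplicative function. -/
theorem newton_monics {k : Type*} [Field k] [Fintype k] (F : k[X] → ℂ)
    (hF1 : F 1 = 1) (hF : ∀ P Q : k[X], P.Monic → Q.Monic → F (P * Q) = F P * F Q) (m : ℕ) :
    (m : ℂ) * ∑ P ∈ monicsOfDegree k m, F P =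
      ∑ j ∈ Finset.Icc 1 m, irredPowerSum F j * ∑ P ∈ monicsOfDegree k (m - j), F P := by
  have hFpow : ∀ (P : k[X]), P.Monic → ∀ e, F (P ^ e) = F P ^ e := by
    intro P hP e
    induction e with
    | zero => simp [hF1]
    | succ e ih => rw [pow_succ, hF _ _ (hP.pow e) hP, ih, pow_succ]
  have key : ∀ j ∈ Finset.Icc 1 m, irredPowerSum F j * ∑ P ∈ monicsOfDegree k (m - j), F P =
      ∑ d ∈ j.divisors, ∑ π ∈ irredsOfDegree k d, ∑ P ∈ monicsOfDegree k m,
        ((if π ^ (j / d) ∣ P then d else 0 : ℕ) : ℂ) * F P := by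
    intro j hj
    rw [irredPowerSum, Finset.sum_mul]
    refine Finset.sum_congr rfl fun d hd => ?_
    rw [Finset.sum_mul]
    refine Finset.sum_congr rfl fun π hπ => ?_
    simp only [irredsOfDegree, Finset.mem_filter, mem_monicsOfDegree] at hπ
    obtain ⟨⟨h1, h1'⟩, h2⟩ := hπ
    have hdj := (Nat.mem_divisors.1 hd).1
    have hdeg : (π ^ (j / d)).natDegree = j := by
      rw [natDegree_pow, h1', Nat.div_mul_cancel hdj]
    have hmon : (π ^ (j / d)).Monic := h1.pow _
    have hjm := Finset.mem_Icc.1 hj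
    simp only [Nat.cast_ite, Nat.cast_zero, ite_mul, zero_mul]
    rw [← Finset.sum_filter, Finset.mul_sum]
    refine Finset.sum_bij (fun R _ => π ^ (j / d) * R) ?_ ?_ ?_ ?_
    · intro R hR
      obtain ⟨h3, h4⟩ := mem_monicsOfDegree.1 hR
      rw [Finset.mem_filter, mem_monicsOfDegree]
      refine ⟨⟨hmon.mul h3, ?_⟩, dvd_mul_right _ _⟩
      rw [hmon.natDegree_mul h3, hdeg, h4]; omega
    · intro R _ R' _ h
      exact mul_left_cancel₀ hmon.ne_zero h
    · intro P hP
      rw [Finset.mem_filter, mem_monicsOfDegree] at hP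
      obtain ⟨⟨h3, h4⟩, R, rfl⟩ := hP
      have hR := hmon.of_mul_monic_left h3
      refine ⟨R, mem_monicsOfDegree.2 ⟨hR, ?_⟩, rfl⟩
      rw [hmon.natDegree_mul hR, hdeg] at h4; omega
    · intro R hR
      rw [hF _ _ hmon (mem_monicsOfDegree.1 hR).1, hFpow π h1, mul_assoc]
  rw [Finset.sum_congr rfl key, Finset.mul_sum]
  have swap : ∀ j, ∑ d ∈ j.divisors, ∑ π ∈ irredsOfDegree k d, ∑ P ∈ monicsOfDegree k m,
        ((if π ^ (j / d) ∣ P then d else 0 : ℕ) : ℂ) * F P =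
      ∑ P ∈ monicsOfDegree k m, ∑ d ∈ j.divisors, ∑ π ∈ irredsOfDegree k d,
        ((if π ^ (j / d) ∣ P then d else 0 : ℕ) : ℂ) * F P := by
    intro j
    rw [Finset.sum_comm]
    exact Finset.sum_congr rfl fun d _ => Finset.sum_comm
  simp_rw [swap]
  rw [Finset.sum_comm]
  refine Finset.sum_congr rfl fun P hP => ?_
  conv_lhs => rw [← sum_irreds_dvd_eq_natDegree m hP]
  push_cast
  simp_rw [Finset.sum_mul]

/-- Power sums determined by Newton's identities with only two nonzero coefficients. -/
theorem powerSum_of_newton (c S : ℕ → ℂ) (h0 : c 0 = 1) (hc : ∀ m, 3 ≤ m → c m = 0)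
    (h : ∀ m : ℕ, (m : ℂ) * c m = ∑ j ∈ Finset.Icc 1 m, S j * c (m - j)) :
    ∃ α β : ℂ, ∀ n : ℕ, 1 ≤ n → S n = -(α ^ n + β ^ n) := by
  obtain ⟨δ, hδ⟩ := IsAlgClosed.exists_pow_nat_eq (c 1 ^ 2 - 4 * c 2) (n := 2) (by norm_num)
  set α := (-c 1 + δ) / 2 with hα
  set β := (-c 1 - δ) / 2 with hβ
  have hsum : c 1 = -(α + β) := by rw [hα, hβ]; ring
  have hprod : c 2 = α * β := by
    rw [hα, hβ]; linear_combination (1 / 4 : ℂ) * hδ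
  refine ⟨α, β, fun n => ?_⟩
  induction n using Nat.strong_induction_on with
  | _ n ih =>
    intro hn
    have h1 := h n
    obtain ⟨n, rfl⟩ : ∃ n', n = n' + 1 := ⟨n - 1, by omega⟩
    rcases n with _ | _ | n
    · simp [h0] at h1
      simp [← h1, hsum]
    · have h2 := ih 1 (by omega) le_rfl
      rw [show Finset.Icc 1 (0 + 1 + 1) = {1, 2} by decide] at h1
      rw [Finset.sum_pair (by norm_num)] at h1
      norm_num [h0] at h1
      rw [h2, hsum, hprod] at h1
      simp only [zero_add, Nat.reduceAdd]
      linear_combination -h1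
    · rw [hc _ (by omega), mul_zero] at h1
      have h2 := ih (n + 1) (by omega) (by omega)
      have h3 := ih (n + 2) (by omega) (by omega)
      have hz : ∑ j ∈ Finset.Icc 1 (n + 1 + 1 + 1), S j * c (n + 1 + 1 + 1 - j) =
          ∑ j ∈ ({n + 1, n + 2, n + 3} : Finset ℕ), S j * c (n + 1 + 1 + 1 - j) := by
        symm
        refine Finset.sum_subset ?_ ?_
        · intro j hj
          simp only [Finset.mem_insert, Finset.mem_singleton] at hj
          rw [Finset.mem_Icc]; omega
        · intro j hj hj2
          simp only [Finset.mem_insert, Finset.mem_singleton, Finset.mem_Icc] at hj hj2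
          rw [hc _ (by omega), mul_zero]
      rw [hz, Finset.sum_insert (by simp), Finset.sum_pair (by simp)] at h1
      have e1 : n + 1 + 1 + 1 - (n + 1) = 2 := by omega
      have e2 : n + 1 + 1 + 1 - (n + 2) = 1 := by omega
      have e3 : n + 1 + 1 + 1 - (n + 3) = 0 := by omega
      rw [e1, e2, e3, h0, h2, h3, hsum, hprod] at h1
      have : S (n + 3) = -(α ^ (n + 3) + β ^ (n + 3)) := by linear_combination -h1
      exact this

open Polynomial IntermediateField in
theorem norm_eq_minpoly_coeff_pow {k K : Type*} [Field k] [Field K] [Algebra k K]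
    [FiniteDimensional k K] (x : K) :
    Algebra.norm k x = ((-1) ^ (minpoly k x).natDegree * (minpoly k x).coeff 0) ^
      (Module.finrank k K / (minpoly k x).natDegree) := by
  have hx : IsIntegral k x := .of_finite k x
  have h1 := Algebra.PowerBasis.norm_gen_eq_coeff_zero_minpoly
    (IntermediateField.adjoin.powerBasis hx)
  rw [IntermediateField.adjoin.powerBasis_gen, IntermediateField.minpoly_gen,
    IntermediateField.adjoin.powerBasis_dim] at h1
  rw [Algebra.norm_eq_norm_adjoin, h1]
  congr 1
  have h2 := Module.finrank_mul_finrank k k⟮x⟯ K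
  rw [IntermediateField.adjoin.finrank hx] at h2
  rw [← h2, Nat.mul_div_cancel_left _ (minpoly.natDegree_pos hx)]

open Polynomial IntermediateField in
theorem trace_eq_minpoly_nextCoeff {k K : Type*} [Field k] [Field K] [Algebra k K]
    [FiniteDimensional k K] (x : K) :
    Algebra.trace k K x = (Module.finrank k K / (minpoly k x).natDegree) •
      (-(minpoly k x).nextCoeff) := by
  have hx : IsIntegral k x := .of_finite k x
  have h1 := PowerBasis.trace_gen_eq_nextCoeff_minpoly
    (IntermediateField.adjoin.powerBasis hx)
  rw [IntermediateField.adjoin.powerBasis_gen, IntermediateField.minpoly_gen] at h1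
  rw [trace_eq_trace_adjoin, h1]
  congr 1
  have h2 := Module.finrank_mul_finrank k k⟮x⟯ K
  rw [IntermediateField.adjoin.finrank hx] at h2
  rw [← h2, Nat.mul_div_cancel_left _ (minpoly.natDegree_pos hx)]

open Polynomial IntermediateField in
theorem minpoly_inv_eq {k K : Type*} [Field k] [Field K] [Algebra k K]
    [FiniteDimensional k K] {x : K} (hx0 : x ≠ 0) :
    minpoly k x⁻¹ = C ((minpoly k x).coeff 0)⁻¹ * (minpoly k x).reverse := by
  have hx : IsIntegral k x := .of_finite k x
  have hx' : IsIntegral k x⁻¹ := .of_finite k x⁻¹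
  have hc : (minpoly k x).coeff 0 ≠ 0 := minpoly.coeff_zero_ne_zero hx hx0
  have hdeg : (minpoly k x).reverse.natDegree = (minpoly k x).natDegree := by
    rw [reverse_natDegree, natTrailingDegree_eq_zero_of_constantCoeff_ne_zero (by simpa using hc),
      Nat.sub_zero]
  have hd' : (minpoly k x⁻¹).natDegree = (minpoly k x).natDegree := by
    rw [← IntermediateField.adjoin.finrank hx, ← IntermediateField.adjoin.finrank hx']
    have : k⟮x⁻¹⟯ = k⟮x⟯ := by
      apply le_antisymm
      · rw [IntermediateField.adjoin_simple_le_iff]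
        exact inv_mem (IntermediateField.mem_adjoin_simple_self k x)
      · rw [IntermediateField.adjoin_simple_le_iff]
        have := inv_mem (IntermediateField.mem_adjoin_simple_self k x⁻¹)
        rwa [inv_inv] at this
    rw [this]
  have hlead : (minpoly k x).reverse.leadingCoeff = (minpoly k x).coeff 0 := by
    rw [reverse_leadingCoeff, trailingCoeff,
      natTrailingDegree_eq_zero_of_constantCoeff_ne_zero (by simpa using hc)]
  have hmon : (C ((minpoly k x).coeff 0)⁻¹ * (minpoly k x).reverse).Monic := by
    rw [Monic, leadingCoeff_mul, leadingCoeff_C, hlead, inv_mul_cancel₀ hc]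
  symm
  refine minpoly.unique_of_degree_le_degree_minpoly k x⁻¹ hmon ?_ ?_
  · let _ := invertibleOfNonzero hx0
    have h0 := (eval₂_reverse_eq_zero_iff (algebraMap k K) x (minpoly k x)).2 (minpoly.aeval k x)
    rw [invOf_eq_inv] at h0
    rw [map_mul, aeval_def x⁻¹ (minpoly k x).reverse, h0, mul_zero]
  · rw [degree_eq_natDegree hmon.ne_zero, degree_eq_natDegree (minpoly.ne_zero hx'), hd',
      natDegree_C_mul (inv_ne_zero hc), hdeg]

open Polynomial IntermediateField in
theorem trace_inv_eq_minpoly_coeff {k K : Type*} [Field k] [Field K] [Algebra k K]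
    [FiniteDimensional k K] {x : K} (hx0 : x ≠ 0) :
    Algebra.trace k K x⁻¹ = (Module.finrank k K / (minpoly k x).natDegree) •
      (-((minpoly k x).coeff 1 / (minpoly k x).coeff 0)) := by
  have hx : IsIntegral k x := .of_finite k x
  have hx' : IsIntegral k x⁻¹ := .of_finite k x⁻¹
  have hc : (minpoly k x).coeff 0 ≠ 0 := minpoly.coeff_zero_ne_zero hx hx0
  have hpos := minpoly.natDegree_pos hx
  have hdeg : (minpoly k x).reverse.natDegree = (minpoly k x).natDegree := by
    rw [reverse_natDegree, natTrailingDegree_eq_zero_of_constantCoeff_ne_zero (by simpa using hc),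
      Nat.sub_zero]
  rw [trace_eq_minpoly_nextCoeff, minpoly_inv_eq hx0, natDegree_C_mul (inv_ne_zero hc), hdeg]
  congr 2
  rw [nextCoeff_of_natDegree_pos (by rw [natDegree_C_mul (inv_ne_zero hc), hdeg]; exact hpos),
    natDegree_C_mul (inv_ne_zero hc), hdeg, coeff_C_mul, coeff_reverse,
    revAt_le (Nat.sub_le _ _), Nat.sub_sub_self hpos, div_eq_inv_mul]

open Polynomial Classical in
/-- Sums over a finite extension field in terms of monic irreducible polynomials. -/
theorem sum_minpoly_eq_irredPowerSum {k K : Type*} [Field k] [Field K] [Algebra k K] [Fintype k]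
    [Fintype K] (F : k[X] → ℂ) :
    ∑ x : K, F (minpoly k x) ^ (Module.finrank k K / (minpoly k x).natDegree) =
      irredPowerSum F (Module.finrank k K) := by
  set n := Module.finrank k K with hn
  have hn0 : n ≠ 0 := Module.finrank_pos.ne'
  have h_int : ∀ x : K, IsIntegral k x := fun x => .of_finite k x
  rw [irredPowerSum, Finset.sum_sigma']
  rw [← Finset.sum_fiberwise_of_maps_to (s := Finset.univ)
      (t := n.divisors.sigma (irredsOfDegree k))
    (g := fun x : K => (⟨(minpoly k x).natDegree, minpoly k x⟩ : Σ _ : ℕ, k[X]))]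
  · refine Finset.sum_congr rfl fun y hy => ?_
    obtain ⟨d, π⟩ := y
    simp only [Finset.mem_sigma, Nat.mem_divisors, irredsOfDegree, Finset.mem_filter,
      mem_monicsOfDegree] at hy
    obtain ⟨⟨hd, -⟩, ⟨h1, h2⟩, h3⟩ := hy
    have hroot : ∀ x : K, (⟨(minpoly k x).natDegree, minpoly k x⟩ : Σ _ : ℕ, k[X]) = ⟨d, π⟩ ↔
        aeval x π = 0 := by
      intro x
      constructor
      · intro h
        rw [Sigma.mk.injEq] at h
        rw [← eq_of_heq h.2, minpoly.aeval]
      · intro h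
        have := minpoly.eq_of_irreducible_of_monic h3 h h1
        rw [← this, h2]
    simp_rw [hroot]
    rw [Finset.sum_congr rfl (g := fun _ => F π ^ (n / d))]
    · rw [Finset.sum_const, nsmul_eq_mul]
      congr 1
      have hsep : π.Separable := PerfectField.separable_of_irreducible h3
      have hsplit : (π.map (algebraMap k K)).Splits := by
        have := (Irreducible.natDegree_dvd_iff_dvd_X_pow_card_pow_sub_X h3 (n := n)).1 (h2 ▸ hd)
        refine Splits.of_dvd ?_ ?_ (map_dvd (mapRingHom (algebraMap k K)) this)
        · have := (FiniteField.isSplittingField_sub K k).splits'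
          rw [← Module.natCard_eq_pow_finrank, Nat.card_eq_fintype_card]
          exact this
        · have := FiniteField.X_pow_card_pow_sub_X_ne_zero k hn0 (Finite.one_lt_card (α := k))
          exact (Polynomial.map_ne_zero_iff (algebraMap k K).injective).2 this
      have h4 := card_rootSet_eq_natDegree hsep hsplit
      rw [h2] at h4
      rw [← h4, ← Set.toFinset_card]
      congr 2
      ext x
      simp [mem_rootSet, h1.ne_zero]
    · intro x hx
      have h4 := (Finset.mem_filter.1 hx).2
      have := minpoly.eq_of_irreducible_of_monic h3 h4 h1
      rw [← this, h2]
  · intro x _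
    simp only [Finset.mem_sigma, Nat.mem_divisors, irredsOfDegree, Finset.mem_filter,
      mem_monicsOfDegree]
    exact ⟨⟨minpoly.degree_dvd (h_int x), hn0⟩, ⟨minpoly.monic (h_int x), trivial⟩,
      minpoly.irreducible (h_int x)⟩

open Polynomial in
/-- Powers of the characteristic move polynomials to constants modulo high powers of `X - w`. -/
theorem X_sub_C_pow_dvd_pow_sub_C_eval {K : Type*} [Field K] (p : ℕ) [Fact p.Prime] [CharP K p]
    (t : ℕ) (f : K[X]) (w : K) :
    (X - C w) ^ p ^ t ∣ f ^ p ^ t - C (f.eval w ^ p ^ t) := by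
  have h : f ^ p ^ t - C (f.eval w ^ p ^ t) = (f - C (f.eval w)) ^ p ^ t := by
    rw [sub_pow_char_pow, C_pow]
  rw [h]
  exact pow_dvd_pow_of_dvd (X_sub_C_dvd_sub_C_eval) _

open Polynomial in
theorem X_sub_C_pow_dvd_of_hasseDeriv {K : Type*} [Field K] (f : K[X]) (w : K) (M : ℕ)
    (h : ∀ m < M, (hasseDeriv m f).eval w = 0) : (X - C w) ^ M ∣ f := by
  have h1 : X ^ M ∣ taylor w f := by
    rw [X_pow_dvd_iff]
    intro m hm
    rw [taylor_coeff, h m hm]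
  obtain ⟨g, hg⟩ := h1
  refine ⟨taylor (-w) g, ?_⟩
  have h2 : taylor (-w) (taylor w f) = f := by
    rw [taylor_taylor]; simp
  rw [← h2, hg, taylor_mul, taylor_X_pow]
  simp [sub_eq_add_neg]

open Polynomial in
/-- The auxiliary coefficients in Stepanov's method. -/
noncomputable def stepanovCoeff {K : Type*} [Field K] {d J e : ℕ} (v : Fin d × Fin J × Fin e → K)
    (i : Fin d) (j : Fin J) : K[X] := ∑ t : Fin e, C (v (i, j, t)) * X ^ (t : ℕ)

open Polynomial in
theorem stepanovCoeff_coeff {K : Type*} [Field K] {d J e : ℕ} (v : Fin d × Fin J × Fin e → K)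
    (i : Fin d) (j : Fin J) (t : Fin e) : (stepanovCoeff v i j).coeff t = v (i, j, t) := by
  simp only [stepanovCoeff, finsetSum_coeff, coeff_C_mul, coeff_X_pow]
  rw [Finset.sum_eq_single t]
  · simp
  · intro b _ hb
    have : (t : ℕ) ≠ b := fun h => hb (Fin.ext h.symm)
    simp [this]
  · simp

open Polynomial in
theorem stepanovCoeff_degree {K : Type*} [Field K] {d J e : ℕ} (v : Fin d × Fin J × Fin e → K)
    (i : Fin d) (j : Fin J) : (stepanovCoeff v i j).degree < e := by
  unfold stepanovCoeff
  refine (degree_sum_le _ _).trans_lt ?_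
  rw [Finset.sup_lt_iff (by exact WithBot.bot_lt_coe e)]
  intro t _
  refine (degree_C_mul_X_pow_le _ _).trans_lt ?_
  exact_mod_cast t.2

open Polynomial in
/-- Existence of auxiliary polynomials in Stepanov's method. -/
theorem stepanov_exists {K : Type*} [Field K] (B C₀ : K[X]) (ω : K) (d u J e M D : ℕ)
    (hB : B.natDegree ≤ D) (hC : C₀.natDegree ≤ D)
    (hdim : M * (e + J + 2 * D * (d * u)) < d * (J * e)) :
    ∃ v : Fin d × Fin J × Fin e → K, v ≠ 0 ∧ ∀ m < M,
      ∑ i : Fin d, ∑ j : Fin J, C (ω ^ (i : ℕ)) * X ^ (j : ℕ) *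
        hasseDeriv m (stepanovCoeff v i j * (B ^ (i * u) * C₀ ^ ((d - 1 - i) * u))) *
        (B ^ ((d - 1 - i) * u) * C₀ ^ (i * u)) = 0 := by
  set Y := e + J + 2 * D * (d * u) with hY
  let R : (Fin d × Fin J × Fin e → K) → ℕ → K[X] := fun v m =>
    ∑ i : Fin d, ∑ j : Fin J, C (ω ^ (i : ℕ)) * X ^ (j : ℕ) *
        hasseDeriv m (stepanovCoeff v i j * (B ^ (i * u) * C₀ ^ ((d - 1 - i) * u))) *
        (B ^ ((d - 1 - i) * u) * C₀ ^ (i * u))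
  have hadd : ∀ v w m, R (v + w) m = R v m + R w m := by
    intro v w m
    simp only [R, ← Finset.sum_add_distrib]
    refine Finset.sum_congr rfl fun i _ => Finset.sum_congr rfl fun j _ => ?_
    have : stepanovCoeff (v + w) i j = stepanovCoeff v i j + stepanovCoeff w i j := by
      simp [stepanovCoeff, ← Finset.sum_add_distrib, add_mul]
    rw [this, add_mul, map_add]; ring
  have hsmul : ∀ (c : K) v m, R (c • v) m = C c * R v m := by
    intro c v m
    simp only [R, Finset.mul_sum]
    refine Finset.sum_congr rfl fun i _ => Finset.sum_congr rfl fun j _ => ?_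
    have : stepanovCoeff (c • v) i j = C c * stepanovCoeff v i j := by
      simp [stepanovCoeff, Finset.mul_sum, mul_assoc]
    have h2 : ∀ f : K[X], hasseDeriv m (C c * f) = C c * hasseDeriv m f := fun f => by
      rw [← smul_eq_C_mul, map_smul, smul_eq_C_mul]
    rw [this, mul_assoc (C c), h2]; ring
  let φ : (Fin d × Fin J × Fin e → K) →ₗ[K] (Fin M × Fin Y → K) :=
    { toFun := fun v x => (R v x.1).coeff x.2
      map_add' := fun v w => by ext x; simp [hadd]
      map_smul' := fun c v => by ext x; simp [hsmul] }
  have hker : φ.ker ≠ ⊥ := by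
    apply LinearMap.ker_ne_bot_of_finrank_lt
    simpa [Fintype.card_prod] using hdim
  obtain ⟨v, hv, hv0⟩ := Submodule.exists_mem_ne_zero_of_ne_bot hker
  refine ⟨v, hv0, fun m hm => ?_⟩
  have hpow : ∀ (x y : ℕ), x + y ≤ d → (B ^ (x * u) * C₀ ^ (y * u)).natDegree ≤ D * (d * u) := by
    intro x y hxy
    refine natDegree_mul_le.trans ?_
    have h1 := natDegree_pow_le (p := B) (n := x * u)
    have h2 := natDegree_pow_le (p := C₀) (n := y * u)
    calc _ ≤ x * u * B.natDegree + y * u * C₀.natDegree := add_le_add h1 h2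
      _ ≤ x * u * D + y * u * D := by gcongr
      _ = (x + y) * u * D := by ring
      _ ≤ d * u * D := by gcongr
      _ = _ := by ring
  have hdeg : (R v m).degree < Y := by
    refine (degree_sum_le _ _).trans_lt ?_
    rw [Finset.sup_lt_iff (by exact WithBot.bot_lt_coe Y)]
    intro i _
    refine (degree_sum_le _ _).trans_lt ?_
    rw [Finset.sup_lt_iff (by exact WithBot.bot_lt_coe Y)]
    intro j _
    refine degree_le_natDegree.trans_lt ?_
    have he : 0 < e := by
      rcases Nat.eq_zero_or_pos e with h | h
      · simp [h] at hdim
      · exact h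
    have h0 : (stepanovCoeff v i j).natDegree ≤ e - 1 := by
      have := stepanovCoeff_degree v i j
      by_cases hz : stepanovCoeff v i j = 0
      · simp [hz]
      · have := (natDegree_lt_iff_degree_lt hz).2 this
        omega
    have hi := i.2
    have hj := j.2
    have h1 := hpow i (d - 1 - i) (by omega)
    have h2 := hpow (d - 1 - i) i (by omega)
    have h3 : (hasseDeriv m (stepanovCoeff v i j *
        (B ^ (i * u) * C₀ ^ ((d - 1 - i) * u)))).natDegree
        ≤ e - 1 + D * (d * u) := by
      refine (natDegree_hasseDeriv_le _ _).trans ((Nat.sub_le _ _).trans ?_)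
      exact natDegree_mul_le.trans (add_le_add h0 h1)
    have h4 : (C (ω ^ (i : ℕ)) * X ^ (j : ℕ)).natDegree ≤ (j : ℕ) := natDegree_C_mul_X_pow_le _ _
    have h5 := natDegree_mul_le_of_le (natDegree_mul_le_of_le h4 h3) h2
    have : (j : ℕ) + (e - 1 + D * (d * u)) + D * (d * u) < Y := by
      rw [hY]; have : 2 * D * (d * u) = D * (d * u) + D * (d * u) := by ring
      omega
    exact_mod_cast h5.trans_lt this
  change R v m = 0
  ext t
  by_cases ht : t < Y
  · have := congrFun (LinearMap.mem_ker.1 hv) (⟨m, hm⟩, ⟨t, ht⟩)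
    simpa [φ] using this
  · rw [coeff_zero]
    apply coeff_eq_zero_of_degree_lt
    exact hdeg.trans_le (by exact_mod_cast not_lt.1 ht)

open Polynomial in
/-- Nonvanishing of the auxiliary function in Stepanov's method. -/
theorem stepanov_ne_zero {K : Type*} [Field K] (B₁ C₀ : K[X]) (d J e Q : ℕ)
    (hB : B₁.eval 0 ≠ 0) (hC : C₀.eval 0 ≠ 0) (hQ : d * e ≤ Q)
    (v : Fin d × Fin J × Fin e → K) (hv : v ≠ 0) :
    ∑ i : Fin d, ∑ j : Fin J, stepanovCoeff v i j * X ^ (j * Q) *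
        ((X * B₁) ^ (i * e) * C₀ ^ ((d - 1 - i) * e)) ≠ 0 := by
  classical
  intro h0
  have hex : ∃ x : Fin d × Fin J, stepanovCoeff v x.1 x.2 ≠ 0 := by
    by_contra! hcon
    apply hv
    ext ⟨i, j, t⟩
    rw [← stepanovCoeff_coeff v i j t, hcon (i, j)]; simp
  let S := Finset.univ.filter fun x : Fin d × Fin J => stepanovCoeff v x.1 x.2 ≠ 0
  have hS : S.Nonempty := by
    obtain ⟨x, hx⟩ := hex
    exact ⟨x, by simp [S, hx]⟩
  obtain ⟨⟨i₀, j₀⟩, hmem, hmin⟩ := S.exists_min_image (fun x => (x.2 : ℕ) * Q + x.1 * e) hS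
  have hne : stepanovCoeff v i₀ j₀ ≠ 0 := by simpa [S] using hmem
  set n₀ := (j₀ : ℕ) * Q + i₀ * e with hn₀
  rw [← Finset.sum_product', ← Finset.add_sum_erase _ _
    (by simp : (i₀, j₀) ∈ Finset.univ ×ˢ Finset.univ)] at h0
  have hterm : ∀ (i : Fin d) (j : Fin J), stepanovCoeff v i j * X ^ (j * Q) *
        ((X * B₁) ^ (i * e) * C₀ ^ ((d - 1 - i) * e)) =
      X ^ ((j : ℕ) * Q + i * e) * (stepanovCoeff v i j *
        (B₁ ^ (i * e) * C₀ ^ ((d - 1 - i) * e))) := by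
    intro i j; rw [mul_pow, pow_add]; ring
  have hrest : X ^ (n₀ + e) ∣ ∑ x ∈ (Finset.univ ×ˢ Finset.univ).erase (i₀, j₀),
      stepanovCoeff v x.1 x.2 * X ^ (x.2 * Q) *
        ((X * B₁) ^ (x.1 * e) * C₀ ^ ((d - 1 - x.1) * e)) := by
    refine Finset.dvd_sum fun x hx => ?_
    obtain ⟨i, j⟩ := x
    by_cases hz : stepanovCoeff v i j = 0
    · simp [hz]
    rw [hterm]
    apply Dvd.dvd.mul_right
    apply pow_dvd_pow
    have h1 : n₀ ≤ j * Q + i * e := hmin (i, j) (by simp [S, hz])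
    have hne' : (i, j) ≠ (i₀, j₀) := (Finset.mem_erase.1 hx).1
    have hi : (i : ℕ) + 1 ≤ d := i.2
    have hi0 : (i₀ : ℕ) + 1 ≤ d := i₀.2
    have a1 : ((i : ℕ) + 1) * e ≤ Q := (Nat.mul_le_mul_right e hi).trans hQ
    have a2 : ((i₀ : ℕ) + 1) * e ≤ Q := (Nat.mul_le_mul_right e hi0).trans hQ
    simp only
    rcases lt_trichotomy (j : ℕ) j₀ with hj | hj | hj
    · have : ((j : ℕ) + 1) * Q ≤ j₀ * Q := Nat.mul_le_mul_right Q hj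
      rw [add_mul] at *
      have he : 0 < e := by
        by_contra hcon
        apply hne
        have := stepanovCoeff_degree v i₀ j₀
        have he0 : e = 0 := by omega
        subst he0
        simpa using this
      exfalso
      nlinarith
    · rcases lt_trichotomy (i : ℕ) i₀ with hi' | hi' | hi'
      · have : ((i : ℕ) + 1) * e ≤ i₀ * e := Nat.mul_le_mul_right e hi'
        have he : 0 < e := by
          by_contra hcon
          apply hne
          have := stepanovCoeff_degree v i₀ j₀
          have he0 : e = 0 := by omega
          subst he0
          simpa using this
        exfalso
        rw [hj] at h1
        rw [add_mul] at this
        omega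
      · exact absurd (Prod.ext (Fin.ext hi') (Fin.ext hj)) hne'
      · have : ((i₀ : ℕ) + 1) * e ≤ i * e := Nat.mul_le_mul_right e hi'
        rw [hn₀, hj]
        rw [add_mul] at this
        omega
    · have : ((j₀ : ℕ) + 1) * Q ≤ j * Q := Nat.mul_le_mul_right Q hj
      rw [hn₀]
      rw [add_mul] at *
      omega
  have hmain : X ^ (n₀ + e) ∣ X ^ n₀ * (stepanovCoeff v i₀ j₀ *
        (B₁ ^ (i₀ * e) * C₀ ^ ((d - 1 - i₀) * e))) := by
    rw [← hterm]
    exact (dvd_add_left hrest).1 (h0 ▸ dvd_zero _)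
  rw [pow_add] at hmain
  have hX : (X : K[X]) ^ n₀ ≠ 0 := pow_ne_zero _ X_ne_zero
  have h2 := (mul_dvd_mul_iff_left hX).1 hmain
  have hcop : ∀ f : K[X], f.eval 0 ≠ 0 → IsCoprime X f := by
    intro f hf
    refine (irreducible_X.coprime_iff_not_dvd).2 ?_
    rw [X_dvd_iff, coeff_zero_eq_eval_zero]
    exact hf
  have h3 : IsCoprime ((X : K[X]) ^ e) (B₁ ^ (i₀ * e) * C₀ ^ ((d - 1 - i₀) * e)) :=
    IsCoprime.pow_left (IsCoprime.mul_right (hcop _ hB).pow_right (hcop _ hC).pow_right)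
  have h4 := h3.dvd_of_dvd_mul_right h2
  have h5 := degree_le_of_dvd h4 hne
  rw [degree_X_pow] at h5
  exact absurd (stepanovCoeff_degree v i₀ j₀) (not_lt.2 h5)

open Polynomial in
/-- Stepanov's bound for the number of solutions of `B(z) ^ e = ω * C(z) ^ e` over a finite
field with `M ^ 2` elements. -/
theorem stepanov_card_le {K : Type*} [Field K] [Fintype K] [DecidableEq K] (p : ℕ) [Fact p.Prime]
    [CharP K p] (t M d u D : ℕ) (hM : M = p ^ t) (hM2 : 2 ≤ M) (hcard : Fintype.card K = M ^ 2)
    (hd : d * u = M - 1) (B₁ C₀ : K[X]) (hBdeg : (X * B₁).natDegree ≤ D) (hCdeg : C₀.natDegree ≤ D)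
    (hB : B₁.eval 0 ≠ 0) (hC : C₀.eval 0 ≠ 0) (ω : K) :
    (Finset.univ.filter fun z : K => (X * B₁).eval z ≠ 0 ∧ C₀.eval z ≠ 0 ∧
      (X * B₁).eval z ^ (u * (M + 1)) = ω * C₀.eval z ^ (u * (M + 1))).card
      ≤ (u + 9 * D + 9) * M := by
  set B := X * B₁ with hBdef
  set e := u * (M + 1) with he
  set W := Finset.univ.filter fun z : K => B.eval z ≠ 0 ∧ C₀.eval z ≠ 0 ∧
      B.eval z ^ e = ω * C₀.eval z ^ e with hW
  obtain ⟨m', rfl⟩ : ∃ m', M = m' + 2 := ⟨M - 2, by omega⟩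
  set M := m' + 2 with hMdef
  have hd1 : d * u + 1 = M := by omega
  have hdpos : 0 < d := by
    rcases Nat.eq_zero_or_pos d with h | h
    · rw [h] at hd1; omega
    · exact h
  have hu : u + 1 ≤ M := by nlinarith
  have hde : d * e + 1 = M ^ 2 := by
    rw [he, ← mul_assoc]
    have : d * u = m' + 1 := by omega
    rw [this, hMdef]; ring
  set J := u + 8 * D + 8 with hJ
  have hdim : M * (e + J + 2 * D * (d * u)) < d * (J * e) := by
    have h1 : d * (J * e) = J * (d * e) := by ring
    have h2 : d * e = m' ^ 2 + 4 * m' + 3 := by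
      have : M ^ 2 = m' ^ 2 + 4 * m' + 4 := by rw [hMdef]; ring
      omega
    have h3 : d * u = m' + 1 := by omega
    have hu' : u ≤ m' + 1 := by omega
    rw [h1, h2, h3, he, hJ, hMdef]
    nlinarith [Nat.zero_le (D * m'), Nat.zero_le (D * m' ^ 2), Nat.mul_le_mul_right m' hu']
  obtain ⟨v, hv0, hv⟩ := stepanov_exists B C₀ ω d u J e M D hBdeg hCdeg hdim
  set Φ := ∑ i : Fin d, ∑ j : Fin J, stepanovCoeff v i j * X ^ (j * M ^ 2) *
        (B ^ (i * e) * C₀ ^ ((d - 1 - i) * e)) with hΦ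
  have hΦ0 : Φ ≠ 0 := stepanov_ne_zero B₁ C₀ d J e (M ^ 2) hB hC (by omega) v hv0
  have hdvd : ∀ w ∈ W, (X - C w) ^ M ∣ Φ := by
    intro w hw
    obtain ⟨hβ, hγ, hω⟩ : B.eval w ≠ 0 ∧ C₀.eval w ≠ 0 ∧ B.eval w ^ e = ω * C₀.eval w ^ e := by
      simpa [hW] using hw
    set β := B.eval w with hβdef
    set γ := C₀.eval w with hγdef
    set I := Ideal.span {(X - C w) ^ M} with hI
    let π := Ideal.Quotient.mk I
    have hpow : ∀ f : K[X], π (f ^ M) = π (C (f.eval w ^ M)) := by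
      intro f
      rw [Ideal.Quotient.eq, hI, Ideal.mem_span_singleton]
      have := X_sub_C_pow_dvd_pow_sub_C_eval p t f w
      rwa [← hM] at this
    have hXQ : π (X ^ M ^ 2) = π (C w) := by
      rw [sq, pow_mul, map_pow, hpow, ← map_pow, ← C_pow, eval_X, ← pow_mul, ← sq, ← hcard,
        FiniteField.pow_card]
    have hBe : ∀ f : K[X], π (f ^ e) = π (f ^ u) * π (C (f.eval w ^ (u * M))) := by
      intro f
      have : f ^ e = f ^ u * (f ^ M) ^ u := by rw [he, ← pow_mul, ← pow_add]; ring
      rw [this, map_mul, map_pow π (f ^ M), hpow, ← map_pow, ← C_pow, ← pow_mul]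
      ring_nf
    set Ψ := ∑ i : Fin d, ∑ j : Fin J, C (ω ^ (i : ℕ) * w ^ (j : ℕ) *
        (β ^ ((d - 1 - i) * u) * γ ^ (i * u))) *
        (stepanovCoeff v i j * (B ^ (i * u) * C₀ ^ ((d - 1 - i) * u))) with hΨ
    have hΨdvd : (X - C w) ^ M ∣ Ψ := by
      apply X_sub_C_pow_dvd_of_hasseDeriv
      intro m hm
      have := congrArg (eval w) (hv m hm)
      rw [eval_zero] at this
      rw [← this, hΨ]
      simp only [map_sum, eval_finsetSum]
      refine Finset.sum_congr rfl fun i _ => Finset.sum_congr rfl fun j _ => ?_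
      rw [← smul_eq_C_mul, map_smul]
      simp only [eval_smul, eval_mul, eval_C, eval_pow, eval_X, smul_eq_mul]
      ring
    have hkey : π (C ((β * γ) ^ ((d - 1) * u)) * Φ) = π (C (γ ^ ((d - 1) * e)) * Ψ) := by
      rw [hΦ, hΨ, Finset.mul_sum, Finset.mul_sum, map_sum, map_sum]
      refine Finset.sum_congr rfl fun i _ => ?_
      rw [Finset.mul_sum, Finset.mul_sum, map_sum, map_sum]
      refine Finset.sum_congr rfl fun j _ => ?_
      have hi := i.2
      obtain ⟨i', hi'⟩ : ∃ i', d - 1 = i + i' := ⟨d - 1 - i, by omega⟩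
      have hsub : d - 1 - i = i' := by omega
      rw [hsub, hi']
      have e1 : π (X ^ (j * M ^ 2)) = π (C (w ^ (j : ℕ))) := by
        rw [mul_comm, pow_mul, map_pow, hXQ, ← map_pow, ← C_pow]
      have e2 : ∀ (f : K[X]) (n : ℕ), π (f ^ (n * e)) =
          π (f ^ (n * u)) * π (C (f.eval w ^ (n * (u * M)))) := by
        intro f n
        rw [mul_comm n e, pow_mul, map_pow, hBe, mul_pow, ← map_pow, ← map_pow, ← C_pow,
          ← pow_mul, ← pow_mul]
        ring_nf
      have e3 : (β * γ) ^ ((i + i') * u) * (w ^ (j : ℕ) *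
          (β ^ (i * (u * M)) * γ ^ (i' * (u * M)))) =
          γ ^ ((i + i') * e) * (ω ^ (i : ℕ) * w ^ (j : ℕ) * (β ^ (i' * u) * γ ^ (i * u))) := by
        have : β ^ (i * e) = ω ^ (i : ℕ) * γ ^ (i * e) := by
          rw [mul_comm (i : ℕ) e, pow_mul, hω, mul_pow, ← pow_mul]
        have t1 : (β * γ) ^ ((i + i') * u) * (w ^ (j : ℕ) *
          (β ^ (i * (u * M)) * γ ^ (i' * (u * M)))) =
            β ^ (i * e) * w ^ (j : ℕ) * β ^ (i' * u) * γ ^ (i * u) * γ ^ (i' * e) := by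
          rw [he]; ring
        rw [t1, this]; ring
      have e4 := congrArg (fun x => π (C x)) e3
      simp only [map_mul] at e4
      rw [map_mul, map_mul, map_mul, map_mul, e1, e2, e2, map_mul, map_mul π (C _),
        map_mul π (stepanovCoeff v i j),
        map_mul π (B ^ _)]
      simp only [map_mul]
      simp only [← hβdef, ← hγdef]
      linear_combination (π (stepanovCoeff v i j) * π (B ^ (i * u)) * π (C₀ ^ (i' * u))) * e4
    have h1 : (X - C w) ^ M ∣ C ((β * γ) ^ ((d - 1) * u)) * Φ := by
      rw [Ideal.Quotient.eq, hI, Ideal.mem_span_singleton] at hkey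
      exact (dvd_sub_left (hΨdvd.mul_left _)).1 hkey
    have hunit : IsUnit (C ((β * γ) ^ ((d - 1) * u))) :=
      isUnit_C.2 (IsUnit.mk0 _ (pow_ne_zero _ (mul_ne_zero hβ hγ)))
    exact (hunit.dvd_mul_left).1 h1
  have hprod : ∏ w ∈ W, (X - C w) ^ M ∣ Φ := by
    refine Finset.prod_dvd_of_coprime ?_ hdvd
    intro x _ y _ hxy
    exact (isCoprime_X_sub_C_of_isUnit_sub (sub_ne_zero.2 hxy).isUnit).pow
  have hdeg : W.card * M ≤ Φ.natDegree := by
    have := natDegree_le_of_dvd hprod hΦ0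
    rw [natDegree_prod _ _ fun w _ => pow_ne_zero _ (X_sub_C_ne_zero w)] at this
    simpa using this
  have hupper : Φ.natDegree ≤ e + (J - 1) * M ^ 2 + D * ((d - 1) * e) := by
    refine natDegree_sum_le_of_forall_le _ _ fun i _ =>
      natDegree_sum_le_of_forall_le _ _ fun j _ => ?_
    have hj := j.2
    have hi := i.2
    have h0 : (stepanovCoeff v i j).natDegree ≤ e :=
      natDegree_le_of_degree_le (stepanovCoeff_degree v i j).le
    have h1 : (B ^ (i * e) * C₀ ^ ((d - 1 - i) * e)).natDegree ≤ D * ((d - 1) * e) := by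
      refine natDegree_mul_le.trans ?_
      calc _ ≤ i * e * B.natDegree + (d - 1 - i) * e * C₀.natDegree :=
            add_le_add natDegree_pow_le natDegree_pow_le
        _ ≤ i * e * D + (d - 1 - i) * e * D := by gcongr
        _ = (i + (d - 1 - i)) * e * D := by ring
        _ = (d - 1) * e * D := by congr 2; omega
        _ = _ := by ring
    refine natDegree_mul_le_of_le (natDegree_mul_le_of_le h0 ?_) h1
    rw [natDegree_X_pow]
    exact Nat.mul_le_mul_right _ (by omega)
  have h1 : (d - 1) * e ≤ M ^ 2 := (Nat.mul_le_mul_right e (Nat.sub_le d 1)).trans (by omega)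
  have h2 : e ≤ M ^ 2 := by
    have : 1 * e ≤ d * e := Nat.mul_le_mul_right e hdpos
    omega
  have h3 : J - 1 = u + 8 * D + 7 := by omega
  rw [h3] at hupper
  have h4 : W.card * M ≤ ((u + 9 * D + 9) * M) * M := by
    calc _ ≤ _ := hdeg.trans hupper
      _ ≤ M ^ 2 + (u + 8 * D + 7) * M ^ 2 + D * M ^ 2 := by gcongr
      _ ≤ _ := by nlinarith
  exact Nat.le_of_mul_le_mul_right h4 (by omega)

open Polynomial in
/-- The Artin–Schreier map covers the trace zero elements uniformly. -/
theorem sum_artinSchreier {k K : Type*} [Field k] [Field K] [Algebra k K] [Fintype k]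
    [Fintype K] [DecidableEq k] (F : K → ℂ) :
    ∑ z : K, F (z ^ Fintype.card k - z) =
      Fintype.card k * ∑ x ∈ Finset.univ.filter (fun x : K => Algebra.trace k K x = 0), F x := by
  classical
  set κ := Fintype.card k with hκ
  set n := Module.finrank k K with hn
  let φ : K →ₗ[k] K := (FiniteField.frobeniusAlgHom k K).toLinearMap - LinearMap.id
  have hφ : ∀ z, φ z = z ^ κ - z := fun z => by
    simp [φ, hκ]
  have hle : φ.range ≤ (Algebra.trace k K).ker := by
    rintro _ ⟨z, rfl⟩
    rw [LinearMap.mem_ker, hφ, map_sub, sub_eq_zero]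
    have := Algebra.trace_eq_of_algEquiv (FiniteField.frobeniusAlgEquivOfAlgebraic k K) z
    rw [← this]
    rfl
  have hker1 : Module.finrank k φ.ker ≤ 1 := by
    have h1 : Nat.card φ.ker ≤ κ := by
      have hcard : 1 < κ := Fintype.one_lt_card
      have hne := FiniteField.X_pow_card_sub_X_ne_zero K hcard
      have h2 : (Finset.univ.filter fun z : K => φ z = 0) ⊆
          (X ^ κ - X : K[X]).roots.toFinset := by
        intro z hz
        rw [Multiset.mem_toFinset, mem_roots hne]
        have := (Finset.mem_filter.1 hz).2
        rw [hφ] at this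
        simpa using this
      have h3 : Nat.card φ.ker = (Finset.univ.filter fun z : K => φ z = 0).card := by
        rw [Nat.card_eq_fintype_card, ← Fintype.card_subtype]
        exact Fintype.card_congr (Equiv.refl _)
      rw [h3]
      refine (Finset.card_le_card h2).trans ((Multiset.toFinset_card_le _).trans ?_)
      refine (card_roots' _).trans ?_
      rw [FiniteField.X_pow_card_sub_X_natDegree_eq K hcard]
    rw [Module.natCard_eq_pow_finrank (K := k), Nat.card_eq_fintype_card] at h1
    by_contra! hcon
    have h4 : κ ^ 2 ≤ κ ^ Module.finrank k φ.ker := Nat.pow_le_pow_right Fintype.card_pos hcon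
    have : 1 < κ := Fintype.one_lt_card
    nlinarith
  have h1 := φ.finrank_range_add_finrank_ker
  have h2 := (Algebra.trace k K).finrank_range_add_finrank_ker
  have h3 : (Algebra.trace k K).range = ⊤ :=
    LinearMap.range_eq_top.2 (Algebra.trace_surjective k K)
  rw [h3, finrank_top, Module.finrank_self] at h2
  have hrange : φ.range = (Algebra.trace k K).ker := by
    apply Submodule.eq_of_le_of_finrank_le hle
    omega
  have hker : Module.finrank k φ.ker = 1 := by
    rw [hrange] at h1; omega
  have hkercard : (Finset.univ.filter fun z : K => φ z = 0).card = κ := by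
    have h3 : Nat.card φ.ker = (Finset.univ.filter fun z : K => φ z = 0).card := by
      rw [Nat.card_eq_fintype_card, ← Fintype.card_subtype]
      exact Fintype.card_congr (Equiv.refl _)
    rw [← h3, Module.natCard_eq_pow_finrank (K := k), hker, pow_one, Nat.card_eq_fintype_card]
  rw [← Finset.sum_fiberwise_of_maps_to (s := Finset.univ)
    (t := Finset.univ.filter (fun x : K => Algebra.trace k K x = 0)) (g := φ)]
  · rw [Finset.mul_sum]
    refine Finset.sum_congr rfl fun x hx => ?_
    have hx' : x ∈ φ.range := by
      rw [hrange]; exact (Finset.mem_filter.1 hx).2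
    obtain ⟨z₀, hz₀⟩ := hx'
    have hfib : (Finset.univ.filter fun z : K => φ z = x).card = κ := by
      rw [← hkercard]
      refine Finset.card_bij' (fun z _ => z - z₀) (fun z _ => z + z₀) ?_ ?_ ?_ ?_
      · intro z hz
        simp only [Finset.mem_filter, Finset.mem_univ, true_and] at hz ⊢
        rw [map_sub, hz, hz₀, sub_self]
      · intro z hz
        simp only [Finset.mem_filter, Finset.mem_univ, true_and] at hz ⊢
        rw [map_add, hz, hz₀, zero_add]
      · intro z _; simp
      · intro z _; simp
    rw [Finset.sum_congr rfl (g := fun _ => F x), Finset.sum_const, hfib, nsmul_eq_mul]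
    intro z hz
    rw [← hφ, (Finset.mem_filter.1 hz).2]
  · intro z _
    simp only [Finset.mem_filter, Finset.mem_univ, true_and]
    exact hle ⟨z, rfl⟩

open Polynomial in
/-- The completely multiplicative function behind `∑ χ(x) χ⁻¹(x + a) ψ(x)`. -/
noncomputable def shiftChar {k : Type*} [Field k] (χ : MulChar k ℂ) (ψ : AddChar k ℂ) (a : k)
    (P : k[X]) : ℂ := χ (P.eval 0) * χ⁻¹ (P.eval (-a)) * ψ (-P.nextCoeff)

open Polynomial in
theorem shiftChar_mul {k : Type*} [Field k] (χ : MulChar k ℂ) (ψ : AddChar k ℂ) (a : k)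
    (P Q : k[X]) (hP : P.Monic) (hQ : Q.Monic) :
    shiftChar χ ψ a (P * Q) = shiftChar χ ψ a P * shiftChar χ ψ a Q := by
  simp only [shiftChar, eval_mul, map_mul, hP.nextCoeff_mul hQ, neg_add, AddChar.map_add_eq_mul]
  ring

open Polynomial in
theorem sum_monics_eq_zero_of_shift {k : Type*} [Field k] [Fintype k] (F : k[X] → ℂ) (m : ℕ)
    (D : k[X]) (hD : D.degree < (m : WithBot ℕ)) (z : ℂ) (hz : z ≠ 1)
    (h : ∀ P : k[X], P.Monic → P.natDegree = m → F (P + D) = z * F P) :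
    ∑ P ∈ monicsOfDegree k m, F P = 0 := by
  have hmem : ∀ D' : k[X], D'.degree < (m : WithBot ℕ) → ∀ P ∈ monicsOfDegree k m,
      P + D' ∈ monicsOfDegree k m := by
    intro D' hD' P hP
    obtain ⟨h1, h2⟩ := mem_monicsOfDegree.1 hP
    have h3 : D'.degree < P.degree := by rwa [degree_eq_natDegree h1.ne_zero, h2]
    refine mem_monicsOfDegree.2 ⟨h1.add_of_left h3, ?_⟩
    rw [natDegree_add_eq_left_of_degree_lt h3, h2]
  have h1 : ∑ P ∈ monicsOfDegree k m, F P = ∑ P ∈ monicsOfDegree k m, F (P + D) := by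
    refine Finset.sum_bij' (fun P _ => P + -D) (fun P _ => P + D) (hmem (-D) (by rwa [degree_neg]))
      (hmem D hD) ?_ ?_ ?_
    · intro P _; simp
    · intro P _; simp
    · intro P _; simp
  have h2 : ∑ P ∈ monicsOfDegree k m, F (P + D) = z * ∑ P ∈ monicsOfDegree k m, F P := by
    rw [Finset.mul_sum]
    refine Finset.sum_congr rfl fun P hP => ?_
    obtain ⟨h1, h2⟩ := mem_monicsOfDegree.1 hP
    exact h P h1 h2
  rw [h2] at h1
  have : (1 - z) * ∑ P ∈ monicsOfDegree k m, F P = 0 := by linear_combination h1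
  rcases mul_eq_zero.1 this with h3 | h3
  · exact absurd (sub_eq_zero.1 h3).symm hz
  · exact h3

open Polynomial in
theorem sum_shiftChar_eq_zero {k : Type*} [Field k] [Fintype k] (χ : MulChar k ℂ)
    (ψ : AddChar k ℂ) (hψ : ψ ≠ 1) (a : k) (m : ℕ) (hm : 3 ≤ m) :
    ∑ P ∈ monicsOfDegree k m, shiftChar χ ψ a P = 0 := by
  obtain ⟨t, ht⟩ := AddChar.ne_one_iff.1 hψ
  have hmon : (X ^ (m - 2) * (X + C a)).Monic := (monic_X_pow _).mul (monic_X_add_C a)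
  have hdeg : (X ^ (m - 2) * (X + C a)).natDegree = m - 1 := by
    rw [(monic_X_pow _).natDegree_mul (monic_X_add_C a), natDegree_X_pow, natDegree_X_add_C]
    omega
  have hD : (C (-t) * (X ^ (m - 2) * (X + C a))).degree < (m : WithBot ℕ) := by
    refine degree_le_natDegree.trans_lt ?_
    have := (natDegree_C_mul_le (-t) (X ^ (m - 2) * (X + C a))).trans hdeg.le
    exact_mod_cast (by omega : (C (-t) * (X ^ (m - 2) * (X + C a))).natDegree < m)
  refine sum_monics_eq_zero_of_shift _ m _ hD (ψ t) ht ?_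
  intro P hP hPm
  have h3 : (C (-t) * (X ^ (m - 2) * (X + C a))).degree < P.degree := by
    rwa [degree_eq_natDegree hP.ne_zero, hPm]
  have h4 : (P + C (-t) * (X ^ (m - 2) * (X + C a))).nextCoeff = P.nextCoeff - t := by
    rw [nextCoeff_of_natDegree_pos, nextCoeff_of_natDegree_pos,
      natDegree_add_eq_left_of_degree_lt h3, coeff_add, coeff_C_mul, hPm]
    · have : (X ^ (m - 2) * (X + C a)).coeff (m - 1) = 1 := by
        have := hmon.coeff_natDegree
        rwa [hdeg] at this
      rw [this]; ring
    · omega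
    · rw [natDegree_add_eq_left_of_degree_lt h3]; omega
  have h5 : m - 2 ≠ 0 := by omega
  rw [shiftChar, h4, shiftChar]
  have h6 : -(P.nextCoeff - t) = t + -P.nextCoeff := by ring
  rw [h6, AddChar.map_add_eq_mul]
  simp [h5]
  ring

open Polynomial in
theorem shiftChar_minpoly {k K : Type*} [Field k] [Field K] [Algebra k K]
    [FiniteDimensional k K] (χ : MulChar k ℂ) (ψ : AddChar k ℂ) (a : k) (x : K) :
    shiftChar χ ψ a (minpoly k x) ^ (Module.finrank k K / (minpoly k x).natDegree) =
      χ (Algebra.norm k x) * χ⁻¹ (Algebra.norm k (x + algebraMap k K a)) *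
        ψ (Algebra.trace k K x) := by
  rw [norm_eq_minpoly_coeff_pow x, norm_eq_minpoly_coeff_pow (x + algebraMap k K a),
    trace_eq_minpoly_nextCoeff, minpoly.add_algebraMap, AddChar.map_nsmul_eq_pow]
  have h1 : ((minpoly k x).comp (X - C a)).natDegree = (minpoly k x).natDegree := by
    rw [natDegree_comp, natDegree_X_sub_C, mul_one]
  have h2 : ((minpoly k x).comp (X - C a)).coeff 0 = (minpoly k x).eval (-a) := by
    rw [coeff_zero_eq_eval_zero, eval_comp]; simp
  rw [h1, h2, coeff_zero_eq_eval_zero, map_pow, map_pow, map_mul, map_mul, ← mul_pow, ← mul_pow,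
    shiftChar]
  congr 1
  have h3 : χ ((-1) ^ (minpoly k x).natDegree) * χ⁻¹ ((-1) ^ (minpoly k x).natDegree) = 1 := by
    rw [← MulChar.mul_apply, mul_inv_cancel, MulChar.one_apply]
    exact (isUnit_one.neg).pow _
  linear_combination (-χ (eval 0 (minpoly k x)) * χ⁻¹ (eval (-a) (minpoly k x)) *
    ψ (-(minpoly k x).nextCoeff)) * h3

/-- The `L`-function of the shifted character sum has two reciprocal roots. -/
theorem exists_roots_shiftChar {k : Type*} [Field k] [Fintype k] (χ : MulChar k ℂ)
    (ψ : AddChar k ℂ) (hψ : ψ ≠ 1) (a : k) : ∃ α β : ℂ, ∀ (K : Type) [Field K] [Algebra k K]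
      [Fintype K], ∑ x : K, χ (Algebra.norm k x) * χ⁻¹ (Algebra.norm k (x + algebraMap k K a)) *
        ψ (Algebra.trace k K x) = -(α ^ Module.finrank k K + β ^ Module.finrank k K) := by
  obtain ⟨α, β, h⟩ := powerSum_of_newton
    (fun m => ∑ P ∈ monicsOfDegree k m, shiftChar χ ψ a P) (irredPowerSum (shiftChar χ ψ a))
    (by
      rw [sum_monicsOfDegree]
      simp [monicOfCoeffs, shiftChar, Polynomial.nextCoeff])
    (fun m hm => sum_shiftChar_eq_zero χ ψ hψ a m hm)
    (fun m => newton_monics _ (by simp [shiftChar, Polynomial.nextCoeff]) (shiftChar_mul χ ψ a) m)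
  refine ⟨α, β, fun K _ _ _ => ?_⟩
  rw [← h _ Module.finrank_pos, ← sum_minpoly_eq_irredPowerSum]
  exact Finset.sum_congr rfl fun x _ => (shiftChar_minpoly χ ψ a x).symm

open Polynomial in
theorem card_artinSchreier_eq_le {K : Type*} [Field K] [Fintype K] [DecidableEq K] (κ : ℕ)
    (hκ : 2 ≤ κ) (c : K) : (Finset.univ.filter fun z : K => z ^ κ - z = c).card ≤ κ := by
  have hdeg : (X ^ κ - X - C c : K[X]).natDegree = κ := by
    rw [sub_sub]
    have h1 : (X + C c : K[X]).natDegree < (X ^ κ : K[X]).natDegree := by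
      rw [natDegree_X_pow, natDegree_X_add_C]; omega
    rw [natDegree_sub_eq_left_of_natDegree_lt h1, natDegree_X_pow]
  have hne : (X ^ κ - X - C c : K[X]) ≠ 0 := fun h => by
    rw [h, natDegree_zero] at hdeg; omega
  have h2 : (Finset.univ.filter fun z : K => z ^ κ - z = c) ⊆
      (X ^ κ - X - C c : K[X]).roots.toFinset := by
    intro z hz
    rw [Multiset.mem_toFinset, mem_roots hne]
    have := (Finset.mem_filter.1 hz).2
    simp [this]
  refine (Finset.card_le_card h2).trans ((Multiset.toFinset_card_le _).trans ?_)
  exact (card_roots' _).trans hdeg.le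

open Polynomial in
theorem card_normRatio_le {k K : Type*} [Field k] [Field K] [Algebra k K] [Fintype k]
    [Fintype K] [DecidableEq k] [DecidableEq K] (s : ℕ) (hs : 1 ≤ s)
    (hK : Module.finrank k K = 2 * s) (a : k) (ha : a ≠ 0) (ω : k) :
    ((Finset.univ.filter fun z : K => z ^ Fintype.card k - z ≠ 0 ∧
      z ^ Fintype.card k - z + algebraMap k K a ≠ 0 ∧
      Algebra.norm k (z ^ Fintype.card k - z) =
        ω * Algebra.norm k (z ^ Fintype.card k - z + algebraMap k K a)).card : ℕ) ≤
      ((Fintype.card k ^ s - 1) / (Fintype.card k - 1) + 9 * Fintype.card k + 9) *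
        Fintype.card k ^ s := by
  obtain ⟨p, hp⟩ := CharP.exists k
  obtain ⟨n, hpp, hn⟩ := FiniteField.card k p
  have : Fact p.Prime := ⟨hpp⟩
  have : CharP K p := charP_of_injective_algebraMap (algebraMap k K).injective p
  have hκ2 : 2 ≤ Fintype.card k := Fintype.one_lt_card
  set κ := Fintype.card k with hκ
  have hM2 : 2 ≤ κ ^ s := hκ2.trans (Nat.le_self_pow (by omega) κ)
  have hcard : Fintype.card K = (κ ^ s) ^ 2 := by
    rw [Module.card_eq_pow_finrank (K := k), hK, ← pow_mul, mul_comm 2 s]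
  have hdvd : (κ - 1) * ((κ ^ s - 1) / (κ - 1)) = κ ^ s - 1 :=
    Nat.mul_div_cancel' (by simpa using Nat.sub_dvd_pow_sub_pow κ 1 s)
  have hexp : (Nat.card K - 1) / (Nat.card k - 1) = (κ ^ s - 1) / (κ - 1) * (κ ^ s + 1) := by
    rw [Nat.card_eq_fintype_card, Nat.card_eq_fintype_card, hcard, ← hκ]
    apply Nat.div_eq_of_eq_mul_right (by omega)
    rw [← mul_assoc, hdvd]
    have := Nat.sq_sub_sq (κ ^ s) 1
    rw [one_pow] at this
    rw [this, mul_comm]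
  have hX : (X * (X ^ (κ - 1) - 1) : K[X]) = X ^ κ - X := by
    rw [mul_sub, ← pow_succ', mul_one, Nat.sub_add_cancel (by omega)]
  have hdeg : (X ^ κ - X : K[X]).natDegree ≤ κ := by
    rw [FiniteField.X_pow_card_sub_X_natDegree_eq K (by omega)]
  have key := stepanov_card_le (K := K) p (n * s) (κ ^ s) (κ - 1) ((κ ^ s - 1) / (κ - 1)) κ
    (by rw [hn, pow_mul]) hM2 hcard hdvd (X ^ (κ - 1) - 1) (X ^ κ - X + C (algebraMap k K a))
    (by rw [hX]; exact hdeg)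
    ((natDegree_add_le _ _).trans (by simpa using hdeg))
    (by simp [show κ - 1 ≠ 0 by omega])
    (by simpa [show κ ≠ 0 by omega] using ha) (algebraMap k K ω)
  refine le_trans (Finset.card_le_card ?_) key
  intro z hz
  simp only [Finset.mem_filter, Finset.mem_univ, true_and] at hz ⊢
  have e1 : (X * (X ^ (κ - 1) - 1) : K[X]).eval z = z ^ κ - z := by rw [hX]; simp
  have e2 : (X ^ κ - X + C (algebraMap k K a) : K[X]).eval z = z ^ κ - z + algebraMap k K a := by
    simp
  rw [e1, e2]
  refine ⟨hz.1, hz.2.1, ?_⟩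
  have := congrArg (algebraMap k K) hz.2.2
  rw [map_mul, FiniteField.algebraMap_norm_eq_pow, FiniteField.algebraMap_norm_eq_pow, hexp] at this
  exact this

theorem norm_mulChar_of_ne_zero {k : Type*} [Field k] [Finite k] (χ : MulChar k ℂ) {x : k}
    (hx : x ≠ 0) : ‖χ x‖ = 1 := by
  have := Fintype.ofFinite k
  have h1 : χ x ^ (Fintype.card k - 1) = 1 := by
    rw [← map_pow, FiniteField.pow_card_sub_one_eq_one x hx, map_one]
  have h2 : Fintype.card k - 1 ≠ 0 := by
    have : 1 < Fintype.card k := Fintype.one_lt_card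
    omega
  exact Complex.norm_eq_one_of_pow_eq_one h1 h2

theorem norm_mulChar_le_one {k : Type*} [Field k] [Finite k] (χ : MulChar k ℂ) (x : k) :
    ‖χ x‖ ≤ 1 := by
  rcases eq_or_ne x 0 with rfl | hx
  · rw [MulChar.map_zero, norm_zero]
    exact zero_le_one
  · exact (norm_mulChar_of_ne_zero χ hx).le

theorem norm_sum_normRatio_le {k K : Type*} [Field k] [Field K] [Algebra k K] [Fintype k]
    [Fintype K] (s : ℕ) (hs : 1 ≤ s)
    (hK : Module.finrank k K = 2 * s) (χ : MulChar k ℂ) (hχ : χ ≠ 1) (a : k) (ha : a ≠ 0) :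
    ‖∑ z : K, χ (Algebra.norm k (z ^ Fintype.card k - z)) *
      χ⁻¹ (Algebra.norm k (z ^ Fintype.card k - z + algebraMap k K a))‖ ≤
      (9 * Fintype.card k ^ 2 + 2 * Fintype.card k : ℕ) * (Fintype.card k : ℝ) ^ s := by
  classical
  have hκ2 : 2 ≤ Fintype.card k := Fintype.one_lt_card
  have hU := card_normRatio_le (K := K) s hs hK a ha
  set κ := Fintype.card k with hκ
  set U := ((κ ^ s - 1) / (κ - 1) + 9 * κ + 9) * κ ^ s with hUdef
  set B : K → K := fun z => z ^ κ - z with hB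
  set c := algebraMap k K a with hc
  set G := Finset.univ.filter fun z : K => B z ≠ 0 ∧ B z + c ≠ 0 with hG
  set ρ : K → k := fun z => Algebra.norm k (B z) * (Algebra.norm k (B z + c))⁻¹ with hρ
  have hnorm : ∀ x : K, x ≠ 0 → Algebra.norm k x ≠ 0 := fun x hx => Algebra.norm_ne_zero_iff.2 hx
  have h1 : ∑ z : K, χ (Algebra.norm k (B z)) * χ⁻¹ (Algebra.norm k (B z + c)) =
      ∑ z ∈ G, χ (ρ z) := by
    rw [hG, Finset.sum_filter]
    refine Finset.sum_congr rfl fun z _ => ?_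
    split_ifs with h
    · rw [map_mul, MulChar.inv_apply' χ]
    · rw [not_and_or, not_not, not_not] at h
      rcases h with h | h
      · rw [h, Algebra.norm_zero, MulChar.map_zero, zero_mul]
      · rw [h, Algebra.norm_zero, MulChar.map_zero, mul_zero]
  have h2 : ∑ z ∈ G, χ (ρ z) =
      ∑ ω ∈ Finset.univ.erase (0 : k), χ ω * ((G.filter fun z => ρ z = ω).card : ℂ) := by
    rw [← Finset.sum_fiberwise_of_maps_to (s := G) (t := Finset.univ.erase (0 : k)) (g := ρ)]
    · refine Finset.sum_congr rfl fun ω _ => ?_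
      rw [Finset.sum_congr rfl (g := fun _ => χ ω), Finset.sum_const, nsmul_eq_mul, mul_comm]
      intro z hz
      rw [(Finset.mem_filter.1 hz).2]
    · intro z hz
      have := (Finset.mem_filter.1 hz).2
      simp only [Finset.mem_erase, Finset.mem_univ, and_true]
      exact mul_ne_zero (hnorm _ this.1) (inv_ne_zero (hnorm _ this.2))
  have hcardG : G.card = ∑ ω ∈ Finset.univ.erase (0 : k), (G.filter fun z => ρ z = ω).card := by
    apply Finset.card_eq_sum_card_fiberwise
    intro z hz
    have := (Finset.mem_filter.1 hz).2
    simp only [Finset.coe_erase, Finset.coe_univ, Set.mem_sdiff, Set.mem_univ, true_and,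
      Set.mem_singleton_iff]
    exact mul_ne_zero (hnorm _ this.1) (inv_ne_zero (hnorm _ this.2))
  have h3 : ∀ ω, (G.filter fun z => ρ z = ω).card ≤ U := by
    intro ω
    refine le_trans (Finset.card_le_card ?_) (hU ω)
    intro z hz
    rw [Finset.mem_filter, hG, Finset.mem_filter] at hz
    simp only [Finset.mem_filter, Finset.mem_univ, true_and]
    refine ⟨hz.1.2.1, hz.1.2.2, ?_⟩
    rw [← hz.2, hρ]
    simp only
    rw [mul_assoc, inv_mul_cancel₀ (hnorm _ hz.1.2.2), mul_one]
  have hsumχ : ∑ ω ∈ Finset.univ.erase (0 : k), χ ω = 0 := by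
    have := MulChar.sum_eq_zero_of_ne_one hχ
    rwa [← Finset.add_sum_erase _ _ (Finset.mem_univ (0 : k)), MulChar.map_zero, zero_add] at this
  have h4 : ∑ z ∈ G, χ (ρ z) = -∑ ω ∈ Finset.univ.erase (0 : k),
      χ ω * ((U : ℂ) - ((G.filter fun z => ρ z = ω).card : ℂ)) := by
    rw [h2]
    simp_rw [mul_sub]
    rw [Finset.sum_sub_distrib, ← Finset.sum_mul, hsumχ]
    ring
  have hGc : κ ^ s * κ ^ s ≤ G.card + 2 * κ := by
    have hcard : Fintype.card K = κ ^ s * κ ^ s := by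
      rw [Module.card_eq_pow_finrank (K := k), hK, ← pow_add, two_mul]
    rw [← hcard, ← Finset.card_univ (α := K),
      ← Finset.card_sdiff_add_card_eq_card (Finset.subset_univ G)]
    have : Finset.univ \ G ⊆ (Finset.univ.filter fun z : K => z ^ κ - z = 0) ∪
        (Finset.univ.filter fun z : K => z ^ κ - z = -c) := by
      intro z hz
      simp only [hG, Finset.mem_sdiff, Finset.mem_univ, Finset.mem_filter, true_and,
        not_and_or, not_not, Finset.mem_union, hB] at hz ⊢
      rcases hz with h | h
      · exact Or.inl h
      · exact Or.inr (eq_neg_of_add_eq_zero_left h)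
    have h5 := (Finset.card_le_card this).trans (Finset.card_union_le _ _)
    have h6 := card_artinSchreier_eq_le κ hκ2 (0 : K)
    have h7 := card_artinSchreier_eq_le κ hκ2 (-c)
    omega
  have hbound : ‖∑ z ∈ G, χ (ρ z)‖ ≤ (κ - 1) * (U : ℝ) - G.card := by
    rw [h4, norm_neg]
    refine (norm_sum_le _ _).trans ?_
    have : ∀ ω ∈ Finset.univ.erase (0 : k),
        ‖χ ω * ((U : ℂ) - ((G.filter fun z => ρ z = ω).card : ℂ))‖ ≤
          (U : ℝ) - (G.filter fun z => ρ z = ω).card := by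
      intro ω _
      rw [norm_mul]
      have h8 : ‖((U : ℂ) - ((G.filter fun z => ρ z = ω).card : ℂ))‖ =
          (U : ℝ) - (G.filter fun z => ρ z = ω).card := by
        rw [← Nat.cast_sub (h3 ω), Complex.norm_natCast, Nat.cast_sub (h3 ω)]
      rw [h8]
      have h9 : ‖χ ω‖ ≤ 1 := norm_mulChar_le_one χ ω
      have h10 : (0 : ℝ) ≤ (U : ℝ) - (G.filter fun z => ρ z = ω).card :=
        sub_nonneg.2 (by exact_mod_cast h3 ω)
      exact mul_le_of_le_one_left h10 h9
    refine (Finset.sum_le_sum this).trans ?_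
    rw [Finset.sum_sub_distrib, Finset.sum_const, Finset.card_erase_of_mem (Finset.mem_univ _),
      Finset.card_univ, ← hκ, nsmul_eq_mul, Nat.cast_sub (by omega), hcardG]
    push_cast
    exact le_rfl
  have hdvd : (κ - 1) * ((κ ^ s - 1) / (κ - 1)) = κ ^ s - 1 :=
    Nat.mul_div_cancel' (by simpa using Nat.sub_dvd_pow_sub_pow κ 1 s)
  rw [h1]
  refine hbound.trans ?_
  have hM1 : 1 ≤ κ ^ s := Nat.one_le_pow _ _ (by omega)
  have h11 : ((κ : ℝ) - 1) * (((κ ^ s - 1) / (κ - 1) : ℕ) : ℝ) = (κ : ℝ) ^ s - 1 := by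
    have := congrArg (Nat.cast (R := ℝ)) hdvd
    push_cast [Nat.cast_sub (show 1 ≤ κ by omega), Nat.cast_sub hM1] at this
    exact this
  have h12 : (κ : ℝ) ^ s * (κ : ℝ) ^ s ≤ G.card + 2 * κ := by exact_mod_cast hGc
  have h13 : (1 : ℝ) ≤ (κ : ℝ) ^ s := by exact_mod_cast hM1
  rw [hUdef]
  generalize (κ ^ s - 1) / (κ - 1) = u at h11
  push_cast
  have hk : (2 : ℝ) ≤ κ := by exact_mod_cast hκ2
  have : ((κ : ℝ) - 1) * ((u + 9 * κ + 9) * (κ : ℝ) ^ s) =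
      ((κ : ℝ) ^ s - 1) * (κ : ℝ) ^ s + (9 * κ ^ 2 - 9) * (κ : ℝ) ^ s := by
    rw [← h11]; ring
  rw [this]
  nlinarith

/-- The pullback of a multiplicative character along the norm. -/
noncomputable def normMulChar {k : Type*} (K : Type*) [Field k] [Field K] [Algebra k K]
    [FiniteDimensional k K] (χ : MulChar k ℂ) : MulChar K ℂ where
  toMonoidHom := χ.toMonoidHom.comp (Algebra.norm k)
  map_nonunit' x hx := by
    have : x = 0 := by simpa using hx
    subst this
    change χ (Algebra.norm k 0) = 0
    rw [Algebra.norm_zero, MulChar.map_zero]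

theorem normMulChar_apply {k K : Type*} [Field k] [Field K] [Algebra k K]
    [FiniteDimensional k K] (χ : MulChar k ℂ) (x : K) :
    normMulChar K χ x = χ (Algebra.norm k x) := rfl

theorem normMulChar_inv_apply {k K : Type*} [Field k] [Field K] [Algebra k K]
    [FiniteDimensional k K] (χ : MulChar k ℂ) (x : K) :
    (normMulChar K χ)⁻¹ x = χ⁻¹ (Algebra.norm k x) := by
  rw [MulChar.inv_apply', MulChar.inv_apply', normMulChar_apply, Algebra.norm_inv]

theorem normMulChar_ne_one {k K : Type*} [Field k] [Field K] [Algebra k K] [Finite K]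
    (χ : MulChar k ℂ) (hχ : χ ≠ 1) :
    normMulChar K χ ≠ 1 := by
  obtain ⟨u, hu⟩ := MulChar.ne_one_iff.1 hχ
  obtain ⟨x, hx⟩ := FiniteField.norm_surjective k K (u : k)
  have hx0 : x ≠ 0 := by
    rintro rfl
    rw [Algebra.norm_zero] at hx
    exact u.ne_zero hx.symm
  refine MulChar.ne_one_iff.2 ⟨Units.mk0 x hx0, ?_⟩
  rwa [Units.val_mk0, normMulChar_apply, hx]

theorem norm_sum_mulChar_shift_le_one {K : Type*} [Field K] [Fintype K] (χ : MulChar K ℂ)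
    (hχ : χ ≠ 1) (a : K) (ha : a ≠ 0) : ‖∑ x : K, χ x * χ⁻¹ (x + a)‖ ≤ 1 := by
  have h1 : ∑ x : K, χ x * χ⁻¹ (x + a) = ∑ y : K, χ (-1) * (χ y * χ⁻¹ (1 - y)) := by
    refine (Fintype.sum_equiv (Equiv.mulLeft₀ (-a) (neg_ne_zero.2 ha)) _ _ fun y => ?_).symm
    have e1 : Equiv.mulLeft₀ (-a) (neg_ne_zero.2 ha) y = -1 * (a * y) := by simp
    have e2 : -1 * (a * y) + a = a * (1 - y) := by ring
    rw [e1, e2]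
    simp only [map_mul]
    have e3 : χ a * χ⁻¹ a = 1 := by
      rw [← MulChar.mul_apply, mul_inv_cancel, MulChar.one_apply (Ne.isUnit ha)]
    linear_combination (-(χ (-1) * (χ y * χ⁻¹ (1 - y)))) * e3
  rw [h1, ← Finset.mul_sum]
  have h2 : ∑ y : K, χ y * χ⁻¹ (1 - y) = -χ (-1) := jacobiSum_nontrivial_inv hχ
  rw [h2, mul_neg, norm_neg, norm_mul]
  exact mul_le_one₀ (norm_mulChar_le_one χ _) (norm_nonneg _) (norm_mulChar_le_one χ _)

theorem mulShift_ne_one {k : Type*} [Field k] {ψ : AddChar k ℂ} (hψ : ψ ≠ 1) {b : k}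
    (hb : b ≠ 0) : ψ.mulShift b ≠ 1 := AddChar.IsPrimitive.of_ne_one hψ hb

/-- The Weil bound for `∑ χ(x) χ⁻¹(x + a) ψ(x)`. -/
theorem norm_sum_shiftChar_le {k : Type} [Field k] [Fintype k] (χ : MulChar k ℂ) (hχ : χ ≠ 1)
    (ψ : AddChar k ℂ) (hψ : ψ ≠ 1) (a : k) (ha : a ≠ 0) :
    ‖∑ x : k, χ x * χ⁻¹ (x + a) * ψ x‖ ≤ 2 * √(Fintype.card k) := by
  classical
  have hroots : ∀ b : {b : k // b ≠ 0}, ∃ α β : ℂ, ∀ (K : Type) [Field K] [Algebra k K]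
      [Fintype K], ∑ x : K, χ (Algebra.norm k x) * χ⁻¹ (Algebra.norm k (x + algebraMap k K a)) *
        ψ.mulShift b (Algebra.trace k K x) =
          -(α ^ Module.finrank k K + β ^ Module.finrank k K) := fun b =>
    exists_roots_shiftChar χ (ψ.mulShift b) (mulShift_ne_one hψ b.2) a
  choose α β hαβ using hroots
  set κ := Fintype.card k with hκ
  have hκ2 : 2 ≤ κ := Fintype.one_lt_card
  set Cκ : ℝ := ((9 * κ ^ 2 + 2 * κ : ℕ) : ℝ) with hCκ
  have hpow : ∀ s, 1 ≤ s →
      ‖∑ b : {b : k // b ≠ 0}, (α b ^ (2 * s) + β b ^ (2 * s))‖ ≤ (Cκ + 1) * (κ : ℝ) ^ s := by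
    intro s hs
    obtain ⟨p, hp⟩ := CharP.exists k
    have : Fact p.Prime := ⟨CharP.char_is_prime k p⟩
    have : NeZero (2 * s) := ⟨by omega⟩
    let K := FiniteField.Extension k p (2 * s)
    let _ : Fintype K := Fintype.ofFinite K
    have hfin : Module.finrank k K = 2 * s := FiniteField.finrank_extension k p (2 * s)
    set g : K → ℂ := fun x => χ (Algebra.norm k x) * χ⁻¹ (Algebra.norm k (x + algebraMap k K a))
      with hg
    have h1 := sum_artinSchreier (k := k) g
    have h2 : ∑ b : k, ∑ x : K, g x * ψ (b * Algebra.trace k K x) =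
        κ * ∑ x ∈ Finset.univ.filter (fun x : K => Algebra.trace k K x = 0), g x := by
      rw [Finset.sum_comm, Finset.mul_sum, Finset.sum_filter]
      refine Finset.sum_congr rfl fun x _ => ?_
      rw [← Finset.mul_sum, AddChar.sum_mulShift _ (AddChar.IsPrimitive.of_ne_one hψ)]
      split_ifs
      · rw [mul_comm]
      · rw [Nat.cast_zero, mul_zero]
    have h3 : ∑ b : k, ∑ x : K, g x * ψ (b * Algebra.trace k K x) =
        ∑ x : K, g x + ∑ b : {b : k // b ≠ 0}, -(α b ^ (2 * s) + β b ^ (2 * s)) := by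
      rw [← Finset.add_sum_erase _ _ (Finset.mem_univ (0 : k))]
      congr 1
      · simp
      · rw [Finset.sum_subtype (p := fun b : k => b ≠ 0) (h := by simp)]
        refine Finset.sum_congr rfl fun b _ => ?_
        have := hαβ b K
        rw [hfin] at this
        rw [← this]
        rfl
    have h4 : ‖∑ z : K, g (z ^ κ - z)‖ ≤ Cκ * (κ : ℝ) ^ s :=
      norm_sum_normRatio_le s hs hfin χ hχ a ha
    have h5 : ‖∑ x : K, g x‖ ≤ 1 := by
      have := norm_sum_mulChar_shift_le_one (normMulChar K χ) (normMulChar_ne_one χ hχ)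
        (algebraMap k K a) (by simpa using ha)
      simpa only [normMulChar_apply, normMulChar_inv_apply] using this
    have h6 : ∑ b : {b : k // b ≠ 0}, (α b ^ (2 * s) + β b ^ (2 * s)) =
        ∑ x : K, g x - ∑ z : K, g (z ^ κ - z) := by
      rw [h1, ← h2, h3, Finset.sum_neg_distrib]
      ring
    rw [h6]
    refine (norm_sub_le _ _).trans ?_
    have : (1 : ℝ) ≤ (κ : ℝ) ^ s := one_le_pow₀ (by exact_mod_cast (by omega : 1 ≤ κ))
    linarith
  have hbound := norm_le_of_powerSum_le
    (Sum.elim (fun b => α b ^ 2) (fun b => β b ^ 2) : {b : k // b ≠ 0} ⊕ {b : k // b ≠ 0} → ℂ)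
    κ (Cκ + 1) (by exact_mod_cast (by omega : 0 < κ)) (fun s hs => by
      rw [Fintype.sum_sum_type]
      simp only [Sum.elim_inl, Sum.elim_inr, ← pow_mul]
      rw [← Finset.sum_add_distrib]
      exact hpow s hs)
  have hα := hbound (Sum.inl ⟨1, one_ne_zero⟩)
  have hβ := hbound (Sum.inr ⟨1, one_ne_zero⟩)
  simp only [Sum.elim_inl, Sum.elim_inr, norm_pow] at hα hβ
  have h1 := hαβ ⟨1, one_ne_zero⟩ k
  simp only [Module.finrank_self, pow_one, Algebra.norm_self, MonoidHom.id_apply,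
    Algebra.algebraMap_self_apply,
    Algebra.trace_self_apply, AddChar.mulShift_apply, one_mul] at h1
  rw [h1, norm_neg]
  refine (norm_add_le _ _).trans ?_
  have := Real.le_sqrt_of_sq_le hα
  have := Real.le_sqrt_of_sq_le hβ
  linarith

open Classical in
/-- The Kloosterman sum over a finite field. -/
noncomputable def kloostermanSum {K : Type*} [Field K] [Fintype K] (ψ : AddChar K ℂ)
    (a b : K) : ℂ :=
  ∑ x : K, if x = 0 then 0 else ψ (a * x + b * x⁻¹)

theorem kloostermanSum_mul_right {K : Type*} [Field K] [Fintype K] (ψ : AddChar K ℂ) (a b c : K)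
    (hc : c ≠ 0) : kloostermanSum ψ (a * c) (b * c⁻¹) = kloostermanSum ψ a b := by
  refine Fintype.sum_equiv (Equiv.mulLeft₀ c hc) _ _ fun y => ?_
  have e : Equiv.mulLeft₀ c hc y = c * y := rfl
  rcases eq_or_ne y 0 with rfl | hy
  · simp
  · rw [if_neg hy, if_neg (by rw [e]; exact mul_ne_zero hc hy), e, mul_inv, ← mul_assoc,
      ← mul_assoc]

theorem card_add_inv_eq {K : Type*} [Field K] [Fintype K] [DecidableEq K] (h2 : ringChar K ≠ 2)
    (t : K) : ((Finset.univ.filter fun y : K => y ≠ 0 ∧ y + y⁻¹ = t).card : ℤ) =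
      quadraticChar K (t - 2) * quadraticChar K (t + 2) + 1 := by
  have h20 : (2 : K) ≠ 0 := Ring.two_ne_zero h2
  rw [← map_mul, ← quadraticChar_card_sqrts h2]
  congr 1
  have hsq : ∀ y : K, y ≠ 0 ∧ y + y⁻¹ = t ↔ (2 * y - t) ^ 2 = (t - 2) * (t + 2) := by
    intro y
    constructor
    · rintro ⟨hy, rfl⟩
      field_simp
      ring
    · intro h
      have h4 : (2 * 2 : K) * (y ^ 2 + 1 - t * y) = 0 := by linear_combination h
      have h5 : y ^ 2 + 1 - t * y = 0 :=
        (mul_eq_zero.1 h4).resolve_left (mul_ne_zero h20 h20)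
      have hy : y ≠ 0 := by
        rintro rfl
        simp at h5
      refine ⟨hy, ?_⟩
      field_simp
      linear_combination h5
  refine Finset.card_bij' (fun y _ => 2 * y - t) (fun x _ => (x + t) / 2) ?_ ?_ ?_ ?_
  · intro y hy
    simp only [Finset.mem_filter, Finset.mem_univ, true_and, Set.mem_toFinset,
      Set.mem_ofPred_eq] at hy ⊢
    exact (hsq y).1 hy
  · intro x hx
    simp only [Finset.mem_filter, Finset.mem_univ, true_and, Set.mem_toFinset,
      Set.mem_ofPred_eq] at hx ⊢
    rw [hsq, mul_div_cancel₀ _ h20, add_sub_cancel_right, hx]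
  · intro y _
    field_simp
    ring
  · intro x _
    field_simp
    ring

theorem norm_kloostermanSum_diag_le {K : Type} [Field K] [Fintype K] (h2 : ringChar K ≠ 2)
    (ψ : AddChar K ℂ) (hψ : ψ ≠ 1) : ‖kloostermanSum ψ 1 1‖ ≤ 2 * √(Fintype.card K) := by
  classical
  have h20 : (2 : K) ≠ 0 := Ring.two_ne_zero h2
  set η : MulChar K ℂ := (quadraticChar K).ringHomComp (Int.castRingHom ℂ) with hη
  have hηinv : η⁻¹ = η := ((quadraticChar_isQuadratic K).comp _).inv
  have hη1 : η ≠ 1 := by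
    obtain ⟨a, ha⟩ := MulChar.ne_one_iff.1 (quadraticChar_ne_one h2)
    refine MulChar.ne_one_iff.2 ⟨a, ?_⟩
    rw [hη, MulChar.ringHomComp_apply]
    simpa using ha
  have h1 : kloostermanSum ψ 1 1 =
      ∑ t : K, (η (t - 2) * η (t + 2) + 1) * ψ t := by
    have e1 : kloostermanSum ψ 1 1 =
        ∑ y ∈ Finset.univ.filter fun y : K => y ≠ 0, ψ (y + y⁻¹) := by
      rw [kloostermanSum, Finset.sum_filter]
      refine Finset.sum_congr rfl fun x _ => ?_
      split_ifs <;> simp_all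
    rw [e1, ← Finset.sum_fiberwise_of_maps_to (t := Finset.univ) (g := fun y : K => y + y⁻¹)
      (fun _ _ => Finset.mem_univ _)]
    refine Finset.sum_congr rfl fun t _ => ?_
    rw [Finset.sum_congr rfl (g := fun _ => ψ t), Finset.sum_const, nsmul_eq_mul,
      Finset.filter_filter]
    · congr 1
      have := congrArg (Int.cast (R := ℂ)) (card_add_inv_eq h2 t)
      push_cast at this
      rw [this]
      simp [hη, MulChar.ringHomComp_apply]
    · intro y hy
      rw [(Finset.mem_filter.1 hy).2]
  have h3 : kloostermanSum ψ 1 1 = ψ 2 * ∑ x : K, η x * η⁻¹ (x + 4) * ψ x := by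
    rw [h1]
    simp_rw [add_mul, one_mul]
    rw [Finset.sum_add_distrib, AddChar.sum_eq_zero_of_ne_one hψ, add_zero, Finset.mul_sum]
    refine (Fintype.sum_equiv (Equiv.addRight (2 : K)) _ _ fun x => ?_).symm
    rw [hηinv, Equiv.coe_addRight, add_sub_cancel_right, AddChar.map_add_eq_mul]
    ring_nf
  have h4 : (4 : K) ≠ 0 := by
    have : (4 : K) = 2 * 2 := by norm_num
    rw [this]
    exact mul_ne_zero h20 h20
  rw [h3, norm_mul, AddChar.norm_apply, one_mul]
  exact norm_sum_shiftChar_le η hη1 ψ hψ 4 h4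

theorem norm_kloostermanSum_le_of_isSquare {K : Type} [Field K] [Fintype K] (h2 : ringChar K ≠ 2)
    (ψ : AddChar K ℂ) (hψ : ψ ≠ 1) (a b : K) (ha : a ≠ 0) (hb : b ≠ 0) (hab : IsSquare (a * b)) :
    ‖kloostermanSum ψ a b‖ ≤ 2 * √(Fintype.card K) := by
  obtain ⟨r, hr⟩ := hab
  have hr0 : r ≠ 0 := by
    rintro rfl
    rw [mul_zero] at hr
    exact mul_ne_zero ha hb hr
  have h1 : kloostermanSum ψ a b = kloostermanSum (ψ.mulShift r) 1 1 := by
    rw [← kloostermanSum_mul_right ψ a b (r * a⁻¹) (mul_ne_zero hr0 (inv_ne_zero ha))]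
    refine Finset.sum_congr rfl fun x _ => ?_
    have e1 : a * (r * a⁻¹) = r := by field_simp
    have e2 : b * (r * a⁻¹)⁻¹ = r := by
      field_simp
      linear_combination hr
    rw [e1, e2, AddChar.mulShift_apply, mul_add, one_mul, one_mul]
  rw [h1]
  exact norm_kloostermanSum_diag_le h2 _ (mulShift_ne_one hψ hr0)

open Polynomial Classical in
/-- The completely multiplicative function behind Kloosterman sums. -/
noncomputable def kloostermanChar {k : Type*} [Field k] (ψ : AddChar k ℂ) (a b : k)
    (P : k[X]) : ℂ :=
  if P.coeff 0 = 0 then 0 else ψ (-(a * P.nextCoeff) - b * (P.coeff 1 / P.coeff 0))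

open Polynomial in
theorem kloostermanChar_one {k : Type*} [Field k] (ψ : AddChar k ℂ) (a b : k) :
    kloostermanChar ψ a b 1 = 1 := by
  simp [kloostermanChar, nextCoeff, coeff_one]

open Polynomial in
theorem kloostermanChar_mul {k : Type*} [Field k] (ψ : AddChar k ℂ) (a b : k)
    (P Q : k[X]) (hP : P.Monic) (hQ : Q.Monic) :
    kloostermanChar ψ a b (P * Q) = kloostermanChar ψ a b P * kloostermanChar ψ a b Q := by
  have h1 : (P * Q).coeff 1 = P.coeff 0 * Q.coeff 1 + P.coeff 1 * Q.coeff 0 := by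
    rw [coeff_mul, Finset.Nat.antidiagonal_succ]
    simp
  simp only [kloostermanChar, mul_coeff_zero, hP.nextCoeff_mul hQ, h1, mul_eq_zero]
  by_cases hp : P.coeff 0 = 0
  · simp [hp]
  by_cases hq : Q.coeff 0 = 0
  · simp [hq]
  rw [if_neg (by simp [mul_coeff_zero, hp, hq]), if_neg hp, if_neg hq, ← AddChar.map_add_eq_mul]
  congr 1
  field_simp
  ring

open Polynomial in
theorem kloostermanChar_minpoly {k K : Type*} [Field k] [Field K] [Algebra k K]
    [FiniteDimensional k K] (ψ : AddChar k ℂ) (a b : k) (x : K) (hx : x ≠ 0) :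
    kloostermanChar ψ a b (minpoly k x) ^ (Module.finrank k K / (minpoly k x).natDegree) =
      ψ (Algebra.trace k K (algebraMap k K a * x + algebraMap k K b * x⁻¹)) := by
  have hx' : IsIntegral k x := .of_finite k x
  have hc : (minpoly k x).coeff 0 ≠ 0 := minpoly.coeff_zero_ne_zero hx' hx
  rw [kloostermanChar, if_neg hc, map_add, ← Algebra.smul_def, ← Algebra.smul_def, map_smul,
    map_smul, trace_inv_eq_minpoly_coeff hx, trace_eq_minpoly_nextCoeff, ← AddChar.map_nsmul_eq_pow]
  congr 1
  simp only [nsmul_eq_mul, smul_eq_mul]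
  ring

open Polynomial in
theorem sum_kloostermanChar_minpoly {k K : Type*} [Field k] [Field K] [Algebra k K] [Fintype k]
    [Fintype K] (ψ : AddChar k ℂ) (ψ' : AddChar K ℂ)
    (hψ' : ∀ x, ψ' x = ψ (Algebra.trace k K x)) (a b : k) :
    irredPowerSum (kloostermanChar ψ a b) (Module.finrank k K) =
      kloostermanSum ψ' (algebraMap k K a) (algebraMap k K b) := by
  rw [← sum_minpoly_eq_irredPowerSum, kloostermanSum]
  refine Finset.sum_congr rfl fun x _ => ?_
  split_ifs with hx
  · rw [hx, minpoly.zero, natDegree_X, Nat.div_one, kloostermanChar, if_pos (coeff_X_zero),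
      zero_pow Module.finrank_pos.ne']
  · rw [kloostermanChar_minpoly ψ a b x hx, hψ']

open Polynomial in
theorem irredPowerSum_two {k : Type*} [Field k] [Fintype k]
    (F : k[X] → ℂ) (hF1 : F 1 = 1)
    (hF : ∀ P Q : k[X], P.Monic → Q.Monic → F (P * Q) = F P * F Q) :
    irredPowerSum F 2 = 2 * ∑ P ∈ monicsOfDegree k 2, F P - irredPowerSum F 1 ^ 2 := by
  have h0 : ∑ P ∈ monicsOfDegree k 0, F P = 1 := by
    rw [sum_monicsOfDegree]
    simp [monicOfCoeffs, hF1]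
  have h1 := newton_monics F hF1 hF 1
  have h2 := newton_monics F hF1 hF 2
  simp only [Finset.Icc_self, Finset.sum_singleton, Nat.sub_self, h0, Nat.cast_one, one_mul,
    mul_one] at h1
  have e : Finset.Icc 1 2 = {1, 2} := rfl
  rw [e, Finset.sum_pair (by norm_num)] at h2
  simp only [Nat.sub_self, h0, h1, Nat.reduceSub, mul_one, Nat.cast_ofNat] at h2
  linear_combination -h2

open Polynomial in
theorem sum_monicsOfDegree_two_kloostermanChar {k : Type*} [Field k] [Fintype k]
    (ψ : AddChar k ℂ) (hψ : ψ ≠ 1) (a b : k) (ha : a ≠ 0) (hb : b ≠ 0) :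
    ∑ P ∈ monicsOfDegree k 2, kloostermanChar ψ a b P = Fintype.card k := by
  classical
  rw [sum_monicsOfDegree]
  have hval : ∀ v : Fin 2 → k, kloostermanChar ψ a b (monicOfCoeffs v) =
      if v 0 = 0 then 0 else ψ (v 1 * (-a - b / v 0)) := by
    intro v
    have e0 : (monicOfCoeffs v).coeff 0 = v 0 := monicOfCoeffs_coeff v 0
    have e1 : (monicOfCoeffs v).coeff 1 = v 1 := monicOfCoeffs_coeff v 1
    have e2 : (monicOfCoeffs v).nextCoeff = v 1 := by
      rw [nextCoeff_of_natDegree_pos (by rw [monicOfCoeffs_natDegree]; norm_num),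
        monicOfCoeffs_natDegree]
      exact e1
    rw [kloostermanChar, e0, e1, e2]
    split_ifs
    · rfl
    · congr 1
      ring
  simp_rw [hval]
  rw [← (finTwoArrowEquiv k).symm.sum_comp, Fintype.sum_prod_type]
  have hab : -b / a ≠ 0 := div_ne_zero (neg_ne_zero.2 hb) ha
  rw [Finset.sum_eq_single (-b / a)]
  · simp only [finTwoArrowEquiv_symm_apply, Matrix.cons_val_zero, Matrix.cons_val_one, hab,
      if_false]
    have : -a - b / (-b / a) = 0 := by field_simp; ring
    simp [this]
  · intro u _ hu
    simp only [finTwoArrowEquiv_symm_apply, Matrix.cons_val_zero, Matrix.cons_val_one]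
    split_ifs with hu0
    · simp
    · rw [AddChar.sum_mulShift _ (AddChar.IsPrimitive.of_ne_one hψ), if_neg, Nat.cast_zero]
      intro h
      apply hu
      field_simp at h ⊢
      linear_combination -h
  · simp

/-- The Weil bound for Kloosterman sums in odd characteristic. -/
theorem norm_kloostermanSum_le {k : Type} [Field k] [Fintype k] (h2 : ringChar k ≠ 2)
    (ψ : AddChar k ℂ) (hψ : ψ ≠ 1) (a b : k) (ha : a ≠ 0) (hb : b ≠ 0) :
    ‖kloostermanSum ψ a b‖ ≤ 2 * √(Fintype.card k) := by
  classical
  obtain ⟨p, hp⟩ := CharP.exists k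
  have : Fact p.Prime := ⟨CharP.char_is_prime k p⟩
  let K := FiniteField.Extension k p 2
  let _ : Fintype K := Fintype.ofFinite K
  have hfin : Module.finrank k K = 2 := FiniteField.finrank_extension k p 2
  set κ := Fintype.card k with hκ
  have hcard : Fintype.card K = κ ^ 2 := by
    rw [Module.card_eq_pow_finrank (K := k), hfin]
  let ψ' : AddChar K ℂ := ψ.compAddMonoidHom (Algebra.trace k K).toAddMonoidHom
  have hψ'v : ∀ x, ψ' x = ψ (Algebra.trace k K x) := fun _ => rfl
  have hψ' : ψ' ≠ 1 := by
    obtain ⟨t, ht⟩ := AddChar.ne_one_iff.1 hψ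
    obtain ⟨x, hx⟩ := Algebra.trace_surjective k K t
    refine AddChar.ne_one_iff.2 ⟨x, ?_⟩
    rwa [hψ'v, hx]
  have h2K : ringChar K ≠ 2 := by
    have : CharP K p := charP_of_injective_algebraMap (algebraMap k K).injective p
    rw [ringChar.eq K p]
    rwa [ringChar.eq k p] at h2
  have hodd : κ % 2 = 1 := FiniteField.odd_card_of_char_ne_two h2
  have hsq : IsSquare (algebraMap k K a * algebraMap k K b) := by
    rw [← map_mul]
    have hab : a * b ≠ 0 := mul_ne_zero ha hb
    rw [FiniteField.isSquare_iff h2K (by simpa using hab), hcard]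
    have : κ ^ 2 / 2 = (κ - 1) * ((κ + 1) / 2) := by
      obtain ⟨m, hm⟩ : ∃ m, κ = 2 * m + 1 := ⟨κ / 2, by omega⟩
      rw [hm]
      have e1 : (2 * m + 1 + 1) / 2 = m + 1 := by omega
      have e2 : (2 * m + 1) ^ 2 = 2 * (2 * m * (m + 1)) + 1 := by ring
      rw [e1, e2]
      have : (2 * (2 * m * (m + 1)) + 1) / 2 = 2 * m * (m + 1) := by omega
      rw [this]
      simp
    rw [this, pow_mul, ← map_pow, FiniteField.pow_card_sub_one_eq_one _ hab, map_one, one_pow]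
  have hS2 := norm_kloostermanSum_le_of_isSquare h2K ψ' hψ' _ _ (by simpa using ha)
    (by simpa using hb) hsq
  have hsum2 := sum_kloostermanChar_minpoly (K := K) ψ ψ' hψ'v a b
  have hsum1 := sum_kloostermanChar_minpoly (K := k) ψ ψ (fun x => by simp) a b
  have hnewton := irredPowerSum_two (kloostermanChar ψ a b)
    (kloostermanChar_one ψ a b) (kloostermanChar_mul ψ a b)
  rw [hfin] at hsum2
  rw [Module.finrank_self] at hsum1
  rw [hsum2, hsum1, sum_monicsOfDegree_two_kloostermanChar ψ hψ a b ha hb] at hnewton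
  have h3 : kloostermanSum ψ a b ^ 2 = 2 * κ -
      kloostermanSum ψ' (algebraMap k K a) (algebraMap k K b) := by
    rw [hnewton]
    simp [hκ]
  have hκ0 : (0 : ℝ) ≤ κ := Nat.cast_nonneg _
  rw [hcard, Nat.cast_pow, Real.sqrt_sq hκ0] at hS2
  have h4 : ‖kloostermanSum ψ a b‖ ^ 2 ≤ 4 * κ := by
    rw [← norm_pow, h3]
    refine (norm_sub_le _ _).trans ?_
    have : ‖(2 * κ : ℂ)‖ = 2 * κ := by simp
    rw [this]
    linarith
  have h5 := Real.le_sqrt_of_sq_le h4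
  rwa [show (4 * κ : ℝ) = 2 ^ 2 * κ by norm_num, Real.sqrt_mul (by norm_num),
    Real.sqrt_sq (by norm_num)] at h5

namespace ZModPrimePow

theorem isUnit_natCast {p k : ℕ} [hp : Fact p.Prime] {m : ℕ} (hm : ¬p ∣ m) :
    IsUnit (m : ZMod (p ^ k)) :=
  (ZMod.isUnit_iff_coprime _ _).2 (((hp.out.coprime_iff_not_dvd.2 hm).symm).pow_right k)

theorem exists_eq_pow_mul_isUnit {p k : ℕ} [hp : Fact p.Prime] (x : ZMod (p ^ k)) :
    ∃ i ≤ k, ∃ u, IsUnit u ∧ x = (p : ZMod (p ^ k)) ^ i * u := by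
  rcases eq_or_ne x 0 with rfl | hx
  · refine ⟨k, le_rfl, 1, isUnit_one, ?_⟩
    rw [mul_one, ← Nat.cast_pow, ZMod.natCast_self]
  · have hval : x.val ≠ 0 := by rwa [Ne, ZMod.val_eq_zero]
    obtain ⟨i, m, hm, hi⟩ := Nat.exists_eq_pow_mul_and_not_dvd hval p hp.out.ne_one
    refine ⟨i, ?_, m, isUnit_natCast hm, ?_⟩
    · have h1 : p ^ i ≤ x.val := Nat.le_of_dvd (Nat.pos_of_ne_zero hval) ⟨m, hi⟩
      exact (Nat.pow_lt_pow_iff_right hp.out.one_lt).1 (h1.trans_lt (ZMod.val_lt x)) |>.le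
    · rw [← ZMod.natCast_zmod_val x, hi]
      push_cast
      rfl

theorem pow_self_eq_zero {p k : ℕ} : (p : ZMod (p ^ k)) ^ k = 0 := by
  rw [← Nat.cast_pow, ZMod.natCast_self]

theorem pow_eq_zero_iff {p k : ℕ} [hp : Fact p.Prime] (i : ℕ) :
    (p : ZMod (p ^ k)) ^ i = 0 ↔ k ≤ i := by
  rw [← Nat.cast_pow, ZMod.natCast_eq_zero_iff, Nat.pow_dvd_pow_iff_le_right hp.out.one_lt]

theorem pow_mul_eq_zero_iff {p k : ℕ} [hp : Fact p.Prime] {i : ℕ} (hi : i ≤ k)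
    (x : ZMod (p ^ k)) : (p : ZMod (p ^ k)) ^ i * x = 0 ↔ (p : ZMod (p ^ k)) ^ (k - i) ∣ x := by
  constructor
  · intro h
    obtain ⟨j, hj, u, hu, rfl⟩ := exists_eq_pow_mul_isUnit x
    rw [← mul_assoc, ← pow_add, hu.mul_left_eq_zero, pow_eq_zero_iff] at h
    exact (pow_dvd_pow _ (by omega)).mul_right u
  · rintro ⟨y, rfl⟩
    rw [← mul_assoc, ← pow_add, Nat.add_sub_cancel' hi, pow_self_eq_zero, zero_mul]

theorem pow_dvd_pow_mul_iff {p k : ℕ} [hp : Fact p.Prime] {i j : ℕ} (hi : i ≤ j) (hj : j ≤ k)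
    (x : ZMod (p ^ k)) :
    (p : ZMod (p ^ k)) ^ j ∣ (p : ZMod (p ^ k)) ^ i * x ↔ (p : ZMod (p ^ k)) ^ (j - i) ∣ x := by
  constructor
  · rintro ⟨y, hy⟩
    have h1 : (p : ZMod (p ^ k)) ^ i * (x - p ^ (j - i) * y) = 0 := by
      rw [mul_sub, hy, ← mul_assoc, ← pow_add, Nat.add_sub_cancel' hi, sub_self]
    have h2 := (pow_mul_eq_zero_iff (hi.trans hj) _).1 h1
    have h3 := (pow_dvd_pow (p : ZMod (p ^ k)) (by omega : j - i ≤ k - i)).trans h2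
    exact (dvd_sub_left (dvd_mul_right _ _)).1 h3
  · rintro ⟨y, rfl⟩
    rw [← mul_assoc, ← pow_add, Nat.add_sub_cancel' hi]
    exact dvd_mul_right _ _

theorem not_isUnit_iff {p k : ℕ} [hp : Fact p.Prime] (hk : k ≠ 0) (x : ZMod (p ^ k)) :
    ¬IsUnit x ↔ (p : ZMod (p ^ k)) ∣ x := by
  have hnil : IsNilpotent (p : ZMod (p ^ k)) := ⟨k, pow_self_eq_zero⟩
  have : Fact (1 < p ^ k) := ⟨Nat.one_lt_pow hk hp.out.one_lt⟩
  constructor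
  · intro h
    obtain ⟨j, hj, u, hu, rfl⟩ := exists_eq_pow_mul_isUnit x
    refine (dvd_pow_self _ ?_).mul_right u
    rintro rfl
    exact h (by simpa using hu)
  · rintro h hx
    exact hnil.not_isUnit (isUnit_of_dvd_unit h hx)

theorem pow_dvd_intCast_iff {p k : ℕ} [hp : Fact p.Prime] {i : ℕ} (hi : i ≤ k) (a : ℤ) :
    (p : ZMod (p ^ k)) ^ i ∣ (a : ZMod (p ^ k)) ↔ p ^ i ∣ Int.gcd a (p ^ k : ℕ) := by
  have h0 : p ^ i ∣ p ^ k := pow_dvd_pow p hi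
  rw [Int.gcd_eq_natAbs, Nat.dvd_gcd_iff, Int.natAbs_natCast, ← Int.natCast_dvd]
  constructor
  · rintro ⟨y, hy⟩
    refine ⟨?_, h0⟩
    have h1 : ((a - (p ^ i : ℕ) * y.val : ℤ) : ZMod (p ^ k)) = 0 := by
      push_cast
      rw [hy, ZMod.natCast_zmod_val, sub_self]
    rw [ZMod.intCast_zmod_eq_zero_iff_dvd] at h1
    have h2 : ((p ^ i : ℕ) : ℤ) ∣ a - (p ^ i : ℕ) * y.val :=
      (Int.natCast_dvd_natCast.2 h0).trans h1
    exact (dvd_sub_left (dvd_mul_right _ _)).1 h2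
  · rintro ⟨⟨y, rfl⟩, -⟩
    push_cast
    exact dvd_mul_right _ _

theorem card_dvd_sub_le {p k : ℕ} [hp : Fact p.Prime] {i : ℕ} (hi : i ≤ k) (c : ZMod (p ^ k))
    [DecidablePred fun y : ZMod (p ^ k) => (p : ZMod (p ^ k)) ^ i ∣ y - c] :
    (Finset.univ.filter fun y : ZMod (p ^ k) => (p : ZMod (p ^ k)) ^ i ∣ y - c).card
      ≤ p ^ (k - i) := by
  classical
  have : (Finset.univ.filter fun y : ZMod (p ^ k) => (p : ZMod (p ^ k)) ^ i ∣ y - c) ⊆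
      (Finset.range (p ^ (k - i))).image fun t : ℕ =>
        c + (p : ZMod (p ^ k)) ^ i * (t : ZMod (p ^ k)) := by
    intro y hy
    obtain ⟨t, ht⟩ := (Finset.mem_filter.1 hy).2
    refine Finset.mem_image.2 ⟨t.val % p ^ (k - i), Finset.mem_range.2
      (Nat.mod_lt _ (pow_pos hp.out.pos _)), ?_⟩
    have h1 : (t.val : ZMod (p ^ k)) =
        (p ^ (k - i) * (t.val / p ^ (k - i)) + t.val % p ^ (k - i) : ℕ) := by
      rw [Nat.div_add_mod]
    rw [ZMod.natCast_zmod_val] at h1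
    have h2 : y = c + (p : ZMod (p ^ k)) ^ i * t := by rw [← ht]; ring
    rw [h2]
    conv_rhs => rw [h1]
    push_cast
    rw [mul_add, ← mul_assoc, ← pow_add, Nat.add_sub_cancel' hi, pow_self_eq_zero, zero_mul,
      zero_add]
  refine (Finset.card_le_card this).trans (Finset.card_image_le.trans ?_)
  rw [Finset.card_range]

/-- Counting solutions of a quadratic congruence. -/
theorem card_quadratic_le {p k : ℕ} [hp : Fact p.Prime] (hp2 : p ≠ 2) {b : ℕ} (hb : b ≤ k)
    (h w : ZMod (p ^ k)) (hh : IsUnit h)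
    [DecidablePred fun y : ZMod (p ^ k) => (p : ZMod (p ^ k)) ^ b ∣ h * y ^ 2 - w] :
    ∃ j, 2 * j ≤ b ∧ (p : ZMod (p ^ k)) ^ (2 * j) ∣ w ∧
      (Finset.univ.filter fun y : ZMod (p ^ k) => (p : ZMod (p ^ k)) ^ b ∣ h * y ^ 2 - w).card
        ≤ 2 * p ^ (k - b + j) := by
  classical
  have h2 : IsUnit (2 : ZMod (p ^ k)) := by
    have := isUnit_natCast (p := p) (k := k) (m := 2) (fun h => hp2
      ((Nat.prime_dvd_prime_iff_eq hp.out Nat.prime_two).1 h))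
    simpa using this
  by_cases hw : (p : ZMod (p ^ k)) ^ b ∣ w
  · refine ⟨b / 2, by omega, (pow_dvd_pow _ (by omega)).trans hw, ?_⟩
    have : (Finset.univ.filter fun y : ZMod (p ^ k) => (p : ZMod (p ^ k)) ^ b ∣ h * y ^ 2 - w) ⊆
        Finset.univ.filter fun y : ZMod (p ^ k) => (p : ZMod (p ^ k)) ^ (b - b / 2) ∣ y - 0 := by
      intro y hy
      have h1 := (dvd_sub_left hw).1 (Finset.mem_filter.1 hy).2
      simp only [Finset.mem_filter, Finset.mem_univ, true_and, sub_zero]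
      obtain ⟨i, hi, u, hu, rfl⟩ := exists_eq_pow_mul_isUnit y
      refine (pow_dvd_pow _ ?_).mul_right u
      rw [hh.dvd_mul_left, mul_pow, (hu.pow 2).dvd_mul_right, ← pow_mul] at h1
      by_contra! hcon
      have h3 := mul_dvd_mul_left ((p : ZMod (p ^ k)) ^ (k - b)) h1
      rw [← pow_add, ← pow_add, Nat.sub_add_cancel hb, pow_self_eq_zero, zero_dvd_iff,
        pow_eq_zero_iff] at h3
      omega
    refine (Finset.card_le_card this).trans ((card_dvd_sub_le (by omega) 0).trans ?_)
    have : k - (b - b / 2) = k - b + b / 2 := by omega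
    rw [this]
    omega
  · rcases Finset.eq_empty_or_nonempty
      (Finset.univ.filter fun y : ZMod (p ^ k) =>
        (p : ZMod (p ^ k)) ^ b ∣ h * y ^ 2 - w) with he | he
    · exact ⟨0, by omega, by simp, by simp [he]⟩
    obtain ⟨y₁, hy₁⟩ := he
    have hy₁ := (Finset.mem_filter.1 hy₁).2
    obtain ⟨j, hj, u, hu, hyj⟩ := exists_eq_pow_mul_isUnit y₁
    have hjb : 2 * j < b := by
      by_contra! hcon
      apply hw
      have h3 : (p : ZMod (p ^ k)) ^ b ∣ h * y₁ ^ 2 := by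
        rw [hyj, mul_pow, ← pow_mul]
        exact ((pow_dvd_pow _ (by omega)).mul_right _).mul_left h
      exact (dvd_sub_right h3).1 hy₁
    refine ⟨j, hjb.le, ?_, ?_⟩
    · have h3 : (p : ZMod (p ^ k)) ^ (2 * j) ∣ h * y₁ ^ 2 := by
        rw [hyj, mul_pow, ← pow_mul]
        exact ((pow_dvd_pow _ (by omega)).mul_right _).mul_left h
      exact (dvd_sub_right h3).1 ((pow_dvd_pow _ hjb.le).trans hy₁)
    · have hsub : (Finset.univ.filter fun y : ZMod (p ^ k) =>
          (p : ZMod (p ^ k)) ^ b ∣ h * y ^ 2 - w) ⊆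
          (Finset.univ.filter fun y : ZMod (p ^ k) => (p : ZMod (p ^ k)) ^ (b - j) ∣ y - y₁) ∪
          (Finset.univ.filter fun y : ZMod (p ^ k) => (p : ZMod (p ^ k)) ^ (b - j) ∣ y - -y₁) := by
        intro y hy
        have hy := (Finset.mem_filter.1 hy).2
        simp only [Finset.mem_union, Finset.mem_filter, Finset.mem_univ, true_and]
        have h3 : (p : ZMod (p ^ k)) ^ b ∣ (y - y₁) * (y - -y₁) := by
          have := dvd_sub hy hy₁
          rw [← hh.dvd_mul_left]
          convert this using 1
          ring
        obtain ⟨i, hi, v, hv, hA⟩ := exists_eq_pow_mul_isUnit (y - y₁)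
        obtain ⟨i', hi', v', hv', hB⟩ := exists_eq_pow_mul_isUnit (y - -y₁)
        rw [hA, hB]
        have h4 : b ≤ i + i' := by
          rw [hA, hB] at h3
          by_contra! hcon
          have h5 : (p : ZMod (p ^ k)) ^ b ∣ (p : ZMod (p ^ k)) ^ (i + i') := by
            rw [← (hv.mul hv').dvd_mul_right]
            convert h3 using 1
            ring
          have h6 := mul_dvd_mul_left ((p : ZMod (p ^ k)) ^ (k - b)) h5
          rw [← pow_add, ← pow_add, Nat.sub_add_cancel hb, pow_self_eq_zero, zero_dvd_iff,
            pow_eq_zero_iff] at h6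
          omega
        have h5 : i ≤ j ∨ i' ≤ j := by
          by_contra! hcon
          have h6 : (p : ZMod (p ^ k)) ^ (j + 1) ∣ (y - -y₁) - (y - y₁) := by
            rw [hA, hB]
            exact dvd_sub ((pow_dvd_pow _ hcon.2).mul_right _) ((pow_dvd_pow _ hcon.1).mul_right _)
          have h7 : (y - -y₁) - (y - y₁) = 2 * y₁ := by ring
          rw [h7, h2.dvd_mul_left, hyj, hu.dvd_mul_right] at h6
          have h8 := mul_dvd_mul_left ((p : ZMod (p ^ k)) ^ (k - (j + 1))) h6
          rw [← pow_add, ← pow_add, Nat.sub_add_cancel (by omega), pow_self_eq_zero, zero_dvd_iff,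
            pow_eq_zero_iff] at h8
          omega
        rcases h5 with h5 | h5
        · exact Or.inr ((pow_dvd_pow _ (by omega)).mul_right _)
        · exact Or.inl ((pow_dvd_pow _ (by omega)).mul_right _)
      refine (Finset.card_le_card hsub).trans ((Finset.card_union_le _ _).trans ?_)
      have e : k - (b - j) = k - b + j := by omega
      have h3 := card_dvd_sub_le (p := p) (k := k) (i := b - j) (by omega) y₁
      have h4 := card_dvd_sub_le (p := p) (k := k) (i := b - j) (by omega) (-y₁)
      rw [e] at h3 h4
      omega

end ZModPrimePow

/-- A Dirichlet character which is not induced from `q / p` for any prime `p ∣ q`. -/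
def IsLocallyPrimitive {q : ℕ} (χ : DirichletCharacter ℂ q) : Prop :=
  ∀ p : ℕ, p.Prime → p ∣ q → ∃ y : ZMod q,
    IsUnit (1 + ((q / p : ℕ) : ZMod q) * y) ∧ χ (1 + ((q / p : ℕ) : ZMod q) * y) ≠ 1

/-- The complete correlation sum `∑ χ(n + a) χ⁻¹(n) ψ(h n)` modulo `q`. -/
noncomputable def correlationSum {q : ℕ} [NeZero q] (χ : DirichletCharacter ℂ q)
    (ψ : AddChar (ZMod q) ℂ) (a h : ZMod q) : ℂ := ∑ n : ZMod q, χ (n + a) * χ⁻¹ n * ψ (h * n)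

theorem sum_addChar_mul {q : ℕ} [NeZero q] {ψ : AddChar (ZMod q) ℂ} (hψ : ψ.IsPrimitive)
    (b : ZMod q) : ∑ x : ZMod q, ψ (b * x) = if b = 0 then (q : ℂ) else 0 := by
  classical
  have := AddChar.sum_mulShift b hψ
  simp_rw [mul_comm _ b] at this
  rw [this, ZMod.card]
  split_ifs <;> simp

theorem exists_eq_mulShift {q : ℕ} [NeZero q] {ψ : AddChar (ZMod q) ℂ} (hψ : ψ.IsPrimitive)
    (φ : AddChar (ZMod q) ℂ) : ∃ d : ZMod q, ∀ x, φ x = ψ (d * x) := by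
  have hinj := AddChar.to_mulShift_inj_of_isPrimitive hψ
  have hbij : Function.Bijective ψ.mulShift :=
    (Fintype.bijective_iff_injective_and_card _).2 ⟨hinj, AddChar.card_eq.symm⟩
  obtain ⟨d, rfl⟩ := hbij.2 φ
  exact ⟨d, fun x => rfl⟩

namespace ZModPrimePow

theorem eq_zero_of_forall_addChar {q : ℕ} [NeZero q] {ψ : AddChar (ZMod q) ℂ} (hψ : ψ.IsPrimitive)
    {d : ZMod q} (h : ∀ x, ψ (d * x) = 1) : d = 0 := by
  by_contra hd
  exact hψ hd (by ext x; simpa using h x)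

theorem exists_isUnit_character_eq {p k : ℕ} [hp : Fact p.Prime] (hk : 2 ≤ k)
    (χ : DirichletCharacter ℂ (p ^ k)) (hχ : IsLocallyPrimitive χ)
    (ψ : AddChar (ZMod (p ^ k)) ℂ) (hψ : ψ.IsPrimitive) :
    ∃ c : ZMod (p ^ k), IsUnit c ∧ ∀ s, k ≤ 2 * s → ∀ x : ZMod (p ^ k),
      χ (1 + (p : ZMod (p ^ k)) ^ s * x) = ψ (c * ((p : ZMod (p ^ k)) ^ s * x)) := by
  set s₀ := (k + 1) / 2 with hs₀
  let φ : AddChar (ZMod (p ^ k)) ℂ :=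
    { toFun := fun x => χ (1 + (p : ZMod (p ^ k)) ^ s₀ * x)
      map_zero_eq_one' := by simp
      map_add_eq_mul' := fun x y => by
        rw [← map_mul]
        congr 1
        have h0 : (p : ZMod (p ^ k)) ^ s₀ * p ^ s₀ = 0 := by
          rw [← pow_add, pow_eq_zero_iff]; omega
        linear_combination (-x * y) * h0 }
  obtain ⟨d, hd⟩ := exists_eq_mulShift hψ φ
  have hd0 : (p : ZMod (p ^ k)) ^ (k - s₀) * d = 0 := by
    apply eq_zero_of_forall_addChar hψ
    intro x
    rw [mul_comm _ d, mul_assoc, ← hd]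
    change χ (1 + (p : ZMod (p ^ k)) ^ s₀ * _) = 1
    rw [← mul_assoc, ← pow_add, Nat.add_sub_cancel' (by omega), pow_self_eq_zero, zero_mul,
      add_zero, map_one]
  obtain ⟨c, hc⟩ := (pow_mul_eq_zero_iff (by omega) d).1 hd0
  rw [Nat.sub_sub_self (by omega)] at hc
  have key : ∀ s, k ≤ 2 * s → ∀ x : ZMod (p ^ k),
      χ (1 + (p : ZMod (p ^ k)) ^ s * x) = ψ (c * ((p : ZMod (p ^ k)) ^ s * x)) := by
    intro s hs x
    have h1 : (p : ZMod (p ^ k)) ^ s = p ^ s₀ * p ^ (s - s₀) := by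
      rw [← pow_add, Nat.add_sub_cancel' (by omega)]
    have h2 := hd ((p : ZMod (p ^ k)) ^ (s - s₀) * x)
    rw [h1, mul_assoc]
    refine h2.trans ?_
    rw [hc]
    congr 1
    ring
  refine ⟨c, ?_, key⟩
  by_contra hcu
  rw [not_isUnit_iff (by omega)] at hcu
  obtain ⟨c', rfl⟩ := hcu
  obtain ⟨y, -, hy⟩ := hχ p hp.out (dvd_pow_self p (by omega))
  apply hy
  have h1 : p ^ k / p = p ^ (k - 1) := by
    rw [Nat.div_eq_of_eq_mul_left hp.out.pos]
    rw [← pow_succ, Nat.sub_add_cancel (by omega)]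
  rw [h1, Nat.cast_pow, key (k - 1) (by omega)]
  have h2 : (p : ZMod (p ^ k)) * c' * (p ^ (k - 1) * y) = 0 := by
    have : (p : ZMod (p ^ k)) * p ^ (k - 1) = 0 := by
      rw [← pow_succ', Nat.sub_add_cancel (by omega), pow_self_eq_zero]
    linear_combination c' * y * this
  rw [h2, AddChar.map_zero_eq_one]

theorem isUnit_one_add_pow_mul {p k : ℕ} {e : ℕ} (he : 1 ≤ e) (t : ZMod (p ^ k)) :
    IsUnit (1 + (p : ZMod (p ^ k)) ^ e * t) := by
  apply IsNilpotent.isUnit_one_add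
  refine ⟨k, ?_⟩
  rw [mul_pow, ← pow_mul, mul_comm e k, pow_mul, pow_self_eq_zero, zero_pow (by omega), zero_mul]

theorem isUnit_add_pow_mul_iff {p k : ℕ} {e : ℕ} (he : 1 ≤ e)
    (x t : ZMod (p ^ k)) : IsUnit (x + (p : ZMod (p ^ k)) ^ e * t) ↔ IsUnit x := by
  have hnil : ∀ t, IsNilpotent ((p : ZMod (p ^ k)) ^ e * t) := fun t => by
    refine ⟨k, ?_⟩
    rw [mul_pow, ← pow_mul, mul_comm e k, pow_mul, pow_self_eq_zero, zero_pow (by omega), zero_mul]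
  constructor
  · intro h
    have := (hnil (-t)).isUnit_add_left_of_commute h (Commute.all _ _)
    convert this using 1
    ring
  · intro h
    exact (hnil t).isUnit_add_left_of_commute h (Commute.all _ _)

theorem summand_mul_eq {p k : ℕ} (χ : DirichletCharacter ℂ (p ^ k)) (a n u : ZMod (p ^ k))
    (z : ZMod (p ^ k))
    (hu : IsUnit u) (hw : n * u + a = (n + a) * u * (1 + z)) :
    χ (n * u + a) * χ⁻¹ (n * u) = χ (n + a) * χ⁻¹ n * χ (1 + z) := by
  have h1 : χ u * χ⁻¹ u = 1 := by
    rw [← MulChar.mul_apply, mul_inv_cancel, MulChar.one_apply hu]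
  rw [hw]
  simp only [map_mul]
  linear_combination (χ (n + a) * χ⁻¹ n * χ (1 + z)) * h1

end ZModPrimePow

theorem norm_correlationSum_summand_le {q : ℕ} [NeZero q] (χ : DirichletCharacter ℂ q)
    (ψ : AddChar (ZMod q) ℂ) (a h n : ZMod q) : ‖χ (n + a) * χ⁻¹ n * ψ (h * n)‖ ≤ 1 := by
  rw [norm_mul, norm_mul, AddChar.norm_apply, mul_one]
  exact mul_le_one₀ (χ.norm_le_one _) (norm_nonneg _) (χ⁻¹.norm_le_one _)

theorem norm_correlationSum_le {q : ℕ} [NeZero q] (χ : DirichletCharacter ℂ q)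
    (ψ : AddChar (ZMod q) ℂ) (a h : ZMod q) : ‖correlationSum χ ψ a h‖ ≤ q := by
  refine (norm_sum_le _ _).trans ?_
  refine (Finset.sum_le_sum fun n _ => norm_correlationSum_summand_le χ ψ a h n).trans ?_
  simp [ZMod.card]

namespace ZModPrimePow

/-- The linearisation data of a character modulo `p ^ k`. -/
def IsLogCoeff {p k : ℕ} (χ : DirichletCharacter ℂ (p ^ k)) (ψ : AddChar (ZMod (p ^ k)) ℂ)
    (c : ZMod (p ^ k)) : Prop :=
  ∀ s, k ≤ 2 * s → ∀ x : ZMod (p ^ k),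
      χ (1 + (p : ZMod (p ^ k)) ^ s * x) = ψ (c * ((p : ZMod (p ^ k)) ^ s * x))

/-- The stationary set of the correlation sum at level `e`. -/
def stationarySet {p k : ℕ} (a h c : ZMod (p ^ k)) (e : ℕ) : Set (ZMod (p ^ k)) :=
  {n | IsUnit n ∧ IsUnit (n + a) ∧ (p : ZMod (p ^ k)) ^ e * (h * (n * (n + a)) - c * a) = 0}

theorem summand_eq_zero {q : ℕ} (χ : DirichletCharacter ℂ q) (ψ : AddChar (ZMod q) ℂ)
    {a n : ZMod q} (h : ZMod q) (hn : ¬(IsUnit n ∧ IsUnit (n + a))) :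
    χ (n + a) * χ⁻¹ n * ψ (h * n) = 0 := by
  rcases not_and_or.1 hn with hn | hn
  · rw [MulChar.map_nonunit _ hn, mul_zero, zero_mul]
  · rw [MulChar.map_nonunit _ hn, zero_mul, zero_mul]

theorem isUnit_mul_one_add_add_iff {p k e : ℕ} (he : 1 ≤ e) (n a t : ZMod (p ^ k)) :
    (IsUnit (n * (1 + (p : ZMod (p ^ k)) ^ e * t)) ∧
      IsUnit (n * (1 + (p : ZMod (p ^ k)) ^ e * t) + a)) ↔ IsUnit n ∧ IsUnit (n + a) := by
  have h1 : n * (1 + (p : ZMod (p ^ k)) ^ e * t) + a = n + a + p ^ e * (n * t) := by ring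
  rw [IsUnit.mul_iff, h1, isUnit_add_pow_mul_iff he (n + a)]
  have := isUnit_one_add_pow_mul he t
  tauto

theorem summand_mul_one_add {p k v e : ℕ} [hp : Fact p.Prime] (he : 1 ≤ e) (hk : k ≤ v + 2 * e)
    {χ : DirichletCharacter ℂ (p ^ k)} {ψ : AddChar (ZMod (p ^ k)) ℂ} {c : ZMod (p ^ k)}
    (hc : IsLogCoeff χ ψ c) {a a' : ZMod (p ^ k)} (ha : a = (p : ZMod (p ^ k)) ^ v * a')
    (h n w t : ZMod (p ^ k)) (hw : (n + a) * w = 1) :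
    χ (n * (1 + (p : ZMod (p ^ k)) ^ e * t) + a) * χ⁻¹ (n * (1 + (p : ZMod (p ^ k)) ^ e * t)) *
        ψ (h * (n * (1 + (p : ZMod (p ^ k)) ^ e * t))) =
      χ (n + a) * χ⁻¹ n * ψ (h * n) *
        ψ ((p : ZMod (p ^ k)) ^ e * (h * n - c * a * w) * t) := by
  have hu := isUnit_one_add_pow_mul he t
  obtain ⟨u', hu'⟩ := hu.exists_right_inv
  have h0 : (p : ZMod (p ^ k)) ^ v * (p ^ e * p ^ e) = 0 := by
    rw [← pow_add, ← pow_add, pow_eq_zero_iff]; omega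
  have h3 : (p : ZMod (p ^ k)) ^ (v + e) * (-(a' * t * w * u')) =
      (p : ZMod (p ^ k)) ^ (v + e) * (-(a' * t * w)) := by
    rw [pow_add]
    linear_combination (a' * t * w * p ^ v * p ^ e) * (-hu') + u' * a' * t ^ 2 * w * h0
  have h1 := summand_mul_eq χ a n (1 + (p : ZMod (p ^ k)) ^ e * t)
    ((p : ZMod (p ^ k)) ^ (v + e) * (-(a' * t * w))) hu (by
      rw [← h3, pow_add, ha] at *
      linear_combination
        (-(1 + (p : ZMod (p ^ k)) ^ e * t) * (-u' * a' * t * p ^ v * p ^ e)) * hw +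
        (p ^ v * a' * p ^ e * t) * hu')
  rw [h1, hc _ (by omega), mul_assoc, mul_assoc (χ (n + a) * χ⁻¹ n), ← AddChar.map_add_eq_mul,
    ← AddChar.map_add_eq_mul]
  congr 2
  rw [pow_add, ha]
  ring

theorem sum_mul_isUnit {p k : ℕ} [hp : Fact p.Prime] (f : ZMod (p ^ k) → ℂ) {u : ZMod (p ^ k)}
    (hu : IsUnit u) : ∑ n, f (n * u) = ∑ n, f n := by
  obtain ⟨u, rfl⟩ := hu
  exact Equiv.sum_comp (Units.mulRight u) f

open Classical in
theorem correlationSum_eq_sum_stationarySet {p k v e : ℕ} [hp : Fact p.Prime] (he : 1 ≤ e)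
    (hk : k ≤ v + 2 * e) {χ : DirichletCharacter ℂ (p ^ k)} {ψ : AddChar (ZMod (p ^ k)) ℂ}
    (hψ : ψ.IsPrimitive) {c : ZMod (p ^ k)}
    (hc : IsLogCoeff χ ψ c) {a a' : ZMod (p ^ k)} (ha : a = (p : ZMod (p ^ k)) ^ v * a')
    (h : ZMod (p ^ k)) :
    correlationSum χ ψ a h =
      ∑ n with n ∈ stationarySet a h c e, χ (n + a) * χ⁻¹ n * ψ (h * n) := by
  set f : ZMod (p ^ k) → ℂ := fun n => χ (n + a) * χ⁻¹ n * ψ (h * n) with hf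
  have hq : ((p ^ k : ℕ) : ℂ) ≠ 0 := Nat.cast_ne_zero.2 (NeZero.ne _)
  have h1 : ∀ n, ∑ t, f (n * (1 + (p : ZMod (p ^ k)) ^ e * t)) =
      if n ∈ stationarySet a h c e then ((p ^ k : ℕ) : ℂ) * f n else 0 := by
    intro n
    by_cases hn : IsUnit n ∧ IsUnit (n + a)
    · obtain ⟨w, hw⟩ := hn.2.exists_right_inv
      have h2 : ∀ t, f (n * (1 + (p : ZMod (p ^ k)) ^ e * t)) =
          f n * ψ ((p : ZMod (p ^ k)) ^ e * (h * n - c * a * w) * t) := fun t =>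
        summand_mul_one_add he hk hc ha h n w t hw
      have h3 : (p : ZMod (p ^ k)) ^ e * (h * n - c * a * w) = 0 ↔ n ∈ stationarySet a h c e := by
        have h4 : (p : ZMod (p ^ k)) ^ e * (h * (n * (n + a)) - c * a) =
            p ^ e * (h * n - c * a * w) * (n + a) := by
          linear_combination (p ^ e * c * a) * hw
        rw [← hn.2.mul_left_eq_zero, ← h4]
        exact ⟨fun h => ⟨hn.1, hn.2, h⟩, fun h => h.2.2⟩
      simp_rw [h2, ← Finset.mul_sum, sum_addChar_mul hψ, h3]
      split_ifs <;> ring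
    · rw [if_neg fun h => hn ⟨h.1, h.2.1⟩]
      exact Finset.sum_eq_zero fun t _ =>
        summand_eq_zero χ ψ h ((isUnit_mul_one_add_add_iff he n a t).not.2 hn)
  have h2 : ((p ^ k : ℕ) : ℂ) * ∑ n, f n = ∑ n, ∑ t, f (n * (1 + (p : ZMod (p ^ k)) ^ e * t)) := by
    rw [Finset.sum_comm]
    simp_rw [sum_mul_isUnit f (isUnit_one_add_pow_mul he _)]
    simp [ZMod.card]
  rw [correlationSum, Finset.sum_filter, ← mul_right_inj' hq, h2, Finset.mul_sum]
  refine Finset.sum_congr rfl fun n _ => ?_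
  rw [h1]
  split_ifs <;> simp [hf]

theorem isUnit_of_dvd_sub {p k b : ℕ} (hb : 1 ≤ b) {x y : ZMod (p ^ k)}
    (hxy : (p : ZMod (p ^ k)) ^ b ∣ x - y) (hy : IsUnit y) : IsUnit x := by
  obtain ⟨t, ht⟩ := hxy
  rw [← isUnit_add_pow_mul_iff hb y t, ← ht] at hy
  simpa using hy

theorem isUnit_two {p k : ℕ} [hp : Fact p.Prime] (hp2 : p ≠ 2) : IsUnit (2 : ZMod (p ^ k)) := by
  have := isUnit_natCast (p := p) (k := k) (m := 2) (fun h => hp2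
    ((Nat.prime_dvd_prime_iff_eq hp.out Nat.prime_two).1 h))
  simpa using this

theorem of_mem_stationarySet {p k v b e : ℕ} [hp : Fact p.Prime] (hb : 1 ≤ b)
    (hk : k = v + b + e) {a a' h c n : ZMod (p ^ k)} (ha : a = (p : ZMod (p ^ k)) ^ v * a')
    (ha' : IsUnit a') (hc : IsUnit c) (hn : n ∈ stationarySet a h c e) :
    ∃ h', IsUnit h' ∧ h = (p : ZMod (p ^ k)) ^ v * h' := by
  obtain ⟨h1, h2, h3⟩ := hn
  rw [pow_mul_eq_zero_iff (by omega), (by omega : k - e = v + b)] at h3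
  have h4 : (p : ZMod (p ^ k)) ^ v ∣ h * (n * (n + a)) := by
    have h5 := (pow_dvd_pow (p : ZMod (p ^ k)) (by omega : v ≤ v + b)).trans h3
    refine (dvd_sub_left ?_).1 h5
    rw [ha]
    exact (dvd_mul_right _ _).mul_left c
  rw [(h1.mul h2).dvd_mul_right] at h4
  obtain ⟨h', rfl⟩ := h4
  refine ⟨h', ?_, rfl⟩
  have h5 : (p : ZMod (p ^ k)) ^ v * h' * (n * (n + a)) - c * a =
      p ^ v * (h' * (n * (n + a)) - c * a') := by rw [ha]; ring
  rw [h5, pow_dvd_pow_mul_iff (by omega) (by omega), Nat.add_sub_cancel_left] at h3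
  exact (IsUnit.mul_iff.1 (isUnit_of_dvd_sub hb h3 (hc.mul ha'))).1

theorem dvd_of_mem_stationarySet {p k v b e : ℕ} [hp : Fact p.Prime]
    (hk : k = v + b + e) {a a' h h' c n : ZMod (p ^ k)} (ha : a = (p : ZMod (p ^ k)) ^ v * a')
    (hh : h = (p : ZMod (p ^ k)) ^ v * h') (hn : n ∈ stationarySet a h c e) :
    (p : ZMod (p ^ k)) ^ b ∣ h' * (2 * n + a) ^ 2 - a' * (a * h + 4 * c) := by
  obtain ⟨-, -, h3⟩ := hn
  rw [pow_mul_eq_zero_iff (by omega), (by omega : k - e = v + b)] at h3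
  have h5 : h * (n * (n + a)) - c * a = p ^ v * (h' * (n * (n + a)) - c * a') := by
    rw [ha, hh]; ring
  rw [h5, pow_dvd_pow_mul_iff (by omega) (by omega), Nat.add_sub_cancel_left] at h3
  have h6 : h' * (2 * n + a) ^ 2 - a' * (a * h + 4 * c) = 4 * (h' * (n * (n + a)) - c * a') := by
    rw [hh]
    linear_combination (h' * a) * ha
  rw [h6]
  exact h3.mul_left 4

open Classical in
theorem card_stationarySet_le {p k v b e : ℕ} [hp : Fact p.Prime] (hp2 : p ≠ 2)
    (hk : k = v + b + e) {a a' h h' c : ZMod (p ^ k)} (ha : a = (p : ZMod (p ^ k)) ^ v * a')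
    (ha' : IsUnit a') (hh : h = (p : ZMod (p ^ k)) ^ v * h') (hh' : IsUnit h') :
    ∃ j, 2 * j ≤ b ∧ (p : ZMod (p ^ k)) ^ (2 * j) ∣ a * h + 4 * c ∧
      (Finset.univ.filter (· ∈ stationarySet a h c e)).card ≤ 2 * p ^ (v + e + j) := by
  obtain ⟨j, hj, hd, hcard⟩ := card_quadratic_le hp2 (by omega : b ≤ k) h'
    (a' * (a * h + 4 * c)) hh'
  refine ⟨j, hj, (ha'.dvd_mul_left).1 hd, ?_⟩
  rw [(by omega : k - b = v + e)] at hcard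
  refine le_trans ?_ hcard
  refine Finset.card_le_card_of_injOn (fun n => 2 * n + a) ?_ ?_
  · intro n hn
    simp only [Finset.coe_filter, Finset.mem_univ, true_and] at hn ⊢
    exact dvd_of_mem_stationarySet hk ha hh hn
  · intro n _ n' _ hnn
    exact (isUnit_two hp2).mul_left_cancel (add_right_cancel hnn)

end ZModPrimePow

namespace ZModPrimePow

theorem norm_eq_one_of_isUnit {q : ℕ} [NeZero q] (χ : DirichletCharacter ℂ q) {x : ZMod q}
    (hx : IsUnit x) : ‖χ x‖ = 1 := by
  obtain ⟨u, rfl⟩ := hx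
  exact χ.unit_norm_eq_one u

/-- Second-order differencing of the summand along `u ↦ 1 + p ^ b t`. -/
theorem summand_add_mul_summand_zero {p k v b : ℕ} [hp : Fact p.Prime] (hb : 1 ≤ b)
    (hk : k = v + (2 * b + 1))
    {χ : DirichletCharacter ℂ (p ^ k)} {ψ : AddChar (ZMod (p ^ k)) ℂ} {c : ZMod (p ^ k)}
    (hc : IsLogCoeff χ ψ c) {a a' : ZMod (p ^ k)} (ha : a = (p : ZMod (p ^ k)) ^ v * a')
    {n w : ZMod (p ^ k)} (hn : IsUnit n) (hw : (n + a) * w = 1) (h s r : ZMod (p ^ k))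
    (F : ZMod (p ^ k) → ℂ)
    (hF : ∀ t, F t = χ (n * (1 + (p : ZMod (p ^ k)) ^ b * t) + a) *
      χ⁻¹ (n * (1 + (p : ZMod (p ^ k)) ^ b * t)) *
      ψ (h * (n * (1 + (p : ZMod (p ^ k)) ^ b * t)))) :
    F (s + r) * F 0 = F s * F r *
      ψ ((p : ZMod (p ^ k)) ^ (k - 1) * (c * a' * w ^ 2 * (2 * n + a)) * s * r) := by
  set π : ZMod (p ^ k) := (p : ZMod (p ^ k)) ^ b with hπ
  set z : ZMod (p ^ k) := (p : ZMod (p ^ k)) ^ (k - 1) * (a' * w ^ 2 * (2 * n + a) * s * r) with hz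
  have hna : IsUnit (n + a) := IsUnit.of_mul_eq_one _ hw
  have hu : ∀ t, IsUnit (1 + π * t) := fun t => isUnit_one_add_pow_mul hb t
  have hX : ∀ t, IsUnit (n * (1 + π * t) + a) := fun t =>
    ((isUnit_mul_one_add_add_iff hb n a t).2 ⟨hn, hna⟩).2
  have hnu : ∀ t, IsUnit (n * (1 + π * t)) := fun t => hn.mul (hu t)
  have h1 : π * π * a = (p : ZMod (p ^ k)) ^ (k - 1) * a' := by
    rw [ha, (by omega : k - 1 = b + b + v), pow_add, pow_add]; ring
  have h2 : π * z = 0 := by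
    have : π * (p : ZMod (p ^ k)) ^ (k - 1) = 0 := by
      rw [hπ, ← pow_add, pow_eq_zero_iff]; omega
    rw [hz, ← mul_assoc, this, zero_mul]
  have h3 : z = π * π * a * w ^ 2 * (2 * n + a) * s * r := by
    rw [h1, hz]; ring
  -- the algebraic identity behind the differencing
  have h4 : π * π * π * a = 0 := by
    rw [hπ, ha, ← pow_add, ← pow_add, ← mul_assoc, ← pow_add, (pow_eq_zero_iff _).2 (by omega),
      zero_mul]
  have key : (n * (1 + π * (s + r)) + a) * (n * (1 + π * 0) + a) *
        ((n * (1 + π * s)) * (n * (1 + π * r))) =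
      (n * (1 + π * s) + a) * (n * (1 + π * r) + a) *
        ((n * (1 + π * (s + r))) * (n * (1 + π * 0))) * (1 + z) := by
    have hA : ∀ t, n * (1 + π * t) + a = (n + a) * (1 + n * w * π * t) := fun t => by
      linear_combination (-n * π * t) * hw
    have hXX : (1 + n * w * π * (s + r)) * ((1 + π * s) * (1 + π * r)) =
        (1 + n * w * π * s) * (1 + n * w * π * r) * (1 + π * (s + r)) + z := by
      rw [h3]
      linear_combination (-(π * π * s * r) * (1 + n * w + π * (s + r) * n * w + a * w)) * hw +
        (s * r * (s + r) * n * w ^ 2) * h4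
    have hzz : (1 + n * w * π * s) * (1 + n * w * π * r) * (1 + π * (s + r)) * z = z := by
      linear_combination (n * w * (s + r) + n * w * π * n * w * s * r +
        (1 + n * w * π * s) * (1 + n * w * π * r) * (s + r)) * h2
    rw [hA, hA, hA, hA]
    linear_combination ((n + a) ^ 2 * n ^ 2) * hXX - ((n + a) ^ 2 * n ^ 2) * hzz
  have h5 : χ (1 + z) = ψ (c * z) := hc (k - 1) (by omega) _
  have h6 : χ (n * (1 + π * (s + r)) + a) * χ (n * (1 + π * 0) + a) *
        χ⁻¹ (n * (1 + π * (s + r))) * χ⁻¹ (n * (1 + π * 0)) =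
      χ (n * (1 + π * s) + a) * χ (n * (1 + π * r) + a) *
        χ⁻¹ (n * (1 + π * s)) * χ⁻¹ (n * (1 + π * r)) * χ (1 + z) := by
    have h7 := congrArg χ key
    simp only [map_mul] at h7
    have h8 : ∀ t, χ n * χ (1 + π * t) * (χ⁻¹ n * χ⁻¹ (1 + π * t)) = 1 := fun t => by
      rw [← map_mul, ← map_mul, ← MulChar.mul_apply, mul_inv_cancel, MulChar.one_apply (hnu t)]
    simp only [map_mul]
    have e1 := h8 s
    have e2 := h8 r
    have e3 := h8 (s + r)
    have e4 := h8 0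
    set A1 := χ (n * (1 + π * (s + r)) + a)
    set A2 := χ (n * (1 + π * 0) + a)
    set A3 := χ (n * (1 + π * s) + a)
    set A4 := χ (n * (1 + π * r) + a)
    set B1 := χ n * χ (1 + π * (s + r))
    set B2 := χ n * χ (1 + π * 0)
    set B3 := χ n * χ (1 + π * s)
    set B4 := χ n * χ (1 + π * r)
    set C1 := χ⁻¹ n * χ⁻¹ (1 + π * (s + r))
    set C2 := χ⁻¹ n * χ⁻¹ (1 + π * 0)
    set C3 := χ⁻¹ n * χ⁻¹ (1 + π * s)
    set C4 := χ⁻¹ n * χ⁻¹ (1 + π * r)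
    calc A1 * A2 * C1 * C2 = (A1 * A2 * (B3 * B4)) * (C1 * C2 * C3 * C4) := by
          linear_combination (-A1 * A2 * C1 * C2) * e1 * 1 + (-A1 * A2 * C1 * C2 * B3 * C3) * e2
      _ = _ := by
          rw [h7]
          linear_combination (A3 * A4 * χ (1 + z) * C3 * C4) * e3 +
            (A3 * A4 * χ (1 + z) * C3 * C4 * B1 * C1) * e4
  have h9 : ψ (h * (n * (1 + π * (s + r)))) * ψ (h * (n * (1 + π * 0))) =
      ψ (h * (n * (1 + π * s))) * ψ (h * (n * (1 + π * r))) := by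
    rw [← AddChar.map_add_eq_mul, ← AddChar.map_add_eq_mul]
    congr 1
    ring
  have h10 : (p : ZMod (p ^ k)) ^ (k - 1) * (c * a' * w ^ 2 * (2 * n + a)) * s * r = c * z := by
    rw [hz]; ring
  rw [h10, ← h5, hF, hF, hF, hF]
  linear_combination (ψ (h * (n * (1 + π * (s + r)))) * ψ (h * (n * (1 + π * 0)))) * h6 +
    (χ (n * (1 + π * s) + a) * χ (n * (1 + π * r) + a) *
        χ⁻¹ (n * (1 + π * s)) * χ⁻¹ (n * (1 + π * r)) * χ (1 + z)) * h9

theorem norm_sq_sum_le {p k v b : ℕ} [hp : Fact p.Prime] (hb : 1 ≤ b)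
    (hk : k = v + (2 * b + 1)) {χ : DirichletCharacter ℂ (p ^ k)}
    {ψ : AddChar (ZMod (p ^ k)) ℂ} (hψ : ψ.IsPrimitive) {c : ZMod (p ^ k)}
    (hcu : IsUnit c) (hc : IsLogCoeff χ ψ c) {a a' : ZMod (p ^ k)}
    (ha : a = (p : ZMod (p ^ k)) ^ v * a') (ha' : IsUnit a')
    {n : ZMod (p ^ k)} (hn : IsUnit n) (hna : IsUnit (n + a)) (hy : IsUnit (2 * n + a))
    (h : ZMod (p ^ k)) :
    ‖∑ t, χ (n * (1 + (p : ZMod (p ^ k)) ^ b * t) + a) *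
      χ⁻¹ (n * (1 + (p : ZMod (p ^ k)) ^ b * t)) *
      ψ (h * (n * (1 + (p : ZMod (p ^ k)) ^ b * t)))‖ ^ 2 ≤ (p : ℝ) ^ k * (p : ℝ) ^ (k - 1) := by
  classical
  obtain ⟨w, hw⟩ := hna.exists_right_inv
  have hwu : IsUnit w := IsUnit.of_mul_eq_one_right _ hw
  set F : ZMod (p ^ k) → ℂ := fun t => χ (n * (1 + (p : ZMod (p ^ k)) ^ b * t) + a) *
      χ⁻¹ (n * (1 + (p : ZMod (p ^ k)) ^ b * t)) *
      ψ (h * (n * (1 + (p : ZMod (p ^ k)) ^ b * t))) with hF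
  have hnorm : ∀ t, ‖F t‖ = 1 := fun t => by
    have h1 := (isUnit_mul_one_add_add_iff hb n a t).2 ⟨hn, hna⟩
    rw [hF]
    simp only [norm_mul, AddChar.norm_apply, norm_eq_one_of_isUnit χ h1.2,
      mul_one]
    rw [one_mul, norm_eq_one_of_isUnit χ⁻¹ h1.1]
  have hconj : ∀ t, F t * (starRingEnd ℂ) (F t) = 1 := fun t => by
    rw [Complex.mul_conj, Complex.normSq_eq_norm_sq, hnorm]; simp
  set κ := c * a' * w ^ 2 * (2 * n + a) with hκ
  have hκu : IsUnit κ := ((hcu.mul ha').mul (hwu.pow 2)).mul hy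
  have hdiff : ∀ s r, F (s + r) * (starRingEnd ℂ) (F s) =
      F r * (starRingEnd ℂ) (F 0) * ψ ((p : ZMod (p ^ k)) ^ (k - 1) * κ * r * s) := by
    intro s r
    have h1 := summand_add_mul_summand_zero hb hk hc ha hn hw h s r F (fun t => rfl)
    rw [← hκ, mul_right_comm _ s r] at h1
    linear_combination (starRingEnd ℂ (F s) * starRingEnd ℂ (F 0)) * h1 -
      (F (s + r) * starRingEnd ℂ (F s)) * hconj 0 + (F r * starRingEnd ℂ (F 0) *
        ψ ((p : ZMod (p ^ k)) ^ (k - 1) * κ * r * s)) * hconj s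
  have hsum : ((‖∑ t, F t‖ ^ 2 : ℝ) : ℂ) = ∑ r, F r * (starRingEnd ℂ) (F 0) *
      (if (p : ZMod (p ^ k)) ^ (k - 1) * κ * r = 0 then ((p ^ k : ℕ) : ℂ) else 0) := by
    simp_rw [← sum_addChar_mul hψ, Finset.mul_sum, ← hdiff]
    rw [Finset.sum_comm, ← Complex.normSq_eq_norm_sq, ← Complex.mul_conj, map_sum,
      Finset.mul_sum]
    refine Finset.sum_congr rfl fun s _ => ?_
    rw [← Finset.sum_mul, ← Equiv.sum_comp (Equiv.addLeft s) F]
    rfl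
  have hle : ‖((‖∑ t, F t‖ ^ 2 : ℝ) : ℂ)‖ ≤ (p : ℝ) ^ k * (p : ℝ) ^ (k - 1) := by
    rw [hsum]
    refine (norm_sum_le _ _).trans ?_
    have h1 : ∀ r : ZMod (p ^ k), (p : ZMod (p ^ k)) ^ (k - 1) * κ * r = 0 ↔
        (p : ZMod (p ^ k)) ^ 1 ∣ r - 0 := fun r => by
      rw [sub_zero, mul_assoc, pow_mul_eq_zero_iff (by omega), (by omega : k - (k - 1) = 1),
        hκu.dvd_mul_left]
    simp_rw [h1, norm_mul, RCLike.norm_conj, hnorm, one_mul]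
    have h2 : ∀ r : ZMod (p ^ k), ‖(if (p : ZMod (p ^ k)) ^ 1 ∣ r - 0 then ((p ^ k : ℕ) : ℂ)
        else 0)‖ = if (p : ZMod (p ^ k)) ^ 1 ∣ r - 0 then (p : ℝ) ^ k else 0 := fun r => by
      split_ifs <;> simp
    simp_rw [h2]
    rw [← Finset.sum_filter, Finset.sum_const, nsmul_eq_mul, mul_comm]
    gcongr
    exact_mod_cast card_dvd_sub_le (by omega : 1 ≤ k) (0 : ZMod (p ^ k))
  rwa [Complex.norm_real, Real.norm_of_nonneg (by positivity)] at hle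

open Classical in
theorem norm_sum_stationarySet_le {p k v b : ℕ} [hp : Fact p.Prime] (hb : 1 ≤ b)
    (hk : k = v + (2 * b + 1)) {χ : DirichletCharacter ℂ (p ^ k)}
    {ψ : AddChar (ZMod (p ^ k)) ℂ} (hψ : ψ.IsPrimitive) {c : ZMod (p ^ k)}
    (hcu : IsUnit c) (hc : IsLogCoeff χ ψ c) {a a' : ZMod (p ^ k)}
    (ha : a = (p : ZMod (p ^ k)) ^ v * a') (ha' : IsUnit a') (h : ZMod (p ^ k))
    (hy : ∀ n ∈ stationarySet a h c (b + 1), IsUnit (2 * n + a)) :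
    ‖∑ n with n ∈ stationarySet a h c (b + 1), χ (n + a) * χ⁻¹ n * ψ (h * n)‖ * √p ≤
      (Finset.univ.filter (· ∈ stationarySet a h c (b + 1))).card := by
  set A := Finset.univ.filter (· ∈ stationarySet a h c (b + 1)) with hA
  set f : ZMod (p ^ k) → ℂ := fun n => χ (n + a) * χ⁻¹ n * ψ (h * n) with hf
  have hq : (0 : ℝ) < (p : ℝ) ^ k := by have := hp.out.pos; positivity
  have hinv : ∀ n t, n * (1 + (p : ZMod (p ^ k)) ^ b * t) ∈ stationarySet a h c (b + 1) ↔
      n ∈ stationarySet a h c (b + 1) := by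
    intro n t
    have h1 := isUnit_mul_one_add_add_iff hb n a t
    by_cases hh : ∃ h', h = (p : ZMod (p ^ k)) ^ v * h'
    · obtain ⟨h', rfl⟩ := hh
      have h0 : (p : ZMod (p ^ k)) ^ (b + 1) * (p ^ v * p ^ b) = 0 := by
        rw [← pow_add, ← pow_add, pow_eq_zero_iff]; omega
      have h2 : (p : ZMod (p ^ k)) ^ (b + 1) * (p ^ v * h' * (n * (1 + p ^ b * t) *
          (n * (1 + p ^ b * t) + a)) - c * a) =
          p ^ (b + 1) * (p ^ v * h' * (n * (n + a)) - c * a) := by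
        linear_combination (h' * n * t * (2 * n + n * p ^ b * t + a)) * h0
      simp only [stationarySet, Set.mem_ofPred_eq, h2]
      rw [← and_assoc, ← and_assoc, h1]
    · have h2 : ∀ n, n ∉ stationarySet a h c (b + 1) := fun n hn => by
        obtain ⟨h', -, hh'⟩ := of_mem_stationarySet hb (by omega) ha ha' hcu hn
        exact hh ⟨h', hh'⟩
      simp [h2]
  have h2 : (p : ℂ) ^ k * ∑ n ∈ A, f n =
      ∑ n ∈ A, ∑ t, f (n * (1 + (p : ZMod (p ^ k)) ^ b * t)) := by
    rw [Finset.sum_comm]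
    have h3 : ∀ t, ∑ n ∈ A, f (n * (1 + (p : ZMod (p ^ k)) ^ b * t)) = ∑ n ∈ A, f n := by
      intro t
      rw [hA, Finset.sum_filter, Finset.sum_filter, ← sum_mul_isUnit
        (fun n => if n ∈ stationarySet a h c (b + 1) then f n else 0) (isUnit_one_add_pow_mul hb t)]
      simp_rw [hinv]
    simp [h3, ZMod.card]
  have h4 : (p : ℝ) ^ k * ‖∑ n ∈ A, f n‖ ≤ A.card * √((p : ℝ) ^ k * (p : ℝ) ^ (k - 1)) := by
    have h5 := congrArg norm h2
    rw [norm_mul, norm_pow, Complex.norm_natCast] at h5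
    rw [h5]
    refine (norm_sum_le _ _).trans ?_
    rw [← nsmul_eq_mul]
    refine Finset.sum_le_card_nsmul _ _ _ fun n hn => ?_
    have hn := (Finset.mem_filter.1 hn).2
    exact Real.le_sqrt_of_sq_le
      (norm_sq_sum_le hb hk hψ hcu hc ha ha' hn.1 hn.2.1 (hy n hn) h)
  have h6 : √((p : ℝ) ^ k * (p : ℝ) ^ (k - 1)) * √p = (p : ℝ) ^ k := by
    rw [← Real.sqrt_mul (by positivity), mul_assoc, ← pow_succ, (by omega : k - 1 + 1 = k),
      Real.sqrt_mul_self hq.le]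
  refine le_of_mul_le_mul_left ?_ hq
  calc (p : ℝ) ^ k * (‖∑ n ∈ A, f n‖ * √p) = (p : ℝ) ^ k * ‖∑ n ∈ A, f n‖ * √p := by ring
    _ ≤ A.card * √((p : ℝ) ^ k * (p : ℝ) ^ (k - 1)) * √p := by gcongr
    _ = (p : ℝ) ^ k * A.card := by rw [mul_assoc, h6]; ring

end ZModPrimePow

namespace ZModPrimePow

theorem pow_pred_mul_natCast_congr {p k : ℕ} (hk : k ≠ 0) {m m' : ℕ}
    (h : (m : ZMod p) = (m' : ZMod p)) :
    (p : ZMod (p ^ k)) ^ (k - 1) * (m : ZMod (p ^ k)) = p ^ (k - 1) * (m' : ZMod (p ^ k)) := by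
  have h1 := ((ZMod.natCast_eq_natCast_iff _ _ _).1 h).mul_left' (p ^ (k - 1))
  rw [← pow_succ, Nat.sub_add_cancel (by omega)] at h1
  have h2 := (ZMod.natCast_eq_natCast_iff _ _ _).2 h1
  push_cast at h2
  exact h2

theorem exists_addChar_reduction {p k : ℕ} [hp : Fact p.Prime] (hk : k ≠ 0)
    {ψ : AddChar (ZMod (p ^ k)) ℂ} (hψ : ψ.IsPrimitive) :
    ∃ φ : AddChar (ZMod p) ℂ, φ ≠ 1 ∧ ∀ y : ZMod (p ^ k),
      ψ ((p : ZMod (p ^ k)) ^ (k - 1) * y) = φ (ZMod.castHom (dvd_pow_self p hk) (ZMod p) y) := by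
  let φ : AddChar (ZMod p) ℂ :=
    { toFun := fun x => ψ ((p : ZMod (p ^ k)) ^ (k - 1) * (x.val : ZMod (p ^ k)))
      map_zero_eq_one' := by simp
      map_add_eq_mul' := fun x y => by
        rw [← AddChar.map_add_eq_mul, ← mul_add, ← Nat.cast_add]
        congr 1
        exact pow_pred_mul_natCast_congr hk (by simp) }
  have h1 : ∀ y : ZMod (p ^ k),
      ψ ((p : ZMod (p ^ k)) ^ (k - 1) * y) = φ (ZMod.castHom (dvd_pow_self p hk) (ZMod p) y) := by
    intro y
    conv_rhs => rw [← ZMod.natCast_zmod_val y, map_natCast]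
    conv_lhs => rw [← ZMod.natCast_zmod_val y]
    change _ = ψ _
    congr 1
    exact pow_pred_mul_natCast_congr hk (by simp)
  refine ⟨φ, fun hφ => ?_, h1⟩
  have h2 : (p : ZMod (p ^ k)) ^ (k - 1) = 0 := by
    apply eq_zero_of_forall_addChar hψ
    intro x
    rw [h1, hφ, AddChar.one_apply]
  rw [pow_eq_zero_iff] at h2
  omega

theorem castHom_eq_zero_iff {p k : ℕ} [hp : Fact p.Prime] (hk : k ≠ 0) (x : ZMod (p ^ k)) :
    ZMod.castHom (dvd_pow_self p hk) (ZMod p) x = 0 ↔ ¬IsUnit x := by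
  rw [not_isUnit_iff hk]
  constructor
  · intro h
    rw [← ZMod.natCast_zmod_val x, map_natCast, ZMod.natCast_eq_zero_iff] at h
    rw [← ZMod.natCast_zmod_val x]
    exact Nat.cast_dvd_cast h
  · rintro ⟨y, rfl⟩
    rw [map_mul, map_natCast, ZMod.natCast_self, zero_mul]

theorem exists_sum_castHom_eq {p k : ℕ} [hp : Fact p.Prime] (hk : k ≠ 0) :
    ∃ N : ℕ, N ≤ p ^ (k - 1) ∧ ∀ g : ZMod p → ℂ,
      ∑ n, g (ZMod.castHom (dvd_pow_self p hk) (ZMod p) n) = N * ∑ x, g x := by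
  classical
  set f := ZMod.castHom (dvd_pow_self p hk) (ZMod p) with hf
  have hsurj : Function.Surjective f := ZMod.castHom_surjective _
  refine ⟨(Finset.univ.filter fun n => f n = 0).card, ?_, fun g => ?_⟩
  · refine (Finset.card_le_card ?_).trans (card_dvd_sub_le (by omega : 1 ≤ k) (0 : ZMod (p ^ k)))
    intro x hx
    have hx := (Finset.mem_filter.1 hx).2
    rw [castHom_eq_zero_iff hk, not_isUnit_iff hk] at hx
    simpa using hx
  · rw [← Finset.sum_fiberwise Finset.univ f, Finset.mul_sum]
    refine Finset.sum_congr rfl fun x _ => ?_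
    rw [Finset.sum_congr rfl (g := fun _ => g x) fun n hn => by
      rw [(Finset.mem_filter.1 hn).2], Finset.sum_const, nsmul_eq_mul]
    congr 2
    exact AddMonoidHom.card_fiber_eq_of_mem_range f.toAddMonoidHom (hsurj x) (hsurj 0)

theorem norm_kloostermanSum_zero_le {κ : Type} [Field κ] [Fintype κ] {ψ : AddChar κ ℂ}
    (hψ : ψ ≠ 1) {b : κ} (hb : b ≠ 0) : ‖kloostermanSum ψ 0 b‖ ≤ 1 := by
  classical
  have h1 : kloostermanSum ψ 0 b = ∑ x, ψ (x * b) - 1 := by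
    rw [kloostermanSum, ← Equiv.sum_comp (Equiv.inv κ) fun x => ψ (x * b), eq_sub_iff_add_eq,
      ← Finset.add_sum_erase _ _ (Finset.mem_univ (0 : κ)),
      ← Finset.add_sum_erase _ _ (Finset.mem_univ (0 : κ))]
    simp only [if_true, zero_add, Equiv.inv_apply, inv_zero, zero_mul, AddChar.map_zero_eq_one]
    rw [add_comm]
    congr 1
    refine Finset.sum_congr rfl fun x hx => ?_
    rw [if_neg (Finset.ne_of_mem_erase hx), mul_comm]
  rw [h1, AddChar.sum_mulShift b (AddChar.IsPrimitive.of_ne_one hψ), if_neg hb]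
  simp

theorem pow_mul_eq_zero_of_sum_ne_zero {p k : ℕ} [hp : Fact p.Prime]
    {ψ : AddChar (ZMod (p ^ k)) ℂ} (hψ : ψ.IsPrimitive) (g : ZMod (p ^ k) → ℂ)
    (hg : ∀ n y, g (n + p * y) = g n) {h : ZMod (p ^ k)} (hne : ∑ n, g n * ψ (h * n) ≠ 0) :
    p * h = 0 := by
  by_contra hph
  apply hph
  apply eq_zero_of_forall_addChar hψ
  intro y
  have h1 := Equiv.sum_comp (Equiv.addRight (p * y)) fun n => g n * ψ (h * n)
  simp only [Equiv.coe_addRight, hg, mul_add, AddChar.map_add_eq_mul, ← mul_assoc] at h1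
  rw [← Finset.sum_mul] at h1
  rw [mul_comm (p : ZMod (p ^ k)) h]
  exact mul_left_cancel₀ hne (by rw [mul_one]; exact h1)

end ZModPrimePow

namespace ZModPrimePow

/-- The local form of the bound for correlation sums. -/
def LocalBound {p k : ℕ} [NeZero (p ^ k)] (χ : DirichletCharacter ℂ (p ^ k))
    (ψ : AddChar (ZMod (p ^ k)) ℂ) (c a h : ZMod (p ^ k)) (v : ℕ) : Prop :=
  ∃ i ≤ v, (p : ZMod (p ^ k)) ^ i ∣ h ∧ ∃ d ≤ k, (p : ZMod (p ^ k)) ^ d ∣ a * h + 4 * c ∧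
    ‖correlationSum χ ψ a h‖ ≤
      2 * (p : ℝ) ^ i * min (√((p : ℝ) ^ (k - v)) * (p : ℝ) ^ d) ((p : ℝ) ^ (k - v))

theorem LocalBound.of_eq_zero {p k : ℕ} [NeZero (p ^ k)] {χ : DirichletCharacter ℂ (p ^ k)}
    {ψ : AddChar (ZMod (p ^ k)) ℂ} {c a h : ZMod (p ^ k)} {v : ℕ}
    (h0 : correlationSum χ ψ a h = 0) : LocalBound χ ψ c a h v :=
  ⟨0, by omega, by simp, 0, by omega, by simp, by rw [h0, norm_zero]; positivity⟩

theorem localBound_of_two_le {p k v : ℕ} [hp : Fact p.Prime] (hp2 : p ≠ 2) (hv : v + 2 ≤ k)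
    {χ : DirichletCharacter ℂ (p ^ k)} {ψ : AddChar (ZMod (p ^ k)) ℂ} (hψ : ψ.IsPrimitive)
    {c : ZMod (p ^ k)} (hcu : IsUnit c) (hc : IsLogCoeff χ ψ c) {a a' : ZMod (p ^ k)}
    (ha : a = (p : ZMod (p ^ k)) ^ v * a') (ha' : IsUnit a') (h : ZMod (p ^ k)) :
    LocalBound χ ψ c a h v := by
  classical
  obtain ⟨b, e, hb, hk, heb⟩ : ∃ b e, 1 ≤ b ∧ k = v + b + e ∧ (e = b ∨ e = b + 1) :=
    ⟨(k - v) / 2, (k - v) - (k - v) / 2, by omega, by omega, by omega⟩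
  have hp1 : (1 : ℝ) ≤ p := by exact_mod_cast hp.out.one_lt.le
  have hp0 : (0 : ℝ) < p := by linarith
  have hS := correlationSum_eq_sum_stationarySet (by omega : 1 ≤ e) (by omega : k ≤ v + 2 * e)
    hψ hc ha h
  have hcard : ‖correlationSum χ ψ a h‖ ≤
      (Finset.univ.filter (· ∈ stationarySet a h c e)).card := by
    rw [hS]
    refine (norm_sum_le _ _).trans ?_
    refine (Finset.sum_le_sum fun n _ => norm_correlationSum_summand_le χ ψ a h n).trans ?_
    simp
  rcases Set.eq_empty_or_nonempty (stationarySet a h c e) with hemp | ⟨n, hn⟩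
  · apply LocalBound.of_eq_zero
    rw [hS, hemp]
    simp
  obtain ⟨h', hh', hh⟩ := of_mem_stationarySet hb hk ha ha' hcu hn
  obtain ⟨j, hj, hjd, hjc⟩ := card_stationarySet_le hp2 hk (c := c) ha ha' hh hh'
  have hjc' : ((Finset.univ.filter (· ∈ stationarySet a h c e)).card : ℝ) ≤
      2 * (p : ℝ) ^ (v + e + j) := by exact_mod_cast hjc
  have hkv : k - v = b + e := by omega
  have htriv : ‖correlationSum χ ψ a h‖ ≤ 2 * (p : ℝ) ^ v * (p : ℝ) ^ (k - v) := by
    have h1 := norm_correlationSum_le χ ψ a h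
    push_cast at h1
    have h2 : (p : ℝ) ^ k = p ^ v * p ^ (k - v) := by rw [← pow_add]; congr 1; omega
    have : 0 < (p : ℝ) ^ k := by positivity
    linarith
  suffices H : ∃ d ≤ k, (p : ZMod (p ^ k)) ^ d ∣ a * h + 4 * c ∧ ‖correlationSum χ ψ a h‖ ≤
      2 * (p : ℝ) ^ v * (√((p : ℝ) ^ (k - v)) * (p : ℝ) ^ d) by
    obtain ⟨d, hd, hdd, hle⟩ := H
    refine ⟨v, le_rfl, ⟨h', hh⟩, d, hd, hdd, ?_⟩
    rw [mul_min_of_nonneg _ _ (by positivity)]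
    exact le_min hle htriv
  rcases heb with rfl | rfl
  · refine ⟨2 * j, by omega, hjd, hcard.trans (hjc'.trans ?_)⟩
    rw [hkv, pow_add (p : ℝ) e e, Real.sqrt_mul_self (by positivity), mul_assoc, ← pow_add,
      ← pow_add, ← add_assoc]
    gcongr
    omega
  · have hsq : √((p : ℝ) ^ (k - v)) = p ^ b * √p := by
      rw [hkv, (by omega : b + (b + 1) = b * 2 + 1), pow_succ, pow_mul,
        Real.sqrt_mul (by positivity), Real.sqrt_sq (by positivity)]
    have hsp : (1 : ℝ) ≤ √p := Real.one_le_sqrt.2 hp1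
    rw [hsq]
    by_cases hD : (p : ZMod (p ^ k)) ∣ a * h + 4 * c
    · refine ⟨max 1 (2 * j), by omega, ?_, hcard.trans (hjc'.trans ?_)⟩
      · rcases le_total 1 (2 * j) with h1 | h1
        · rwa [max_eq_right h1]
        · rwa [max_eq_left h1, pow_one]
      · have h1 : (p : ℝ) ^ (v + (b + 1) + j) ≤ (p : ℝ) ^ (v + b + max 1 (2 * j)) :=
          pow_le_pow_right₀ hp1 (by omega)
        calc 2 * (p : ℝ) ^ (v + (b + 1) + j) ≤ 2 * (p : ℝ) ^ (v + b + max 1 (2 * j)) * 1 := by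
              linarith
          _ ≤ 2 * (p : ℝ) ^ (v + b + max 1 (2 * j)) * √p := by gcongr
          _ = _ := by rw [pow_add, pow_add]; ring
    · have hj0 : j = 0 := by
        by_contra hj0
        exact hD ((dvd_pow_self _ (by omega)).trans hjd)
      subst hj0
      refine ⟨0, by omega, by simp, ?_⟩
      have hy : ∀ n ∈ stationarySet a h c (b + 1), IsUnit (2 * n + a) := fun n hn => by
        by_contra hy
        rw [not_isUnit_iff (by omega)] at hy
        have h1 := (dvd_pow_self _ (by omega : b ≠ 0)).trans
          (dvd_of_mem_stationarySet hk ha hh hn)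
        have h2 : (p : ZMod (p ^ k)) ∣ h' * (2 * n + a) ^ 2 :=
          (hy.trans (dvd_pow_self _ two_ne_zero)).mul_left _
        exact hD ((ha'.dvd_mul_left).1 ((dvd_sub_right h2).1 h1))
      have h1 := norm_sum_stationarySet_le hb (by omega) hψ hcu hc ha ha' h hy
      rw [← hS] at h1
      have h2 : ‖correlationSum χ ψ a h‖ * √p ≤
          2 * (p : ℝ) ^ v * (p ^ b * √p * p ^ 0) * √p := by
        refine (h1.trans hjc').trans (le_of_eq ?_)
        have : √(p : ℝ) * √p = p := Real.mul_self_sqrt hp0.le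
        rw [pow_add, pow_add, pow_add]
        linear_combination (-2 * (p : ℝ) ^ v * p ^ b) * this
      exact le_of_mul_le_mul_right h2 (by linarith)

theorem localBound_zero {p k : ℕ} [hp : Fact p.Prime] (hk : k ≠ 0)
    {χ : DirichletCharacter ℂ (p ^ k)} {ψ : AddChar (ZMod (p ^ k)) ℂ} (hψ : ψ.IsPrimitive)
    (c h : ZMod (p ^ k)) : LocalBound χ ψ c 0 h k := by
  classical
  have hS : correlationSum χ ψ 0 h =
      ∑ n : ZMod (p ^ k), (if IsUnit n then (1 : ℂ) else 0) * ψ (h * n) := by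
    refine Finset.sum_congr rfl fun n _ => ?_
    rw [add_zero]
    congr 1
    rw [← MulChar.mul_apply, mul_inv_cancel]
    split_ifs with hn
    · exact MulChar.one_apply hn
    · exact MulChar.map_nonunit _ hn
  rcases eq_or_ne (correlationSum χ ψ 0 h) 0 with h0 | h0
  · exact LocalBound.of_eq_zero h0
  rw [hS] at h0
  have h1 := pow_mul_eq_zero_of_sum_ne_zero hψ _ (fun n y => by
    have := isUnit_add_pow_mul_iff le_rfl n y
    rw [pow_one] at this
    simp only [this]) h0
  rw [← pow_one (p : ZMod (p ^ k)), pow_mul_eq_zero_iff (by omega)] at h1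
  rcases eq_or_ne h 0 with rfl | hh
  · refine ⟨k, le_rfl, dvd_zero _, 0, by omega, by simp, ?_⟩
    have h2 := norm_correlationSum_le χ ψ 0 0
    push_cast at h2
    have : 0 ≤ (p : ℝ) ^ k := by positivity
    simp
    linarith
  · refine ⟨k - 1, by omega, h1, 0, by omega, by simp, ?_⟩
    have h2 : correlationSum χ ψ 0 h =
        -∑ n with (p : ZMod (p ^ k)) ^ 1 ∣ n - 0, ψ (h * n) := by
      have h3 := sum_addChar_mul hψ h
      rw [if_neg hh] at h3
      rw [hS, eq_neg_iff_add_eq_zero, Finset.sum_filter, ← Finset.sum_add_distrib]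
      refine Eq.trans (Finset.sum_congr rfl fun n _ => ?_) h3
      rw [sub_zero, pow_one]
      have h5 := not_isUnit_iff hk n
      by_cases hn : IsUnit n
      · rw [if_pos hn, if_neg (fun h => h5.2 h hn)]
        ring
      · rw [if_neg hn, if_pos (h5.1 hn)]
        ring
    have h4 : ‖correlationSum χ ψ 0 h‖ ≤ (p : ℝ) ^ (k - 1) := by
      rw [h2, norm_neg]
      refine (norm_sum_le _ _).trans ?_
      simp only [AddChar.norm_apply, Finset.sum_const, nsmul_eq_mul, mul_one]
      exact_mod_cast card_dvd_sub_le (by omega : 1 ≤ k) (0 : ZMod (p ^ k))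
    have : 0 ≤ (p : ℝ) ^ (k - 1) := by positivity
    simp
    linarith

theorem localBound_of_eq_add_one {p k v : ℕ} [hp : Fact p.Prime] (hp2 : p ≠ 2) (hv : 1 ≤ v)
    (hk : k = v + 1) {χ : DirichletCharacter ℂ (p ^ k)} {ψ : AddChar (ZMod (p ^ k)) ℂ}
    (hψ : ψ.IsPrimitive) {c : ZMod (p ^ k)} (hcu : IsUnit c) (hc : IsLogCoeff χ ψ c)
    {a a' : ZMod (p ^ k)} (ha : a = (p : ZMod (p ^ k)) ^ v * a') (ha' : IsUnit a')
    (h : ZMod (p ^ k)) : LocalBound χ ψ c a h v := by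
  classical
  have hk0 : k ≠ 0 := by omega
  have hkv : k - 1 = v := by omega
  have hkv' : k - v = 1 := by omega
  have hp0 : (0 : ℝ) ≤ p := Nat.cast_nonneg _
  have hp1 : (1 : ℝ) ≤ p := by exact_mod_cast hp.out.one_lt.le
  have hunit : ∀ n, IsUnit (n + a) ↔ IsUnit n := fun n => by
    rw [ha, isUnit_add_pow_mul_iff hv]
  have hval : ∀ n w, n * w = 1 → χ (n + a) * χ⁻¹ n = ψ (c * (a * w)) := by
    intro n w hnw
    have h1 : n + a = n * (1 + (p : ZMod (p ^ k)) ^ v * (a' * w)) := by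
      rw [ha]
      linear_combination (-p ^ v * a') * hnw
    have h2 : χ n * χ⁻¹ n = 1 := by
      rw [← MulChar.mul_apply, mul_inv_cancel, MulChar.one_apply (IsUnit.of_mul_eq_one _ hnw)]
    rw [h1, map_mul, hc v (by omega), ← mul_assoc ((p : ZMod (p ^ k)) ^ v), ← ha]
    linear_combination ψ (c * (a * w)) * h2
  have hzero : ∀ n, ¬IsUnit n → χ (n + a) * χ⁻¹ n = 0 := fun n hn => by
    rw [MulChar.map_nonunit χ⁻¹ hn, mul_zero]
  rcases eq_or_ne (correlationSum χ ψ a h) 0 with h0 | h0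
  · exact LocalBound.of_eq_zero h0
  have hpa : (p : ZMod (p ^ k)) * a = 0 := by
    rw [ha, ← mul_assoc, ← pow_succ', ← hk, pow_self_eq_zero, zero_mul]
  have h1 := pow_mul_eq_zero_of_sum_ne_zero hψ _ (fun n y => by
    have hny : IsUnit (n + p * y) ↔ IsUnit n := by
      have := isUnit_add_pow_mul_iff le_rfl n y
      rwa [pow_one] at this
    by_cases hn : IsUnit n
    · obtain ⟨w, hw⟩ := hn.exists_right_inv
      obtain ⟨w', hw'⟩ := (hny.2 hn).exists_right_inv
      rw [hval n w hw, hval _ w' hw']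
      congr 2
      linear_combination (a * w) * hw' - (a * w') * hw - (y * w * w') * hpa
    · rw [hzero n hn, hzero _ (hny.not.2 hn)]) h0
  rw [← pow_one (p : ZMod (p ^ k)), pow_mul_eq_zero_iff (by omega), hkv] at h1
  obtain ⟨h', rfl⟩ := h1
  obtain ⟨φ, hφ1, hφ⟩ := exists_addChar_reduction hk0 hψ
  obtain ⟨N, hN, hsum⟩ := exists_sum_castHom_eq (p := p) hk0
  rw [hkv] at hφ hN
  set f := ZMod.castHom (dvd_pow_self p hk0) (ZMod p) with hf
  have hS : correlationSum χ ψ a (p ^ v * h') = N * kloostermanSum φ (f h') (f (c * a')) := by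
    rw [kloostermanSum, ← hsum]
    refine Finset.sum_congr rfl fun n _ => ?_
    by_cases hn : IsUnit n
    · obtain ⟨w, hw⟩ := hn.exists_right_inv
      have hfn : f n * f w = 1 := by rw [← map_mul, hw, map_one]
      have hfw : (f n)⁻¹ = f w := inv_eq_of_mul_eq_one_right hfn
      rw [if_neg ((castHom_eq_zero_iff hk0 n).not.2 (not_not.2 hn)), hval n w hw, hfw,
        ← map_mul f, ← map_mul f, ← map_add f, ← hφ, ← AddChar.map_add_eq_mul, ha]
      congr 1
      ring
    · rw [if_pos ((castHom_eq_zero_iff hk0 n).2 hn), hzero n hn, zero_mul]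
  have hf0 : ∀ x, IsUnit x → f x ≠ 0 := fun x hx => (castHom_eq_zero_iff hk0 x).not.2 (not_not.2 hx)
  have hK : ‖kloostermanSum φ (f h') (f (c * a'))‖ ≤ 2 * √p := by
    rcases eq_or_ne (f h') 0 with h2 | h2
    · rw [h2]
      refine (norm_kloostermanSum_zero_le hφ1 (hf0 _ (hcu.mul ha'))).trans ?_
      have : 1 ≤ √(p : ℝ) := Real.one_le_sqrt.2 hp1
      linarith
    · have := norm_kloostermanSum_le (by rwa [ZMod.ringChar_zmod_n]) φ hφ1 _ _ h2
        (hf0 _ (hcu.mul ha'))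
      rwa [ZMod.card] at this
  refine ⟨v, le_rfl, dvd_mul_right _ _, 0, by omega, by simp, ?_⟩
  have hN' : (N : ℝ) ≤ (p : ℝ) ^ v := by exact_mod_cast hN
  rw [hS, norm_mul, Complex.norm_natCast, hkv', pow_one, pow_zero, mul_one, min_eq_left]
  · calc (N : ℝ) * ‖kloostermanSum φ (f h') (f (c * a'))‖ ≤ (p : ℝ) ^ v * (2 * √p) := by gcongr
      _ = _ := by ring
  · rw [Real.sqrt_le_left hp0]
    nlinarith

theorem localBound_prime {p k : ℕ} [hp : Fact p.Prime] (hk : k = 1)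
    {χ : DirichletCharacter ℂ (p ^ k)} (hχ : IsLocallyPrimitive χ)
    {ψ : AddChar (ZMod (p ^ k)) ℂ} (hψ : ψ.IsPrimitive) (c : ZMod (p ^ k))
    {a : ZMod (p ^ k)} (ha : IsUnit a) (h : ZMod (p ^ k)) : LocalBound χ ψ c a h 0 := by
  subst hk
  have hp1 : (1 : ℝ) ≤ p := by exact_mod_cast hp.out.one_lt.le
  have : Fact (p ^ 1).Prime := ⟨by rw [pow_one]; exact hp.out⟩
  have hχ1 : χ⁻¹ ≠ 1 := by
    intro h1
    have h1 : χ = 1 := inv_eq_one.1 h1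
    obtain ⟨y, hy, hy1⟩ := hχ p hp.out (by simp)
    exact hy1 (by rw [h1, MulChar.one_apply hy])
  have hψ1 : ψ ≠ 1 := by
    intro h1
    have := hψ one_ne_zero
    rw [h1] at this
    exact this (by ext x; simp)
  have hbound : ‖correlationSum χ ψ a h‖ ≤ 2 * √p := by
    rcases eq_or_ne h 0 with rfl | hh
    · have h1 := norm_sum_mulChar_shift_le_one χ⁻¹ hχ1 a ha.ne_zero
      have : 1 ≤ √(p : ℝ) := Real.one_le_sqrt.2 hp1
      have h2 : correlationSum χ ψ a 0 = ∑ x, χ⁻¹ x * χ⁻¹⁻¹ (x + a) := by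
        refine Finset.sum_congr rfl fun x _ => ?_
        rw [zero_mul, AddChar.map_zero_eq_one, inv_inv]
        ring
      rw [h2]
      linarith
    · have h1 := norm_sum_shiftChar_le χ⁻¹ hχ1 (ψ.mulShift h) (hψ hh) a ha.ne_zero
      have h2 : correlationSum χ ψ a h = ∑ x, χ⁻¹ x * χ⁻¹⁻¹ (x + a) * ψ.mulShift h x := by
        refine Finset.sum_congr rfl fun x _ => ?_
        rw [AddChar.mulShift_apply, inv_inv]
        ring
      rw [h2]
      rwa [ZMod.card, Nat.cast_pow, pow_one (p : ℝ)] at h1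
  refine ⟨0, le_rfl, by simp, 0, by omega, by simp, ?_⟩
  rw [Nat.sub_zero, pow_one (p : ℝ), pow_zero, mul_one, mul_one, min_eq_left]
  · exact hbound
  · rw [Real.sqrt_le_left (by linarith)]
    nlinarith

theorem exists_localBound {p k : ℕ} [hp : Fact p.Prime] (hp2 : p ≠ 2) (hk : k ≠ 0)
    {χ : DirichletCharacter ℂ (p ^ k)} (hχ : IsLocallyPrimitive χ)
    {ψ : AddChar (ZMod (p ^ k)) ℂ} (hψ : ψ.IsPrimitive) :
    ∃ c, IsUnit c ∧ ∀ v ≤ k, ∀ a', IsUnit a' → ∀ h,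
      LocalBound χ ψ c ((p : ZMod (p ^ k)) ^ v * a') h v := by
  have hv0 : ∀ v, v = k → ∀ c a' h, LocalBound χ ψ c ((p : ZMod (p ^ k)) ^ v * a') h v := by
    rintro v rfl c a' h
    rw [pow_self_eq_zero, zero_mul]
    exact localBound_zero hk hψ c h
  rcases (by omega : k = 1 ∨ 2 ≤ k) with h1 | h2
  · refine ⟨1, isUnit_one, fun v hv a' ha' h => ?_⟩
    rcases (by omega : v = k ∨ v = 0) with hv | rfl
    · exact hv0 v hv _ _ _
    · rw [pow_zero, one_mul]
      exact localBound_prime h1 hχ hψ _ ha' h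
  · obtain ⟨c, hcu, hc⟩ := exists_isUnit_character_eq h2 χ hχ ψ hψ
    refine ⟨c, hcu, fun v hv a' ha' h => ?_⟩
    rcases (by omega : v = k ∨ k = v + 1 ∨ v + 2 ≤ k) with hv | hv | hv
    · exact hv0 v hv _ _ _
    · exact localBound_of_eq_add_one hp2 (by omega) hv hψ hcu hc rfl ha' h
    · exact localBound_of_two_le hp2 hv hψ hcu hc rfl ha' h

end ZModPrimePow

namespace ZModPrimePow

theorem gcd_eq_pow {p k v : ℕ} [hp : Fact p.Prime] (hk : k ≠ 0) (hv : v ≤ k) {a : ℤ}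
    {a' : ZMod (p ^ k)} (ha' : IsUnit a') (ha : (a : ZMod (p ^ k)) = p ^ v * a') :
    Int.gcd a (p ^ k : ℕ) = p ^ v := by
  have h1 : p ^ v ∣ Int.gcd a (p ^ k : ℕ) := by
    rw [← pow_dvd_intCast_iff hv, ha]
    exact dvd_mul_right _ _
  have h2 : Int.gcd a (p ^ k : ℕ) ∣ p ^ k := Int.natCast_dvd_natCast.1 (Int.gcd_dvd_right _ _)
  obtain ⟨w, hw, hwe⟩ := (Nat.dvd_prime_pow hp.out).1 h2
  rw [hwe, Nat.pow_dvd_pow_iff_le_right hp.out.one_lt] at h1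
  have h3 : (p : ZMod (p ^ k)) ^ w ∣ (a : ZMod (p ^ k)) := by
    rw [pow_dvd_intCast_iff hw, hwe]
  rw [ha, pow_dvd_pow_mul_iff h1 hw] at h3
  have h4 : w - v = 0 := by
    by_contra h5
    exact (not_isUnit_iff hk a').2 ((dvd_pow_self _ h5).trans h3) ha'
  rw [hwe]
  congr 1
  omega

theorem exists_norm_correlationSum_le {p k : ℕ} [hp : Fact p.Prime] (hp2 : p ≠ 2) (hk : k ≠ 0)
    {χ : DirichletCharacter ℂ (p ^ k)} (hχ : IsLocallyPrimitive χ)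
    {ψ : AddChar (ZMod (p ^ k)) ℂ} (hψ : ψ.IsPrimitive) :
    ∃ c : ℤ, IsUnit (c : ZMod (p ^ k)) ∧ ∀ a h : ℤ, ‖correlationSum χ ψ a h‖ ≤
      (p ^ k).divisors.card * Int.gcd h (Int.gcd a (p ^ k : ℕ)) *
        min (√((p ^ k : ℕ) / Int.gcd a (p ^ k : ℕ)) * Int.gcd (a * h + 4 * c) (p ^ k : ℕ))
          ((p ^ k : ℕ) / Int.gcd a (p ^ k : ℕ)) := by
  obtain ⟨c, hcu, hc⟩ := exists_localBound hp2 hk hχ hψ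
  obtain ⟨c, rfl⟩ := ZMod.intCast_surjective c
  refine ⟨c, hcu, fun a h => ?_⟩
  obtain ⟨v, hv, a', ha', ha⟩ := exists_eq_pow_mul_isUnit (a : ZMod (p ^ k))
  obtain ⟨i, hi, hih, d, hd, hdd, hle⟩ := hc v hv a' ha' h
  rw [← ha] at hle hdd
  rw [gcd_eq_pow hk hv ha' ha]
  have hp0 : (0 : ℝ) < p := by exact_mod_cast hp.out.pos
  have hdiv : ((p ^ k : ℕ) : ℝ) / ((p ^ v : ℕ) : ℝ) = (p : ℝ) ^ (k - v) := by
    push_cast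
    rw [pow_sub₀ _ hp0.ne' hv, div_eq_mul_inv]
  rw [hdiv]
  refine hle.trans ?_
  have h1 : (2 : ℝ) ≤ (p ^ k).divisors.card := by
    rw [Nat.divisors_prime_pow hp.out, Finset.card_map, Finset.card_range]
    push_cast
    have : (1 : ℝ) ≤ k := by exact_mod_cast Nat.one_le_iff_ne_zero.2 hk
    linarith
  have h2 : (p : ℝ) ^ i ≤ Int.gcd h (p ^ v : ℕ) := by
    rw [pow_dvd_intCast_iff (hi.trans hv)] at hih
    have h3 : p ^ i ∣ Int.gcd h (p ^ v : ℕ) :=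
      Int.natCast_dvd_natCast.1 (Int.dvd_coe_gcd
        ((Int.natCast_dvd_natCast.2 hih).trans (Int.gcd_dvd_left _ _))
        (Int.natCast_dvd_natCast.2 (pow_dvd_pow p hi)))
    exact_mod_cast Nat.le_of_dvd (Int.gcd_pos_of_ne_zero_right _
      (by exact_mod_cast (pow_pos hp.out.pos v).ne')) h3
  have h3 : (p : ℝ) ^ d ≤ Int.gcd (a * h + 4 * c) (p ^ k : ℕ) := by
    have h4 : (p : ZMod (p ^ k)) ^ d ∣ ((a * h + 4 * c : ℤ) : ZMod (p ^ k)) := by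
      push_cast
      exact hdd
    rw [pow_dvd_intCast_iff hd] at h4
    exact_mod_cast Nat.le_of_dvd (Int.gcd_pos_of_ne_zero_right _
      (by exact_mod_cast (pow_pos hp.out.pos k).ne')) h4
  gcongr

theorem sum_eq_zero_of_translate {p k v : ℕ} [hp : Fact p.Prime] (hv : v < k)
    {χ : DirichletCharacter ℂ (p ^ k)} (hχ : IsLocallyPrimitive χ) (g : ZMod (p ^ k) → ℂ)
    (hg : ∀ n y, g (n + p ^ (k - 1 - v) * y) = g n) :
    ∑ n, g n * χ (1 + (p : ZMod (p ^ k)) ^ v * n) = 0 := by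
  obtain ⟨y, hyu, hy⟩ := hχ p hp.out (dvd_pow_self p (by omega))
  have h1 : p ^ k / p = p ^ (k - 1) := by
    rw [Nat.div_eq_of_eq_mul_left hp.out.pos]
    rw [← pow_succ, Nat.sub_add_cancel (by omega)]
  rw [h1, Nat.cast_pow] at hyu hy
  obtain ⟨u, hu⟩ := hyu
  set F : ZMod (p ^ k) → ℂ := fun n => g n * χ (1 + (p : ZMod (p ^ k)) ^ v * n) with hF
  have h3 : (p : ZMod (p ^ k)) ^ (k - 1) = p ^ v * p ^ (k - 1 - v) := by
    rw [← pow_add]; congr 1; omega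
  have h2 : ∀ n, F (n * u + p ^ (k - 1 - v) * y) = F n * χ u := by
    intro n
    have h4 : n * u + (p : ZMod (p ^ k)) ^ (k - 1 - v) * y =
        n + p ^ (k - 1 - v) * (p ^ v * y * n + y) := by
      rw [hu, h3]; ring
    have h5 : 1 + (p : ZMod (p ^ k)) ^ v * (n * u + (p : ZMod (p ^ k)) ^ (k - 1 - v) * y) =
        (1 + p ^ v * n) * u := by
      rw [hu, h3]; ring
    simp only [hF]
    rw [h5, map_mul, h4, hg]
    ring
  have h6 : ∑ n, F n = (∑ n, F n) * χ u := by
    rw [Finset.sum_mul, ← Equiv.sum_comp ((Units.mulRight u).trans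
      (Equiv.addRight (p ^ (k - 1 - v) * y))) F]
    exact Finset.sum_congr rfl fun n _ => h2 n
  by_contra h7
  apply hy
  rw [← hu]
  exact mul_left_cancel₀ h7 (by rw [mul_one]; exact h6.symm)

theorem norm_correlationSum_zero_le {p k : ℕ} [hp : Fact p.Prime] (hk : k ≠ 0)
    {χ : DirichletCharacter ℂ (p ^ k)} (hχ : IsLocallyPrimitive χ)
    (ψ : AddChar (ZMod (p ^ k)) ℂ) (a : ℤ) :
    ‖correlationSum χ ψ a 0‖ ≤ Int.gcd a (p ^ k : ℕ) := by
  classical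
  obtain ⟨v, hv, a', ha', ha⟩ := exists_eq_pow_mul_isUnit (a : ZMod (p ^ k))
  rw [gcd_eq_pow hk hv ha' ha]
  push_cast
  rcases eq_or_lt_of_le hv with rfl | hv'
  · refine (norm_correlationSum_le χ ψ a 0).trans (le_of_eq (by push_cast; rfl))
  have hS : correlationSum χ ψ a 0 =
      ∑ n : ZMod (p ^ k), (if IsUnit n then (1 : ℂ) else 0) *
        χ (1 + (p : ZMod (p ^ k)) ^ v * n) := by
    have h1 : ∀ g : ZMod (p ^ k) → ℂ, (∀ n, ¬IsUnit n → g n = 0) →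
        ∑ n, g n = ∑ u : (ZMod (p ^ k))ˣ, g u := fun g hg =>
      (Fintype.sum_of_injective (fun u : (ZMod (p ^ k))ˣ => (u : ZMod (p ^ k)))
        Units.val_injective _ g (fun n hn => hg n fun ⟨u, hu⟩ => hn ⟨u, hu⟩)
        fun _ => rfl).symm
    obtain ⟨b, rfl⟩ := ha'
    rw [correlationSum, h1 _ fun n hn => by rw [MulChar.map_nonunit χ⁻¹ hn, mul_zero, zero_mul],
      h1 _ fun n hn => by rw [if_neg hn, zero_mul],
      ← Equiv.sum_comp ((Equiv.inv (ZMod (p ^ k))ˣ).trans (Equiv.mulLeft b)) (fun u =>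
        (if IsUnit (u : ZMod (p ^ k)) then (1 : ℂ) else 0) * χ (1 + (p : ZMod (p ^ k)) ^ v * u))]
    refine Finset.sum_congr rfl fun u _ => ?_
    have h2 : χ u * χ⁻¹ (u : ZMod (p ^ k)) = 1 := by
      rw [← MulChar.mul_apply, mul_inv_cancel, MulChar.one_apply u.isUnit]
    have h3 : (u : ZMod (p ^ k)) + a = u * (1 + p ^ v * (b * (u⁻¹ : (ZMod (p ^ k))ˣ))) := by
      have h4 : (u : ZMod (p ^ k)) * (u⁻¹ : (ZMod (p ^ k))ˣ) = 1 := Units.mul_inv u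
      rw [ha]
      linear_combination (-p ^ v * b) * h4
    rw [h3, map_mul, zero_mul, AddChar.map_zero_eq_one, if_pos (Units.isUnit _)]
    simp only [Equiv.trans_apply, Equiv.inv_apply, Equiv.coe_mulLeft, Units.val_mul]
    linear_combination χ (1 + p ^ v * (b * (u⁻¹ : (ZMod (p ^ k))ˣ))) * h2
  rcases (by omega : k - 1 - v = 0 ∨ 1 ≤ k - 1 - v) with h0 | h0
  · have h1 := sum_eq_zero_of_translate hv' hχ (fun _ => 1) fun _ _ => rfl
    have h2 : correlationSum χ ψ a 0 = -∑ n with (p : ZMod (p ^ k)) ^ 1 ∣ n - 0,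
        χ (1 + (p : ZMod (p ^ k)) ^ v * n) := by
      rw [hS, eq_neg_iff_add_eq_zero, Finset.sum_filter, ← Finset.sum_add_distrib]
      refine Eq.trans (Finset.sum_congr rfl fun n _ => ?_) h1
      rw [sub_zero, pow_one]
      have h5 := not_isUnit_iff hk n
      by_cases hn : IsUnit n
      · rw [if_pos hn, if_neg (fun h => h5.2 h hn)]
        ring
      · rw [if_neg hn, if_pos (h5.1 hn)]
        ring
    rw [h2, norm_neg]
    refine (norm_sum_le_of_le _ fun n _ => χ.norm_le_one _).trans ?_
    rw [Finset.sum_const, nsmul_eq_mul, mul_one, (by omega : v = k - 1)]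
    exact_mod_cast card_dvd_sub_le (by omega : 1 ≤ k) (0 : ZMod (p ^ k))
  · rw [hS, sum_eq_zero_of_translate hv' hχ _ fun n y => by
      simp only [isUnit_add_pow_mul_iff h0], norm_zero]
    positivity

end ZModPrimePow

section ChineseRemainder

variable {m n : ℕ}

/-- The component modulo `m` of a Dirichlet character modulo `m * n`. -/
noncomputable def DirichletCharacter.fstComponent (hmn : m.Coprime n)
    (χ : DirichletCharacter ℂ (m * n)) : DirichletCharacter ℂ m where
  toFun x := χ ((ZMod.chineseRemainder hmn).symm (x, 1))
  map_one' := by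
    rw [← Prod.one_eq_mk, map_one, map_one]
  map_mul' x y := by
    rw [← map_mul, ← map_mul, Prod.mk_mul_mk, one_mul]
  map_nonunit' x hx := by
    apply MulChar.map_nonunit
    rw [MulEquiv.isUnit_map, Prod.isUnit_iff]
    exact fun h => hx h.1

/-- The component modulo `n` of a Dirichlet character modulo `m * n`. -/
noncomputable def DirichletCharacter.sndComponent (hmn : m.Coprime n)
    (χ : DirichletCharacter ℂ (m * n)) : DirichletCharacter ℂ n where
  toFun x := χ ((ZMod.chineseRemainder hmn).symm (1, x))
  map_one' := by
    rw [← Prod.one_eq_mk, map_one, map_one]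
  map_mul' x y := by
    rw [← map_mul, ← map_mul, Prod.mk_mul_mk, one_mul]
  map_nonunit' x hx := by
    apply MulChar.map_nonunit
    rw [MulEquiv.isUnit_map, Prod.isUnit_iff]
    exact fun h => hx h.2

/-- The component modulo `m` of an additive character modulo `m * n`. -/
noncomputable def AddChar.fstComponent (hmn : m.Coprime n)
    (ψ : AddChar (ZMod (m * n)) ℂ) : AddChar (ZMod m) ℂ where
  toFun x := ψ ((ZMod.chineseRemainder hmn).symm (x, 0))
  map_zero_eq_one' := by
    rw [← Prod.zero_eq_mk, map_zero, AddChar.map_zero_eq_one]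
  map_add_eq_mul' x y := by
    rw [← AddChar.map_add_eq_mul, ← map_add, Prod.mk_add_mk, add_zero]

/-- The component modulo `n` of an additive character modulo `m * n`. -/
noncomputable def AddChar.sndComponent (hmn : m.Coprime n)
    (ψ : AddChar (ZMod (m * n)) ℂ) : AddChar (ZMod n) ℂ where
  toFun x := ψ ((ZMod.chineseRemainder hmn).symm (0, x))
  map_zero_eq_one' := by
    rw [← Prod.zero_eq_mk, map_zero, AddChar.map_zero_eq_one]
  map_add_eq_mul' x y := by
    rw [← AddChar.map_add_eq_mul, ← map_add, Prod.mk_add_mk, add_zero]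

theorem DirichletCharacter.symm_apply_eq (hmn : m.Coprime n) (χ : DirichletCharacter ℂ (m * n))
    (x : ZMod m × ZMod n) : χ ((ZMod.chineseRemainder hmn).symm x) =
      χ.fstComponent hmn x.1 * χ.sndComponent hmn x.2 := by
  change _ = χ _ * χ _
  rw [← map_mul, ← map_mul, Prod.mk_mul_mk, one_mul, mul_one]

theorem DirichletCharacter.inv_fstComponent (hmn : m.Coprime n)
    (χ : DirichletCharacter ℂ (m * n)) : χ⁻¹.fstComponent hmn = (χ.fstComponent hmn)⁻¹ := by
  rw [eq_inv_iff_mul_eq_one]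
  ext u
  have hu : IsUnit ((ZMod.chineseRemainder hmn).symm ((u : ZMod m), 1)) := by
    rw [MulEquiv.isUnit_map, Prod.isUnit_iff]
    exact ⟨u.isUnit, isUnit_one⟩
  rw [MulChar.one_apply u.isUnit, MulChar.mul_apply]
  change χ⁻¹ _ * χ _ = 1
  rw [← MulChar.mul_apply, inv_mul_cancel, MulChar.one_apply hu]

theorem DirichletCharacter.inv_sndComponent (hmn : m.Coprime n)
    (χ : DirichletCharacter ℂ (m * n)) : χ⁻¹.sndComponent hmn = (χ.sndComponent hmn)⁻¹ := by
  rw [eq_inv_iff_mul_eq_one]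
  ext u
  have hu : IsUnit ((ZMod.chineseRemainder hmn).symm (1, (u : ZMod n))) := by
    rw [MulEquiv.isUnit_map, Prod.isUnit_iff]
    exact ⟨isUnit_one, u.isUnit⟩
  rw [MulChar.one_apply u.isUnit, MulChar.mul_apply]
  change χ⁻¹ _ * χ _ = 1
  rw [← MulChar.mul_apply, inv_mul_cancel, MulChar.one_apply hu]

theorem AddChar.symm_apply_eq (hmn : m.Coprime n) (ψ : AddChar (ZMod (m * n)) ℂ)
    (x : ZMod m × ZMod n) : ψ ((ZMod.chineseRemainder hmn).symm x) =
      ψ.fstComponent hmn x.1 * ψ.sndComponent hmn x.2 := by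
  change _ = ψ _ * ψ _
  rw [← AddChar.map_add_eq_mul, ← map_add, Prod.mk_add_mk, zero_add, add_zero]

theorem correlationSum_mul [NeZero m] [NeZero n] [NeZero (m * n)] (hmn : m.Coprime n)
    (χ : DirichletCharacter ℂ (m * n)) (ψ : AddChar (ZMod (m * n)) ℂ) (a h : ℤ) :
    correlationSum χ ψ a h =
      correlationSum (χ.fstComponent hmn) (ψ.fstComponent hmn) a h *
        correlationSum (χ.sndComponent hmn) (ψ.sndComponent hmn) a h := by
  rw [correlationSum, correlationSum, correlationSum, Finset.sum_mul_sum, ← Fintype.sum_prod_type',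
    ← Equiv.sum_comp (ZMod.chineseRemainder hmn).symm.toEquiv]
  refine Fintype.sum_congr _ _ fun x => ?_
  have h1 : ∀ z : ℤ, (z : ZMod (m * n)) = (ZMod.chineseRemainder hmn).symm (z, z) := fun z => by
    rw [RingEquiv.eq_symm_apply, map_intCast]
    rfl
  change χ ((ZMod.chineseRemainder hmn).symm x + a) * χ⁻¹ ((ZMod.chineseRemainder hmn).symm x) *
    ψ (h * (ZMod.chineseRemainder hmn).symm x) = _
  rw [h1 a, h1 h, ← map_add, ← map_mul, DirichletCharacter.symm_apply_eq,
    DirichletCharacter.symm_apply_eq, AddChar.symm_apply_eq, DirichletCharacter.inv_fstComponent,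
    DirichletCharacter.inv_sndComponent]
  simp only [Prod.fst_add, Prod.snd_add, Prod.fst_mul, Prod.snd_mul]
  ring

theorem AddChar.IsPrimitive.fstComponent (hmn : m.Coprime n) {ψ : AddChar (ZMod (m * n)) ℂ}
    (hψ : ψ.IsPrimitive) : (ψ.fstComponent hmn).IsPrimitive := by
  intro a ha h1
  have h2 : (ZMod.chineseRemainder hmn).symm (a, 0) ≠ 0 := by
    rw [Ne, map_eq_zero_iff _ (RingEquiv.injective _)]
    exact fun h => ha (congrArg Prod.fst h)
  apply hψ h2
  ext x
  obtain ⟨y, rfl⟩ := (ZMod.chineseRemainder hmn).symm.surjective x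
  rw [AddChar.mulShift_apply, ← map_mul, AddChar.one_apply]
  have h3 := DFunLike.congr_fun h1 y.1
  rw [AddChar.mulShift_apply, AddChar.one_apply] at h3
  rw [← h3]
  change ψ _ = ψ _
  congr 2
  ext <;> simp

theorem AddChar.IsPrimitive.sndComponent (hmn : m.Coprime n) {ψ : AddChar (ZMod (m * n)) ℂ}
    (hψ : ψ.IsPrimitive) : (ψ.sndComponent hmn).IsPrimitive := by
  intro a ha h1
  have h2 : (ZMod.chineseRemainder hmn).symm (0, a) ≠ 0 := by
    rw [Ne, map_eq_zero_iff _ (RingEquiv.injective _)]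
    exact fun h => ha (congrArg Prod.snd h)
  apply hψ h2
  ext x
  obtain ⟨y, rfl⟩ := (ZMod.chineseRemainder hmn).symm.surjective x
  rw [AddChar.mulShift_apply, ← map_mul, AddChar.one_apply]
  have h3 := DFunLike.congr_fun h1 y.2
  rw [AddChar.mulShift_apply, AddChar.one_apply] at h3
  rw [← h3]
  change ψ _ = ψ _
  congr 2
  ext <;> simp

theorem IsLocallyPrimitive.fstComponent (hmn : m.Coprime n) {χ : DirichletCharacter ℂ (m * n)}
    (hχ : IsLocallyPrimitive χ) : IsLocallyPrimitive (χ.fstComponent hmn) := by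
  intro p hp hpm
  obtain ⟨y, hyu, hy⟩ := hχ p hp (hpm.mul_right n)
  obtain ⟨⟨y₁, y₂⟩, rfl⟩ := (ZMod.chineseRemainder hmn).symm.surjective y
  have h1 : (1 : ZMod (m * n)) + ((m * n / p : ℕ) : ZMod (m * n)) *
      (ZMod.chineseRemainder hmn).symm (y₁, y₂) =
      (ZMod.chineseRemainder hmn).symm (1 + ((m / p : ℕ) : ZMod m) * (n * y₁), 1) := by
    rw [RingEquiv.eq_symm_apply, map_add, map_one, map_mul, map_natCast, RingEquiv.apply_symm_apply,
      Nat.mul_comm m n, Nat.mul_div_assoc _ hpm]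
    ext
    · simp
      ring
    · simp
  rw [h1] at hyu hy
  rw [MulEquiv.isUnit_map, Prod.isUnit_iff] at hyu
  exact ⟨n * y₁, hyu.1, hy⟩

theorem IsLocallyPrimitive.sndComponent (hmn : m.Coprime n) {χ : DirichletCharacter ℂ (m * n)}
    (hχ : IsLocallyPrimitive χ) : IsLocallyPrimitive (χ.sndComponent hmn) := by
  intro p hp hpn
  obtain ⟨y, hyu, hy⟩ := hχ p hp (hpn.mul_left m)
  obtain ⟨⟨y₁, y₂⟩, rfl⟩ := (ZMod.chineseRemainder hmn).symm.surjective y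
  have h1 : (1 : ZMod (m * n)) + ((m * n / p : ℕ) : ZMod (m * n)) *
      (ZMod.chineseRemainder hmn).symm (y₁, y₂) =
      (ZMod.chineseRemainder hmn).symm (1, 1 + ((n / p : ℕ) : ZMod n) * (m * y₂)) := by
    rw [RingEquiv.eq_symm_apply, map_add, map_one, map_mul, map_natCast, RingEquiv.apply_symm_apply,
      Nat.mul_div_assoc _ hpn]
    ext
    · simp
    · simp
      ring
  rw [h1] at hyu hy
  rw [MulEquiv.isUnit_map, Prod.isUnit_iff] at hyu
  exact ⟨m * y₂, hyu.2, hy⟩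

theorem Int.gcd_natCast_mul_of_coprime (hmn : m.Coprime n) (a : ℤ) :
    Int.gcd a (m * n : ℕ) = Int.gcd a m * Int.gcd a n := by
  simp only [Int.gcd_eq_natAbs, Int.natAbs_natCast]
  exact hmn.gcd_mul _

end ChineseRemainder

theorem Int.gcd_add_four_mul_congr {n : ℕ} {c c' : ℤ} (h : (c : ZMod n) = c') (x : ℤ) :
    Int.gcd (x + 4 * c) n = Int.gcd (x + 4 * c') n := by
  rw [ZMod.intCast_eq_intCast_iff_dvd_sub] at h
  obtain ⟨t, ht⟩ := h
  rw [(by linarith : x + 4 * c' = x + 4 * c + n * (4 * t)), Int.gcd_add_mul_left_left]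

theorem exists_norm_correlationSum_le {q : ℕ} [NeZero q] (hq : Odd q)
    {χ : DirichletCharacter ℂ q} (hχ : IsLocallyPrimitive χ)
    {ψ : AddChar (ZMod q) ℂ} (hψ : ψ.IsPrimitive) :
    ∃ c : ℤ, IsUnit (c : ZMod q) ∧ ∀ a h : ℤ, ‖correlationSum χ ψ a h‖ ≤
      q.divisors.card * Int.gcd h (Int.gcd a q) *
        min (√(q / Int.gcd a q) * Int.gcd (a * h + 4 * c) q) (q / Int.gcd a q) := by
  rename_i hq0
  revert hq χ ψ
  revert hq0
  induction q using Nat.recOnPosPrimePosCoprime with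
  | zero => intro h; exact absurd rfl h.out
  | one =>
    intro _ hq χ hχ ψ hψ
    refine ⟨1, by simp, fun a h => ?_⟩
    have := norm_correlationSum_le χ ψ a h
    simpa using this
  | prime_pow p k hp hk =>
    intro _ hq χ hχ ψ hψ
    have : Fact p.Prime := ⟨hp⟩
    refine ZModPrimePow.exists_norm_correlationSum_le ?_ hk.ne' hχ hψ
    rintro rfl
    exact (Nat.not_even_iff_odd.2 hq) ((Nat.even_pow.2 ⟨even_two, hk.ne'⟩))
  | coprime m n hm hn hmn ihm ihn =>
    intro _ hq χ hχ ψ hψ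
    have : NeZero m := ⟨by omega⟩
    have : NeZero n := ⟨by omega⟩
    obtain ⟨c₁, hc₁u, hc₁⟩ := ihm (Nat.odd_mul.1 hq).1 (hχ.fstComponent hmn) (hψ.fstComponent hmn)
    obtain ⟨c₂, hc₂u, hc₂⟩ := ihn (Nat.odd_mul.1 hq).2 (hχ.sndComponent hmn) (hψ.sndComponent hmn)
    obtain ⟨c, hc⟩ := ZMod.intCast_surjective
      ((ZMod.chineseRemainder hmn).symm ((c₁ : ZMod m), (c₂ : ZMod n)))
    have hcc := (RingEquiv.eq_symm_apply _).1 hc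
    rw [map_intCast] at hcc
    have hcm : (c : ZMod m) = c₁ := congrArg Prod.fst hcc
    have hcn : (c : ZMod n) = c₂ := congrArg Prod.snd hcc
    refine ⟨c, ?_, fun a h => ?_⟩
    · rw [hc, MulEquiv.isUnit_map, Prod.isUnit_iff]
      exact ⟨hc₁u, hc₂u⟩
    · rw [correlationSum_mul hmn, norm_mul]
      refine (mul_le_mul (hc₁ a h) (hc₂ a h) (norm_nonneg _) (by positivity)).trans ?_
      have e1 : Int.gcd h (Int.gcd a (m * n : ℕ)) =
          Int.gcd h (Int.gcd a m) * Int.gcd h (Int.gcd a n) := by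
        rw [Int.gcd_natCast_mul_of_coprime hmn, Int.gcd_natCast_mul_of_coprime]
        exact Nat.Coprime.of_dvd (Int.natCast_dvd_natCast.1 (Int.gcd_dvd_right _ _))
          (Int.natCast_dvd_natCast.1 (Int.gcd_dvd_right _ _)) hmn
      have e2 : Int.gcd (a * h + 4 * c) (m * n : ℕ) =
          Int.gcd (a * h + 4 * c₁) m * Int.gcd (a * h + 4 * c₂) n := by
        rw [Int.gcd_natCast_mul_of_coprime hmn, Int.gcd_add_four_mul_congr hcm,
          Int.gcd_add_four_mul_congr hcn]
      have e3 : ((m * n : ℕ) : ℝ) / (Int.gcd a (m * n : ℕ) : ℝ) =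
          (m / Int.gcd a m) * (n / Int.gcd a n) := by
        rw [Int.gcd_natCast_mul_of_coprime hmn]
        push_cast
        rw [mul_div_mul_comm]
      rw [e1, e2, e3, hmn.card_divisors_mul, Real.sqrt_mul (by positivity)]
      push_cast
      set g₁ : ℝ := ((m.divisors.card : ℕ) : ℝ) * ((Int.gcd h (Int.gcd a m) : ℕ) : ℝ)
      set g₂ : ℝ := ((n.divisors.card : ℕ) : ℝ) * ((Int.gcd h (Int.gcd a n) : ℕ) : ℝ)
      set x₁ : ℝ := (m : ℝ) / (Int.gcd a m : ℝ)
      set x₂ : ℝ := (n : ℝ) / (Int.gcd a n : ℝ)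
      set d₁ : ℝ := ((Int.gcd (a * h + 4 * c₁) m : ℕ) : ℝ)
      set d₂ : ℝ := ((Int.gcd (a * h + 4 * c₂) n : ℕ) : ℝ)
      have hx₁ : 0 ≤ x₁ := by positivity
      have hx₂ : 0 ≤ x₂ := by positivity
      have hmin : min (√x₁ * d₁) x₁ * min (√x₂ * d₂) x₂ ≤
          min (√x₁ * √x₂ * (d₁ * d₂)) (x₁ * x₂) := by
        refine le_min ?_ ?_
        · refine (mul_le_mul (min_le_left _ _) (min_le_left _ _) (by positivity)
            (by positivity)).trans (le_of_eq (by ring))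
        · exact mul_le_mul (min_le_right _ _) (min_le_right _ _) (by positivity) hx₁
      calc g₁ * min (√x₁ * d₁) x₁ * (g₂ * min (√x₂ * d₂) x₂) =
          g₁ * g₂ * (min (√x₁ * d₁) x₁ * min (√x₂ * d₂) x₂) := by ring
        _ ≤ g₁ * g₂ * min (√x₁ * √x₂ * (d₁ * d₂)) (x₁ * x₂) := by gcongr
        _ = _ := by simp only [g₁, g₂]; ring

theorem norm_correlationSum_zero_le {q : ℕ} [NeZero q]
    {χ : DirichletCharacter ℂ q} (hχ : IsLocallyPrimitive χ)
    (ψ : AddChar (ZMod q) ℂ) (a : ℤ) : ‖correlationSum χ ψ a 0‖ ≤ Int.gcd a q := by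
  rename_i hq0
  revert χ ψ
  revert hq0
  induction q using Nat.recOnPosPrimePosCoprime with
  | zero => intro h; exact absurd rfl h.out
  | one =>
    intro _ χ hχ ψ
    have := norm_correlationSum_le χ ψ a 0
    simpa using this
  | prime_pow p k hp hk =>
    intro _ χ hχ ψ
    have : Fact p.Prime := ⟨hp⟩
    exact ZModPrimePow.norm_correlationSum_zero_le hk.ne' hχ ψ a
  | coprime m n hm hn hmn ihm ihn =>
    intro _ χ hχ ψ
    have : NeZero m := ⟨by omega⟩
    have : NeZero n := ⟨by omega⟩
    have h1 := correlationSum_mul hmn χ ψ a 0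
    rw [Int.cast_zero, Int.cast_zero, Int.cast_zero] at h1
    rw [h1, norm_mul, Int.gcd_natCast_mul_of_coprime hmn]
    push_cast
    exact mul_le_mul (ihm (hχ.fstComponent hmn) _) (ihn (hχ.sndComponent hmn) _) (norm_nonneg _)
      (by positivity)

theorem DirichletCharacter.IsPrimitive.isLocallyPrimitive {q : ℕ} [NeZero q]
    {χ : DirichletCharacter ℂ q} (hχ : χ.IsPrimitive) : IsLocallyPrimitive χ := by
  intro p hp hpq
  by_contra! hcon
  have hdvd : q / p ∣ q := Nat.div_dvd_of_dvd hpq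
  have hft : χ.FactorsThrough (q / p) := by
    rw [DirichletCharacter.factorsThrough_iff_ker_unitsMap hdvd]
    intro u hu
    rw [MonoidHom.mem_ker] at hu ⊢
    have h1 : ((u : ZMod q).val : ZMod (q / p)) = 1 := by
      have h2 := congrArg Units.val hu
      rw [ZMod.unitsMap_val, Units.val_one] at h2
      rw [ZMod.natCast_val]
      exact h2
    have h2 : ∃ t : ℤ, ((u : ZMod q).val : ℤ) = 1 + (q / p : ℕ) * t := by
      have h3 : (((u : ZMod q).val : ℤ) : ZMod (q / p)) = (1 : ℤ) := by
        push_cast; exact h1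
      obtain ⟨t, ht⟩ := (ZMod.intCast_eq_intCast_iff_dvd_sub _ _ _).1 h3
      exact ⟨-t, by linarith⟩
    obtain ⟨t, ht⟩ := h2
    have h4 : (u : ZMod q) = 1 + ((q / p : ℕ) : ZMod q) * t := by
      have h5 := congrArg (Int.cast : ℤ → ZMod q) ht
      simp only [Int.cast_add, Int.cast_mul, Int.cast_one, Int.cast_natCast] at h5
      rw [← h5, ZMod.natCast_zmod_val]
    have h6 := hcon t (h4 ▸ u.isUnit)
    rw [← h4] at h6
    ext
    rw [MulChar.coe_toUnitHom, h6, Units.val_one]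
  have h1 := Nat.sInf_le (s := χ.conductorSet) hft
  rw [DirichletCharacter.isPrimitive_def] at hχ
  rw [DirichletCharacter.conductor] at hχ
  rw [hχ] at h1
  exact absurd h1 (Nat.not_le.2 (Nat.div_lt_self (NeZero.pos q) hp.one_lt))

/-- The additive character `x ↦ exp (2 π i x)` of the real line. -/
noncomputable def expTwoPi (x : ℝ) : ℂ := Complex.exp ((2 * Real.pi * x : ℝ) * Complex.I)

theorem norm_expTwoPi (x : ℝ) : ‖expTwoPi x‖ = 1 := Complex.norm_exp_ofReal_mul_I _

theorem expTwoPi_add (x y : ℝ) : expTwoPi (x + y) = expTwoPi x * expTwoPi y := by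
  rw [expTwoPi, expTwoPi, expTwoPi, ← Complex.exp_add]
  congr 1
  push_cast
  ring

theorem expTwoPi_intCast (k : ℤ) : expTwoPi k = 1 := by
  rw [expTwoPi, ← Complex.exp_int_mul_two_pi_mul_I k]
  congr 1
  push_cast
  ring

theorem Real.cot_sub_cot {x y : ℝ} (hx : Real.sin x ≠ 0) (hy : Real.sin y ≠ 0) :
    Real.cot x - Real.cot y = Real.sin (y - x) / (Real.sin x * Real.sin y) := by
  rw [Real.cot_eq_cos_div_sin, Real.cot_eq_cos_div_sin, Real.sin_sub]
  field_simp

theorem Real.cot_le_cot {x y : ℝ} (hx : 0 < x) (hxy : x ≤ y) (hy : y < Real.pi) :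
    Real.cot y ≤ Real.cot x := by
  have h1 := Real.sin_pos_of_pos_of_lt_pi hx (hxy.trans_lt hy)
  have h2 := Real.sin_pos_of_pos_of_lt_pi (hx.trans_le hxy) hy
  rw [← sub_nonneg, Real.cot_sub_cot h1.ne' h2.ne']
  exact div_nonneg (Real.sin_nonneg_of_nonneg_of_le_pi (by linarith) (by linarith)) (by positivity)

theorem Real.two_mul_le_sin_pi_mul {θ x : ℝ} (hθ : 0 < θ) (h1 : θ ≤ x) (h2 : x ≤ 1 - θ) :
    2 * θ ≤ Real.sin (Real.pi * x) := by
  have key : ∀ y : ℝ, 0 ≤ y → y ≤ 1 / 2 → 2 * y ≤ Real.sin (Real.pi * y) := by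
    intro y hy0 hy
    have := Real.mul_le_sin (x := Real.pi * y) (by positivity) (by nlinarith [Real.pi_pos])
    refine le_trans (le_of_eq ?_) this
    field_simp
  rcases le_total x (1 / 2) with h | h
  · linarith [key x (by linarith) h]
  · have h3 := key (1 - x) (by linarith) (by linarith)
    rw [(by ring : Real.pi * (1 - x) = Real.pi - Real.pi * x), Real.sin_pi_sub] at h3
    linarith

theorem Real.abs_cot_pi_mul_le {θ x : ℝ} (hθ : 0 < θ) (h1 : θ ≤ x) (h2 : x ≤ 1 - θ) :
    |Real.cot (Real.pi * x)| ≤ 1 / (2 * θ) := by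
  have h3 := Real.two_mul_le_sin_pi_mul hθ h1 h2
  rw [Real.cot_eq_cos_div_sin, abs_div, abs_of_pos (by linarith : 0 < Real.sin (Real.pi * x))]
  exact div_le_div₀ zero_le_one (Real.abs_cos_le_one _) (by positivity) h3

theorem cot_mul_expTwoPi_sub_one {x : ℝ} (hx : Real.sin (Real.pi * x) ≠ 0) :
    (-(1 / 2) - Complex.I / 2 * Real.cot (Real.pi * x)) * (expTwoPi x - 1) = 1 := by
  have h1 : expTwoPi x = (Real.cos (Real.pi * x) + Real.sin (Real.pi * x) * Complex.I) ^ 2 := by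
    rw [expTwoPi, (by push_cast; ring : ((2 * Real.pi * x : ℝ) : ℂ) * Complex.I =
      (2 : ℕ) * (((Real.pi * x : ℝ) : ℂ) * Complex.I)), Complex.exp_nat_mul, Complex.exp_mul_I,
      Complex.ofReal_cos, Complex.ofReal_sin]
  have h2 : (Real.sin (Real.pi * x) : ℂ) ≠ 0 := by exact_mod_cast hx
  have h3 : (Real.sin (Real.pi * x) : ℂ) ^ 2 + (Real.cos (Real.pi * x) : ℂ) ^ 2 = 1 := by
    exact_mod_cast Real.sin_sq_add_cos_sq (Real.pi * x)
  rw [h1, Real.cot_eq_cos_div_sin]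
  push_cast at h2 h3 ⊢
  field_simp
  linear_combination (Complex.sin (Real.pi * x) - Complex.I * Complex.cos (Real.pi * x)) * h3 +
    (-Complex.sin (Real.pi * x) ^ 3
      - Complex.I * Complex.sin (Real.pi * x) ^ 2 * Complex.cos (Real.pi * x)
      - 2 * Complex.sin (Real.pi * x) * Complex.cos (Real.pi * x) ^ 2) * Complex.I_sq

/-- The Kuzmin–Landau inequality. -/
theorem norm_sum_expTwoPi_le_of_antitone {f : ℕ → ℝ} {u v : ℕ} {k : ℤ} {θ : ℝ} (hθ : 0 < θ)
    (hlow : ∀ n ∈ Finset.Ico u v, k + θ ≤ f (n + 1) - f n)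
    (hupp : ∀ n ∈ Finset.Ico u v, f (n + 1) - f n ≤ k + 1 - θ)
    (hanti : ∀ n, u ≤ n → n + 1 < v → f (n + 2) - f (n + 1) ≤ f (n + 1) - f n) :
    ‖∑ n ∈ Finset.Ico u v, expTwoPi (f n)‖ ≤ 2 / θ := by
  rcases le_or_gt v u with huv | huv
  · rw [Finset.Ico_eq_empty (by omega), Finset.sum_empty, norm_zero]
    positivity
  set x : ℕ → ℝ := fun n => f (n + 1) - f n - k with hx
  set d : ℕ → ℝ := fun n => Real.cot (Real.pi * x n) with hd
  set c : ℕ → ℂ := fun n => -(1 / 2) - Complex.I / 2 * d n with hc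
  have hx1 : ∀ n ∈ Finset.Ico u v, θ ≤ x n := fun n hn => by
    have := hlow n hn
    simp only [hx]; linarith
  have hx2 : ∀ n ∈ Finset.Ico u v, x n ≤ 1 - θ := fun n hn => by
    have := hupp n hn
    simp only [hx]; linarith
  have hθ2 : θ ≤ 1 / 2 := by
    linarith [hx1 u (Finset.mem_Ico.2 ⟨le_rfl, huv⟩), hx2 u (Finset.mem_Ico.2 ⟨le_rfl, huv⟩)]
  have hdle : ∀ n ∈ Finset.Ico u v, |d n| ≤ 1 / (2 * θ) := fun n hn =>
    Real.abs_cot_pi_mul_le hθ (hx1 n hn) (hx2 n hn)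
  have hcle : ∀ n ∈ Finset.Ico u v, ‖c n‖ ≤ 1 / (2 * θ) := fun n hn => by
    have h1 : ‖c n‖ ≤ 1 / 2 + 1 / 2 * |d n| := by
      refine (norm_sub_le _ _).trans (le_of_eq ?_)
      rw [norm_mul, norm_div, Complex.norm_I, Complex.norm_real, Real.norm_eq_abs]
      norm_num
    refine h1.trans ?_
    have h2 := hdle n hn
    have h3 : (1 : ℝ) ≤ 1 / (2 * θ) := by
      rw [le_div_iff₀ (by positivity)]; linarith
    linarith
  have hz : ∀ n ∈ Finset.Ico u v, expTwoPi (f n) =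
      expTwoPi (f (n + 1)) * c n - expTwoPi (f n) * c n := fun n hn => by
    have h1 : expTwoPi (f (n + 1)) = expTwoPi (f n) * expTwoPi (x n) := by
      rw [← expTwoPi_add, ← mul_one (expTwoPi (f n + x n)), ← expTwoPi_intCast k, ← expTwoPi_add]
      congr 1
      simp only [hx]; ring
    have h2 := cot_mul_expTwoPi_sub_one (x := x n) (by
      linarith [Real.two_mul_le_sin_pi_mul hθ (hx1 n hn) (hx2 n hn)] :
        0 < Real.sin (Real.pi * x n)).ne'
    rw [h1]
    linear_combination (-expTwoPi (f n)) * h2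
  have key : ∀ m, u + m < v → ‖∑ n ∈ Finset.Ico u (u + m + 1), expTwoPi (f n) -
      expTwoPi (f (u + m + 1)) * c (u + m)‖ ≤ ‖c u‖ + 1 / 2 * (d (u + m) - d u) := by
    intro m
    induction m with
    | zero =>
      intro hm
      simp only [add_zero, Nat.Ico_succ_singleton, Finset.sum_singleton, sub_self, mul_zero]
      have := hz u (Finset.mem_Ico.2 ⟨le_rfl, hm⟩)
      rw [(by linear_combination this : expTwoPi (f u) - expTwoPi (f (u + 1)) * c u =
        - (expTwoPi (f u) * c u)), norm_neg, norm_mul, norm_expTwoPi, one_mul]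
    | succ m ih =>
      intro hm
      have h1 := ih (by omega)
      have h2 := hz (u + m + 1) (Finset.mem_Ico.2 ⟨by omega, by omega⟩)
      rw [← add_assoc, Finset.sum_Ico_succ_top (by omega)]
      have h3 : ‖c (u + m) - c (u + m + 1)‖ = 1 / 2 * (d (u + m + 1) - d (u + m)) := by
        have h4 : d (u + m) ≤ d (u + m + 1) := by
          have hp := Real.pi_pos
          have ha := hx1 (u + m + 1) (Finset.mem_Ico.2 ⟨by omega, by omega⟩)
          have hb := hx2 (u + m) (Finset.mem_Ico.2 ⟨by omega, by omega⟩)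
          have hab : x (u + m + 1) ≤ x (u + m) := by
            have : f (u + m + 1 + 1) - f (u + m + 1) ≤ f (u + m + 1) - f (u + m) :=
              hanti (u + m) (by omega) (by omega)
            simp only [hx]
            linarith
          exact Real.cot_le_cot (by have : 0 < x (u + m + 1) := by linarith
                                    positivity)
            (by gcongr) (by nlinarith)
        have h5 : c (u + m) - c (u + m + 1) =
            Complex.I / 2 * ((d (u + m + 1) - d (u + m) : ℝ) : ℂ) := by
          simp only [hc]; push_cast; ring
        rw [h5, norm_mul, norm_div, Complex.norm_I, Complex.norm_real, Real.norm_eq_abs,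
          abs_of_nonneg (by linarith)]
        norm_num
      rw [(by linear_combination h2 : ∑ n ∈ Finset.Ico u (u + m + 1), expTwoPi (f n) +
          expTwoPi (f (u + m + 1)) - expTwoPi (f (u + m + 1 + 1)) * c (u + m + 1) =
        (∑ n ∈ Finset.Ico u (u + m + 1), expTwoPi (f n) - expTwoPi (f (u + m + 1)) * c (u + m)) +
        expTwoPi (f (u + m + 1)) * (c (u + m) - c (u + m + 1)))]
      refine (norm_add_le _ _).trans ?_
      rw [norm_mul, norm_expTwoPi, one_mul, h3]
      linarith
  obtain ⟨m, rfl⟩ : ∃ m, v = u + m + 1 := ⟨v - u - 1, by omega⟩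
  have h1 := key m (by omega)
  have hu := Finset.mem_Ico.2 ⟨le_rfl, huv⟩
  have hm : u + m ∈ Finset.Ico u (u + m + 1) := Finset.mem_Ico.2 ⟨by omega, by omega⟩
  have h2 : ‖expTwoPi (f (u + m + 1)) * c (u + m)‖ ≤ 1 / (2 * θ) := by
    rw [norm_mul, norm_expTwoPi, one_mul]
    exact hcle _ hm
  have h3 := norm_le_norm_add_norm_sub' (∑ n ∈ Finset.Ico u (u + m + 1), expTwoPi (f n))
    (expTwoPi (f (u + m + 1)) * c (u + m))
  have h4 := hcle u hu
  have h5 := abs_le.1 (hdle u hu)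
  have h6 := abs_le.1 (hdle _ hm)
  have h7 : 2 / θ = 4 * (1 / (2 * θ)) := by field_simp; norm_num
  rw [h7]
  linarith

theorem exists_split_of_antitone {δ : ℕ → ℝ} {u v : ℕ} (huv : u ≤ v)
    (hanti : ∀ n, u ≤ n → n + 1 < v → δ (n + 1) ≤ δ n) (y : ℝ) :
    ∃ w, u ≤ w ∧ w ≤ v ∧ (∀ n ∈ Finset.Ico u w, y ≤ δ n) ∧ ∀ n ∈ Finset.Ico w v, δ n < y := by
  induction v, huv using Nat.le_induction with
  | base => exact ⟨u, le_rfl, le_rfl, by simp, by simp⟩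
  | succ v huv ih =>
    obtain ⟨w, h1, h2, h3, h4⟩ := ih fun n hn hnv => hanti n hn (by omega)
    rcases h2.eq_or_lt with rfl | h2
    · rcases le_or_gt y (δ w) with h | h
      · refine ⟨w + 1, by omega, le_rfl, fun n hn => ?_, by simp⟩
        rcases (Nat.lt_succ_iff.1 (Finset.mem_Ico.1 hn).2).eq_or_lt with rfl | hlt
        · exact h
        · exact h3 n (Finset.mem_Ico.2 ⟨(Finset.mem_Ico.1 hn).1, hlt⟩)
      · refine ⟨w, h1, by omega, h3, fun n hn => ?_⟩
        obtain rfl : n = w := by have := Finset.mem_Ico.1 hn; omega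
        exact h
    · refine ⟨w, h1, by omega, h3, fun n hn => ?_⟩
      rcases (Nat.lt_succ_iff.1 (Finset.mem_Ico.1 hn).2).eq_or_lt with rfl | hlt
      · have h5 := h4 (n - 1) (Finset.mem_Ico.2 ⟨by omega, by omega⟩)
        have h6 := hanti (n - 1) (by omega) (by omega)
        rw [Nat.sub_add_cancel (by omega)] at h6
        linarith
      · exact h4 n (Finset.mem_Ico.2 ⟨(Finset.mem_Ico.1 hn).1, hlt⟩)

theorem card_le_of_decreasing {δ : ℕ → ℝ} {u v : ℕ} {lam y w : ℝ} (hl : 0 < lam) (hw : 0 ≤ w)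
    (hdec : ∀ n, u ≤ n → n + 1 < v → lam ≤ δ n - δ (n + 1))
    (hlow : ∀ n ∈ Finset.Ico u v, y ≤ δ n) (hupp : ∀ n ∈ Finset.Ico u v, δ n ≤ y + w) :
    ((Finset.Ico u v).card : ℝ) ≤ w / lam + 1 := by
  rw [Nat.card_Ico]
  rcases le_or_gt v u with huv | huv
  · rw [Nat.sub_eq_zero_of_le huv, Nat.cast_zero]
    positivity
  have key : ∀ m, u + m < v → m * lam ≤ δ u - δ (u + m) := by
    intro m
    induction m with
    | zero => simp
    | succ m ih =>
      intro hm
      have h1 := ih (by omega)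
      have h2 := hdec (u + m) (by omega) (by omega)
      push_cast
      rw [← add_assoc]
      linarith
  have h1 := key (v - u - 1) (by omega)
  have h2 := hlow (u + (v - u - 1)) (Finset.mem_Ico.2 ⟨by omega, by omega⟩)
  have h3 := hupp u (Finset.mem_Ico.2 ⟨le_rfl, huv⟩)
  have h4 : ((v - u : ℕ) : ℝ) = (v - u - 1 : ℕ) + 1 := by
    rw [← Nat.cast_add_one, Nat.sub_add_cancel (by omega)]
  rw [h4, add_le_add_iff_right, le_div_iff₀ hl]
  linarith

theorem norm_sum_expTwoPi_le_card {f : ℕ → ℝ} (s : Finset ℕ) :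
    ‖∑ n ∈ s, expTwoPi (f n)‖ ≤ s.card := by
  refine (norm_sum_le _ _).trans (le_of_eq ?_)
  simp [norm_expTwoPi]

theorem norm_sum_expTwoPi_le_of_mem_unit {f : ℕ → ℝ} {u v : ℕ} {k : ℤ} {lam : ℝ} (hl : 0 < lam)
    (hl1 : lam ≤ 1) (huv : u ≤ v)
    (hdec : ∀ n, u ≤ n → n + 1 < v → lam ≤ (f (n + 1) - f n) - (f (n + 2) - f (n + 1)))
    (hlow : ∀ n ∈ Finset.Ico u v, k ≤ f (n + 1) - f n)
    (hupp : ∀ n ∈ Finset.Ico u v, f (n + 1) - f n ≤ k + 1) :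
    ‖∑ n ∈ Finset.Ico u v, expTwoPi (f n)‖ ≤ 6 / √lam := by
  set δ : ℕ → ℝ := fun n => f (n + 1) - f n with hδ
  set θ := √lam with hθ
  have hθ0 : 0 < θ := Real.sqrt_pos.2 hl
  have hθ1 : θ ≤ 1 := Real.sqrt_le_one.2 hl1
  have hθl : θ / lam = 1 / θ := by
    rw [div_eq_div_iff hl.ne' hθ0.ne', hθ, Real.mul_self_sqrt hl.le, one_mul]
  obtain ⟨w₁, h1, h2, h3, h4⟩ := exists_split_of_antitone (δ := δ) huv
    (fun n hn hnv => by have := hdec n hn hnv; simp only [hδ]; linarith) (k + 1 - θ)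
  obtain ⟨w₂, h5, h6, h7, h8⟩ := exists_split_of_antitone (δ := δ) h2
    (fun n hn hnv => by have := hdec n (by omega) hnv; simp only [hδ]; linarith) (k + θ)
  rw [← Finset.sum_Ico_consecutive _ h1 h2, ← Finset.sum_Ico_consecutive _ h5 h6]
  have i1 : ‖∑ n ∈ Finset.Ico u w₁, expTwoPi (f n)‖ ≤ θ / lam + 1 := by
    refine (norm_sum_expTwoPi_le_card _).trans (card_le_of_decreasing (δ := δ) hl hθ0.le
      (fun n hn hnv => hdec n hn (by omega)) h3 fun n hn => ?_)
    rw [sub_add_cancel]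
    exact hupp n (Finset.Ico_subset_Ico_right h2 hn)
  have i2 : ‖∑ n ∈ Finset.Ico w₁ w₂, expTwoPi (f n)‖ ≤ 2 / θ :=
    norm_sum_expTwoPi_le_of_antitone hθ0 h7
      (fun n hn => (h4 n (Finset.Ico_subset_Ico_right h6 hn)).le)
      (fun n hn hnv => by have := hdec n (by omega) (by omega); linarith)
  have i3 : ‖∑ n ∈ Finset.Ico w₂ v, expTwoPi (f n)‖ ≤ θ / lam + 1 := by
    refine (norm_sum_expTwoPi_le_card _).trans (card_le_of_decreasing (δ := δ) hl hθ0.le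
      (fun n hn hnv => hdec n (by omega) hnv)
      (fun n hn => hlow n (Finset.Ico_subset_Ico_left (h1.trans h5) hn)) fun n hn => (h8 n hn).le)
  refine (norm_add_le _ _).trans ?_
  have h9 := norm_add_le (∑ n ∈ Finset.Ico w₁ w₂, expTwoPi (f n))
    (∑ n ∈ Finset.Ico w₂ v, expTwoPi (f n))
  have h10 : (1 : ℝ) ≤ 1 / θ := by rw [le_div_iff₀ hθ0]; linarith
  rw [hθl] at i1 i3
  have h11 : 2 / θ = 2 * (1 / θ) := by ring
  have h12 : 6 / θ = 6 * (1 / θ) := by ring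
  linarith

/-- The second difference test for exponential sums. -/
theorem norm_sum_expTwoPi_le_of_second_difference {f : ℕ → ℝ} {u : ℕ} {lam : ℝ} (hl : 0 < lam)
    (hl1 : lam ≤ 1) (m : ℕ) : ∀ {k : ℤ} {v : ℕ}, u ≤ v →
    (∀ n, u ≤ n → n + 1 < v → lam ≤ (f (n + 1) - f n) - (f (n + 2) - f (n + 1))) →
    (∀ n ∈ Finset.Ico u v, k ≤ f (n + 1) - f n) →
    (∀ n ∈ Finset.Ico u v, f (n + 1) - f n < k + m) →
    ‖∑ n ∈ Finset.Ico u v, expTwoPi (f n)‖ ≤ m * (6 / √lam) := by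
  induction m with
  | zero =>
    intro k v huv hdec hlow hupp
    rcases huv.eq_or_lt with rfl | huv
    · simp
    · have h1 := hlow u (Finset.mem_Ico.2 ⟨le_rfl, huv⟩)
      have h2 := hupp u (Finset.mem_Ico.2 ⟨le_rfl, huv⟩)
      rw [Nat.cast_zero, add_zero] at h2
      exact absurd h1 (not_le.2 h2)
  | succ m ih =>
    intro k v huv hdec hlow hupp
    obtain ⟨w, h1, h2, h3, h4⟩ := exists_split_of_antitone (δ := fun n => f (n + 1) - f n) huv
      (fun n hn hnv => by have := hdec n hn hnv; simp only [add_assoc]; linarith) (k + 1)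
    rw [← Finset.sum_Ico_consecutive _ h1 h2]
    refine (norm_add_le _ _).trans ?_
    have i1 := ih (k := k + 1) h1 (fun n hn hnv => hdec n hn (by omega))
      (fun n hn => by push_cast; exact h3 n hn)
      (fun n hn => by
        have := hupp n (Finset.Ico_subset_Ico_right h2 hn)
        push_cast at this ⊢
        linarith)
    have i2 := norm_sum_expTwoPi_le_of_mem_unit hl hl1 h2
      (fun n hn hnv => hdec n (by omega) hnv)
      (fun n hn => hlow n (Finset.Ico_subset_Ico_left h1 hn)) (fun n hn => (h4 n hn).le)
    push_cast
    linarith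

/-- The phase `x n - c log (1 + a / n)`. -/
noncomputable def logPhase (c x : ℝ) (a n : ℕ) : ℝ := x * n - c * Real.log (1 + a / n)

section LogPhase

variable {c x : ℝ} {a n N u v : ℕ}

theorem logPhase_succ_sub (hn : 0 < n) :
    logPhase c x a (n + 1) - logPhase c x a n =
      x + c * Real.log ((n + 1) * (n + a) / (n * (n + a + 1))) := by
  have h0 : (0 : ℝ) < n := by exact_mod_cast hn
  have h1 : (1 : ℝ) + a / n = (n + a) / n := by field_simp
  have h2 : (1 : ℝ) + a / ((n + 1 : ℕ) : ℝ) = (n + a + 1) / (n + 1) := by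
    push_cast; field_simp; ring
  rw [logPhase, logPhase, h1, h2, Real.log_div (by positivity) (by positivity),
    Real.log_div (by positivity) (by positivity), Real.log_div (by positivity) (by positivity),
    Real.log_mul (by positivity) (by positivity), Real.log_mul (by positivity) (by positivity)]
  push_cast
  ring

theorem logPhase_succ_sub_le (hc : 0 ≤ c) (hN : 0 < N) (hn : N ≤ n) :
    logPhase c x a (n + 1) - logPhase c x a n ≤ x + c * a / N ^ 2 := by
  have h0 : (0 : ℝ) < N := by exact_mod_cast hN
  have h1 : (N : ℝ) ≤ n := by exact_mod_cast hn
  have h2 : (0 : ℝ) < n := h0.trans_le h1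
  rw [logPhase_succ_sub (hN.trans_le hn), add_le_add_iff_left, mul_div_assoc c]
  refine mul_le_mul_of_nonneg_left ?_ hc
  refine (Real.log_le_sub_one_of_pos (by positivity)).trans ?_
  have h3 : ((n : ℝ) + 1) * (n + a) / (n * (n + a + 1)) - 1 = a / (n * (n + a + 1)) := by
    field_simp; ring
  rw [h3]
  gcongr
  nlinarith [Nat.cast_nonneg (α := ℝ) a]

theorem le_logPhase_succ_sub (hc : 0 ≤ c) (ha : 0 < a) (hN : 0 < N) (hn : N ≤ n)
    (hnN : n + a ≤ 2 * N) :
    x + c * a / N ^ 2 / 4 ≤ logPhase c x a (n + 1) - logPhase c x a n := by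
  have h0 : (0 : ℝ) < N := by exact_mod_cast hN
  have h1 : (N : ℝ) ≤ n := by exact_mod_cast hn
  have h2 : (0 : ℝ) < n := h0.trans_le h1
  have h4 : (n : ℝ) + a ≤ 2 * N := by exact_mod_cast hnN
  have h5 : (1 : ℝ) ≤ a := by exact_mod_cast ha
  rw [logPhase_succ_sub (hN.trans_le hn), add_le_add_iff_left, mul_div_assoc c,
    mul_div_assoc c]
  refine mul_le_mul_of_nonneg_left ?_ hc
  refine le_trans ?_ (Real.one_sub_inv_le_log_of_pos (by positivity))
  have h3 : 1 - (((n : ℝ) + 1) * (n + a) / (n * (n + a + 1)))⁻¹ = a / ((n + 1) * (n + a)) := by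
    field_simp; ring
  rw [h3, div_div]
  have h6 : ((n : ℝ) + 1) * (n + a) ≤ 2 * N * (2 * N) := by
    gcongr
    linarith
  refine div_le_div_of_nonneg_left (by positivity) (by positivity) ?_
  linarith

theorem le_logPhase_second_difference (hc : 0 ≤ c) (ha : 0 < a) (hN : 0 < N) (hn : N ≤ n)
    (hnN : n + a ≤ 2 * N) :
    c * a / N ^ 2 / (8 * N) ≤ (logPhase c x a (n + 1) - logPhase c x a n) -
      (logPhase c x a (n + 2) - logPhase c x a (n + 1)) := by
  have h0 : (0 : ℝ) < N := by exact_mod_cast hN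
  have h1 : (N : ℝ) ≤ n := by exact_mod_cast hn
  have h2 : (0 : ℝ) < n := h0.trans_le h1
  have h4 : (n : ℝ) + a ≤ 2 * N := by exact_mod_cast hnN
  have h5 : (1 : ℝ) ≤ a := by exact_mod_cast ha
  have e2 : logPhase c x a (n + 2) - logPhase c x a (n + 1) =
      x + c * Real.log ((n + 2) * (n + a + 1) / ((n + 1) * (n + a + 2))) := by
    rw [show n + 2 = n + 1 + 1 from rfl, logPhase_succ_sub (Nat.succ_pos n)]
    push_cast
    ring_nf
  have e3 : (logPhase c x a (n + 1) - logPhase c x a n) -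
      (logPhase c x a (n + 2) - logPhase c x a (n + 1)) =
      c * Real.log ((n + 1) ^ 2 * (n + a) * (n + a + 2) / (n * (n + 2) * (n + a + 1) ^ 2)) := by
    rw [e2, logPhase_succ_sub (hN.trans_le hn), add_sub_add_left_eq_sub, ← mul_sub,
      ← Real.log_div (by positivity) (by positivity)]
    congr 2
    field_simp
  rw [e3, mul_div_assoc c, mul_div_assoc c]
  refine mul_le_mul_of_nonneg_left ?_ hc
  refine le_trans ?_ (Real.one_sub_inv_le_log_of_pos (by positivity))
  have h3 : 1 - (((n : ℝ) + 1) ^ 2 * (n + a) * (n + a + 2) / (n * (n + 2) * (n + a + 1) ^ 2))⁻¹ =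
      (a : ℝ) * (2 * n + a + 2) / ((n + 1) ^ 2 * (n + a) * (n + a + 2)) := by
    field_simp; ring
  rw [h3, div_div, div_le_div_iff₀ (by positivity) (by positivity)]
  have h6 : ((n : ℝ) + 1) ^ 2 * (n + a) ≤ (2 * N) ^ 2 * (2 * N) := by
    gcongr
    linarith
  have h7 : (a : ℝ) * (n + a + 2) ≤ a * (2 * n + a + 2) := by
    gcongr
    linarith
  refine le_trans (le_of_eq (by ring)) ((mul_le_mul h7 h6 (by positivity) (by positivity)).trans
    (le_of_eq (by ring)))

theorem norm_sum_logPhase_le_card (hu : N ≤ u) (hv : v ≤ 2 * N) :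
    ‖∑ n ∈ Finset.Ico u v, expTwoPi (logPhase c x a n)‖ ≤ N := by
  refine (norm_sum_expTwoPi_le_card _).trans ?_
  rw [Nat.card_Ico]
  exact_mod_cast (by omega : v - u ≤ N)

theorem norm_sum_logPhase_le (hc : 0 < c) (ha : 0 < a) (hN : 0 < N) (hu : N ≤ u)
    (hv : v + a ≤ 2 * N) :
    ‖∑ n ∈ Finset.Ico u v, expTwoPi (logPhase c x a n)‖ ≤
      18 * (c * a / N ^ 2 + 2) * √(N / (c * a / N ^ 2)) := by
  rcases lt_or_ge v u with huv | huv
  · rw [Finset.Ico_eq_empty (by omega), Finset.sum_empty, norm_zero]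
    positivity
  set μ : ℝ := c * a / N ^ 2 with hμ
  have hN0 : (0 : ℝ) < N := by exact_mod_cast hN
  have ha0 : (0 : ℝ) < a := by exact_mod_cast ha
  have hμ0 : 0 < μ := by positivity
  rcases le_or_gt (μ / (8 * N)) 1 with hl | hl
  · have h1 := norm_sum_expTwoPi_le_of_second_difference (f := logPhase c x a)
      (by positivity : 0 < μ / (8 * N)) hl (⌊μ⌋₊ + 2) (k := ⌊x⌋) huv
      (fun n hn hnv => le_logPhase_second_difference hc.le ha hN (hu.trans hn) (by omega))
      (fun n hn => by
        have hn := Finset.mem_Ico.1 hn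
        have := le_logPhase_succ_sub (x := x) hc.le ha hN (hu.trans hn.1) (by omega)
        have := Int.floor_le x
        have : 0 ≤ c * a / N ^ 2 / 4 := by positivity
        linarith)
      (fun n hn => by
        have hn := Finset.mem_Ico.1 hn
        have h2 := logPhase_succ_sub_le (x := x) (a := a) hc.le hN (hu.trans hn.1)
        have h3 := Int.lt_floor_add_one x
        have h4 := Nat.lt_floor_add_one μ
        push_cast
        linarith)
    refine h1.trans ?_
    have h2 : (((⌊μ⌋₊ + 2 : ℕ)) : ℝ) ≤ μ + 2 := by
      push_cast
      linarith [Nat.floor_le hμ0.le]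
    have h3 : 6 / √(μ / (8 * N)) ≤ 18 * √(N / μ) := by
      have h4 : 8 * N / μ = (√(μ / (8 * N)))⁻¹ ^ 2 := by
        rw [inv_pow, Real.sq_sqrt (by positivity), inv_div]
      have h5 : (√(μ / (8 * N)))⁻¹ ≤ 3 * √(N / μ) := by
        refine le_of_sq_le_sq ?_ (by positivity)
        rw [← h4, mul_pow, Real.sq_sqrt (by positivity), mul_div_assoc]
        gcongr
        norm_num
      rw [div_eq_mul_inv]
      linarith
    calc _ ≤ (μ + 2) * (18 * √(N / μ)) := by gcongr
      _ = _ := by ring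
  · refine (norm_sum_logPhase_le_card hu (by omega)).trans ?_
    rw [lt_div_iff₀ (by positivity), one_mul] at hl
    have h1 : (N : ℝ) / μ = (√(N / μ)) ^ 2 := (Real.sq_sqrt (by positivity)).symm
    have h2 : √(N / μ) ≤ 1 := by
      exact Real.sqrt_le_one.2 ((div_le_one hμ0).2 (by linarith))
    have h3 : (N : ℝ) = μ * √(N / μ) ^ 2 := by rw [← h1]; field_simp
    have h4 : 0 ≤ √(N / μ) := Real.sqrt_nonneg _
    calc (N : ℝ) = μ * √(N / μ) ^ 2 := h3
      _ ≤ μ * √(N / μ) := by gcongr; nlinarith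
      _ ≤ 18 * (μ + 2) * √(N / μ) := by gcongr; linarith

theorem norm_sum_logPhase_le_of_small {q : ℕ} {h : ℤ} (hc : 0 < c) (ha : 0 < a) (hN : 0 < N)
    (hu : N ≤ u) (hv : v + a ≤ 2 * N) (hq : 0 < q) (hh : h ≠ 0) (hhq : 2 * |h| ≤ q)
    (hμ : c * a / N ^ 2 ≤ |(h : ℝ)| / (4 * q)) :
    ‖∑ n ∈ Finset.Ico u v, expTwoPi (logPhase c (h / q) a n)‖ ≤ 4 * (q / |(h : ℝ)|) := by
  have hq0 : (0 : ℝ) < q := by exact_mod_cast hq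
  have hh0 : 0 < |(h : ℝ)| := abs_pos.2 (by exact_mod_cast hh)
  have hhq' : 2 * |(h : ℝ)| ≤ q := by exact_mod_cast hhq
  have hhq2 : |(h : ℝ)| / q ≤ 1 / 2 := by rw [div_le_iff₀ hq0]; linarith
  set y : ℝ := |(h : ℝ)| / q with hy
  have hy0 : 0 < y := by positivity
  have e1 : |(h : ℝ)| / (4 * q) = y / 4 := by rw [hy]; ring
  have e2 : 4 * (q / |(h : ℝ)|) = 2 / (y / 2) := by rw [hy]; field_simp; norm_num
  rw [e1] at hμ
  rw [e2]
  have hμ0 : 0 ≤ c * a / N ^ 2 / 4 := by positivity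
  have hlow : ∀ n ∈ Finset.Ico u v,
      h / q ≤ logPhase c (h / q) a (n + 1) - logPhase c (h / q) a n := fun n hn => by
    have hn := Finset.mem_Ico.1 hn
    have := le_logPhase_succ_sub (x := h / q) hc.le ha hN (hu.trans hn.1) (by omega)
    linarith
  have hupp : ∀ n ∈ Finset.Ico u v,
      logPhase c (h / q) a (n + 1) - logPhase c (h / q) a n ≤ h / q + y / 4 := fun n hn => by
    have hn := Finset.mem_Ico.1 hn
    have := logPhase_succ_sub_le (x := h / q) (a := a) hc.le hN (hu.trans hn.1)
    linarith
  have hanti : ∀ n, u ≤ n → n + 1 < v →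
      logPhase c (h / q) a (n + 2) - logPhase c (h / q) a (n + 1) ≤
      logPhase c (h / q) a (n + 1) - logPhase c (h / q) a n := fun n hn hnv => by
    have := le_logPhase_second_difference (x := h / q) hc.le ha hN (hu.trans hn) (by omega)
    have : 0 ≤ c * a / N ^ 2 / (8 * N) := by positivity
    linarith
  rcases lt_or_gt_of_ne hh with hneg | hpos
  · have e3 : (h : ℝ) / q = -y := by
      rw [hy, abs_of_neg (by exact_mod_cast hneg)]; ring
    refine norm_sum_expTwoPi_le_of_antitone (k := -1) (by positivity) (fun n hn => ?_)
      (fun n hn => ?_) hanti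
    · have := hlow n hn
      push_cast
      linarith
    · have := hupp n hn
      push_cast
      linarith
  · have e3 : (h : ℝ) / q = y := by rw [hy, abs_of_pos (by exact_mod_cast hpos)]
    refine norm_sum_expTwoPi_le_of_antitone (k := 0) (by positivity) (fun n hn => ?_)
      (fun n hn => ?_) hanti
    · have := hlow n hn
      push_cast
      linarith
    · have := hupp n hn
      push_cast
      linarith

theorem norm_sum_logPhase_zero_le (hc : 0 < c) (ha : 0 < a) (hN : 0 < N) (hu : N ≤ u)
    (hv : v + a ≤ 2 * N) (hμ : c * a / N ^ 2 ≤ 1 / 2) :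
    ‖∑ n ∈ Finset.Ico u v, expTwoPi (logPhase c 0 a n)‖ ≤ 8 / (c * a / N ^ 2) := by
  have hN0 : (0 : ℝ) < N := by exact_mod_cast hN
  have ha0 : (0 : ℝ) < a := by exact_mod_cast ha
  set μ : ℝ := c * a / N ^ 2 with hμ'
  have hμ0 : 0 < μ := by positivity
  rw [(by field_simp; norm_num : 8 / μ = 2 / (μ / 4))]
  refine norm_sum_expTwoPi_le_of_antitone (k := 0) (by positivity) (fun n hn => ?_)
    (fun n hn => ?_) (fun n hn hnv => ?_)
  · have hn := Finset.mem_Ico.1 hn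
    have := le_logPhase_succ_sub (x := 0) hc.le ha hN (hu.trans hn.1) (by omega)
    push_cast
    exact this
  · have hn := Finset.mem_Ico.1 hn
    have := logPhase_succ_sub_le (x := 0) (a := a) hc.le hN (hu.trans hn.1)
    push_cast
    linarith
  · have := le_logPhase_second_difference (x := 0) hc.le ha hN (hu.trans hn) (by omega)
    have : 0 ≤ c * a / N ^ 2 / (8 * N) := by positivity
    linarith

end LogPhase

/-- The divisor bound `τ(n) ≪ n ^ ε`. -/
theorem exists_card_divisors_le_rpow {ε : ℝ} (hε : 0 < ε) :
    ∃ C : ℝ, 1 ≤ C ∧ ∀ n : ℕ, 0 < n → (n.divisors.card : ℝ) ≤ C * (n : ℝ) ^ ε := by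
  set A : ℝ := 1 + 1 / (ε * Real.log 2) with hA
  have hlog : 0 < Real.log 2 := Real.log_pos one_lt_two
  have hA1 : 1 ≤ A := by
    have : 0 < 1 / (ε * Real.log 2) := by positivity
    linarith
  set P : ℕ := ⌈(2 : ℝ) ^ (1 / ε)⌉₊ with hP
  refine ⟨A ^ P, one_le_pow₀ hA1, fun n hn => ?_⟩
  have hn0 : n ≠ 0 := hn.ne'
  have hfac : (n : ℝ) ^ ε = ∏ p ∈ n.primeFactors, ((p : ℝ) ^ (n.factorization p)) ^ ε := by
    conv_lhs => rw [← Nat.prod_factorization_pow_eq_self hn0]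
    rw [Finsupp.prod, Nat.support_factorization]
    push_cast
    rw [Real.finsetProd_rpow _ _ fun p _ => by positivity]
  have hprod : ∏ p ∈ n.primeFactors, (if p < P then A else 1) ≤ A ^ P := by
    rw [Finset.prod_ite, Finset.prod_const_one, mul_one, Finset.prod_const]
    refine pow_le_pow_right₀ hA1 ?_
    refine (Finset.card_le_card (t := Finset.range P) fun p hp => ?_).trans
      (Finset.card_range P).le
    exact Finset.mem_range.2 (Finset.mem_filter.1 hp).2
  rw [Nat.card_divisors hn0, hfac]
  push_cast
  refine le_trans ?_ (mul_le_mul_of_nonneg_right hprod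
    (Finset.prod_nonneg fun p _ => by positivity))
  rw [← Finset.prod_mul_distrib]
  refine Finset.prod_le_prod (fun p _ => by positivity) fun p hp => ?_
  have hp2 : (2 : ℝ) ≤ p := by exact_mod_cast (Nat.prime_of_mem_primeFactors hp).two_le
  set e := n.factorization p
  have hpe : ((p : ℝ) ^ e) ^ ε = ((p : ℝ) ^ ε) ^ e := by
    rw [← Real.rpow_natCast, ← Real.rpow_natCast, ← Real.rpow_mul (by positivity),
      ← Real.rpow_mul (by positivity), mul_comm]
  rw [hpe]
  split_ifs with h
  · have h1 : 1 + e * (ε * Real.log 2) ≤ ((p : ℝ) ^ ε) ^ e := by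
      calc 1 + e * (ε * Real.log 2) ≤ (1 + ε * Real.log 2) ^ e :=
            one_add_mul_le_pow (by nlinarith [mul_pos hε hlog]) e
        _ ≤ ((p : ℝ) ^ ε) ^ e := by
            gcongr
            calc 1 + ε * Real.log 2 ≤ Real.exp (ε * Real.log 2) := by
                  linarith [Real.add_one_le_exp (ε * Real.log 2)]
              _ = (2 : ℝ) ^ ε := by rw [Real.rpow_def_of_pos two_pos, mul_comm]
              _ ≤ (p : ℝ) ^ ε := by gcongr
    have h2 : (e : ℝ) + 1 ≤ A * (1 + e * (ε * Real.log 2)) := by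
      have h3 : A * (1 + e * (ε * Real.log 2)) =
          e + 1 + (1 / (ε * Real.log 2) + e * (ε * Real.log 2)) := by
        rw [hA]; field_simp; ring
      have : 0 ≤ 1 / (ε * Real.log 2) + e * (ε * Real.log 2) := by positivity
      linarith
    exact h2.trans (by gcongr)
  · have h1 : (2 : ℝ) ≤ (p : ℝ) ^ ε := by
      have h2 : (2 : ℝ) ^ (1 / ε) ≤ p := (Nat.le_ceil _).trans (by exact_mod_cast not_lt.1 h)
      calc (2 : ℝ) = ((2 : ℝ) ^ (1 / ε)) ^ ε := by
            rw [← Real.rpow_mul two_pos.le, one_div_mul_cancel hε.ne', Real.rpow_one]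
        _ ≤ (p : ℝ) ^ ε := by gcongr
    rw [one_mul]
    calc (e : ℝ) + 1 ≤ 2 ^ e := by exact_mod_cast Nat.lt_two_pow_self
      _ ≤ _ := by gcongr

theorem card_filter_dvd_mul_add_le {Z D : ℕ} {s b : ℤ} (hb : IsCoprime b (D : ℤ)) :
    ((Finset.Icc 1 Z).filter fun y : ℕ => (D : ℤ) ∣ s * y + b).card ≤ Z / D + 1 := by
  rw [← Finset.card_range (Z / D + 1)]
  refine Finset.card_le_card_of_injOn (fun y => y / D) (fun y hy => ?_) fun y hy y' hy' h => ?_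
  · rw [Finset.mem_coe, Finset.mem_filter, Finset.mem_Icc] at hy
    exact Finset.mem_coe.2 (Finset.mem_range.2 (Nat.lt_succ_of_le (Nat.div_le_div_right hy.1.2)))
  · rw [Finset.mem_coe, Finset.mem_filter] at hy hy'
    have hs : IsCoprime s (D : ℤ) := by
      obtain ⟨t, ht⟩ := hy.2
      have h1 : IsCoprime (s * y) (D : ℤ) := by
        rw [(by linarith : s * y = -b + D * t)]
        exact (IsCoprime.add_mul_left_left hb.neg_left t)
      exact h1.of_mul_left_left
    have h1 : (D : ℤ) ∣ s * ((y : ℤ) - y') := by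
      have := dvd_sub hy.2 hy'.2
      rwa [(by ring : s * y + b - (s * y' + b) = s * ((y : ℤ) - y'))] at this
    have h2 := hs.symm.dvd_of_dvd_mul_left h1
    have h3 : y % D = y' % D := ((Nat.modEq_iff_dvd.2 h2 : y' ≡ y [MOD D])).symm
    rw [← Nat.div_add_mod y D, ← Nat.div_add_mod y' D, h3]
    simp only at h
    rw [h]

theorem card_pairs_filter_dvd_le {L H g d D W : ℕ} (hg : 0 < g) (hd : 0 < d) (hD : 0 < D)
    {s b : ℤ} (hb : IsCoprime b (D : ℤ))
    (hW : ∀ x, 0 < x → x ≤ L * H → x.divisors.card ≤ W) :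
    (((Finset.Icc 1 L ×ˢ Finset.Icc 1 H).filter fun p : ℕ × ℕ =>
      g ∣ p.1 ∧ d ∣ p.2 ∧ (D : ℤ) ∣ s * (p.1 * p.2) + b).card : ℝ) ≤
      W * (L * H / (g * d * D) + 1) := by
  have hgd : 0 < g * d := Nat.mul_pos hg hd
  set Z := L * H / (g * d) with hZ
  have h1 := Finset.card_le_mul_card_image_of_maps_to
    (s := (Finset.Icc 1 L ×ˢ Finset.Icc 1 H).filter fun p : ℕ × ℕ =>
      g ∣ p.1 ∧ d ∣ p.2 ∧ (D : ℤ) ∣ s * (p.1 * p.2) + b)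
    (t := (Finset.Icc 1 Z).filter fun y : ℕ => (D : ℤ) ∣ (s * (g * d)) * y + b)
    (f := fun p => p.1 * p.2 / (g * d)) (fun p hp => by
      simp only [Finset.mem_filter, Finset.mem_product, Finset.mem_Icc] at hp ⊢
      obtain ⟨⟨⟨h1, h2⟩, h3, h4⟩, h5, h6, h7⟩ := hp
      have h8 : g * d ∣ p.1 * p.2 := mul_dvd_mul h5 h6
      refine ⟨⟨?_, Nat.div_le_div_right (Nat.mul_le_mul h2 h4)⟩, ?_⟩
      · exact Nat.div_pos (Nat.le_of_dvd (Nat.mul_pos h1 h3) h8) hgd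
      · rw [mul_assoc]
        have h9 : ((g : ℤ) * d) * ((p.1 * p.2 / (g * d) : ℕ) : ℤ) = p.1 * p.2 := by
          exact_mod_cast Nat.mul_div_cancel' h8
        rwa [h9]) W (fun y hy => by
      simp only [Finset.mem_filter, Finset.mem_Icc] at hy
      have hy1 : 0 < g * d * y := Nat.mul_pos hgd hy.1.1
      have hy2 : g * d * y ≤ L * H := by
        have := (Nat.le_div_iff_mul_le hgd).1 hy.1.2
        linarith
      refine le_trans ?_ (hW _ hy1 hy2)
      have hmul : ∀ p ∈ (((Finset.Icc 1 L ×ˢ Finset.Icc 1 H).filter fun p : ℕ × ℕ =>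
          g ∣ p.1 ∧ d ∣ p.2 ∧ (D : ℤ) ∣ s * (p.1 * p.2) + b).filter fun p =>
          p.1 * p.2 / (g * d) = y : Finset (ℕ × ℕ)), 0 < p.1 ∧ p.1 * p.2 = g * d * y := by
        intro p hp
        simp only [Finset.mem_filter, Finset.mem_product, Finset.mem_Icc] at hp
        refine ⟨hp.1.1.1.1, ?_⟩
        rw [← hp.2, Nat.mul_div_cancel' (mul_dvd_mul hp.1.2.1 hp.1.2.2.1)]
      refine Finset.card_le_card_of_injOn Prod.fst (fun p hp => ?_) fun p hp p' hp' h => ?_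
      · have := hmul p hp
        exact Finset.mem_coe.2 (Nat.mem_divisors.2 ⟨⟨_, this.2.symm⟩, hy1.ne'⟩)
      · have e1 := hmul p hp
        have e2 := hmul p' hp'
        refine Prod.ext h (Nat.eq_of_mul_eq_mul_left e1.1 ?_)
        rw [e1.2, h, e2.2])
  have h2 := card_filter_dvd_mul_add_le (Z := Z) (s := s * (g * d)) hb
  have h3 := h1.trans (Nat.mul_le_mul_left W h2)
  refine (Nat.cast_le (α := ℝ).2 h3).trans ?_
  push_cast
  gcongr
  refine Nat.cast_div_le.trans ?_
  rw [← div_div]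
  gcongr
  refine Nat.cast_div_le.trans ?_
  push_cast
  exact le_rfl

theorem gcd_mul_min_mul_le {q₀ r g d D L H : ℝ} (hg : 1 ≤ g) (hd : 0 < d) (hD : 0 < D)
    (hr : 0 ≤ r) (hL : 0 ≤ L) (hH : 0 ≤ H) (hdle : d ≤ q₀ * g) :
    d * min (√(r / g) * D) (r / g) * (L * H / (g * d * D) + 1) ≤ √r * L * H + q₀ * r := by
  have hg0 : 0 < g := by linarith
  rw [mul_add, mul_one]
  refine add_le_add ?_ ?_
  · calc d * min (√(r / g) * D) (r / g) * (L * H / (g * d * D)) ≤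
        d * (√(r / g) * D) * (L * H / (g * d * D)) :=
          mul_le_mul_of_nonneg_right (mul_le_mul_of_nonneg_left (min_le_left _ _) hd.le)
            (by positivity)
      _ = √(r / g) * (L * H) / g := by field_simp
      _ ≤ √(r / g) * (L * H) := div_le_self (by positivity) hg
      _ ≤ √r * (L * H) := by gcongr; exact div_le_self hr hg
      _ = √r * L * H := by ring
  · calc d * min (√(r / g) * D) (r / g) ≤ (q₀ * g) * (r / g) :=
          mul_le_mul hdle (min_le_right _ _) (by positivity) (hd.le.trans hdle)
      _ = q₀ * r := by field_simp

theorem sum_norm_correlationSum_le {q q₀ r : ℕ} [NeZero q] (hq : Odd q) (hqr : q₀ * r = q)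
    {χ : DirichletCharacter ℂ q} (hχ : IsLocallyPrimitive χ)
    {ψ : AddChar (ZMod q) ℂ} (hψ : ψ.IsPrimitive) {L H W : ℕ}
    (hW : ∀ x, 0 < x → x ≤ L * H → x.divisors.card ≤ W) {σ : ℤ} (hσ : IsUnit σ) :
    ∑ p ∈ Finset.Icc 1 L ×ˢ Finset.Icc 1 H,
      ‖correlationSum χ ψ ((q₀ * p.1 : ℤ) : ZMod q) ((σ * p.2 : ℤ) : ZMod q)‖ ≤
      (q.divisors.card : ℝ) ^ 4 * W * (√r * L * H + q) := by
  obtain ⟨c, hcu, hc⟩ := exists_norm_correlationSum_le hq hχ hψ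
  have hqpos : 0 < q := NeZero.pos q
  have hq₀ : 0 < q₀ := Nat.pos_of_ne_zero (by rintro rfl; omega)
  have hr : 0 < r := Nat.pos_of_ne_zero (by rintro rfl; omega)
  have hcop : IsCoprime (4 * c) (q : ℤ) := by
    refine IsCoprime.mul_left ?_ ?_
    · have : Nat.Coprime 4 q := (Nat.Coprime.pow_left 2 hq.coprime_two_left : Nat.Coprime (2 ^ 2) q)
      exact_mod_cast Nat.isCoprime_iff_coprime.2 this
    · exact ((ZMod.coe_int_isUnit_iff_isCoprime c q).1 hcu).symm
  set S := Finset.Icc 1 L ×ˢ Finset.Icc 1 H with hS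
  set Φ : ℕ × ℕ → ℕ × ℕ × ℕ := fun p => (Nat.gcd p.1 r, Nat.gcd p.2 (q₀ * Nat.gcd p.1 r),
    Int.gcd ((q₀ * p.1 : ℤ) * (σ * p.2) + 4 * c) q) with hΦ
  set V := q.divisors ×ˢ q.divisors ×ˢ q.divisors with hV
  have hgr : ∀ x, q₀ * Nat.gcd x r ∣ q := fun x => by
    rw [← hqr]; exact mul_dvd_mul_left _ (Nat.gcd_dvd_right _ _)
  have hmaps : ∀ p ∈ S, Φ p ∈ V := fun p _ => by
    simp only [hΦ, hV, Finset.mem_product, Nat.mem_divisors]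
    refine ⟨⟨(Dvd.intro_left q₀ rfl).trans (hgr p.1), hqpos.ne'⟩,
      ⟨(Nat.gcd_dvd_right _ _).trans (hgr p.1), hqpos.ne'⟩, ⟨?_, hqpos.ne'⟩⟩
    exact_mod_cast Int.gcd_dvd_right (a := (q₀ * p.1 : ℤ) * (σ * p.2) + 4 * c) (b := (q : ℤ))
  have hpt : ∀ p ∈ S, ‖correlationSum χ ψ ((q₀ * p.1 : ℤ) : ZMod q) ((σ * p.2 : ℤ) : ZMod q)‖ ≤
      q.divisors.card * ((Φ p).2.1 * min (√(r / (Φ p).1) * (Φ p).2.2) (r / (Φ p).1)) := by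
    intro p _
    refine (hc (q₀ * p.1) (σ * p.2)).trans (le_of_eq ?_)
    have e1 : Int.gcd (q₀ * p.1 : ℤ) q = q₀ * Nat.gcd p.1 r := by
      rw [← hqr]
      push_cast
      rw [Int.gcd_mul_left, Int.natAbs_natCast, Int.gcd_natCast_natCast]
    have e2 : Int.gcd (σ * p.2 : ℤ) ((q₀ * Nat.gcd p.1 r : ℕ) : ℤ) =
        Nat.gcd p.2 (q₀ * Nat.gcd p.1 r) := by
      rw [Int.gcd_eq_natAbs, Int.natAbs_mul, Int.isUnit_iff_natAbs_eq.1 hσ, one_mul,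
        Int.natAbs_natCast, Int.natAbs_natCast]
    have e3 : (q : ℝ) / ((q₀ * Nat.gcd p.1 r : ℕ) : ℝ) = r / (Nat.gcd p.1 r : ℕ) := by
      rw [← hqr]
      push_cast
      have : (q₀ : ℝ) ≠ 0 := by positivity
      rw [mul_div_mul_left _ _ this]
    rw [e1, e2, e3, mul_assoc]
  rw [← Finset.sum_fiberwise_of_maps_to hmaps]
  have hfib : ∀ y ∈ V, ∑ p ∈ S with Φ p = y,
      ‖correlationSum χ ψ ((q₀ * p.1 : ℤ) : ZMod q) ((σ * p.2 : ℤ) : ZMod q)‖ ≤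
      q.divisors.card * W * (√r * L * H + q) := by
    rintro ⟨g, d, D⟩ hy
    simp only [hV, Finset.mem_product] at hy
    have hg := Nat.pos_of_mem_divisors hy.1
    have hd := Nat.pos_of_mem_divisors hy.2.1
    have hD := Nat.pos_of_mem_divisors hy.2.2
    rcases (S.filter fun p => Φ p = (g, d, D)).eq_empty_or_nonempty with he | ⟨p₀, hp₀⟩
    · rw [he, Finset.sum_empty]
      positivity
    have hdle : d ≤ q₀ * g := by
      have h1 := (Finset.mem_filter.1 hp₀).2
      simp only [hΦ, Prod.mk.injEq] at h1
      rw [← h1.1, ← h1.2.1]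
      exact Nat.le_of_dvd (Nat.mul_pos hq₀ (h1.1 ▸ hg)) (Nat.gcd_dvd_right _ _)
    have hcard : ((S.filter fun p => Φ p = (g, d, D)).card : ℝ) ≤
        W * (L * H / (g * d * D) + 1) := by
      refine le_trans ?_ (card_pairs_filter_dvd_le hg hd hD (s := q₀ * σ) (b := 4 * c) ?_ hW)
      · refine Nat.cast_le.2 (Finset.card_le_card fun p hp => ?_)
        rw [Finset.mem_filter] at hp ⊢
        have h1 := hp.2
        simp only [hΦ, Prod.mk.injEq] at h1
        refine ⟨hp.1, h1.1 ▸ Nat.gcd_dvd_left _ _, h1.2.1 ▸ Nat.gcd_dvd_left _ _, ?_⟩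
        rw [← h1.2.2, (by ring : (q₀ * σ : ℤ) * (p.1 * p.2) + 4 * c =
          (q₀ * p.1 : ℤ) * (σ * p.2) + 4 * c)]
        exact Int.gcd_dvd_left _ _
      · exact hcop.of_isCoprime_of_dvd_right
          (Int.natCast_dvd_natCast.2 (Nat.dvd_of_mem_divisors hy.2.2))
    calc _ ≤ ∑ p ∈ S with Φ p = (g, d, D),
          (q.divisors.card : ℝ) * (d * min (√(r / g) * D) (r / g)) := by
          refine Finset.sum_le_sum fun p hp => ?_
          rw [Finset.mem_filter] at hp
          have := hpt p hp.1
          rwa [hp.2] at this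
      _ = (S.filter fun p => Φ p = (g, d, D)).card *
          (q.divisors.card * (d * min (√(r / g) * D) (r / g))) := by
          rw [Finset.sum_const, nsmul_eq_mul]
      _ ≤ (W * (L * H / (g * d * D) + 1)) *
          (q.divisors.card * (d * min (√(r / g) * D) (r / g))) := by gcongr
      _ = q.divisors.card * W *
          (d * min (√(r / g) * D) (r / g) * (L * H / (g * d * D) + 1)) := by ring
      _ ≤ q.divisors.card * W * (√r * L * H + q₀ * r) := by
          gcongr
          exact gcd_mul_min_mul_le (by exact_mod_cast hg) (by positivity) (by positivity)
            (by positivity) (by positivity) (by positivity) (by exact_mod_cast hdle)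
      _ = _ := by rw [← hqr]; push_cast; ring
  refine (Finset.sum_le_sum hfib).trans (le_of_eq ?_)
  rw [Finset.sum_const, hV, Finset.card_product, Finset.card_product, nsmul_eq_mul]
  push_cast
  ring

theorem sum_zmod_eq_of_odd {M : Type*} [AddCommMonoid M] {q : ℕ} [NeZero q] (hq : Odd q)
    (F : ZMod q → M) : ∑ x, F x = F 0 + ∑ k ∈ Finset.Icc 1 (q / 2),
      (F ((k : ℤ) : ZMod q) + F ((-(k : ℤ) : ℤ) : ZMod q)) := by
  obtain ⟨m, hm⟩ := hq
  have h1 : ∑ x, F x = ∑ k ∈ Finset.range q, F (k : ZMod q) := by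
    refine (Finset.sum_bij (fun (k : ℕ) _ => (k : ZMod q)) (fun _ _ => Finset.mem_univ _)
      (fun k hk k' hk' h => ?_) (fun x _ => ⟨x.val, Finset.mem_range.2 x.val_lt, by simp⟩)
      (fun _ _ => rfl)).symm
    rw [ZMod.natCast_eq_natCast_iff] at h
    exact Nat.ModEq.eq_of_lt_of_lt h (Finset.mem_range.1 hk) (Finset.mem_range.1 hk')
  have h2 : q / 2 = m := by omega
  have h3 : ∑ k ∈ Finset.Ico (m + 1) q, F (k : ZMod q) =
      ∑ k ∈ Finset.Icc 1 m, F ((-(k : ℤ) : ℤ) : ZMod q) := by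
    refine Finset.sum_bij (fun (k : ℕ) _ => q - k) (fun k hk => ?_) (fun k hk k' hk' h => ?_)
      (fun k hk => ⟨q - k, ?_, ?_⟩) (fun k hk => ?_)
    · have := Finset.mem_Ico.1 hk
      exact Finset.mem_Icc.2 ⟨by omega, by omega⟩
    · have := Finset.mem_Ico.1 hk
      have := Finset.mem_Ico.1 hk'
      omega
    · have := Finset.mem_Icc.1 hk
      exact Finset.mem_Ico.2 ⟨by omega, by omega⟩
    · have := Finset.mem_Icc.1 hk
      omega
    · have := Finset.mem_Ico.1 hk
      congr 1
      push_cast [Nat.cast_sub this.2.le]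
      simp
  rw [h1, h2, Finset.range_eq_Ico, ← Finset.sum_Ico_consecutive _ (Nat.zero_le (m + 1))
    (by omega : m + 1 ≤ q), h3, Finset.sum_eq_sum_Ico_succ_bot (Nat.succ_pos m), Nat.cast_zero,
    Finset.sum_add_distrib, add_assoc]
  congr 2
  simp only [Int.cast_natCast]
  rfl

theorem character_mul_inv_eq_sum_correlationSum {q : ℕ} [NeZero q] (χ : DirichletCharacter ℂ q)
    {ψ : AddChar (ZMod q) ℂ} (hψ : ψ.IsPrimitive) (a n : ZMod q) :
    χ (n + a) * χ⁻¹ n = (q : ℂ)⁻¹ * ∑ h, correlationSum χ ψ a h * ψ (-(h * n)) := by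
  have h1 : ∑ h, correlationSum χ ψ a h * ψ (-(h * n)) =
      ∑ m, χ (m + a) * χ⁻¹ m * ∑ h, ψ ((m - n) * h) := by
    simp only [correlationSum, Finset.sum_mul, Finset.mul_sum]
    rw [Finset.sum_comm]
    refine Finset.sum_congr rfl fun m _ => Finset.sum_congr rfl fun h _ => ?_
    rw [mul_assoc, ← AddChar.map_add_eq_mul]
    ring_nf
  have h2 : (q : ℂ) ≠ 0 := by exact_mod_cast NeZero.ne q
  rw [h1, Finset.sum_eq_single n]
  · rw [sum_addChar_mul hψ, sub_self, if_pos rfl]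
    field_simp
  · intro m _ hm
    rw [sum_addChar_mul hψ, if_neg (sub_ne_zero.2 hm), mul_zero]
  · simp

theorem stdAddChar_neg_intCast_mul {q : ℕ} [NeZero q] (h : ℤ) (n : ℕ) :
    ZMod.stdAddChar (-((h : ZMod q) * (n : ZMod q))) = expTwoPi ((-h : ℤ) / q * n) := by
  have h1 : -((h : ZMod q) * (n : ZMod q)) = ((-h * n : ℤ) : ZMod q) := by push_cast; ring
  rw [h1, ZMod.stdAddChar_coe, expTwoPi]
  congr 1
  push_cast
  ring

/-- The correlation of `χ` with its translate, twisted by `(n / (n + a)) ^ (i t)` where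
`c = t / (2 π)`. -/
noncomputable def twistedCorrelation {q : ℕ} (χ : DirichletCharacter ℂ q) (c : ℝ) (a n : ℕ) : ℂ :=
  χ ((n : ZMod q) + a) * χ⁻¹ (n : ZMod q) * expTwoPi (-(c * Real.log (1 + a / n)))

theorem norm_sum_twistedCorrelation_le {q : ℕ} [NeZero q] (hq : Odd q)
    (χ : DirichletCharacter ℂ q) (c : ℝ) (a u v : ℕ) :
    ‖∑ n ∈ Finset.Ico u v, twistedCorrelation χ c a n‖ ≤
      (q : ℝ)⁻¹ * (‖correlationSum χ ZMod.stdAddChar (a : ZMod q) 0‖ *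
        ‖∑ n ∈ Finset.Ico u v, expTwoPi (logPhase c 0 a n)‖ +
      ∑ k ∈ Finset.Icc 1 (q / 2),
        (‖correlationSum χ ZMod.stdAddChar (a : ZMod q) ((k : ℤ) : ZMod q)‖ *
          ‖∑ n ∈ Finset.Ico u v, expTwoPi (logPhase c ((-(k : ℤ) : ℤ) / q) a n)‖ +
        ‖correlationSum χ ZMod.stdAddChar (a : ZMod q) ((-(k : ℤ) : ℤ) : ZMod q)‖ *
          ‖∑ n ∈ Finset.Ico u v, expTwoPi (logPhase c ((k : ℤ) / q) a n)‖)) := by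
  have hψ : (ZMod.stdAddChar (N := q)).IsPrimitive := ZMod.isPrimitive_stdAddChar q
  have h1 : ∑ n ∈ Finset.Ico u v, twistedCorrelation χ c a n =
      (q : ℂ)⁻¹ * ∑ h : ZMod q, correlationSum χ ZMod.stdAddChar (a : ZMod q) h *
        ∑ n ∈ Finset.Ico u v, ZMod.stdAddChar (-(h * (n : ZMod q))) *
          expTwoPi (-(c * Real.log (1 + a / n))) := by
    simp only [twistedCorrelation, character_mul_inv_eq_sum_correlationSum χ hψ, Finset.mul_sum,
      Finset.sum_mul]
    rw [Finset.sum_comm]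
    refine Finset.sum_congr rfl fun h _ => Finset.sum_congr rfl fun n _ => by ring
  have h2 : ∀ h : ℤ, ∑ n ∈ Finset.Ico u v, ZMod.stdAddChar (-((h : ZMod q) * (n : ZMod q))) *
      expTwoPi (-(c * Real.log (1 + a / n))) =
      ∑ n ∈ Finset.Ico u v, expTwoPi (logPhase c ((-h : ℤ) / q) a n) := by
    intro h
    refine Finset.sum_congr rfl fun n _ => ?_
    rw [stdAddChar_neg_intCast_mul, ← expTwoPi_add, logPhase, sub_eq_add_neg]
  have h3 := h2 0
  rw [neg_zero, Int.cast_zero, Int.cast_zero, zero_div] at h3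
  rw [h1, sum_zmod_eq_of_odd hq, norm_mul, norm_inv, Complex.norm_natCast, h3]
  refine mul_le_mul_of_nonneg_left ((norm_add_le _ _).trans ?_) (by positivity)
  rw [norm_mul]
  refine add_le_add le_rfl ((norm_sum_le _ _).trans (Finset.sum_le_sum fun k _ => ?_))
  rw [h2, h2, neg_neg]
  refine (norm_add_le _ _).trans (le_of_eq ?_)
  rw [norm_mul, norm_mul]

section Weights

variable {c : ℝ} {q₀ N L l u v : ℕ}

theorem norm_sum_logPhase_zero_le_of_le (hc : 0 < c) (hq₀ : 0 < q₀) (hl : 0 < l) (hlL : l ≤ L)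
    (hN : 0 < N) (hu : N ≤ u) (hv : v + q₀ * l ≤ 2 * N) :
    ‖∑ n ∈ Finset.Ico u v, expTwoPi (logPhase c 0 (q₀ * l) n)‖ ≤
      L / l * (8 / (c * (q₀ * L) / N ^ 2) + 90 * √(N * (c * (q₀ * L) / N ^ 2))) := by
  have hN0 : (0 : ℝ) < N := by exact_mod_cast hN
  have hl0 : (0 : ℝ) < l := by exact_mod_cast hl
  have hq0 : (0 : ℝ) < q₀ := by exact_mod_cast hq₀
  have hlL' : (l : ℝ) ≤ L := by exact_mod_cast hlL
  have hL0 : (0 : ℝ) < L := hl0.trans_le hlL'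
  have hLl : 1 ≤ (L : ℝ) / l := (one_le_div hl0).2 hlL'
  set M : ℝ := c * (q₀ * L) / N ^ 2 with hM
  have hM0 : 0 < M := by positivity
  rw [mul_add]
  have ha : 0 < q₀ * l := Nat.mul_pos hq₀ hl
  have hμ : c * ((q₀ * l : ℕ) : ℝ) / N ^ 2 = M / (L / l) := by
    rw [hM]; push_cast; field_simp
  rcases le_or_gt (c * ((q₀ * l : ℕ) : ℝ) / N ^ 2) (1 / 2) with h | h
  · have h1 := norm_sum_logPhase_zero_le hc ha hN hu hv h
    rw [hμ] at h1
    have h2 : 8 / (M / (L / l)) = L / l * (8 / M) := by field_simp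
    have h3 : 0 ≤ L / l * (90 * √(N * M)) := by positivity
    linarith
  · have h1 := norm_sum_logPhase_le (x := 0) hc ha hN hu hv
    set μ : ℝ := c * ((q₀ * l : ℕ) : ℝ) / N ^ 2 with hμ'
    have hμ0 : 0 < μ := by linarith
    have hμM : μ ≤ M := by rw [hμ]; exact div_le_self hM0.le hLl
    have h2 : 18 * (μ + 2) * √(N / μ) ≤ 90 * √(N * M) := by
      have h3 : √((N : ℝ) / μ) = √(N * μ) / μ := by
        rw [Real.sqrt_div' _ hμ0.le, Real.sqrt_mul' _ hμ0.le]
        have := Real.sq_sqrt hμ0.le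
        have h4 : √μ ≠ 0 := (Real.sqrt_pos.2 hμ0).ne'
        field_simp
        rw [this]
      rw [h3, ← mul_div_assoc, div_le_iff₀ hμ0]
      calc 18 * (μ + 2) * √(N * μ) ≤ 90 * μ * √(N * M) := by gcongr ?_ * ?_; linarith; gcongr
        _ = _ := by ring
    have h3 : 90 * √(N * M) ≤ L / l * (90 * √(N * M)) := le_mul_of_one_le_left (by positivity) hLl
    have h4 : 0 ≤ L / l * (8 / M) := by positivity
    linarith

theorem norm_sum_logPhase_div_le {q : ℕ} {h : ℤ} (hc : 0 < c) (hq₀ : 0 < q₀) (hl : 0 < l)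
    (hlL : l ≤ L) (hN : 0 < N) (hu : N ≤ u) (hv : v + q₀ * l ≤ 2 * N) (hq : 0 < q) (hh : h ≠ 0)
    (hhq : 2 * |h| ≤ q) :
    ‖∑ n ∈ Finset.Ico u v, expTwoPi (logPhase c (h / q) (q₀ * l) n)‖ ≤
      min (N : ℝ) ((4 + 270 * √(N * (c * (q₀ * L) / N ^ 2))) * (q / |(h : ℝ)|)) := by
  refine le_min (norm_sum_logPhase_le_card hu (by omega)) ?_
  have hN0 : (0 : ℝ) < N := by exact_mod_cast hN
  have hl0 : (0 : ℝ) < l := by exact_mod_cast hl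
  have hq0 : (0 : ℝ) < q₀ := by exact_mod_cast hq₀
  have hlL' : (l : ℝ) ≤ L := by exact_mod_cast hlL
  have hL0 : (0 : ℝ) < L := hl0.trans_le hlL'
  have hqpos : (0 : ℝ) < q := by exact_mod_cast hq
  have hh0 : 0 < |(h : ℝ)| := abs_pos.2 (by exact_mod_cast hh)
  have hhq' : 2 * |(h : ℝ)| ≤ q := by exact_mod_cast hhq
  set M : ℝ := c * (q₀ * L) / N ^ 2 with hM
  have hM0 : 0 < M := by positivity
  have ha : 0 < q₀ * l := Nat.mul_pos hq₀ hl
  set y : ℝ := q / |(h : ℝ)| with hy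
  have hy1 : 1 ≤ y := (one_le_div hh0).2 (by linarith)
  rw [add_mul]
  rcases le_or_gt (c * ((q₀ * l : ℕ) : ℝ) / N ^ 2) (|(h : ℝ)| / (4 * q)) with h1 | h1
  · have h2 := norm_sum_logPhase_le_of_small hc ha hN hu hv hq hh hhq h1
    have h3 : 0 ≤ 270 * √(N * M) * y := by positivity
    linarith
  · have h2 := norm_sum_logPhase_le (x := h / q) hc ha hN hu hv
    have hμM : c * ((q₀ * l : ℕ) : ℝ) / N ^ 2 ≤ M := by
      rw [hM]; push_cast; gcongr
    set μ : ℝ := c * ((q₀ * l : ℕ) : ℝ) / N ^ 2 with hμ'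
    have hμ0 : 0 < μ := by positivity
    have hyμ : 1 ≤ 4 * y * μ := by
      have e1 : |(h : ℝ)| / (4 * q) = 1 / (4 * y) := by rw [hy]; field_simp
      rw [e1, div_lt_iff₀ (by positivity)] at h1
      linarith
    have h3 : √((N : ℝ) / μ) * μ = √(N * μ) := by
      rw [Real.sqrt_div' _ hμ0.le, Real.sqrt_mul' _ hμ0.le]
      have := Real.sq_sqrt hμ0.le
      have h4 : √μ ≠ 0 := (Real.sqrt_pos.2 hμ0).ne'
      field_simp
      rw [this]
    have h5 : (μ + 2) ≤ 12 * (y * μ) := by nlinarith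
    have h4 : 18 * (μ + 2) * √(N / μ) ≤ 270 * √(N * M) * y := by
      calc 18 * (μ + 2) * √(N / μ) ≤ 18 * (12 * (y * μ)) * √(N / μ) := by gcongr
        _ = 216 * y * (√(N / μ) * μ) := by ring
        _ = 216 * y * √(N * μ) := by rw [h3]
        _ ≤ 270 * y * √(N * M) := by gcongr; norm_num
        _ = _ := by ring
    have h6 : 0 ≤ 4 * y := by positivity
    linarith

end Weights

theorem sum_gcd_div_le {L r : ℕ} (hr : 0 < r) :
    ∑ l ∈ Finset.Icc 1 L, (Nat.gcd l r : ℝ) / l ≤ r.divisors.card * (1 + Real.log L) := by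
  have h1 : ∀ l ∈ Finset.Icc 1 L, (Nat.gcd l r : ℝ) / l ≤
      ∑ g ∈ r.divisors, if g ∣ l then (g : ℝ) / l else 0 := by
    intro l _
    refine (le_of_eq ?_).trans (Finset.single_le_sum
      (f := fun g : ℕ => if g ∣ l then (g : ℝ) / l else 0) (fun g _ => by positivity)
      (Nat.mem_divisors.2 ⟨Nat.gcd_dvd_right l r, hr.ne'⟩))
    rw [if_pos (Nat.gcd_dvd_left l r)]
  refine (Finset.sum_le_sum h1).trans ?_
  rw [Finset.sum_comm, ← nsmul_eq_mul]
  refine Finset.sum_le_card_nsmul _ _ _ fun g hg => ?_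
  have hg0 : 0 < g := Nat.pos_of_mem_divisors hg
  have h2 : (harmonic L : ℝ) = ∑ m ∈ Finset.Icc 1 L, (1 : ℝ) / m := by
    rw [harmonic_eq_sum_Icc]
    push_cast
    simp
  refine le_trans ?_ (harmonic_le_one_add_log L)
  rw [h2, ← Finset.sum_filter]
  refine (le_of_eq ?_).trans (Finset.sum_le_sum_of_subset_of_nonneg
    (Finset.Icc_subset_Icc_right (Nat.div_le_self L g)) fun m _ _ => by positivity)
  symm
  refine Finset.sum_bij (fun m _ => g * m) (fun m hm => ?_) (fun m _ m' _ h => ?_)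
    (fun l hl => ?_) (fun m hm => ?_)
  · obtain ⟨h3, h4⟩ := Finset.mem_Icc.1 hm
    refine Finset.mem_filter.2 ⟨Finset.mem_Icc.2 ⟨Nat.mul_pos hg0 h3, ?_⟩, dvd_mul_right _ _⟩
    rw [mul_comm]
    exact (Nat.le_div_iff_mul_le hg0).1 h4
  · exact Nat.eq_of_mul_eq_mul_left hg0 h
  · obtain ⟨h3, m, rfl⟩ := Finset.mem_filter.1 hl
    obtain ⟨h4, h5⟩ := Finset.mem_Icc.1 h3
    refine ⟨m, Finset.mem_Icc.2 ⟨Nat.pos_of_mul_pos_left h4, ?_⟩, rfl⟩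
    rw [Nat.le_div_iff_mul_le hg0, mul_comm]
    exact h5
  · have h3 : (0 : ℝ) < g := by exact_mod_cast hg0
    have h4 : (0 : ℝ) < m := by exact_mod_cast (Finset.mem_Icc.1 hm).1
    push_cast
    field_simp

theorem sum_mul_min_div_le_of_dyadic {M : ℕ} {f : ℕ → ℝ} (hf : ∀ k, 0 ≤ f k) {N A P Q : ℝ}
    (hN : 0 ≤ N) (hA : 0 ≤ A) (hP : 0 ≤ P) (hQ : 0 ≤ Q)
    (h : ∀ H : ℕ, H ≤ 2 * M → ∑ k ∈ Finset.Icc 1 H, f k ≤ P * H + Q) :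
    ∑ k ∈ Finset.Icc 1 M, f k * min N (A / k) ≤ (Nat.log 2 M + 1) * (2 * A * P + N * Q) := by
  rw [← Finset.sum_fiberwise_of_maps_to (g := Nat.log 2) (t := Finset.range (Nat.log 2 M + 1))
    (fun k hk => Finset.mem_range.2
      (Nat.lt_succ_of_le (Nat.log_mono_right (Finset.mem_Icc.1 hk).2)))]
  have h1 : ∀ j ∈ Finset.range (Nat.log 2 M + 1),
      ∑ k ∈ (Finset.Icc 1 M).filter (fun k => Nat.log 2 k = j), f k * min N (A / k) ≤
        2 * A * P + N * Q := by
    intro j hj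
    have hj' : j ≤ Nat.log 2 M := Nat.lt_succ_iff.1 (Finset.mem_range.1 hj)
    rcases Nat.eq_zero_or_pos M with rfl | hM
    · simp only [Finset.Icc_eq_empty (by norm_num : ¬ (1 ≤ 0)), Finset.filter_empty,
        Finset.sum_empty]
      positivity
    have h2j : 2 ^ j ≤ M := Nat.pow_le_of_le_log hM.ne' hj'
    have h2 := h (2 ^ (j + 1)) (by rw [pow_succ]; omega)
    have h2jp : (0 : ℝ) < 2 ^ j := by positivity
    calc ∑ k ∈ (Finset.Icc 1 M).filter (fun k => Nat.log 2 k = j), f k * min N (A / k)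
        ≤ ∑ k ∈ (Finset.Icc 1 M).filter (fun k => Nat.log 2 k = j), f k * min N (A / 2 ^ j) := by
          refine Finset.sum_le_sum fun k hk => mul_le_mul_of_nonneg_left ?_ (hf k)
          obtain ⟨h3, h4⟩ := Finset.mem_filter.1 hk
          have h5 : 2 ^ j ≤ k := by
            rw [← h4]; exact Nat.pow_log_le_self 2 (by have := (Finset.mem_Icc.1 h3).1; omega)
          have h6 : (2 : ℝ) ^ j ≤ k := by exact_mod_cast h5
          exact min_le_min_left _ (div_le_div_of_nonneg_left hA h2jp h6)
      _ ≤ ∑ k ∈ Finset.Icc 1 (2 ^ (j + 1)), f k * min N (A / 2 ^ j) := by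
          refine Finset.sum_le_sum_of_subset_of_nonneg (fun k hk => ?_) fun k _ _ =>
            mul_nonneg (hf k) (le_min hN (by positivity))
          obtain ⟨h3, h4⟩ := Finset.mem_filter.1 hk
          refine Finset.mem_Icc.2 ⟨(Finset.mem_Icc.1 h3).1, ?_⟩
          rw [← h4]
          exact (Nat.lt_pow_succ_log_self (by norm_num) k).le
      _ ≤ (P * (2 ^ (j + 1) : ℕ) + Q) * min N (A / 2 ^ j) := by
          rw [← Finset.sum_mul]
          exact mul_le_mul_of_nonneg_right h2 (le_min hN (by positivity))
      _ = P * (2 ^ (j + 1) : ℕ) * min N (A / 2 ^ j) + Q * min N (A / 2 ^ j) := by ring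
      _ ≤ P * (2 ^ (j + 1) : ℕ) * (A / 2 ^ j) + Q * N := by
          refine add_le_add (mul_le_mul_of_nonneg_left (min_le_right _ _) (by positivity))
            (mul_le_mul_of_nonneg_left (min_le_left _ _) hQ)
      _ = 2 * A * P + N * Q := by
          push_cast
          rw [pow_succ]
          field_simp
  refine (Finset.sum_le_card_nsmul _ _ _ h1).trans (le_of_eq ?_)
  rw [Finset.card_range, nsmul_eq_mul]
  push_cast
  ring

/-- A bound for the sums of `twistedCorrelation χ c (q₀ * l)` over subintervals of a dyadic
interval, in terms of complete correlation sums. -/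
noncomputable def twistedCorrelationBound {q : ℕ} [NeZero q] (χ : DirichletCharacter ℂ q)
    (c : ℝ) (q₀ r N L l : ℕ) : ℝ :=
  (q : ℝ)⁻¹ * (q₀ * Nat.gcd l r * (L / l *
      (8 / (c * (q₀ * L) / N ^ 2) + 90 * √(N * (c * (q₀ * L) / N ^ 2)))) +
    ∑ k ∈ Finset.Icc 1 (q / 2),
      (‖correlationSum χ ZMod.stdAddChar ((q₀ * l : ℤ) : ZMod q) ((1 * k : ℤ) : ZMod q)‖ +
        ‖correlationSum χ ZMod.stdAddChar ((q₀ * l : ℤ) : ZMod q) ((-1 * k : ℤ) : ZMod q)‖) *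
        min (N : ℝ) ((4 + 270 * √(N * (c * (q₀ * L) / N ^ 2))) * q / k))

theorem norm_sum_twistedCorrelation_le_bound {q q₀ r N L l u v : ℕ} [NeZero q] (hq : Odd q)
    (hqr : q₀ * r = q) {χ : DirichletCharacter ℂ q} (hχ : IsLocallyPrimitive χ) {c : ℝ} (hc : 0 < c)
    (hl : 0 < l)
    (hlL : l ≤ L) (hN : 0 < N) (hu : N ≤ u) (hv : v + q₀ * l ≤ 2 * N) :
    ‖∑ n ∈ Finset.Ico u v, twistedCorrelation χ c (q₀ * l) n‖ ≤
      twistedCorrelationBound χ c q₀ r N L l := by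
  have hq0 : 0 < q := NeZero.pos q
  have hq₀ : 0 < q₀ := Nat.pos_of_ne_zero (by rintro rfl; omega)
  have hcast : ((q₀ * l : ℕ) : ZMod q) = ((q₀ * l : ℤ) : ZMod q) := by push_cast; rfl
  refine (norm_sum_twistedCorrelation_le hq χ c (q₀ * l) u v).trans ?_
  rw [twistedCorrelationBound, hcast]
  refine mul_le_mul_of_nonneg_left (add_le_add ?_ (Finset.sum_le_sum fun k hk => ?_))
    (by positivity)
  · refine mul_le_mul ?_ (norm_sum_logPhase_zero_le_of_le hc hq₀ hl hlL hN hu hv)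
      (norm_nonneg _) (by positivity)
    refine (norm_correlationSum_zero_le hχ ZMod.stdAddChar (q₀ * l : ℤ)).trans (le_of_eq ?_)
    rw [← hqr]
    have : Int.gcd ((q₀ : ℤ) * l) ((q₀ * r : ℕ) : ℤ) = q₀ * Nat.gcd l r := by
      rw [← Nat.gcd_mul_left]
      exact_mod_cast Int.gcd_natCast_natCast (q₀ * l) (q₀ * r)
    rw [this]
    push_cast
    rfl
  · obtain ⟨h1, h2⟩ := Finset.mem_Icc.1 hk
    have hk0 : (k : ℤ) ≠ 0 := by omega
    have h3 := norm_sum_logPhase_div_le (h := k) hc hq₀ hl hlL hN hu hv hq0 hk0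
      (by rw [abs_of_nonneg (by positivity)]; omega)
    have h4 := norm_sum_logPhase_div_le (h := -k) hc hq₀ hl hlL hN hu hv hq0 (neg_ne_zero.2 hk0)
      (by rw [abs_neg, abs_of_nonneg (by positivity)]; omega)
    have e1 : |((k : ℤ) : ℝ)| = k := by simp
    have e2 : |((-k : ℤ) : ℝ)| = k := by simp
    rw [e1, ← mul_div_assoc] at h3
    rw [e2, ← mul_div_assoc] at h4
    rw [one_mul, neg_one_mul, add_mul]
    exact add_le_add (mul_le_mul_of_nonneg_left h4 (norm_nonneg _))
      (mul_le_mul_of_nonneg_left h3 (norm_nonneg _))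

theorem sum_twistedCorrelationBound_le {q q₀ r N L W : ℕ} [NeZero q] (hq : Odd q)
    (hqr : q₀ * r = q) {χ : DirichletCharacter ℂ q} (hχ : IsLocallyPrimitive χ) {c : ℝ}
    (hc : 0 < c) (hW : ∀ x, 0 < x → x ≤ L * q → x.divisors.card ≤ W) :
    ∑ l ∈ Finset.Icc 1 L, twistedCorrelationBound χ c q₀ r N L l ≤
      (q : ℝ)⁻¹ * (q₀ * L * (8 / (c * (q₀ * L) / N ^ 2) + 90 * √(N * (c * (q₀ * L) / N ^ 2))) *
        (r.divisors.card * (1 + Real.log L)) +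
      2 * ((Nat.log 2 q + 1) * ((q.divisors.card : ℝ) ^ 4 * W *
        (2 * √r * L * q * (4 + 270 * √(N * (c * (q₀ * L) / N ^ 2))) + q * N)))) := by
  have hq0 : 0 < q := NeZero.pos q
  have hr : 0 < r := Nat.pos_of_ne_zero (by rintro rfl; omega)
  set A : ℝ := 4 + 270 * √(N * (c * (q₀ * L) / N ^ 2)) with hA
  set P : ℝ := 8 / (c * (q₀ * L) / N ^ 2) + 90 * √(N * (c * (q₀ * L) / N ^ 2)) with hP
  have hA0 : 0 ≤ A := by positivity
  have hP0 : 0 ≤ P := by positivity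
  set κ : ℝ := (q.divisors.card : ℝ) ^ 4 * W with hκ
  have key : ∀ σ : ℤ, IsUnit σ → ∑ l ∈ Finset.Icc 1 L, ∑ k ∈ Finset.Icc 1 (q / 2),
      ‖correlationSum χ ZMod.stdAddChar ((q₀ * l : ℤ) : ZMod q) ((σ * k : ℤ) : ZMod q)‖ *
        min (N : ℝ) (A * q / k) ≤
      (Nat.log 2 q + 1) * (κ * (2 * √r * L * q * A + q * N)) := by
    intro σ hσ
    rw [Finset.sum_comm]
    simp only [← Finset.sum_mul]
    refine (sum_mul_min_div_le_of_dyadic (M := q / 2) (P := κ * (√r * L)) (Q := κ * q)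
      (fun k => Finset.sum_nonneg fun _ _ => norm_nonneg _) (by positivity) (by positivity)
      (by positivity) (by positivity) fun H hH => ?_).trans ?_
    · rw [Finset.sum_comm, ← Finset.sum_product']
      refine (sum_norm_correlationSum_le hq hqr hχ (ZMod.isPrimitive_stdAddChar q) (W := W)
        (fun x h1 h2 => hW x h1 (h2.trans (Nat.mul_le_mul_left L (by omega)))) hσ).trans
        (le_of_eq ?_)
      rw [hκ]; ring
    · have h1 : (Nat.log 2 (q / 2) : ℝ) ≤ Nat.log 2 q := by
        exact_mod_cast Nat.log_mono_right (Nat.div_le_self q 2)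
      have h2 : 2 * (A * q) * (κ * (√r * L)) + N * (κ * q) =
          κ * (2 * √r * L * q * A + q * N) := by ring
      rw [h2]
      exact mul_le_mul_of_nonneg_right (by linarith) (by positivity)
  simp only [twistedCorrelationBound, ← hA, ← hP]
  rw [← Finset.mul_sum]
  refine mul_le_mul_of_nonneg_left ?_ (by positivity)
  rw [Finset.sum_add_distrib]
  refine add_le_add ?_ ?_
  · have h1 : ∀ l ∈ Finset.Icc 1 L, (q₀ : ℝ) * Nat.gcd l r * (L / l * P) =
        q₀ * L * P * (Nat.gcd l r / l) := fun l _ => by ring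
    rw [Finset.sum_congr rfl h1, ← Finset.mul_sum]
    exact mul_le_mul_of_nonneg_left (sum_gcd_div_le hr) (by positivity)
  · simp only [add_mul, Finset.sum_add_distrib]
    have h1 := key 1 isUnit_one
    have h2 := key (-1) isUnit_one.neg
    linarith

theorem mul_sum_twistedCorrelationBound_le {q q₀ r N L W : ℕ} [NeZero q] (hq : Odd q)
    (hqr : q₀ * r = q) {χ : DirichletCharacter ℂ q} (hχ : IsLocallyPrimitive χ)
    (hW : ∀ x, 0 < x → x ≤ L * q → x.divisors.card ≤ W) {T T₀ Y : ℝ} (hT₀ : 1 ≤ T₀)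
    (hT : T₀ ≤ T) (hY : 1 ≤ Y) (hN : 0 < N) (hNY : N ≤ q * T * Y) (hLN : L * T₀ * q₀ ≤ N * Y) :
    T₀ * q₀ / N * ∑ l ∈ Finset.Icc 1 L,
        twistedCorrelationBound χ (T / (2 * Real.pi)) q₀ r N L l ≤
      1500 * Y ^ 2 * (r.divisors.card * (1 + Real.log L) +
        (Nat.log 2 q + 1) * ((q.divisors.card : ℝ) ^ 4 * W)) *
        ((T₀ + √(T / T₀)) * (q₀ + √r)) := by
  have hq0 : 0 < q := NeZero.pos q
  have hr : 0 < r := Nat.pos_of_ne_zero (by rintro rfl; omega)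
  have hq₀ : 0 < q₀ := Nat.pos_of_ne_zero (by rintro rfl; omega)
  rcases Nat.eq_zero_or_pos L with rfl | hL
  · rw [Finset.Icc_eq_empty (by norm_num), Finset.sum_empty, mul_zero, Nat.cast_zero,
      Real.log_zero]
    positivity
  have hT0 : 0 < T := by linarith
  have hT₀0 : 0 < T₀ := by linarith
  have hY0 : 0 < Y := by linarith
  have hπ := Real.pi_pos
  have hqR : (0 : ℝ) < q := by exact_mod_cast hq0
  have hq₀R : (1 : ℝ) ≤ q₀ := by exact_mod_cast hq₀
  have hq₀R' : (0 : ℝ) < q₀ := by linarith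
  have hNR : (0 : ℝ) < N := by exact_mod_cast hN
  have hLR : (1 : ℝ) ≤ L := by exact_mod_cast hL
  have hLR' : (0 : ℝ) < L := by linarith
  have hlog : 0 ≤ Real.log L := Real.log_nonneg hLR
  set s := √(T / T₀) with hs
  have hs0 : 0 ≤ s := Real.sqrt_nonneg _
  have hr0 : 0 ≤ √(r : ℝ) := Real.sqrt_nonneg _
  set R := (T₀ + s) * (q₀ + √r) with hR
  have hR1 : T₀ * q₀ ≤ R := by rw [hR]; gcongr <;> linarith
  have hR2 : √r ≤ R := by rw [hR]; nlinarith [mul_nonneg hs0 hr0]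
  have hR3 : s ≤ R := by rw [hR]; nlinarith [mul_nonneg hs0 hr0]
  have hR4 : √r * s ≤ R := by
    rw [hR]
    have : 0 ≤ T₀ * (q₀ + √r) + s * q₀ := by positivity
    nlinarith
  have hR0 : 0 ≤ R := by positivity
  set M : ℝ := T / (2 * Real.pi) * (q₀ * L) / N ^ 2 with hM
  have hM0 : 0 < M := by positivity
  have hS : √(N * M) ≤ Y * s := by
    rw [hs, ← Real.sqrt_sq hY0.le, ← Real.sqrt_mul (by positivity)]
    refine Real.sqrt_le_sqrt ?_
    have h1 : N * M = T / (2 * Real.pi * N * T₀) * (L * T₀ * q₀) := by rw [hM]; field_simp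
    have h2 : T / (2 * Real.pi * N * T₀) * (N * Y) = Y * (T / T₀) / (2 * Real.pi) := by
      field_simp
    rw [h1]
    refine (mul_le_mul_of_nonneg_left hLN (by positivity)).trans ?_
    rw [h2]
    refine (div_le_self (by positivity) (by linarith [Real.pi_gt_three])).trans ?_
    refine mul_le_mul_of_nonneg_right ?_ (by positivity)
    nlinarith
  set S := √(N * M) with hS'
  have hS0 : 0 ≤ S := Real.sqrt_nonneg _
  set D₁ : ℝ := r.divisors.card * (1 + Real.log L) with hD₁
  have hD₁0 : 0 ≤ D₁ := by positivity
  set κ : ℝ := (q.divisors.card : ℝ) ^ 4 * W with hκ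
  set D₂ : ℝ := (Nat.log 2 q + 1) * κ with hD₂
  have hD₂0 : 0 ≤ D₂ := by positivity
  have hYL : T₀ * q₀ / N * L ≤ Y := by
    rw [div_mul_eq_mul_div, div_le_iff₀ hNR]; linarith
  have hYY : Y ≤ Y ^ 2 := by nlinarith
  have hY1 : 1 ≤ Y ^ 2 := by linarith
  have hq₀q : (q₀ : ℝ) / q ≤ 1 := by
    rw [div_le_one hqR]
    exact_mod_cast Nat.le_of_dvd hq0 ⟨r, hqr.symm⟩
  have p1 : T₀ * q₀ / N * ((q : ℝ)⁻¹ * (q₀ * L * (8 / M))) ≤ 64 * Y ^ 2 * R := by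
    have h1 : T₀ * q₀ / N * ((q : ℝ)⁻¹ * (q₀ * L * (8 / M))) =
        16 * Real.pi * (T₀ * q₀) * (N / (q * T)) := by
      rw [hM]; field_simp; ring
    have h2 : N / (q * T) ≤ Y := by rw [div_le_iff₀ (by positivity)]; linarith
    rw [h1]
    calc 16 * Real.pi * (T₀ * q₀) * (N / (q * T)) ≤ 16 * 4 * R * Y ^ 2 := by
          gcongr
          · exact Real.pi_le_four
          · linarith
      _ = _ := by ring
  have p2 : T₀ * q₀ / N * ((q : ℝ)⁻¹ * (q₀ * L * (90 * S))) ≤ 90 * Y ^ 2 * R := by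
    calc T₀ * q₀ / N * ((q : ℝ)⁻¹ * (q₀ * L * (90 * S))) =
        90 * (T₀ * q₀ / N * L) * (q₀ / q) * S := by ring
      _ ≤ 90 * Y * 1 * (Y * s) := by gcongr
      _ = 90 * Y ^ 2 * s := by ring
      _ ≤ 90 * Y ^ 2 * R := by gcongr
  have p3 : T₀ * q₀ / N * ((q : ℝ)⁻¹ * (2 * √r * L * q * (4 + 270 * S))) ≤
      548 * Y ^ 2 * R := by
    calc T₀ * q₀ / N * ((q : ℝ)⁻¹ * (2 * √r * L * q * (4 + 270 * S))) =
        2 * (T₀ * q₀ / N * L) * √r * (4 + 270 * S) := by field_simp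
      _ ≤ 2 * Y * √r * (4 + 270 * (Y * s)) := by gcongr
      _ = 8 * Y * √r + 540 * Y ^ 2 * (√r * s) := by ring
      _ ≤ 8 * Y ^ 2 * R + 540 * Y ^ 2 * R := by gcongr
      _ = _ := by ring
  have p4 : T₀ * q₀ / N * ((q : ℝ)⁻¹ * (q * N)) ≤ Y ^ 2 * R := by
    have h1 : T₀ * q₀ / N * ((q : ℝ)⁻¹ * (q * N)) = T₀ * q₀ := by field_simp
    rw [h1]
    exact hR1.trans (le_mul_of_one_le_left hR0 hY1)
  refine (mul_le_mul_of_nonneg_left (sum_twistedCorrelationBound_le hq hqr hχ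
    (by positivity : (0 : ℝ) < T / (2 * Real.pi)) hW) (by positivity)).trans ?_
  rw [← hM, ← hS', ← hκ, ← hD₁]
  clear_value D₂ κ D₁ S M R s
  calc T₀ * q₀ / N * ((q : ℝ)⁻¹ * (q₀ * L * (8 / M + 90 * S) * D₁ + 2 * ((Nat.log 2 q + 1) *
        (κ * (2 * √r * L * q * (4 + 270 * S) + q * N))))) =
      (T₀ * q₀ / N * ((q : ℝ)⁻¹ * (q₀ * L * (8 / M))) +
        T₀ * q₀ / N * ((q : ℝ)⁻¹ * (q₀ * L * (90 * S)))) * D₁ +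
      2 * D₂ * (T₀ * q₀ / N * ((q : ℝ)⁻¹ * (2 * √r * L * q * (4 + 270 * S))) +
        T₀ * q₀ / N * ((q : ℝ)⁻¹ * (q * N))) := by rw [hD₂]; ring
    _ ≤ (64 * Y ^ 2 * R + 90 * Y ^ 2 * R) * D₁ + 2 * D₂ * (548 * Y ^ 2 * R + Y ^ 2 * R) :=
        add_le_add (mul_le_mul_of_nonneg_right (add_le_add p1 p2) hD₁0)
          (mul_le_mul_of_nonneg_left (add_le_add p3 p4) (mul_nonneg two_pos.le hD₂0))
    _ ≤ 1500 * Y ^ 2 * (D₁ + D₂) * R := by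
        have h1 : 0 ≤ Y ^ 2 * R * D₁ := by positivity
        have h2 : 0 ≤ Y ^ 2 * R * D₂ := by positivity
        linarith

open Complex in
theorem integral_exp_mul_gaussian {T₀ : ℝ} (hT₀ : 0 < T₀) (T x : ℝ) :
    ∫ t : ℝ, cexp ((x * t : ℝ) * I) * (Real.exp (-((t - T) / T₀) ^ 2) : ℝ) =
      (T₀ * √Real.pi * Real.exp (-(T₀ * x) ^ 2 / 4) : ℝ) * cexp ((x * T : ℝ) * I) := by
  have h1 := fourierIntegral_gaussian (b := ((T₀ ^ 2)⁻¹ : ℝ))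
    (by rw [ofReal_re]; positivity) (x : ℂ)
  rw [← MeasureTheory.integral_add_right_eq_self _ T]
  have h2 : ∀ t : ℝ, cexp ((x * (t + T) : ℝ) * I) *
      (Real.exp (-((t + T - T) / T₀) ^ 2) : ℝ) =
      cexp ((x * T : ℝ) * I) * (cexp (I * x * t) * cexp (-((T₀ ^ 2)⁻¹ : ℝ) * t ^ 2)) := by
    intro t
    rw [ofReal_exp, ← Complex.exp_add, ← Complex.exp_add, ← Complex.exp_add]
    congr 1
    push_cast
    ring
  simp only [h2]
  rw [MeasureTheory.integral_const_mul, h1, mul_comm]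
  congr 1
  have h3 : ((Real.pi : ℂ) / ((T₀ ^ 2)⁻¹ : ℝ)) ^ (1 / 2 : ℂ) = ((T₀ * √Real.pi : ℝ) : ℂ) := by
    have : (Real.pi : ℂ) / ((T₀ ^ 2)⁻¹ : ℝ) = ((Real.pi * T₀ ^ 2 : ℝ) : ℂ) := by
      push_cast
      field_simp
    rw [this, (by push_cast; rfl : (1 / 2 : ℂ) = ((1 / 2 : ℝ) : ℂ)),
      ← ofReal_cpow (by positivity), ← Real.sqrt_eq_rpow, Real.sqrt_mul (by positivity),
      Real.sqrt_sq hT₀.le, mul_comm]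
  rw [h3, ofReal_mul (T₀ * √Real.pi), ofReal_exp]
  congr 2
  push_cast
  have : (T₀ : ℂ) ≠ 0 := by exact_mod_cast hT₀.ne'
  field_simp

theorem integrable_exp_mul_gaussian {T₀ : ℝ} (hT₀ : 0 < T₀) (T x : ℝ) :
    MeasureTheory.Integrable fun t : ℝ => Complex.exp ((x * t : ℝ) * Complex.I) *
      (Real.exp (-((t - T) / T₀) ^ 2) : ℝ) := by
  have h1 : MeasureTheory.Integrable fun t : ℝ => Real.exp (-((t - T) / T₀) ^ 2) := by
    have h2 := (integrable_exp_neg_mul_sq (b := (T₀ ^ 2)⁻¹) (by positivity)).comp_sub_right T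
    refine h2.congr (Filter.Eventually.of_forall fun t => ?_)
    show Real.exp _ = Real.exp _
    congr 1
    field_simp
  refine h1.ofReal.bdd_mul (c := 1) (by fun_prop) (Filter.Eventually.of_forall fun t => ?_)
  rw [Complex.norm_exp_ofReal_mul_I]

theorem intervalIntegral_le_exp_one_mul_integral_gaussian {T₀ T : ℝ} (hT₀ : 0 < T₀)
    {h : ℝ → ℝ} (h0 : ∀ t, 0 ≤ h t)
    (hh : MeasureTheory.Integrable fun t : ℝ => h t * Real.exp (-((t - T) / T₀) ^ 2))
    (hi : IntervalIntegrable h MeasureTheory.volume T (T + T₀)) :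
    ∫ t in T..(T + T₀), h t ≤ Real.exp 1 * ∫ t, h t * Real.exp (-((t - T) / T₀) ^ 2) := by
  rw [intervalIntegral.integral_of_le (by linarith), ← MeasureTheory.integral_const_mul]
  refine (MeasureTheory.setIntegral_mono_on hi.1 (hh.const_mul _).integrableOn measurableSet_Ioc
    fun t ht => ?_).trans (MeasureTheory.setIntegral_le_integral (hh.const_mul _)
      (Filter.Eventually.of_forall fun t => by have := h0 t; positivity))
  have h1 : ((t - T) / T₀) ^ 2 ≤ 1 := by
    have h2 : 0 ≤ (t - T) / T₀ := div_nonneg (by linarith [ht.1]) hT₀.le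
    have h3 : (t - T) / T₀ ≤ 1 := by rw [div_le_one hT₀]; linarith [ht.2]
    exact pow_le_one₀ h2 h3
  have h2 : 1 ≤ Real.exp 1 * Real.exp (-((t - T) / T₀) ^ 2) := by
    rw [← Real.exp_add]
    exact Real.one_le_exp (by linarith)
  calc h t = h t * 1 := (mul_one _).symm
    _ ≤ h t * (Real.exp 1 * Real.exp (-((t - T) / T₀) ^ 2)) := mul_le_mul_of_nonneg_left h2 (h0 t)
    _ = _ := by ring

open Complex in
theorem ofReal_norm_sq_sum_mul_exp (S : Finset ℕ) (b : ℕ → ℂ) (t : ℝ) :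
    ((‖∑ n ∈ S, b n * cexp ((-(t * Real.log n) : ℝ) * I)‖ ^ 2 : ℝ) : ℂ) =
      ∑ m ∈ S, ∑ n ∈ S, b m * (starRingEnd ℂ) (b n) *
        cexp (((Real.log n - Real.log m) * t : ℝ) * I) := by
  rw [ofReal_pow, ← mul_conj', map_sum, Finset.sum_mul_sum]
  refine Finset.sum_congr rfl fun m _ => Finset.sum_congr rfl fun n _ => ?_
  rw [map_mul, ← exp_conj, map_mul, conj_ofReal, conj_I, mul_mul_mul_comm, ← Complex.exp_add]
  congr 2
  push_cast
  ring

/-- The kernel arising from the Gaussian mean square of `∑ b n n ^ (-i t)` around `t = T`. -/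
noncomputable def gaussianKernel (T₀ T : ℝ) (m n : ℕ) : ℂ :=
  (T₀ * √Real.pi * Real.exp (-(T₀ * (Real.log n - Real.log m)) ^ 2 / 4) : ℝ) *
    Complex.exp (((Real.log n - Real.log m) * T : ℝ) * Complex.I)

theorem intervalIntegral_norm_sq_sum_le {T₀ : ℝ} (hT₀ : 0 < T₀) (T : ℝ) (S : Finset ℕ)
    (b : ℕ → ℂ) :
    ∫ t in T..(T + T₀), ‖∑ n ∈ S, b n * Complex.exp ((-(t * Real.log n) : ℝ) * Complex.I)‖ ^ 2 ≤
      Real.exp 1 *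
        (∑ m ∈ S, ∑ n ∈ S, b m * (starRingEnd ℂ) (b n) * gaussianKernel T₀ T m n).re := by
  have h1 : ∀ t : ℝ, (((‖∑ n ∈ S, b n * Complex.exp ((-(t * Real.log n) : ℝ) * Complex.I)‖ ^ 2 *
      Real.exp (-((t - T) / T₀) ^ 2) : ℝ)) : ℂ) = ∑ m ∈ S, ∑ n ∈ S, b m * (starRingEnd ℂ) (b n) *
        (Complex.exp (((Real.log n - Real.log m) * t : ℝ) * Complex.I) *
          (Real.exp (-((t - T) / T₀) ^ 2) : ℝ)) := by
    intro t
    rw [Complex.ofReal_mul, ofReal_norm_sq_sum_mul_exp, Finset.sum_mul]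
    refine Finset.sum_congr rfl fun m _ => ?_
    rw [Finset.sum_mul]
    exact Finset.sum_congr rfl fun n _ => by ring
  have h2 : MeasureTheory.Integrable fun t : ℝ => ∑ m ∈ S, ∑ n ∈ S,
      b m * (starRingEnd ℂ) (b n) *
        (Complex.exp (((Real.log n - Real.log m) * t : ℝ) * Complex.I) *
          (Real.exp (-((t - T) / T₀) ^ 2) : ℝ)) :=
    MeasureTheory.integrable_finsetSum _ fun m _ => MeasureTheory.integrable_finsetSum _ fun n _ =>
      (integrable_exp_mul_gaussian hT₀ T _).const_mul _
  have h3 : MeasureTheory.Integrable fun t : ℝ =>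
      ‖∑ n ∈ S, b n * Complex.exp ((-(t * Real.log n) : ℝ) * Complex.I)‖ ^ 2 *
        Real.exp (-((t - T) / T₀) ^ 2) := by
    refine h2.re.congr (Filter.Eventually.of_forall fun t => ?_)
    show Complex.re _ = _
    rw [← h1, Complex.ofReal_re]
  refine (intervalIntegral_le_exp_one_mul_integral_gaussian hT₀ (fun t => by positivity) h3
    (Continuous.intervalIntegrable (by fun_prop) _ _)).trans (le_of_eq ?_)
  congr 1
  rw [← Complex.ofReal_re (∫ t, _), ← integral_complex_ofReal]
  simp only [h1]
  rw [MeasureTheory.integral_finsetSum _ fun m _ => MeasureTheory.integrable_finsetSum _ fun n _ =>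
      (integrable_exp_mul_gaussian hT₀ T _).const_mul _]
  congr 1
  refine Finset.sum_congr rfl fun m _ => ?_
  rw [MeasureTheory.integral_finsetSum _ fun n _ =>
      (integrable_exp_mul_gaussian hT₀ T _).const_mul _]
  refine Finset.sum_congr rfl fun n _ => ?_
  rw [MeasureTheory.integral_const_mul, integral_exp_mul_gaussian hT₀, gaussianKernel]

theorem sum_changeLevel_mul_conj {q q₀ : ℕ} [NeZero q] [NeZero q₀] (h : q₀ ∣ q) {m n : ℕ}
    (hm : IsUnit (m : ZMod q)) (hn : IsUnit (n : ZMod q)) :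
    ∑ ψ : DirichletCharacter ℂ q₀, DirichletCharacter.changeLevel h ψ (m : ZMod q) *
      (starRingEnd ℂ) (DirichletCharacter.changeLevel h ψ (n : ZMod q)) =
      if (m : ZMod q₀) = n then (q₀.totient : ℂ) else 0 := by
  have hu : ∀ k : ℕ, IsUnit (k : ZMod q) → IsUnit (k : ZMod q₀) ∧
      ∀ ψ : DirichletCharacter ℂ q₀,
        DirichletCharacter.changeLevel h ψ (k : ZMod q) = ψ (k : ZMod q₀) := by
    intro k hk
    obtain ⟨u, hu⟩ := hk
    have h1 : ((k : ZMod q).cast : ZMod q₀) = k := ZMod.cast_natCast h k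
    refine ⟨?_, fun ψ => ?_⟩
    · have := (ZMod.isUnit_iff_coprime k q).1 (hu ▸ u.isUnit)
      exact (ZMod.isUnit_iff_coprime k q₀).2 (Nat.Coprime.coprime_dvd_right h this)
    · rw [← hu, DirichletCharacter.changeLevel_eq_cast_of_dvd, hu, h1]
  obtain ⟨hm', hm⟩ := hu m hm
  obtain ⟨hn', hn⟩ := hu n hn
  have h1 := DirichletCharacter.sum_char_inv_mul_char_eq ℂ hn' (m : ZMod q₀)
  simp only [eq_comm (a := (m : ZMod q₀)), ← h1, hm, hn]
  refine Finset.sum_congr rfl fun ψ _ => ?_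
  obtain ⟨u, hu⟩ := hn'
  have h2 : ψ ((n : ZMod q₀)⁻¹) = (starRingEnd ℂ) (ψ n) := by
    rw [starRingEnd_apply, MulChar.star_apply', MulChar.inv_apply, ← hu, Ring.inverse_unit,
      ZMod.inv_coe_unit]
  rw [mul_comm, h2]

theorem norm_sum_sum_ite_le {q₀ : ℕ} (hq₀ : 0 < q₀) (N v : ℕ) (f : ℕ → ℕ → ℂ)
    (hf : ∀ m n, f n m = (starRingEnd ℂ) (f m n)) :
    ‖∑ m ∈ Finset.Ico N v, ∑ n ∈ Finset.Ico N v, if (m : ZMod q₀) = n then f m n else 0‖ ≤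
      ∑ n ∈ Finset.Ico N v, ‖f n n‖ + 2 * ∑ l ∈ Finset.Icc 1 v,
        ‖∑ n ∈ Finset.Ico N (v - q₀ * l), f (n + q₀ * l) n‖ := by
  set D := ∑ m ∈ Finset.Ico N v, ∑ n ∈ Finset.Ico N v,
    if (m : ZMod q₀) = n ∧ n < m then f m n else 0 with hD
  have h1 : ∑ m ∈ Finset.Ico N v, ∑ n ∈ Finset.Ico N v, (if (m : ZMod q₀) = n then f m n else 0) =
      ∑ n ∈ Finset.Ico N v, f n n + D + (starRingEnd ℂ) D := by
    have h2 : (starRingEnd ℂ) D = ∑ m ∈ Finset.Ico N v, ∑ n ∈ Finset.Ico N v,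
        if (m : ZMod q₀) = n ∧ m < n then f m n else 0 := by
      rw [hD, Finset.sum_comm, map_sum]
      simp only [map_sum]
      refine Finset.sum_congr rfl fun m _ => Finset.sum_congr rfl fun n _ => ?_
      simp only [apply_ite (starRingEnd ℂ), map_zero, ← hf, eq_comm (a := (n : ZMod q₀))]
    have h3 : ∑ n ∈ Finset.Ico N v, f n n = ∑ m ∈ Finset.Ico N v, ∑ n ∈ Finset.Ico N v,
        if m = n then f m n else 0 := by
      refine Finset.sum_congr rfl fun m hm => ?_
      rw [Finset.sum_ite_eq, if_pos hm]
    rw [h2, h3, hD, ← Finset.sum_add_distrib, ← Finset.sum_add_distrib]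
    refine Finset.sum_congr rfl fun m _ => ?_
    rw [← Finset.sum_add_distrib, ← Finset.sum_add_distrib]
    refine Finset.sum_congr rfl fun n _ => ?_
    rcases lt_trichotomy m n with h | rfl | h
    · simp [h, h.ne, h.not_gt]
    · simp
    · simp [h, h.ne', h.not_gt]
  have h3 : D = ∑ l ∈ Finset.Icc 1 v, ∑ n ∈ Finset.Ico N (v - q₀ * l), f (n + q₀ * l) n := by
    have h4 : ∀ l, ∑ n ∈ Finset.Ico N (v - q₀ * l), f (n + q₀ * l) n =
        ∑ n ∈ Finset.Ico N v, if n + q₀ * l < v then f (n + q₀ * l) n else 0 := by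
      intro l
      rw [← Finset.sum_filter]
      refine Finset.sum_congr ?_ fun _ _ => rfl
      ext n
      simp only [Finset.mem_filter, Finset.mem_Ico]
      omega
    simp only [h4, hD]
    rw [Finset.sum_comm, Finset.sum_comm (s := Finset.Icc 1 v)]
    refine Finset.sum_congr rfl fun n hn => ?_
    rw [← Finset.sum_filter, ← Finset.sum_filter]
    symm
    refine Finset.sum_bij (fun l _ => n + q₀ * l) (fun l hl => ?_) (fun l _ l' _ h => ?_)
      (fun m hm => ?_) fun _ _ => rfl
    · obtain ⟨h5, h6⟩ := Finset.mem_filter.1 hl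
      have h7 := Nat.mul_pos hq₀ (Finset.mem_Icc.1 h5).1
      refine Finset.mem_filter.2 ⟨Finset.mem_Ico.2 ⟨?_, h6⟩, by simp, by omega⟩
      have := (Finset.mem_Ico.1 hn).1
      omega
    · exact Nat.eq_of_mul_eq_mul_left hq₀ (Nat.add_left_cancel h)
    · obtain ⟨h5, h6, h7⟩ := Finset.mem_filter.1 hm
      have h8 : n ≡ m [MOD q₀] := (ZMod.natCast_eq_natCast_iff _ _ _).1 h6.symm
      obtain ⟨l, hl⟩ := (Nat.modEq_iff_dvd' h7.le).1 h8
      have h9 : n + q₀ * l = m := by omega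
      have h10 : 0 < l := Nat.pos_of_ne_zero (by rintro rfl; omega)
      have h11 : l ≤ q₀ * l := Nat.le_mul_of_pos_left l hq₀
      have h12 := (Finset.mem_Ico.1 h5).2
      exact ⟨l, Finset.mem_filter.2 ⟨Finset.mem_Icc.2 ⟨h10, by omega⟩, by omega⟩, h9⟩
  rw [h1]
  have h4 : ‖D‖ ≤ ∑ l ∈ Finset.Icc 1 v, ‖∑ n ∈ Finset.Ico N (v - q₀ * l), f (n + q₀ * l) n‖ := by
    rw [h3]; exact norm_sum_le _ _
  refine (norm_add₃_le).trans ?_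
  have h5 : ‖∑ n ∈ Finset.Ico N v, f n n‖ ≤ ∑ n ∈ Finset.Ico N v, ‖f n n‖ := norm_sum_le _ _
  rw [RCLike.norm_conj]
  linarith

theorem sum_Ico_smul_eq_sub {u v : ℕ} (huv : u ≤ v) (w : ℕ → ℝ) (f : ℕ → ℂ) :
    ∑ n ∈ Finset.Ico u (v + 1), (w n : ℂ) * f n =
      w v * ∑ n ∈ Finset.Ico u (v + 1), f n +
        ∑ n ∈ Finset.Ico u v, ((w n - w (n + 1) : ℝ) : ℂ) * ∑ k ∈ Finset.Ico u (n + 1), f k := by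
  induction v, huv using Nat.le_induction with
  | base => simp
  | succ v hv ih =>
    rw [Finset.sum_Ico_succ_top (by omega), ih, Finset.sum_Ico_succ_top (by omega : u ≤ v + 1),
      Finset.sum_Ico_succ_top hv (fun n => ((w n - w (n + 1) : ℝ) : ℂ) * _)]
    push_cast
    ring

theorem norm_sum_mul_le_of_antitoneOn {u v : ℕ} {w : ℕ → ℝ} {f : ℕ → ℂ} {B W : ℝ} (hB0 : 0 ≤ B)
    (hW0 : 0 ≤ W) (hw : AntitoneOn w (Set.Ici u)) (hw0 : ∀ n, u ≤ n → 0 ≤ w n) (hW : w u ≤ W)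
    (hB : ∀ v' ≤ v, ‖∑ n ∈ Finset.Ico u v', f n‖ ≤ B) :
    ‖∑ n ∈ Finset.Ico u v, (w n : ℂ) * f n‖ ≤ W * B := by
  rcases le_or_gt v u with h | h
  · rw [Finset.Ico_eq_empty (by omega), Finset.sum_empty, norm_zero]
    positivity
  obtain ⟨v, rfl⟩ : ∃ k, v = k + 1 := ⟨v - 1, by omega⟩
  rw [sum_Ico_smul_eq_sub (by omega)]
  refine (norm_add_le _ _).trans ?_
  rw [norm_mul, Complex.norm_of_nonneg (hw0 v (by omega))]
  have h1 : ‖∑ n ∈ Finset.Ico u v, ((w n - w (n + 1) : ℝ) : ℂ) * ∑ k ∈ Finset.Ico u (n + 1), f k‖ ≤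
      (w u - w v) * B := by
    have h2 : w u - w v = ∑ n ∈ Finset.Ico u v, (w n - w (n + 1)) := by
      rw [← neg_sub, ← Finset.sum_Ico_sub w (by omega : u ≤ v), ← Finset.sum_neg_distrib]
      exact Finset.sum_congr rfl fun n _ => by ring
    rw [h2, Finset.sum_mul]
    refine (norm_sum_le _ _).trans (Finset.sum_le_sum fun n hn => ?_)
    obtain ⟨h3, h4⟩ := Finset.mem_Ico.1 hn
    have h5 : w (n + 1) ≤ w n := hw h3 (h3.trans (Nat.le_succ n)) (Nat.le_succ n)
    rw [norm_mul, Complex.norm_of_nonneg (by linarith)]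
    exact mul_le_mul_of_nonneg_left (hB (n + 1) (by omega)) (by linarith)
  have h2 := mul_le_mul_of_nonneg_left (hB (v + 1) le_rfl) (hw0 v (by omega))
  nlinarith [mul_le_mul_of_nonneg_right hW hB0]

theorem norm_sum_mul_le_of_monotoneOn {u v : ℕ} {w : ℕ → ℝ} {f : ℕ → ℂ} {B W : ℝ} (hB0 : 0 ≤ B)
    (hW0 : 0 ≤ W) (hw : MonotoneOn w (Set.Ici u)) (hw0 : ∀ n, u ≤ n → 0 ≤ w n)
    (hW : ∀ n, u ≤ n → w n ≤ W) (hB : ∀ v' ≤ v, ‖∑ n ∈ Finset.Ico u v', f n‖ ≤ B) :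
    ‖∑ n ∈ Finset.Ico u v, (w n : ℂ) * f n‖ ≤ 2 * W * B := by
  rcases lt_or_ge u v with h | h
  · have h1 := norm_sum_mul_le_of_antitoneOn (w := fun n => W - w n) hB0 hW0
      (fun m hm n hn hmn => sub_le_sub_left (hw hm hn hmn) W)
      (fun n hn => sub_nonneg.2 (hW n hn)) (sub_le_self W (hw0 u le_rfl)) hB
    have h2 : ∑ n ∈ Finset.Ico u v, (w n : ℂ) * f n = W * ∑ n ∈ Finset.Ico u v, f n -
        ∑ n ∈ Finset.Ico u v, ((W - w n : ℝ) : ℂ) * f n := by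
      rw [Finset.mul_sum, ← Finset.sum_sub_distrib]
      refine Finset.sum_congr rfl fun n _ => ?_
      push_cast
      ring
    have h3 : ‖(W : ℂ) * ∑ n ∈ Finset.Ico u v, f n‖ ≤ W * B := by
      rw [norm_mul, Complex.norm_of_nonneg hW0]
      exact mul_le_mul_of_nonneg_left (hB v le_rfl) hW0
    rw [h2]
    refine (norm_sub_le _ _).trans ?_
    linarith
  · rw [Finset.Ico_eq_empty (by omega), Finset.sum_empty, norm_zero]
    positivity

theorem twistedCorrelationBound_nonneg {q : ℕ} [NeZero q] (χ : DirichletCharacter ℂ q)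
    {c : ℝ} (hc : 0 < c) (q₀ r N L l : ℕ) : 0 ≤ twistedCorrelationBound χ c q₀ r N L l := by
  rw [twistedCorrelationBound]
  positivity

theorem gaussianKernel_conj (T₀ T : ℝ) (m n : ℕ) :
    (starRingEnd ℂ) (gaussianKernel T₀ T m n) = gaussianKernel T₀ T n m := by
  rw [gaussianKernel, gaussianKernel, map_mul, Complex.conj_ofReal, ← Complex.exp_conj, map_mul,
    Complex.conj_ofReal, Complex.conj_I]
  congr 2
  · ring_nf
  · push_cast
    ring

theorem norm_gaussianKernel {T₀ : ℝ} (hT₀ : 0 < T₀) (T : ℝ) (m n : ℕ) :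
    ‖gaussianKernel T₀ T m n‖ =
      T₀ * √Real.pi * Real.exp (-(T₀ * (Real.log n - Real.log m)) ^ 2 / 4) := by
  rw [gaussianKernel, norm_mul, Complex.norm_exp_ofReal_mul_I, mul_one,
    Complex.norm_of_nonneg (by positivity)]

theorem Real.log_natCast_sub_log_add {n : ℕ} (hn : 0 < n) (a : ℕ) :
    Real.log n - Real.log ((n + a : ℕ) : ℝ) = -Real.log (1 + a / n) := by
  have h0 : (0 : ℝ) < n := by exact_mod_cast hn
  have h1 : (1 : ℝ) + a / n = (n + a : ℕ) / n := by push_cast; field_simp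
  rw [h1, Real.log_div (by positivity) h0.ne']
  ring

theorem gaussianKernel_add {n : ℕ} (hn : 0 < n) (T₀ T : ℝ) (a : ℕ) :
    gaussianKernel T₀ T (n + a) n =
      (T₀ * √Real.pi * Real.exp (-(T₀ * Real.log (1 + a / n)) ^ 2 / 4) : ℝ) *
        expTwoPi (-(T / (2 * Real.pi) * Real.log (1 + a / n))) := by
  rw [gaussianKernel, Real.log_natCast_sub_log_add hn, expTwoPi]
  congr 3
  · ring_nf
  · congr 1
    have := Real.pi_pos.ne'
    field_simp

/-- The normalised coefficients `(-1) ^ n χ(n) / √n`. -/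
noncomputable def alternatingCoeff {q : ℕ} (χ : DirichletCharacter ℂ q) (n : ℕ) : ℂ :=
  (-1) ^ n * χ (n : ZMod q) * ((√n)⁻¹ : ℝ)

theorem norm_alternatingCoeff_le {q : ℕ} (χ : DirichletCharacter ℂ q) (n : ℕ) :
    ‖alternatingCoeff χ n‖ ≤ (√n)⁻¹ := by
  rw [alternatingCoeff, norm_mul, norm_mul, norm_pow, norm_neg, norm_one, one_pow, one_mul,
    Complex.norm_of_nonneg (by positivity)]
  exact mul_le_of_le_one_left (by positivity) (χ.norm_le_one _)

theorem alternatingCoeff_mul_conj {q : ℕ} [NeZero q] (χ : DirichletCharacter ℂ q) (n a : ℕ) :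
    alternatingCoeff χ (n + a) * (starRingEnd ℂ) (alternatingCoeff χ n) =
      (-1) ^ a * ((√((n + a : ℕ) : ℝ))⁻¹ * (√n)⁻¹ : ℝ) *
        (χ ((n : ZMod q) + a) * χ⁻¹ (n : ZMod q)) := by
  have h1 : (starRingEnd ℂ) (χ (n : ZMod q)) = χ⁻¹ (n : ZMod q) := MulChar.star_apply' χ _
  rw [alternatingCoeff, alternatingCoeff, map_mul, map_mul, map_pow, map_neg, map_one, h1,
    Complex.conj_ofReal]
  have h2 : ((-1 : ℂ) ^ n) * (-1) ^ n = 1 := by rw [← mul_pow]; norm_num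
  push_cast
  linear_combination (χ ((n : ZMod q) + a) * (-1) ^ a * ((√((n : ℝ) + a) : ℂ))⁻¹ *
    χ⁻¹ (n : ZMod q) * (√(n : ℝ) : ℂ)⁻¹) * h2

theorem norm_sum_alternatingCoeff_gaussianKernel_le {q : ℕ} [NeZero q]
    (χ : DirichletCharacter ℂ q) {T₀ T B : ℝ} (hT₀ : 0 < T₀) (hB0 : 0 ≤ B) {N v a : ℕ}
    (hN : 0 < N) (hB : ∀ v' ≤ v, ‖∑ n ∈ Finset.Ico N v',
      twistedCorrelation χ (T / (2 * Real.pi)) a n‖ ≤ B) :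
    ‖∑ n ∈ Finset.Ico N v, alternatingCoeff χ (n + a) *
      (starRingEnd ℂ) (alternatingCoeff χ n) * gaussianKernel T₀ T (n + a) n‖ ≤
      T₀ * √Real.pi * (2 / N * B) := by
  set g : ℕ → ℝ := fun n => Real.exp (-(T₀ * Real.log (1 + a / n)) ^ 2 / 4) with hg
  set w : ℕ → ℝ := fun n => (√((n + a : ℕ) : ℝ))⁻¹ * (√n)⁻¹ with hw
  have hN0 : (0 : ℝ) < N := by exact_mod_cast hN
  have h1 : ∀ n ∈ Finset.Ico N v, alternatingCoeff χ (n + a) *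
      (starRingEnd ℂ) (alternatingCoeff χ n) * gaussianKernel T₀ T (n + a) n =
      ((-1) ^ a * (T₀ * √Real.pi : ℝ)) *
        ((w n : ℂ) * ((g n : ℂ) * twistedCorrelation χ (T / (2 * Real.pi)) a n)) := by
    intro n hn
    rw [alternatingCoeff_mul_conj, gaussianKernel_add (hN.trans_le (Finset.mem_Ico.1 hn).1),
      twistedCorrelation, Complex.ofReal_mul (T₀ * √Real.pi)]
    ring
  rw [Finset.sum_congr rfl h1, ← Finset.mul_sum, norm_mul, norm_mul, norm_pow, norm_neg, norm_one,
    one_pow, one_mul, Complex.norm_of_nonneg (by positivity)]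
  refine mul_le_mul_of_nonneg_left ?_ (by positivity)
  have h2 : ∀ v' ≤ v, ‖∑ n ∈ Finset.Ico N v',
      (g n : ℂ) * twistedCorrelation χ (T / (2 * Real.pi)) a n‖ ≤ 2 * 1 * B := by
    intro v' hv'
    refine norm_sum_mul_le_of_monotoneOn hB0 zero_le_one (fun m hm n hn hmn => ?_)
      (fun n _ => (Real.exp_pos _).le) (fun n _ => Real.exp_le_one_iff.2 ?_)
      fun v'' hv'' => hB v'' (hv''.trans hv')
    · have hm0 : (0 : ℝ) < m := hN0.trans_le (by exact_mod_cast hm)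
      have hmn' : (m : ℝ) ≤ n := by exact_mod_cast hmn
      refine Real.exp_le_exp.2 ?_
      have h3 : (0 : ℝ) ≤ a / n := by positivity
      have h4 : Real.log (1 + a / n) ≤ Real.log (1 + a / m) :=
        Real.log_le_log (by positivity)
          (add_le_add le_rfl (div_le_div_of_nonneg_left (by positivity) hm0 hmn'))
      have h5 : 0 ≤ Real.log (1 + a / n) := Real.log_nonneg (by linarith)
      rw [neg_div, neg_div, neg_le_neg_iff]
      gcongr
    · rw [neg_div, neg_nonpos]
      positivity
  refine (norm_sum_mul_le_of_antitoneOn (by positivity) (W := (N : ℝ)⁻¹) (by positivity)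
    (fun m hm n hn hmn => ?_) (fun n _ => by positivity) ?_ h2).trans (le_of_eq (by ring))
  · have hm0 : 0 < m := hN.trans_le hm
    have hm1 : (0 : ℝ) < m := by exact_mod_cast hm0
    have hmn' : (m : ℝ) ≤ n := by exact_mod_cast hmn
    simp only [hw]
    push_cast
    gcongr
  · simp only [hw]
    have h3 : (N : ℝ)⁻¹ = (√N)⁻¹ * (√N)⁻¹ := by
      rw [← mul_inv, Real.mul_self_sqrt hN0.le]
    have h4 : (N : ℝ) ≤ (N + a : ℕ) := by push_cast; linarith [(Nat.cast_nonneg a : (0 : ℝ) ≤ a)]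
    rw [h3]
    gcongr

theorem norm_sum_alternatingCoeff_gaussianKernel_le_exp {q : ℕ} [NeZero q]
    (χ : DirichletCharacter ℂ q) {T₀ T Y : ℝ} (hT₀ : 0 < T₀) (hY : 0 ≤ Y) {N v a : ℕ}
    (hN : 0 < N) (hv : v + a ≤ 2 * N) (ha : N * Y ≤ T₀ * a) :
    ‖∑ n ∈ Finset.Ico N v, alternatingCoeff χ (n + a) *
      (starRingEnd ℂ) (alternatingCoeff χ n) * gaussianKernel T₀ T (n + a) n‖ ≤
      T₀ * √Real.pi * Real.exp (-Y ^ 2 / 16) := by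
  have hN0 : (0 : ℝ) < N := by exact_mod_cast hN
  have h1 : ∀ n ∈ Finset.Ico N v, ‖alternatingCoeff χ (n + a) *
      (starRingEnd ℂ) (alternatingCoeff χ n) * gaussianKernel T₀ T (n + a) n‖ ≤
      (N : ℝ)⁻¹ * (T₀ * √Real.pi * Real.exp (-Y ^ 2 / 16)) := by
    intro n hn
    obtain ⟨hn1, hn2⟩ := Finset.mem_Ico.1 hn
    have hn1' : (N : ℝ) ≤ n := by exact_mod_cast hn1
    have hn0 : (0 : ℝ) < n := hN0.trans_le hn1'
    have hna : (n : ℝ) + a ≤ 2 * N := by exact_mod_cast (by omega : n + a ≤ 2 * N)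
    rw [norm_mul, norm_mul, RCLike.norm_conj, norm_gaussianKernel hT₀]
    refine mul_le_mul ?_ ?_ (by positivity) (by positivity)
    · have h3 : (N : ℝ)⁻¹ = (√N)⁻¹ * (√N)⁻¹ := by
        rw [← mul_inv, Real.mul_self_sqrt hN0.le]
      rw [h3]
      refine mul_le_mul ((norm_alternatingCoeff_le χ _).trans ?_)
        ((norm_alternatingCoeff_le χ _).trans ?_) (norm_nonneg _) (by positivity)
      · have : (N : ℝ) ≤ (n + a : ℕ) := by exact_mod_cast (by omega : N ≤ n + a)
        gcongr
      · gcongr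
    · refine mul_le_mul_of_nonneg_left (Real.exp_le_exp.2 ?_) (by positivity)
      rw [Real.log_natCast_sub_log_add (by exact_mod_cast hn0)]
      have h4 : (a : ℝ) / (2 * N) ≤ Real.log (1 + a / n) := by
        have h5 := Real.one_sub_inv_le_log_of_pos (x := 1 + a / n) (by positivity)
        refine le_trans ?_ h5
        have h6 : 1 - (1 + (a : ℝ) / n)⁻¹ = a / (n + a) := by field_simp; ring
        rw [h6]
        exact div_le_div_of_nonneg_left (by positivity) (by positivity) hna
      have h5 : Y / 2 ≤ T₀ * Real.log (1 + a / n) := by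
        refine le_trans ?_ (mul_le_mul_of_nonneg_left h4 hT₀.le)
        rw [← mul_div_assoc, le_div_iff₀ (by positivity)]
        linarith
      have h6 : (Y / 2) ^ 2 ≤ (T₀ * Real.log (1 + a / n)) ^ 2 :=
        pow_le_pow_left₀ (by linarith) h5 2
      rw [mul_neg, neg_sq]
      linarith
  refine (norm_sum_le_of_le _ h1).trans ?_
  rw [Finset.sum_const, Nat.card_Ico, nsmul_eq_mul, ← mul_assoc]
  refine mul_le_of_le_one_left (by positivity) ?_
  rw [← div_eq_mul_inv, div_le_one hN0]
  exact_mod_cast (by omega : v - N ≤ N)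

/-- The alternating Dirichlet polynomial `∑ (-1) ^ n η(n) n ^ (-s)` over `u ≤ n < v`. -/
noncomputable def alternatingSum {q : ℕ} (η : DirichletCharacter ℂ q) (u v : ℕ) (s : ℂ) : ℂ :=
  ∑ n ∈ Finset.Ico u v, (-1) ^ n * η (n : ZMod q) * (n : ℂ) ^ (-s)

theorem Nat.cast_cpow_neg_half_add_mul_I {n : ℕ} (hn : 0 < n) (t : ℝ) :
    (n : ℂ) ^ (-(1 / 2 + t * Complex.I)) =
      ((√n)⁻¹ : ℝ) * Complex.exp ((-(t * Real.log n) : ℝ) * Complex.I) := by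
  have h0 : (n : ℂ) ≠ 0 := by exact_mod_cast hn.ne'
  have h1 : (0 : ℝ) < n := by exact_mod_cast hn
  rw [Complex.cpow_def_of_ne_zero h0, Complex.natCast_log.symm, Real.sqrt_eq_rpow,
    ← Real.rpow_neg h1.le, Real.rpow_def_of_pos h1, Complex.ofReal_exp, ← Complex.exp_add]
  congr 1
  push_cast
  ring

theorem alternatingSum_mul_changeLevel {q q₀ : ℕ} (h : q₀ ∣ q) (χ : DirichletCharacter ℂ q)
    (ψ : DirichletCharacter ℂ q₀) {u : ℕ} (hu : 0 < u) (v : ℕ) (t : ℝ) :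
    alternatingSum (χ * DirichletCharacter.changeLevel h ψ) u v (1 / 2 + t * Complex.I) =
      ∑ n ∈ Finset.Ico u v, (alternatingCoeff χ n *
        DirichletCharacter.changeLevel h ψ (n : ZMod q)) *
          Complex.exp ((-(t * Real.log n) : ℝ) * Complex.I) := by
  refine Finset.sum_congr rfl fun n hn => ?_
  rw [Nat.cast_cpow_neg_half_add_mul_I (hu.trans_le (Finset.mem_Ico.1 hn).1), alternatingCoeff,
    MulChar.mul_apply]
  ring

theorem sum_alternatingCoeff_mul_changeLevel {q q₀ : ℕ} [NeZero q] [NeZero q₀] (h : q₀ ∣ q)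
    (χ : DirichletCharacter ℂ q) (m n : ℕ) (k : ℂ) :
    ∑ ψ : DirichletCharacter ℂ q₀, (alternatingCoeff χ m *
      DirichletCharacter.changeLevel h ψ (m : ZMod q)) * (starRingEnd ℂ) (alternatingCoeff χ n *
        DirichletCharacter.changeLevel h ψ (n : ZMod q)) * k =
      q₀.totient * if (m : ZMod q₀) = n then alternatingCoeff χ m *
        (starRingEnd ℂ) (alternatingCoeff χ n) * k else 0 := by
  have h1 : ∀ ψ : DirichletCharacter ℂ q₀, (alternatingCoeff χ m *
      DirichletCharacter.changeLevel h ψ (m : ZMod q)) * (starRingEnd ℂ) (alternatingCoeff χ n *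
        DirichletCharacter.changeLevel h ψ (n : ZMod q)) * k =
      (alternatingCoeff χ m * (starRingEnd ℂ) (alternatingCoeff χ n) * k) *
        (DirichletCharacter.changeLevel h ψ (m : ZMod q) *
          (starRingEnd ℂ) (DirichletCharacter.changeLevel h ψ (n : ZMod q))) := by
    intro ψ
    rw [map_mul]
    ring
  simp only [h1]
  rw [← Finset.mul_sum]
  by_cases hm : IsUnit (m : ZMod q)
  · by_cases hn : IsUnit (n : ZMod q)
    · rw [sum_changeLevel_mul_conj h hm hn]
      split_ifs <;> ring
    · have : alternatingCoeff χ n = 0 := by rw [alternatingCoeff, MulChar.map_nonunit _ hn]; ring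
      simp [this]
  · have : alternatingCoeff χ m = 0 := by rw [alternatingCoeff, MulChar.map_nonunit _ hm]; ring
    simp [this]

theorem exp_one_mul_sqrt_pi_le : Real.exp 1 * √Real.pi ≤ 5 := by
  have h1 : √Real.pi ≤ 1.8 := by
    rw [Real.sqrt_le_left (by norm_num)]
    linarith [Real.pi_lt_d2]
  have h2 := Real.exp_one_lt_d9
  nlinarith [Real.sqrt_nonneg Real.pi, Real.exp_pos 1]

theorem sum_integral_alternatingSum_le {q q₀ r : ℕ} [NeZero q] (hq : Odd q) (hqr : q₀ * r = q)
    (h : q₀ ∣ q) {χ : DirichletCharacter ℂ q} (hχ : IsLocallyPrimitive χ) {T T₀ Y : ℝ}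
    (hT₀ : 0 < T₀) (hT : 0 < T) (hY : 0 ≤ Y) {N v L : ℕ} (hN : 0 < N) (hv : v ≤ 2 * N)
    (hL : N * Y ≤ (L + 1) * T₀ * q₀) :
    ∑ ψ : DirichletCharacter ℂ q₀, ∫ t in T..(T + T₀),
      ‖alternatingSum (χ * DirichletCharacter.changeLevel h ψ) N v (1 / 2 + t * Complex.I)‖ ^ 2 ≤
      5 * (T₀ * q₀ * (1 + 4 * (N * Real.exp (-Y ^ 2 / 16)))) +
        20 * (T₀ * q₀ / N * ∑ l ∈ Finset.Icc 1 L,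
          twistedCorrelationBound χ (T / (2 * Real.pi)) q₀ r N L l) := by
  have hq0 : 0 < q := NeZero.pos q
  have hq₀ : 0 < q₀ := Nat.pos_of_ne_zero (by rintro rfl; omega)
  have : NeZero q₀ := ⟨hq₀.ne'⟩
  have hN0 : (0 : ℝ) < N := by exact_mod_cast hN
  have hc : 0 < T / (2 * Real.pi) := by positivity
  set f : ℕ → ℕ → ℂ := fun m n => alternatingCoeff χ m *
    (starRingEnd ℂ) (alternatingCoeff χ n) * gaussianKernel T₀ T m n with hf
  set S := ∑ m ∈ Finset.Ico N v, ∑ n ∈ Finset.Ico N v,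
    if (m : ZMod q₀) = n then f m n else 0 with hS
  set Bd := twistedCorrelationBound χ (T / (2 * Real.pi)) q₀ r N L with hBd
  set E := Real.exp (-Y ^ 2 / 16) with hE
  have hBd0 : ∀ l, 0 ≤ Bd l := fun l => twistedCorrelationBound_nonneg χ hc _ _ _ _ _
  have h1 : ∑ ψ : DirichletCharacter ℂ q₀, ∫ t in T..(T + T₀),
      ‖alternatingSum (χ * DirichletCharacter.changeLevel h ψ) N v
        (1 / 2 + t * Complex.I)‖ ^ 2 ≤ Real.exp 1 * (q₀.totient * S).re := by
    simp only [alternatingSum_mul_changeLevel h χ _ hN]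
    refine (Finset.sum_le_sum fun ψ _ => intervalIntegral_norm_sq_sum_le hT₀ T _ _).trans
      (le_of_eq ?_)
    rw [← Finset.mul_sum, ← Complex.re_sum, Finset.sum_comm, hS, Finset.mul_sum]
    congr 2
    refine Finset.sum_congr rfl fun m _ => ?_
    rw [Finset.sum_comm, Finset.mul_sum]
    exact Finset.sum_congr rfl fun n _ => sum_alternatingCoeff_mul_changeLevel h χ m n _
  have h2 : ∑ n ∈ Finset.Ico N v, ‖f n n‖ ≤ T₀ * √Real.pi := by
    have h3 : ∀ n ∈ Finset.Ico N v, ‖f n n‖ ≤ (N : ℝ)⁻¹ * (T₀ * √Real.pi) := by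
      intro n hn
      have hn1 : (N : ℝ) ≤ n := by exact_mod_cast (Finset.mem_Ico.1 hn).1
      simp only [hf]
      rw [norm_mul, norm_mul, RCLike.norm_conj, norm_gaussianKernel hT₀, sub_self, mul_zero,
        (by norm_num : -(0 : ℝ) ^ 2 / 4 = 0), Real.exp_zero, mul_one]
      refine mul_le_mul_of_nonneg_right ?_ (by positivity)
      have h4 : (N : ℝ)⁻¹ = (√N)⁻¹ * (√N)⁻¹ := by rw [← mul_inv, Real.mul_self_sqrt hN0.le]
      have h5 : ‖alternatingCoeff χ n‖ ≤ (√N)⁻¹ :=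
        (norm_alternatingCoeff_le χ n).trans (by gcongr)
      rw [h4]
      exact mul_le_mul h5 h5 (norm_nonneg _) (by positivity)
    refine (Finset.sum_le_sum h3).trans ?_
    rw [Finset.sum_const, Nat.card_Ico, nsmul_eq_mul, ← mul_assoc]
    refine mul_le_of_le_one_left (by positivity) ?_
    rw [← div_eq_mul_inv, div_le_one hN0]
    exact_mod_cast (by omega : v - N ≤ N)
  have h3 : ∀ l ∈ Finset.Icc 1 v, ‖∑ n ∈ Finset.Ico N (v - q₀ * l), f (n + q₀ * l) n‖ ≤
      (if l ≤ L then T₀ * √Real.pi * (2 / N * Bd l) else 0) + T₀ * √Real.pi * E := by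
    intro l hl
    have hl0 : 0 < l := (Finset.mem_Icc.1 hl).1
    have hE0 : 0 ≤ T₀ * √Real.pi * E := by positivity
    rcases lt_or_ge v (q₀ * l) with hvl | hvl
    · rw [Nat.sub_eq_zero_of_le hvl.le, Finset.Ico_eq_empty (by omega), Finset.sum_empty, norm_zero]
      have := hBd0 l
      positivity
    split_ifs with hlL
    · have := norm_sum_alternatingCoeff_gaussianKernel_le χ (T := T) hT₀ (hBd0 l) hN
        (v := v - q₀ * l) (a := q₀ * l) fun v' hv' =>
          norm_sum_twistedCorrelation_le_bound hq hqr hχ hc hl0 hlL hN le_rfl (by omega)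
      linarith
    · rw [zero_add]
      refine norm_sum_alternatingCoeff_gaussianKernel_le_exp χ hT₀ hY hN (by omega) (hL.trans ?_)
      have h4 : ((L : ℝ) + 1) ≤ l := by exact_mod_cast (by omega : L + 1 ≤ l)
      push_cast
      nlinarith [mul_le_mul_of_nonneg_right h4
        (by positivity : (0 : ℝ) ≤ T₀ * q₀)]
  have h4 : ‖S‖ ≤ T₀ * √Real.pi * (1 + 2 * (2 / N * ∑ l ∈ Finset.Icc 1 L, Bd l + 2 * N * E)) := by
    refine (norm_sum_sum_ite_le hq₀ N v f fun m n => ?_).trans ?_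
    · simp only [hf]
      rw [map_mul, map_mul, Complex.conj_conj, gaussianKernel_conj]
      ring
    · have h5 : ∑ l ∈ Finset.Icc 1 v, ‖∑ n ∈ Finset.Ico N (v - q₀ * l), f (n + q₀ * l) n‖ ≤
          T₀ * √Real.pi * (2 / N * ∑ l ∈ Finset.Icc 1 L, Bd l) + 2 * N * (T₀ * √Real.pi * E) := by
        refine (Finset.sum_le_sum h3).trans ?_
        rw [Finset.sum_add_distrib]
        refine add_le_add ?_ ?_
        · rw [← Finset.sum_filter, Finset.mul_sum, Finset.mul_sum]
          refine Finset.sum_le_sum_of_subset_of_nonneg (fun l hl => ?_) fun l _ _ => ?_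
          · obtain ⟨h6, h7⟩ := Finset.mem_filter.1 hl
            exact Finset.mem_Icc.2 ⟨(Finset.mem_Icc.1 h6).1, h7⟩
          · have := hBd0 l
            positivity
        · rw [Finset.sum_const, Nat.card_Icc, nsmul_eq_mul]
          refine mul_le_mul_of_nonneg_right ?_ (by positivity)
          exact_mod_cast (by omega : v + 1 - 1 ≤ 2 * N)
      linarith
  have hSum0 : 0 ≤ ∑ l ∈ Finset.Icc 1 L, Bd l := Finset.sum_nonneg fun l _ => hBd0 l
  have h5 : (q₀.totient * S).re ≤ q₀ * ‖S‖ := by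
    refine (Complex.re_le_norm _).trans ?_
    rw [norm_mul, Complex.norm_natCast]
    refine mul_le_mul_of_nonneg_right ?_ (norm_nonneg _)
    exact_mod_cast Nat.totient_le q₀
  refine h1.trans ?_
  calc Real.exp 1 * (q₀.totient * S).re ≤ Real.exp 1 * (q₀ * (T₀ * √Real.pi *
        (1 + 2 * (2 / N * ∑ l ∈ Finset.Icc 1 L, Bd l + 2 * N * E)))) :=
        mul_le_mul_of_nonneg_left (h5.trans (mul_le_mul_of_nonneg_left h4 (by positivity)))
          (Real.exp_pos 1).le
    _ = (Real.exp 1 * √Real.pi) * (q₀ * T₀ *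
        (1 + 2 * (2 / N * ∑ l ∈ Finset.Icc 1 L, Bd l + 2 * N * E))) := by ring
    _ ≤ 5 * (q₀ * T₀ * (1 + 2 * (2 / N * ∑ l ∈ Finset.Icc 1 L, Bd l + 2 * N * E))) :=
        mul_le_mul_of_nonneg_right exp_one_mul_sqrt_pi_le (by positivity)
    _ = _ := by ring

theorem hasDerivAt_fwdDiff_iter_cpow {h : ℝ} (hh : 0 ≤ h) (k : ℕ) (s : ℂ) {x : ℝ} (hx : 0 < x) :
    HasDerivAt ((fwdDiff h)^[k] fun y : ℝ => (y : ℂ) ^ (-s))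
      (-s * (fwdDiff h)^[k] (fun y : ℝ => (y : ℂ) ^ (-(s + 1))) x) x := by
  induction k generalizing x with
  | zero =>
    have h1 : HasDerivAt (fun y : ℝ => (y : ℂ) ^ (-s)) (-s * (x : ℂ) ^ (-s - 1) * 1) x :=
      ((hasDerivAt_id (x : ℂ)).cpow_const (c := -s) (Or.inl (by simpa using hx))).comp_ofReal
    simp only [Function.iterate_zero, id_eq]
    convert h1 using 1
    ring_nf
  | succ k ih =>
    simp only [Function.iterate_succ_apply', fwdDiff] at ih ⊢
    have h1 := (ih (by positivity : 0 < x + h)).comp_add_const x h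
    rw [mul_sub]
    exact h1.sub (ih hx)

theorem norm_fwdDiff_iter_cpow_le {h : ℝ} (hh : 0 ≤ h) (k : ℕ) {s : ℂ} (hs : 0 ≤ s.re) {x : ℝ}
    (hx : 0 < x) : ‖(fwdDiff h)^[k] (fun y : ℝ => (y : ℂ) ^ (-s)) x‖ ≤
      (‖s‖ + k) ^ k * h ^ k * x ^ (-s.re - k) := by
  induction k generalizing s x with
  | zero => simp [Complex.norm_cpow_eq_rpow_re_of_pos hx]
  | succ k ih =>
    have h1 := norm_image_sub_le_of_norm_deriv_le_segment' (a := x) (b := x + h)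
      (f := (fwdDiff h)^[k] fun y : ℝ => (y : ℂ) ^ (-s))
      (f' := fun y => -s * (fwdDiff h)^[k] (fun y : ℝ => (y : ℂ) ^ (-(s + 1))) y)
      (C := (‖s‖ + (k + 1 : ℕ)) ^ (k + 1) * h ^ k * x ^ (-s.re - (k + 1 : ℕ)))
      (fun y hy => (hasDerivAt_fwdDiff_iter_cpow hh k s (hx.trans_le hy.1)).hasDerivWithinAt)
      (fun y hy => ?_) (x + h) (by simp [hh])
    · rw [Function.iterate_succ_apply']
      refine h1.trans (le_of_eq ?_)
      ring
    · have hy0 : 0 < y := hx.trans_le hy.1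
      have h2 := ih (s := s + 1) (x := y) (by simp; linarith) hy0
      have h3 : ‖s + 1‖ ≤ ‖s‖ + 1 := by simpa using norm_add_le s 1
      rw [norm_mul, norm_neg]
      have h4 : y ^ (-(s + 1).re - k) ≤ x ^ (-s.re - (k + 1 : ℕ)) := by
        have : -(s + 1).re - (k : ℝ) = -s.re - (k + 1 : ℕ) := by
          push_cast
          simp
          ring
        rw [this]
        refine Real.rpow_le_rpow_of_nonpos hx hy.1 ?_
        have : (0 : ℝ) ≤ (k + 1 : ℕ) := Nat.cast_nonneg _
        linarith
      have h5 : ‖s + 1‖ + k ≤ ‖s‖ + (k + 1 : ℕ) := by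
        push_cast
        linarith
      calc ‖s‖ * ‖(fwdDiff h)^[k] (fun y : ℝ => (y : ℂ) ^ (-(s + 1))) y‖
          ≤ (‖s‖ + (k + 1 : ℕ)) * ((‖s‖ + (k + 1 : ℕ)) ^ k * h ^ k *
            x ^ (-s.re - (k + 1 : ℕ))) := by
            refine mul_le_mul (le_add_of_nonneg_right (Nat.cast_nonneg _)) (h2.trans ?_)
              (norm_nonneg _) (by positivity)
            gcongr
        _ = _ := by ring

theorem differentiable_fwdDiff_iter_cpow {h : ℝ} (hh : 0 ≤ h) (k : ℕ) {x : ℝ} (hx : 0 < x) :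
    Differentiable ℂ fun s : ℂ => (fwdDiff h)^[k] (fun y : ℝ => (y : ℂ) ^ (-s)) x := by
  induction k generalizing x with
  | zero =>
    have h0 : (x : ℂ) ≠ 0 := by exact_mod_cast hx.ne'
    intro s
    exact (differentiableAt_id.neg).const_cpow (Or.inl h0)
  | succ k ih =>
    simp only [Function.iterate_succ_apply', fwdDiff] at ih ⊢
    exact (ih (by positivity : 0 < x + h)).sub (ih hx)

/-- The average of `f` at the two ends of an interval of length `q`. -/
noncomputable def halfAverage (q : ℕ) (f : ℕ → ℂ) (M : ℕ) : ℂ := (f M + f (M + q)) / 2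

theorem norm_halfAverage_iter_sq_le (q : ℕ) (f : ℕ → ℂ) (k M : ℕ) :
    ‖(halfAverage q)^[k] f M‖ ^ 2 ≤ ∑ i ∈ Finset.range (k + 1), ‖f (M + i * q)‖ ^ 2 := by
  induction k generalizing M with
  | zero => simp
  | succ k ih =>
    rw [Function.iterate_succ_apply', halfAverage]
    set x := (halfAverage q)^[k] f M
    set y := (halfAverage q)^[k] f (M + q)
    have h1 : ‖(x + y) / 2‖ ^ 2 ≤ (‖x‖ ^ 2 + ‖y‖ ^ 2) / 2 := by
      rw [norm_div, Complex.norm_ofNat]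
      have := norm_add_le x y
      have h2 := pow_le_pow_left₀ (norm_nonneg _) this 2
      nlinarith [sq_nonneg (‖x‖ - ‖y‖)]
    have h2 := ih M
    have h3 := ih (M + q)
    have h4 : ∑ i ∈ Finset.range (k + 1), ‖f (M + i * q)‖ ^ 2 ≤
        ∑ i ∈ Finset.range (k + 1 + 1), ‖f (M + i * q)‖ ^ 2 := by
      rw [Finset.sum_range_succ _ (k + 1)]
      exact le_add_of_nonneg_right (by positivity)
    have h5 : ∑ i ∈ Finset.range (k + 1), ‖f (M + q + i * q)‖ ^ 2 ≤
        ∑ i ∈ Finset.range (k + 1 + 1), ‖f (M + i * q)‖ ^ 2 := by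
      rw [Finset.sum_range_succ' _ (k + 1)]
      have h6 : ∀ i, M + q + i * q = M + (i + 1) * q := fun i => by ring
      simp only [h6]
      exact le_add_of_nonneg_right (by positivity)
    linarith

theorem halfAverage_const_sub (q : ℕ) (c : ℂ) (f : ℕ → ℂ) (k : ℕ) :
    (halfAverage q)^[k] (fun M => c - f M) = fun M => c - (halfAverage q)^[k] f M := by
  induction k with
  | zero => rfl
  | succ k ih =>
    funext M
    rw [Function.iterate_succ_apply', ih, Function.iterate_succ_apply', halfAverage, halfAverage]
    ring

theorem summable_mul_fwdDiff_iter {q : ℕ} {a : ℕ → ℂ} (ha : ∀ n, a (n + q) = -a n) {φ : ℝ → ℂ}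
    (hs : Summable fun n : ℕ => a n * φ n) (k : ℕ) :
    Summable fun n : ℕ => a n * (fwdDiff (q : ℝ))^[k] φ n := by
  induction k with
  | zero => simpa using hs
  | succ k ih =>
    simp only [Function.iterate_succ_apply', fwdDiff]
    have h1 := (summable_nat_add_iff q).2 ih
    refine (h1.neg.sub ih).congr fun n => ?_
    rw [ha]
    push_cast
    ring

theorem halfAverage_iter_tsum {q : ℕ} {a : ℕ → ℂ} (ha : ∀ n, a (n + q) = -a n) {φ : ℝ → ℂ}
    (hs : Summable fun n : ℕ => a n * φ n) (k : ℕ) :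
    (halfAverage q)^[k] (fun M => ∑' n : ℕ, a (n + M) * φ (n + M : ℕ)) =
      fun M => (-1 / 2) ^ k * ∑' n : ℕ, a (n + M) * (fwdDiff (q : ℝ))^[k] φ (n + M : ℕ) := by
  induction k with
  | zero => simp
  | succ k ih =>
    funext M
    rw [Function.iterate_succ_apply', ih, halfAverage]
    have h1 := summable_mul_fwdDiff_iter ha hs k
    have h2 := (summable_nat_add_iff M).2 h1
    have h3 := (summable_nat_add_iff (M + q)).2 h1
    have h4 : ∀ n : ℕ, a (n + M) * (fwdDiff (q : ℝ))^[k + 1] φ (n + M : ℕ) =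
        -(a (n + (M + q)) * (fwdDiff (q : ℝ))^[k] φ (n + (M + q) : ℕ)) -
          a (n + M) * (fwdDiff (q : ℝ))^[k] φ (n + M : ℕ) := by
      intro n
      rw [Function.iterate_succ_apply', fwdDiff, ← add_assoc, ha]
      push_cast
      ring_nf
    rw [tsum_congr h4, h3.neg.tsum_sub h2, tsum_neg, pow_succ]
    ring

theorem halfAverage_iter_sum_Ico {q : ℕ} {a : ℕ → ℂ} (ha : ∀ n, a (n + q) = -a n) {φ : ℝ → ℂ}
    (hs : Summable fun n : ℕ => a n * φ n) (hφ : φ 0 = 0) (k M : ℕ) :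
    (halfAverage q)^[k] (fun M => ∑ n ∈ Finset.Ico 1 M, a n * φ n) M = ∑' n : ℕ, a n * φ n -
      (-1 / 2) ^ k * ∑' n : ℕ, a (n + M) * (fwdDiff (q : ℝ))^[k] φ (n + M : ℕ) := by
  have h1 : (fun M => ∑ n ∈ Finset.Ico 1 M, a n * φ n) =
      fun M : ℕ => ∑' n : ℕ, a n * φ n - ∑' n : ℕ, a (n + M) * φ (n + M : ℕ) := by
    funext M
    rw [← hs.sum_add_tsum_nat_add M, add_sub_cancel_right]
    rcases M.eq_zero_or_pos with rfl | hM
    · simp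
    · rw [← Finset.sum_range_add_sum_Ico _ (by omega : 1 ≤ M)]
      simp [hφ]
  rw [h1, halfAverage_const_sub, halfAverage_iter_tsum ha hs k]

/-- The function `n ↦ (-1) ^ n η(n)`, as a function modulo `2 q`. -/
noncomputable def alternatingTwist {q : ℕ} (η : DirichletCharacter ℂ q) (j : ZMod (2 * q)) : ℂ :=
  (-1) ^ j.val * η (j.val : ZMod q)

theorem alternatingTwist_natCast {q : ℕ} (η : DirichletCharacter ℂ q) (n : ℕ) :
    alternatingTwist η (n : ZMod (2 * q)) = (-1) ^ n * η (n : ZMod q) := by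
  rw [alternatingTwist, ZMod.val_natCast]
  have h1 : ((n % (2 * q) : ℕ) : ZMod q) = n := by
    rw [ZMod.natCast_eq_natCast_iff]
    exact (Nat.mod_modEq n (2 * q)).of_dvd (Dvd.intro_left 2 rfl)
  have h2 : (-1 : ℂ) ^ (n % (2 * q)) = (-1) ^ n := by
    rw [neg_one_pow_eq_pow_mod_two (n := n), neg_one_pow_eq_pow_mod_two,
      Nat.mod_mod_of_dvd _ (Dvd.intro q rfl)]
  rw [h1, h2]

theorem neg_one_pow_mul_add_self {q : ℕ} (hq : Odd q) (η : DirichletCharacter ℂ q) (n : ℕ) :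
    (-1) ^ (n + q) * η ((n + q : ℕ) : ZMod q) = -((-1) ^ n * η (n : ZMod q)) := by
  rw [pow_add, hq.neg_one_pow, Nat.cast_add, ZMod.natCast_self, add_zero]
  ring

theorem sum_alternatingTwist {q : ℕ} [NeZero q] (hq : Odd q) (η : DirichletCharacter ℂ q) :
    ∑ j, alternatingTwist η j = 0 := by
  have h1 : ∑ j, alternatingTwist η (j + (q : ZMod (2 * q))) = ∑ j, alternatingTwist η j :=
    Equiv.sum_comp (Equiv.addRight (q : ZMod (2 * q))) (alternatingTwist η)
  have h2 : ∀ j : ZMod (2 * q), alternatingTwist η (j + (q : ZMod (2 * q))) =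
      -alternatingTwist η j := by
    intro j
    rw [← ZMod.natCast_zmod_val j, ← Nat.cast_add, alternatingTwist_natCast,
      alternatingTwist_natCast, neg_one_pow_mul_add_self hq]
  simp only [h2, Finset.sum_neg_distrib] at h1
  linear_combination (-1 / 2) * h1

theorem tsum_neg_one_pow_mul {b : ℕ → ℂ} (hb : Summable b) :
    ∑' n, (-1) ^ n * b n = 2 * ∑' n, b (2 * n) - ∑' n, b n := by
  have h1 : Summable fun n => b (2 * n) :=
    hb.comp_injective (mul_right_injective₀ (two_ne_zero' ℕ))
  have h2 : Summable fun n => b (2 * n + 1) :=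
    hb.comp_injective ((add_left_injective 1).comp (mul_right_injective₀ (two_ne_zero' ℕ)))
  have h3 : ∀ n, (-1 : ℂ) ^ (2 * n) * b (2 * n) = b (2 * n) := fun n => by
    rw [pow_mul, neg_one_sq, one_pow, one_mul]
  have h4 : ∀ n, (-1 : ℂ) ^ (2 * n + 1) * b (2 * n + 1) = -b (2 * n + 1) := fun n => by
    rw [pow_succ, pow_mul, neg_one_sq, one_pow]
    ring
  rw [← tsum_even_add_odd h1 h2, ← tsum_even_add_odd (h1.congr fun n => (h3 n).symm)
    (h2.neg.congr fun n => (h4 n).symm), tsum_congr h3, tsum_congr h4, tsum_neg]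
  ring

theorem LFunction_alternatingTwist_of_one_lt_re {q : ℕ} [NeZero q] (η : DirichletCharacter ℂ q)
    {s : ℂ} (hs : 1 < s.re) : ZMod.LFunction (alternatingTwist η) s =
      -(1 - 2 * (2 : ℂ) ^ (-s) * η 2) * η.LFunction s := by
  have hs0 : s ≠ 0 := by
    rintro rfl
    simp at hs
    linarith
  rw [ZMod.LFunction_eq_LSeries _ hs, DirichletCharacter.LFunction_eq_LSeries _ hs, LSeries,
    LSeries]
  have h1 : ∀ n : ℕ, LSeries.term (fun n : ℕ => alternatingTwist η (n : ZMod (2 * q))) s n =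
      (-1) ^ n * LSeries.term (fun n : ℕ => η (n : ZMod q)) s n := by
    intro n
    rw [LSeries.term_of_ne_zero' hs0, LSeries.term_of_ne_zero' hs0, alternatingTwist_natCast]
    ring
  have h2 : ∀ n : ℕ, LSeries.term (fun n : ℕ => η (n : ZMod q)) s (2 * n) =
      ((2 : ℂ) ^ (-s) * η 2) * LSeries.term (fun n : ℕ => η (n : ZMod q)) s n := by
    intro n
    rw [LSeries.term_of_ne_zero' hs0, LSeries.term_of_ne_zero' hs0, Nat.cast_mul,
      Nat.cast_mul, Complex.natCast_mul_natCast_cpow, map_mul, Complex.cpow_neg]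
    simp only [Nat.cast_ofNat]
    ring
  rw [tsum_congr h1, tsum_neg_one_pow_mul (ZMod.LSeriesSummable_of_one_lt_re η hs), tsum_congr h2,
    tsum_mul_left]
  ring

theorem LFunction_alternatingTwist {q : ℕ} [NeZero q] (hq : Odd q) (η : DirichletCharacter ℂ q)
    {s : ℂ} (hs : s ≠ 1) : ZMod.LFunction (alternatingTwist η) s =
      -(1 - 2 * (2 : ℂ) ^ (-s) * η 2) * η.LFunction s := by
  have hU : IsOpen ({1}ᶜ : Set ℂ) := isOpen_compl_singleton
  have h1 : AnalyticOnNhd ℂ (ZMod.LFunction (alternatingTwist η)) {1}ᶜ :=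
    (ZMod.differentiable_LFunction_of_sum_zero
      (sum_alternatingTwist hq η)).differentiableOn.analyticOnNhd hU
  have h2 : AnalyticOnNhd ℂ (fun s => -(1 - 2 * (2 : ℂ) ^ (-s) * η 2) * η.LFunction s) {1}ᶜ := by
    refine DifferentiableOn.analyticOnNhd (fun s hs => ?_) hU
    have h3 := DirichletCharacter.differentiableAt_LFunction η s (Or.inl hs)
    have h4 : DifferentiableAt ℂ (fun s : ℂ => (2 : ℂ) ^ (-s)) s :=
      differentiableAt_id.neg.const_cpow (Or.inl two_ne_zero)
    exact ((((h4.const_mul 2).mul_const _).const_sub 1).neg.mul h3).differentiableWithinAt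
  refine h1.eqOn_of_preconnected_of_eventuallyEq h2
    (isConnected_compl_singleton_of_one_lt_rank (by simp) _).isPreconnected (z₀ := 2)
    (by norm_num) ?_ hs
  filter_upwards [(isOpen_lt continuous_const Complex.continuous_re).mem_nhds
    (by simp : (1 : ℝ) < (2 : ℂ).re)] with s hs
  exact LFunction_alternatingTwist_of_one_lt_re η hs

theorem half_add_mul_I_ne_one (t : ℝ) : (1 / 2 + t * Complex.I : ℂ) ≠ 1 := by
  intro h
  have := congrArg Complex.re h
  norm_num at this

theorem norm_LFunction_sq_le {q : ℕ} [NeZero q] (hq : Odd q) (η : DirichletCharacter ℂ q)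
    (t : ℝ) : ‖η.LFunction (1 / 2 + t * Complex.I)‖ ^ 2 ≤
      6 * ‖ZMod.LFunction (alternatingTwist η) (1 / 2 + t * Complex.I)‖ ^ 2 := by
  rw [LFunction_alternatingTwist hq η (half_add_mul_I_ne_one t), norm_mul, norm_neg, mul_pow]
  have h1 : ‖(2 : ℂ) * (2 : ℂ) ^ (-(1 / 2 + t * Complex.I)) * η 2‖ = √2 := by
    have h2 : IsUnit (2 : ZMod q) := by
      have := (ZMod.isUnit_iff_coprime 2 q).2 (Nat.coprime_two_left.2 hq)
      simpa using this
    have h6 := Nat.cast_cpow_neg_half_add_mul_I two_pos t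
    rw [Nat.cast_ofNat] at h6
    rw [norm_mul, norm_mul, ← h2.unit_spec, DirichletCharacter.unit_norm_eq_one, h6, norm_mul,
      Complex.norm_exp_ofReal_mul_I, Complex.norm_real, Real.norm_of_nonneg (by positivity)]
    simp only [Nat.cast_ofNat, Complex.norm_ofNat, mul_one]
    rw [← div_eq_mul_inv, Real.div_sqrt]
  have h3 : √2 - 1 ≤ ‖1 - 2 * (2 : ℂ) ^ (-(1 / 2 + t * Complex.I)) * η 2‖ := by
    have := norm_sub_norm_le (2 * (2 : ℂ) ^ (-(1 / 2 + t * Complex.I)) * η 2) 1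
    rwa [h1, norm_one, norm_sub_rev] at this
  have h4 : (1.41 : ℝ) ≤ √2 := by
    rw [Real.le_sqrt (by norm_num) (by norm_num)]
    norm_num
  have h5 : (1 : ℝ) ≤ 6 * ‖1 - 2 * (2 : ℂ) ^ (-(1 / 2 + t * Complex.I)) * η 2‖ ^ 2 := by
    nlinarith
  nlinarith [sq_nonneg ‖η.LFunction (1 / 2 + t * Complex.I)‖]

theorem differentiable_alternatingSum {q : ℕ} (η : DirichletCharacter ℂ q) {u : ℕ} (hu : 0 < u)
    (v : ℕ) : Differentiable ℂ (alternatingSum η u v) := by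
  intro s
  unfold alternatingSum
  refine DifferentiableAt.fun_sum fun n hn => ?_
  have h0 : (n : ℂ) ≠ 0 := by
    have := (Finset.mem_Ico.1 hn).1
    exact_mod_cast (by omega : n ≠ 0)
  exact (differentiableAt_id.neg.const_cpow (Or.inl h0)).const_mul _

theorem differentiable_halfAverage_iter {q : ℕ} {f : ℂ → ℕ → ℂ}
    (hf : ∀ M, Differentiable ℂ fun s => f s M) (k M : ℕ) :
    Differentiable ℂ fun s => (halfAverage q)^[k] (f s) M := by
  induction k generalizing M with
  | zero => exact hf M
  | succ k ih =>
    simp only [Function.iterate_succ_apply', halfAverage]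
    exact ((ih M).add (ih (M + q))).div_const 2

theorem norm_neg_one_pow_mul_le {q : ℕ} (η : DirichletCharacter ℂ q) (n : ℕ) :
    ‖(-1) ^ n * η (n : ZMod q)‖ ≤ 1 := by
  rw [norm_mul, norm_pow, norm_neg, norm_one, one_pow, one_mul]
  exact η.norm_le_one _

theorem halfAverage_iter_alternatingSum_of_one_lt_re {q : ℕ} [NeZero q] (hq : Odd q)
    (η : DirichletCharacter ℂ q) (k M : ℕ) {s : ℂ} (hs : 1 < s.re) :
    (halfAverage q)^[k] (fun M => alternatingSum η 1 M s) M =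
      ZMod.LFunction (alternatingTwist η) s - (-1 / 2) ^ k * ∑' n : ℕ,
        (-1) ^ (n + M) * η ((n + M : ℕ) : ZMod q) *
          (fwdDiff (q : ℝ))^[k] (fun y : ℝ => (y : ℂ) ^ (-s)) (n + M : ℕ) := by
  have hs0 : s ≠ 0 := by
    rintro rfl
    simp at hs
    linarith
  have h1 : ∀ n : ℕ, LSeries.term (fun n : ℕ => alternatingTwist η (n : ZMod (2 * q))) s n =
      ((-1) ^ n * η (n : ZMod q)) * ((n : ℝ) : ℂ) ^ (-s) := by
    intro n
    rw [LSeries.term_of_ne_zero' hs0, alternatingTwist_natCast, Complex.ofReal_natCast,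
      Complex.cpow_neg]
    rfl
  have h2 := (ZMod.LSeriesSummable_of_one_lt_re (alternatingTwist η) hs).congr h1
  have h3 := halfAverage_iter_sum_Ico (a := fun n : ℕ => (-1) ^ n * η (n : ZMod q))
    (φ := fun y : ℝ => (y : ℂ) ^ (-s)) (fun n => neg_one_pow_mul_add_self hq η n) h2
    (by simp [hs0]) k M
  rw [ZMod.LFunction_eq_LSeries _ hs, LSeries, tsum_congr h1, ← h3]
  simp only [alternatingSum, Complex.ofReal_natCast]

theorem tsum_norm_le_of_le_rpow {g : ℕ → ℂ} {C σ : ℝ} (hσ : 2 ≤ σ) (hC : 0 ≤ C) {M : ℕ} (hM : 0 < M)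
    (hg : ∀ n, ‖g n‖ ≤ C * ((n + M : ℕ) : ℝ) ^ (-σ)) :
    ‖∑' n, g n‖ ≤ 2 * C * (M : ℝ) ^ (2 - σ) := by
  have hM0 : (1 : ℝ) ≤ M := by exact_mod_cast hM
  have h1 : HasSum (fun n : ℕ => 1 / ((n + 1 : ℕ) : ℝ) ^ 2) (Real.pi ^ 2 / 6) := by
    have := (hasSum_nat_add_iff' 1).2 hasSum_zeta_two
    simpa using this
  have h2 : ∀ n, ‖g n‖ ≤ C * (M : ℝ) ^ (2 - σ) * (1 / ((n + 1 : ℕ) : ℝ) ^ 2) := by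
    intro n
    refine (hg n).trans ?_
    have hn : (0 : ℝ) < (n + M : ℕ) := by exact_mod_cast (by omega : 0 < n + M)
    have h3 : ((n + M : ℕ) : ℝ) ^ (-σ) =
        ((n + M : ℕ) : ℝ) ^ (2 - σ) * (1 / ((n + M : ℕ) : ℝ) ^ 2) := by
      rw [← Real.rpow_natCast, one_div, ← Real.rpow_neg hn.le, ← Real.rpow_add hn]
      congr 1
      push_cast
      ring
    rw [h3, mul_assoc]
    refine mul_le_mul_of_nonneg_left (mul_le_mul ?_ ?_ (by positivity) (by positivity)) hC
    · exact Real.rpow_le_rpow_of_nonpos (by linarith) (by exact_mod_cast (by omega : M ≤ n + M))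
        (by linarith)
    · refine one_div_le_one_div_of_le (by positivity) (pow_le_pow_left₀ (by positivity) ?_ 2)
      exact_mod_cast (by omega : n + 1 ≤ n + M)
  have h4 := tsum_of_norm_bounded (h1.mul_left (C * (M : ℝ) ^ (2 - σ))) h2
  refine h4.trans ?_
  have h5 : Real.pi ^ 2 / 6 ≤ 2 := by nlinarith [Real.pi_lt_d2, Real.pi_pos]
  calc _ ≤ C * (M : ℝ) ^ (2 - σ) * 2 := mul_le_mul_of_nonneg_left h5 (by positivity)
    _ = _ := by ring

theorem halfAverage_iter_alternatingSum {q : ℕ} [NeZero q] (hq : Odd q)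
    (η : DirichletCharacter ℂ q) {k : ℕ} (hk : 2 ≤ k) {M : ℕ} (hM : 0 < M) {s : ℂ}
    (hs : 0 < s.re) :
    (halfAverage q)^[k] (fun M => alternatingSum η 1 M s) M =
      ZMod.LFunction (alternatingTwist η) s - (-1 / 2) ^ k * ∑' n : ℕ,
        (-1) ^ (n + M) * η ((n + M : ℕ) : ZMod q) *
          (fwdDiff (q : ℝ))^[k] (fun y : ℝ => (y : ℂ) ^ (-s)) (n + M : ℕ) := by
  set U : Set ℂ := {s | 0 < s.re} ∩ Metric.ball 0 (‖s‖ + 3) with hU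
  have hUo : IsOpen U := (isOpen_lt continuous_const Complex.continuous_re).inter Metric.isOpen_ball
  have hUc : IsPreconnected U :=
    ((convex_halfSpace_re_gt 0).inter (convex_ball 0 _)).isPreconnected
  have h1 : AnalyticOnNhd ℂ (fun s => (halfAverage q)^[k] (fun M => alternatingSum η 1 M s) M) U :=
    (differentiable_halfAverage_iter (fun M => differentiable_alternatingSum η one_pos M) k
      M).differentiableOn.analyticOnNhd hUo
  have h2 : DifferentiableOn ℂ (fun s => ∑' n : ℕ,
        (-1) ^ (n + M) * η ((n + M : ℕ) : ZMod q) *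
          (fwdDiff (q : ℝ))^[k] (fun y : ℝ => (y : ℂ) ^ (-s)) (n + M : ℕ)) U := by
    refine Complex.differentiableOn_tsum_of_summable_norm
      (u := fun n : ℕ => (‖s‖ + 3 + k) ^ k * (q : ℝ) ^ k * ((n + M : ℕ) : ℝ) ^ (-(2 : ℝ))) ?_
      (fun n => ?_) hUo fun n w hw => ?_
    · exact ((summable_nat_add_iff M).2 (Real.summable_nat_rpow.2 (by norm_num))).mul_left _
    · exact ((differentiable_fwdDiff_iter_cpow (Nat.cast_nonneg q) k
        (by exact_mod_cast (by omega : 0 < n + M))).const_mul _).differentiableOn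
    · obtain ⟨hw1, hw2⟩ := hw
      rw [mem_ball_zero_iff] at hw2
      have hn : (1 : ℝ) ≤ (n + M : ℕ) := by exact_mod_cast (by omega : 1 ≤ n + M)
      rw [norm_mul]
      refine (mul_le_of_le_one_left (norm_nonneg _) (norm_neg_one_pow_mul_le η (n + M))).trans ?_
      refine (norm_fwdDiff_iter_cpow_le (Nat.cast_nonneg q) k (le_of_lt hw1)
        (by linarith)).trans ?_
      have hk' : (2 : ℝ) ≤ k := by exact_mod_cast hk
      have hw3 : 0 < w.re := hw1
      gcongr
      linarith
  have h3 : AnalyticOnNhd ℂ (fun s => ZMod.LFunction (alternatingTwist η) s -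
      (-1 / 2) ^ k * ∑' n : ℕ, (-1) ^ (n + M) * η ((n + M : ℕ) : ZMod q) *
        (fwdDiff (q : ℝ))^[k] (fun y : ℝ => (y : ℂ) ^ (-s)) (n + M : ℕ)) U :=
    (((ZMod.differentiable_LFunction_of_sum_zero
      (sum_alternatingTwist hq η)).differentiableOn).sub (h2.const_mul _)).analyticOnNhd hUo
  refine h1.eqOn_of_preconnected_of_eventuallyEq h3 hUc (z₀ := 2) ⟨by simp, ?_⟩ ?_ ⟨hs, ?_⟩
  · simp
    linarith [norm_nonneg s]
  · filter_upwards [(isOpen_lt continuous_const Complex.continuous_re).mem_nhds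
      (by simp : (1 : ℝ) < (2 : ℂ).re)] with s hs
    exact halfAverage_iter_alternatingSum_of_one_lt_re hq η k M hs
  · simp

theorem norm_LFunction_sq_le_sum_alternatingSum {q : ℕ} [NeZero q] (hq : Odd q)
    (η : DirichletCharacter ℂ q) {k : ℕ} (hk : 2 ≤ k) {M : ℕ} (hM : 0 < M) (t : ℝ) :
    ‖η.LFunction (1 / 2 + t * Complex.I)‖ ^ 2 ≤
      12 * (∑ i ∈ Finset.range (k + 1),
          ‖alternatingSum η 1 (M + i * q) (1 / 2 + t * Complex.I)‖ ^ 2 +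
        (2 * ((|t| + k + 1) ^ k * q ^ k) * (M : ℝ) ^ (2 - k : ℝ)) ^ 2) := by
  set s : ℂ := 1 / 2 + t * Complex.I with hs
  have hs1 : s.re = 1 / 2 := by simp [hs]
  have hs2 : ‖s‖ ≤ |t| + 1 := by
    refine (norm_add_le _ _).trans ?_
    rw [norm_mul, Complex.norm_I, mul_one, Complex.norm_real, Real.norm_eq_abs]
    norm_num
    linarith
  have h1 := halfAverage_iter_alternatingSum hq η hk hM (by rw [hs1]; norm_num : 0 < s.re)
  set A := (halfAverage q)^[k] (fun M => alternatingSum η 1 M s) M with hA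
  set R := ∑' n : ℕ, (-1) ^ (n + M) * η ((n + M : ℕ) : ZMod q) *
        (fwdDiff (q : ℝ))^[k] (fun y : ℝ => (y : ℂ) ^ (-s)) (n + M : ℕ) with hR
  have h2 : ‖R‖ ≤ 2 * ((|t| + k + 1) ^ k * q ^ k) * (M : ℝ) ^ (2 - k : ℝ) := by
    refine tsum_norm_le_of_le_rpow (by exact_mod_cast hk) (by positivity) hM fun n => ?_
    have hn : (1 : ℝ) ≤ (n + M : ℕ) := by exact_mod_cast (by omega : 1 ≤ n + M)
    rw [norm_mul]
    refine (mul_le_of_le_one_left (norm_nonneg _) (norm_neg_one_pow_mul_le η (n + M))).trans ?_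
    refine (norm_fwdDiff_iter_cpow_le (Nat.cast_nonneg q) k (by rw [hs1]; norm_num)
      (by linarith)).trans ?_
    have h3 : (‖s‖ + k) ^ k ≤ (|t| + k + 1) ^ k :=
      pow_le_pow_left₀ (by positivity) (by linarith) k
    have h4 : ((n + M : ℕ) : ℝ) ^ (-s.re - k) ≤ ((n + M : ℕ) : ℝ) ^ (-(k : ℝ)) :=
      Real.rpow_le_rpow_of_exponent_le hn (by rw [hs1]; linarith)
    exact mul_le_mul (mul_le_mul_of_nonneg_right h3 (by positivity)) h4 (by positivity)
      (by positivity)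
  have h3 : ZMod.LFunction (alternatingTwist η) s = A + (-1 / 2) ^ k * R := by
    rw [h1]
    ring
  have h4 : ‖(-1 / 2 : ℂ) ^ k * R‖ ≤ ‖R‖ := by
    rw [norm_mul]
    refine mul_le_of_le_one_left (norm_nonneg _) ?_
    rw [norm_pow]
    exact pow_le_one₀ (norm_nonneg _) (by norm_num)
  have h5 := norm_LFunction_sq_le hq η t
  have h6 := norm_halfAverage_iter_sq_le q (fun M => alternatingSum η 1 M s) k M
  have h7 : ‖ZMod.LFunction (alternatingTwist η) s‖ ≤ ‖A‖ + ‖R‖ := by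
    rw [h3]
    exact (norm_add_le _ _).trans (by linarith)
  have h8 := pow_le_pow_left₀ (norm_nonneg _) h7 2
  have h9 := pow_le_pow_left₀ (norm_nonneg _) h2 2
  have h10 : (‖A‖ + ‖R‖) ^ 2 ≤ 2 * (‖A‖ ^ 2 + ‖R‖ ^ 2) := by
    nlinarith [sq_nonneg (‖A‖ - ‖R‖)]
  linarith

theorem mul_pow_rpow_le {K X η : ℝ} (hK : 1 ≤ K) (hX : 1 ≤ X) (hη1 : η ≤ 1) (a b : ℕ) :
    (K ^ a * X ^ b) ^ η ≤ K ^ a * (X ^ η) ^ b := by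
  have hK0 : (1 : ℝ) ≤ K ^ a := one_le_pow₀ hK
  have h1 : (X ^ b) ^ η = (X ^ η) ^ b := by
    rw [← Real.rpow_natCast, ← Real.rpow_mul (by linarith), mul_comm, Real.rpow_mul (by linarith),
      Real.rpow_natCast]
  rw [Real.mul_rpow (by linarith) (by positivity), h1]
  refine mul_le_mul_of_nonneg_right ?_ (by positivity)
  simpa using Real.rpow_le_rpow_of_exponent_le hK0 hη1

theorem one_add_log_le_mul_rpow {K X η x : ℝ} (hK : 1 ≤ K) (hX : 1 ≤ X) (hη : 0 < η) (hη1 : η ≤ 1)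
    (a b : ℕ) (hx0 : 0 ≤ x) (hx : x ≤ K ^ a * X ^ b) :
    1 + Real.log x ≤ (1 + K ^ a / η) * (X ^ η) ^ b := by
  have hu : 1 ≤ (X ^ η) ^ b := one_le_pow₀ (Real.one_le_rpow hX hη.le)
  have h1 : Real.log x ≤ K ^ a / η * (X ^ η) ^ b := by
    refine (Real.log_le_rpow_div hx0 hη).trans ?_
    rw [div_mul_eq_mul_div]
    refine div_le_div_of_nonneg_right ?_ hη.le
    exact (Real.rpow_le_rpow hx0 hx hη.le).trans (mul_pow_rpow_le hK hX hη1 a b)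
  linarith

theorem Nat.log_two_add_one_le (n : ℕ) : ((Nat.log 2 n : ℕ) : ℝ) + 1 ≤ 2 * (1 + Real.log n) := by
  rcases n.eq_zero_or_pos with rfl | hn
  · norm_num
  have h1 : ((Nat.log 2 n : ℕ) : ℝ) ≤ Real.logb 2 n := by
    have := Real.natLog_le_logb n 2
    simpa using this
  have h2 : Real.logb 2 n ≤ 2 * Real.log n := by
    rw [Real.logb, div_le_iff₀ (Real.log_pos (by norm_num))]
    have h3 : 0 ≤ Real.log n := Real.log_nonneg (by exact_mod_cast hn)
    have h4 : (1 / 2 : ℝ) ≤ Real.log 2 := by linarith [Real.log_two_gt_d9]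
    nlinarith
  linarith

theorem mul_exp_neg_sq_div_le {Y : ℝ} (hY : 1 ≤ Y) (m : ℕ) :
    Y ^ m * Real.exp (-Y ^ 2 / 16) ≤ 16 ^ m * m.factorial := by
  have h1 := Real.pow_div_factorial_le_exp (Y ^ 2 / 16) (by positivity) m
  have h2 : Y ^ m ≤ (Y ^ 2) ^ m := pow_le_pow_left₀ (by linarith) (by nlinarith) m
  rw [neg_div, Real.exp_neg, ← div_eq_mul_inv, div_le_iff₀ (Real.exp_pos _)]
  rw [div_pow, div_div, div_le_iff₀ (by positivity)] at h1
  linarith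

theorem exists_block_le {η : ℝ} (hη : 0 < η) (hη1 : η ≤ 1) {k : ℕ} (hk : 1 ≤ η * k) :
    ∃ C : ℝ, 0 ≤ C ∧ ∀ {q q₀ r : ℕ} [NeZero q] (_ : Odd q) (_ : q₀ * r = q) (h : q₀ ∣ q)
      {χ : DirichletCharacter ℂ q} (_ : IsLocallyPrimitive χ) {T T₀ : ℝ} (_ : 1 ≤ T₀) (_ : T₀ ≤ T)
      {N v : ℕ} (_ : 0 < N) (_ : v ≤ 2 * N)
      (_ : N ≤ q * T * ((k + 2) * (q * T : ℝ) ^ η)),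
      ∑ ψ : DirichletCharacter ℂ q₀, ∫ t in T..(T + T₀),
        ‖alternatingSum (χ * DirichletCharacter.changeLevel h ψ) N v
          (1 / 2 + t * Complex.I)‖ ^ 2 ≤
        C * ((q * T : ℝ) ^ η) ^ 11 * ((T₀ + √(T / T₀)) * (q₀ + √r)) := by
  obtain ⟨Cd, hCd1, hCd⟩ := exists_card_divisors_le_rpow hη
  set K : ℝ := k + 2 with hK
  have hK1 : 1 ≤ K := by
    have : (0 : ℝ) ≤ k := Nat.cast_nonneg k
    linarith
  set CE : ℝ := 16 ^ (k + 1) * (k + 1).factorial with hCE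
  set c₁ := 1 + K ^ 2 / η with hc₁
  set c₂ := 2 * (1 + K ^ 0 / η) with hc₂
  have hc₁0 : 0 ≤ c₁ := by positivity
  have hc₂0 : 0 ≤ c₂ := by positivity
  refine ⟨5 * (1 + 4 * CE) + 30000 * K ^ 2 * (Cd * c₁ + c₂ * (Cd ^ 4 * (Cd * K ^ 2))),
    by positivity, ?_⟩
  intro q q₀ r _ hq hqr h χ hχ T T₀ hT₀ hT N v hN hv hNX
  have hq0 : 0 < q := NeZero.pos q
  have hq₀ : 0 < q₀ := Nat.pos_of_ne_zero (by rintro rfl; omega)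
  have hr : 0 < r := Nat.pos_of_ne_zero (by rintro rfl; omega)
  have hq1 : (1 : ℝ) ≤ q := by exact_mod_cast hq0
  have hq₀1 : (1 : ℝ) ≤ q₀ := by exact_mod_cast hq₀
  have hT1 : 1 ≤ T := hT₀.trans hT
  set X : ℝ := q * T with hX
  have hX1 : 1 ≤ X := one_le_mul_of_one_le_of_one_le hq1 hT1
  have hqX : (q : ℝ) ≤ X := le_mul_of_one_le_right (by linarith) hT1
  set u := X ^ η with hu
  have hu1 : 1 ≤ u := Real.one_le_rpow hX1 hη.le
  have huX : u ≤ X := by simpa using Real.rpow_le_rpow_of_exponent_le hX1 hη1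
  set Y := K * u with hY
  have hY1 : 1 ≤ Y := one_le_mul_of_one_le_of_one_le hK1 hu1
  have hYX : Y ≤ K * X := mul_le_mul_of_nonneg_left huX (by linarith)
  have hTq : 1 ≤ T₀ * q₀ := one_le_mul_of_one_le_of_one_le hT₀ hq₀1
  set L := ⌊N * Y / (T₀ * q₀)⌋₊ with hL
  have hNY0 : 0 ≤ N * Y := by positivity
  have hL1 : L * T₀ * q₀ ≤ N * Y := by
    have := Nat.floor_le (by positivity : 0 ≤ N * Y / (T₀ * q₀))
    rw [le_div_iff₀ (by linarith)] at this
    rw [mul_assoc]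
    exact this
  have hL2 : N * Y ≤ (L + 1) * T₀ * q₀ := by
    have := (Nat.lt_floor_add_one (N * Y / (T₀ * q₀))).le
    rw [div_le_iff₀ (by linarith)] at this
    rw [mul_assoc]
    exact this
  have hL3 : (L : ℝ) ≤ K ^ 2 * X ^ 3 := by
    have h1 : (L : ℝ) ≤ N * Y := by
      refine le_trans ?_ hL1
      rw [mul_assoc]
      exact le_mul_of_one_le_right (Nat.cast_nonneg _) hTq
    calc (L : ℝ) ≤ N * Y := h1
      _ ≤ X * (K * X) * (K * X) := by gcongr; exact hNX.trans (by gcongr)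
      _ = _ := by ring
  set W := ⌊Cd * (K ^ 2 * X ^ 4) ^ η⌋₊ with hW
  have hW1 : ∀ x, 0 < x → x ≤ L * q → x.divisors.card ≤ W := by
    intro x hx hxL
    refine Nat.le_floor ((hCd x hx).trans ?_)
    refine mul_le_mul_of_nonneg_left (Real.rpow_le_rpow (Nat.cast_nonneg _) ?_ hη.le) (by linarith)
    have h1 : (x : ℝ) ≤ L * q := by exact_mod_cast hxL
    calc (x : ℝ) ≤ L * q := h1
      _ ≤ K ^ 2 * X ^ 3 * X := by gcongr
      _ = _ := by ring
  have hW2 : (W : ℝ) ≤ Cd * K ^ 2 * u ^ 4 := by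
    refine (Nat.floor_le (by positivity)).trans ?_
    rw [mul_assoc]
    exact mul_le_mul_of_nonneg_left (mul_pow_rpow_le hK1 hX1 hη1 2 4) (by linarith)
  have hdiv : ∀ n : ℕ, 0 < n → n ≤ q → (n.divisors.card : ℝ) ≤ Cd * u := by
    intro n hn hnq
    refine (hCd n hn).trans (mul_le_mul_of_nonneg_left ?_ (by linarith))
    refine Real.rpow_le_rpow (Nat.cast_nonneg _) ?_ hη.le
    have : (n : ℝ) ≤ q := by exact_mod_cast hnq
    linarith
  have hlogL : 1 + Real.log L ≤ c₁ * u ^ 3 :=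
    one_add_log_le_mul_rpow hK1 hX1 hη hη1 2 3 (Nat.cast_nonneg _) hL3
  have hlogq : (Nat.log 2 q : ℝ) + 1 ≤ c₂ * u := by
    refine (Nat.log_two_add_one_le q).trans ?_
    have := one_add_log_le_mul_rpow hK1 hX1 hη hη1 0 1 (Nat.cast_nonneg q) (by simpa using hqX)
    rw [pow_one] at this
    rw [hc₂, mul_assoc]
    linarith
  have hE : N * Real.exp (-Y ^ 2 / 16) ≤ CE := by
    refine le_trans ?_ (mul_exp_neg_sq_div_le hY1 (k + 1))
    refine mul_le_mul_of_nonneg_right ?_ (Real.exp_pos _).le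
    have h1 : X ≤ Y ^ k := by
      have h2 : X ≤ u ^ k := by
        rw [hu, ← Real.rpow_natCast, ← Real.rpow_mul (by linarith)]
        simpa using Real.rpow_le_rpow_of_exponent_le hX1 hk
      refine h2.trans (pow_le_pow_left₀ (by linarith) ?_ k)
      exact le_mul_of_one_le_left (by linarith) hK1
    rw [pow_succ]
    exact hNX.trans (mul_le_mul_of_nonneg_right h1 (by linarith))
  have hmain := sum_integral_alternatingSum_le hq hqr h hχ (by linarith : 0 < T₀)
    (by linarith : 0 < T) (by linarith : 0 ≤ Y) hN hv hL2
  have hbd := mul_sum_twistedCorrelationBound_le hq hqr hχ hW1 hT₀ hT hY1 hN hNX hL1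
  set D := (T₀ + √(T / T₀)) * (q₀ + √r) with hD
  have hTD : T₀ * q₀ ≤ D :=
    mul_le_mul (le_add_of_nonneg_right (Real.sqrt_nonneg _))
      (le_add_of_nonneg_right (Real.sqrt_nonneg _)) (by linarith) (by positivity)
  have hD0 : 0 ≤ D := by linarith
  refine hmain.trans ((add_le_add_right (mul_le_mul_of_nonneg_left hbd (by norm_num)) _).trans ?_)
  have hlogL0 : 0 ≤ 1 + Real.log L := by
    have : 0 ≤ Real.log L := Real.log_natCast_nonneg L
    linarith
  have hr1 := hdiv r hr (Nat.le_of_dvd hq0 (Dvd.intro_left q₀ hqr))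
  have hq2 := hdiv q hq0 le_rfl
  have h1 : r.divisors.card * (1 + Real.log L) ≤ Cd * c₁ * u ^ 9 := by
    calc r.divisors.card * (1 + Real.log L) ≤ Cd * u * (c₁ * u ^ 3) :=
          mul_le_mul hr1 hlogL hlogL0 (by positivity)
      _ = Cd * c₁ * u ^ 4 := by ring
      _ ≤ _ := mul_le_mul_of_nonneg_left (pow_le_pow_right₀ hu1 (by norm_num)) (by positivity)
  have h2 : (Nat.log 2 q + 1) * ((q.divisors.card : ℝ) ^ 4 * W) ≤
      c₂ * (Cd ^ 4 * (Cd * K ^ 2)) * u ^ 9 := by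
    calc (Nat.log 2 q + 1) * ((q.divisors.card : ℝ) ^ 4 * W) ≤
          (c₂ * u) * ((Cd * u) ^ 4 * (Cd * K ^ 2 * u ^ 4)) :=
          mul_le_mul hlogq (mul_le_mul (pow_le_pow_left₀ (Nat.cast_nonneg _) hq2 4) hW2
            (Nat.cast_nonneg _) (by positivity)) (by positivity) (by positivity)
      _ = _ := by ring
  have h3 : T₀ * q₀ * (1 + 4 * (N * Real.exp (-Y ^ 2 / 16))) ≤ (1 + 4 * CE) * u ^ 11 * D := by
    have h4 : 1 + 4 * (N * Real.exp (-Y ^ 2 / 16)) ≤ (1 + 4 * CE) * u ^ 11 := by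
      have h5 : (1 : ℝ) ≤ u ^ 11 := one_le_pow₀ hu1
      refine le_trans (by linarith) (le_mul_of_one_le_right (by positivity) h5)
    rw [mul_comm]
    exact mul_le_mul h4 hTD (by linarith) (by positivity)
  calc _ ≤ 5 * ((1 + 4 * CE) * u ^ 11 * D) + 20 * (1500 * Y ^ 2 *
        (Cd * c₁ * u ^ 9 + c₂ * (Cd ^ 4 * (Cd * K ^ 2)) * u ^ 9) * D) := by
        refine add_le_add (mul_le_mul_of_nonneg_left h3 (by norm_num))
          (mul_le_mul_of_nonneg_left (mul_le_mul_of_nonneg_right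
            (mul_le_mul_of_nonneg_left (add_le_add h1 h2) (by positivity)) hD0) (by norm_num))
    _ = _ := by
        rw [hY]
        ring

theorem alternatingSum_one_eq_sum {q : ℕ} (η : DirichletCharacter ℂ q) {V : ℕ} (hV : 0 < V) (s : ℂ)
    (J : ℕ) : alternatingSum η 1 (min (2 ^ J) V) s =
      ∑ i ∈ Finset.range J, alternatingSum η (min (2 ^ i) V) (min (2 ^ (i + 1)) V) s := by
  have h1 : ∀ i : ℕ, 1 ≤ min (2 ^ i) V := fun i => le_min Nat.one_le_two_pow hV
  induction J with
  | zero =>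
    simp [alternatingSum]
  | succ J ih =>
    rw [Finset.sum_range_succ, ← ih]
    unfold alternatingSum
    exact (Finset.sum_Ico_consecutive _ (h1 J) (min_le_min_right V
      (Nat.pow_le_pow_right two_pos J.le_succ))).symm

theorem norm_alternatingSum_one_sq_le {q : ℕ} (η : DirichletCharacter ℂ q) {V : ℕ} (hV : 0 < V)
    (s : ℂ) : ‖alternatingSum η 1 V s‖ ^ 2 ≤ (Nat.log 2 V + 1 : ℕ) *
      ∑ i ∈ Finset.range (Nat.log 2 V + 1),
        ‖alternatingSum η (2 ^ i) (min (2 ^ (i + 1)) V) s‖ ^ 2 := by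
  have h1 := alternatingSum_one_eq_sum η hV s (Nat.log 2 V + 1)
  rw [min_eq_right (Nat.lt_pow_succ_log_self one_lt_two V).le] at h1
  have h2 : alternatingSum η 1 V s = ∑ i ∈ Finset.range (Nat.log 2 V + 1),
      alternatingSum η (2 ^ i) (min (2 ^ (i + 1)) V) s := by
    rw [h1]
    refine Finset.sum_congr rfl fun i hi => ?_
    rw [min_eq_left ((Nat.pow_le_pow_right two_pos
      (Nat.lt_succ_iff.1 (Finset.mem_range.1 hi))).trans (Nat.pow_log_le_self 2 hV.ne'))]
  rw [h2]
  refine (pow_le_pow_left₀ (norm_nonneg _) (norm_sum_le _ _) 2).trans ?_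
  have h3 := sq_sum_le_card_mul_sum_sq (s := Finset.range (Nat.log 2 V + 1))
    (f := fun i => ‖alternatingSum η (2 ^ i) (min (2 ^ (i + 1)) V) s‖)
  rwa [Finset.card_range] at h3

theorem continuous_norm_alternatingSum_sq {q : ℕ} (η : DirichletCharacter ℂ q) {u : ℕ}
    (hu : 0 < u) (v : ℕ) :
    Continuous fun t : ℝ => ‖alternatingSum η u v (1 / 2 + t * Complex.I)‖ ^ 2 := by
  have h1 := (differentiable_alternatingSum η hu v).continuous
  have h2 : Continuous fun t : ℝ => (1 / 2 + t * Complex.I : ℂ) := by fun_prop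
  exact (h1.comp h2).norm.pow 2

theorem continuous_norm_LFunction_sq {q : ℕ} [NeZero q] (η : DirichletCharacter ℂ q) :
    Continuous fun t : ℝ => ‖η.LFunction (1 / 2 + t * Complex.I)‖ ^ 2 := by
  have h2 : Continuous fun t : ℝ => (1 / 2 + t * Complex.I : ℂ) := by fun_prop
  refine Continuous.pow (Continuous.norm ?_) 2
  refine continuous_iff_continuousAt.2 fun t => ?_
  exact ContinuousAt.comp (f := fun t : ℝ => (1 / 2 + t * Complex.I : ℂ))
    (DirichletCharacter.differentiableAt_LFunction η _
      (Or.inl (half_add_mul_I_ne_one t))).continuousAt h2.continuousAt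

theorem sum_integral_alternatingSum_one_le {ι : Type*} [Fintype ι] {q : ℕ}
    (η : ι → DirichletCharacter ℂ q) {V : ℕ} (hV : 0 < V) {a b B : ℝ} (hab : a ≤ b)
    (hB : ∀ i ≤ Nat.log 2 V, ∑ j, ∫ t in a..b, ‖alternatingSum (η j) (2 ^ i)
      (min (2 ^ (i + 1)) V) (1 / 2 + t * Complex.I)‖ ^ 2 ≤ B) :
    ∑ j, ∫ t in a..b, ‖alternatingSum (η j) 1 V (1 / 2 + t * Complex.I)‖ ^ 2 ≤
      (Nat.log 2 V + 1 : ℕ) * ((Nat.log 2 V + 1 : ℕ) * B) := by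
  have hc : ∀ j (i : ℕ), Continuous fun t : ℝ => ‖alternatingSum (η j) (2 ^ i)
      (min (2 ^ (i + 1)) V) (1 / 2 + t * Complex.I)‖ ^ 2 := fun j i =>
    continuous_norm_alternatingSum_sq _ (Nat.two_pow_pos i) _
  have h1 : ∀ j, ∫ t in a..b, ‖alternatingSum (η j) 1 V (1 / 2 + t * Complex.I)‖ ^ 2 ≤
      (Nat.log 2 V + 1 : ℕ) * ∑ i ∈ Finset.range (Nat.log 2 V + 1), ∫ t in a..b,
        ‖alternatingSum (η j) (2 ^ i) (min (2 ^ (i + 1)) V) (1 / 2 + t * Complex.I)‖ ^ 2 := by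
    intro j
    rw [← intervalIntegral.integral_finsetSum fun i _ => (hc j i).intervalIntegrable a b,
      ← intervalIntegral.integral_const_mul]
    refine intervalIntegral.integral_mono_on hab
      ((continuous_norm_alternatingSum_sq _ one_pos _).intervalIntegrable a b)
      ((continuous_const.mul (continuous_finsetSum _ fun i _ => hc j i)).intervalIntegrable a b)
      fun t _ => norm_alternatingSum_one_sq_le _ hV _
  refine (Finset.sum_le_sum fun j _ => h1 j).trans ?_
  rw [← Finset.mul_sum, Finset.sum_comm]
  refine mul_le_mul_of_nonneg_left ?_ (Nat.cast_nonneg _)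
  refine (Finset.sum_le_card_nsmul _ _ B fun i hi =>
    hB i (Nat.lt_succ_iff.1 (Finset.mem_range.1 hi))).trans (le_of_eq ?_)
  rw [Finset.card_range, nsmul_eq_mul]

theorem truncation_error_le {X u A : ℝ} {k M : ℕ} (hk : 2 ≤ k) (hX : 1 ≤ X) (hu : 1 ≤ u)
    (hM : X * u ≤ M) (huk : (X * u) ^ 2 ≤ u ^ k) (hA0 : 0 ≤ A) :
    2 * (A ^ k * X ^ k) * (M : ℝ) ^ (2 - k : ℝ) ≤ 2 * A ^ k := by
  have hXu : 1 ≤ X * u := one_le_mul_of_one_le_of_one_le hX hu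
  have h1 : (M : ℝ) ^ (2 - k : ℝ) ≤ (X * u) ^ (2 - k : ℝ) := by
    refine Real.rpow_le_rpow_of_nonpos (by linarith) hM ?_
    have : (2 : ℝ) ≤ k := by exact_mod_cast hk
    linarith
  have h2 : X ^ k * (M : ℝ) ^ (2 - k : ℝ) ≤ 1 := by
    refine (mul_le_mul_of_nonneg_left h1 (by positivity)).trans ?_
    rw [Real.rpow_sub (by linarith), Real.rpow_natCast, Real.rpow_ofNat, mul_pow X u k,
      ← mul_div_assoc, div_le_one (by positivity)]
    exact mul_le_mul_of_nonneg_left huk (by positivity)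
  calc _ = 2 * A ^ k * (X ^ k * (M : ℝ) ^ (2 - k : ℝ)) := by ring
    _ ≤ _ := mul_le_of_le_one_right (by positivity) h2

theorem exists_sum_integral_LFunction_le {η : ℝ} (hη : 0 < η) (hη1 : η ≤ 1) :
    ∃ C : ℝ, 0 < C ∧ ∀ {q q₀ r : ℕ} [NeZero q] (_ : Odd q) (_ : q₀ * r = q) (h : q₀ ∣ q)
      {χ : DirichletCharacter ℂ q} (_ : IsLocallyPrimitive χ) {T T₀ : ℝ} (_ : 1 ≤ T₀) (_ : T₀ ≤ T),
      ∑ ψ : DirichletCharacter ℂ q₀, ∫ t in T..(T + T₀),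
        ‖(χ * DirichletCharacter.changeLevel h ψ).LFunction (1 / 2 + t * Complex.I)‖ ^ 2 ≤
        C * ((q * T : ℝ) ^ η) ^ 15 * ((T₀ + √(T / T₀)) * (q₀ + √r)) := by
  set k := ⌈4 / η⌉₊ with hkdef
  have hηk : 4 ≤ η * k := by
    have := Nat.le_ceil (4 / η)
    rw [div_le_iff₀ hη] at this
    linarith
  have hk4 : (4 : ℝ) ≤ k := by
    refine hηk.trans (mul_le_of_le_one_left (Nat.cast_nonneg _) hη1)
  have hk : 2 ≤ k := by
    have : 4 ≤ k := by exact_mod_cast hk4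
    omega
  obtain ⟨CB, hCB0, hCB⟩ := exists_block_le hη hη1 (by linarith : 1 ≤ η * k)
  set K : ℝ := k + 2 with hK
  have hK1 : 1 ≤ K := by linarith
  set c := 2 * (1 + K ^ 1 / η) with hc
  have hc0 : 0 ≤ c := by positivity
  set R := 2 * (k + 3 : ℝ) ^ k with hR
  refine ⟨12 * ((k + 1) * (c * (c * CB)) + R ^ 2), by positivity, ?_⟩
  intro q q₀ r _ hq hqr h χ hχ T T₀ hT₀ hT
  have hq0 : 0 < q := NeZero.pos q
  have hq₀ : 0 < q₀ := Nat.pos_of_ne_zero (by rintro rfl; omega)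
  have : NeZero q₀ := ⟨hq₀.ne'⟩
  have hq1 : (1 : ℝ) ≤ q := by exact_mod_cast hq0
  have hT1 : 1 ≤ T := hT₀.trans hT
  set X : ℝ := q * T with hX
  have hX1 : 1 ≤ X := one_le_mul_of_one_le_of_one_le hq1 hT1
  have hqX : (q : ℝ) ≤ X := le_mul_of_one_le_right (by linarith) hT1
  set u := X ^ η with hu
  have hu1 : 1 ≤ u := Real.one_le_rpow hX1 hη.le
  have huX : u ≤ X := by simpa using Real.rpow_le_rpow_of_exponent_le hX1 hη1
  have hXu : 1 ≤ X * u := one_le_mul_of_one_le_of_one_le hX1 hu1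
  set D := (T₀ + √(T / T₀)) * (q₀ + √r) with hD
  have hTD : T₀ * q₀ ≤ D :=
    mul_le_mul (le_add_of_nonneg_right (Real.sqrt_nonneg _))
      (le_add_of_nonneg_right (Real.sqrt_nonneg _)) (Nat.cast_nonneg _) (by positivity)
  have hD0 : 0 ≤ D := le_trans (by positivity) hTD
  set M := ⌈X * u⌉₊ with hM
  have hM1 : X * u ≤ M := Nat.le_ceil _
  have hM2 : (M : ℝ) ≤ X * u + 1 := (Nat.ceil_lt_add_one (by linarith)).le
  have hM0 : 0 < M := by
    have : (0 : ℝ) < M := by linarith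
    exact_mod_cast this
  have huk : (X * u) ^ 2 ≤ u ^ k := by
    have h1 : X ^ 4 ≤ u ^ k := by
      rw [hu, ← Real.rpow_natCast X 4, ← Real.rpow_natCast, ← Real.rpow_mul (by linarith)]
      exact Real.rpow_le_rpow_of_exponent_le hX1 (by exact_mod_cast hηk)
    refine le_trans ?_ h1
    calc (X * u) ^ 2 ≤ (X * X) ^ 2 := by gcongr
      _ = _ := by ring
  have hV : ∀ i ≤ k, ((M + i * q : ℕ) : ℝ) ≤ X * (K * u) := by
    intro i hi
    have h1 : (i : ℝ) ≤ k := by exact_mod_cast hi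
    have h2 : (i : ℝ) * q ≤ k * (X * u) :=
      mul_le_mul h1 (hqX.trans (le_mul_of_one_le_right (by linarith) hu1)) (by linarith)
        (by linarith)
    push_cast
    calc (M : ℝ) + i * q ≤ (X * u + 1) + k * (X * u) := add_le_add hM2 h2
      _ ≤ (X * u + X * u) + k * (X * u) := by linarith
      _ = _ := by rw [hK]; ring
  have hS : ∀ i ≤ k, ∑ ψ : DirichletCharacter ℂ q₀, ∫ t in T..(T + T₀),
      ‖alternatingSum (χ * DirichletCharacter.changeLevel h ψ) 1 (M + i * q)
        (1 / 2 + t * Complex.I)‖ ^ 2 ≤ c * (c * CB) * (u ^ 15 * D) := by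
    intro i hi
    have hV0 : 0 < M + i * q := by omega
    have hVi := hV i hi
    have h1 := sum_integral_alternatingSum_one_le
      (fun ψ : DirichletCharacter ℂ q₀ => χ * DirichletCharacter.changeLevel h ψ) hV0
      (by linarith : T ≤ T + T₀) (B := CB * u ^ 11 * D) fun j hj => by
        refine hCB hq hqr h hχ hT₀ hT (Nat.two_pow_pos j) ?_ ?_
        · refine (min_le_left _ _).trans (le_of_eq ?_)
          rw [pow_succ, mul_comm]
        · refine le_trans ?_ hVi
          exact_mod_cast (Nat.pow_le_pow_right two_pos hj).trans (Nat.pow_log_le_self 2 hV0.ne')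
    have hJ : ((Nat.log 2 (M + i * q) + 1 : ℕ) : ℝ) ≤ c * u ^ 2 := by
      rw [Nat.cast_add_one]
      refine (Nat.log_two_add_one_le _).trans ?_
      have := one_add_log_le_mul_rpow hK1 hX1 hη hη1 1 2 (Nat.cast_nonneg (M + i * q))
        (hVi.trans (le_of_le_of_eq (mul_le_mul_of_nonneg_left
          (mul_le_mul_of_nonneg_left huX (by linarith)) (by linarith)) (by ring)))
      rw [hc, mul_assoc]
      linarith
    refine h1.trans ?_
    calc _ ≤ (c * u ^ 2) * ((c * u ^ 2) * (CB * u ^ 11 * D)) :=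
          mul_le_mul hJ (mul_le_mul_of_nonneg_right hJ (by positivity)) (by positivity)
            (by positivity)
      _ = _ := by ring
  have hpt : ∀ ψ : DirichletCharacter ℂ q₀, ∫ t in T..(T + T₀),
      ‖(χ * DirichletCharacter.changeLevel h ψ).LFunction (1 / 2 + t * Complex.I)‖ ^ 2 ≤
      12 * ((∑ i ∈ Finset.range (k + 1), ∫ t in T..(T + T₀),
        ‖alternatingSum (χ * DirichletCharacter.changeLevel h ψ) 1 (M + i * q)
          (1 / 2 + t * Complex.I)‖ ^ 2) + T₀ * R ^ 2) := by
    intro ψ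
    have hcont : ∀ i : ℕ, Continuous fun t : ℝ =>
        ‖alternatingSum (χ * DirichletCharacter.changeLevel h ψ) 1 (M + i * q)
          (1 / 2 + t * Complex.I)‖ ^ 2 := fun i => continuous_norm_alternatingSum_sq _ one_pos _
    have hconts : Continuous fun t : ℝ => ∑ i ∈ Finset.range (k + 1),
        ‖alternatingSum (χ * DirichletCharacter.changeLevel h ψ) 1 (M + i * q)
          (1 / 2 + t * Complex.I)‖ ^ 2 := continuous_finsetSum _ fun i _ => hcont i
    have h1 : T₀ * R ^ 2 = ∫ _ in T..(T + T₀), R ^ 2 := by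
      rw [intervalIntegral.integral_const, add_sub_cancel_left, smul_eq_mul]
    rw [h1, ← intervalIntegral.integral_finsetSum fun i _ => (hcont i).intervalIntegrable _ _,
      ← intervalIntegral.integral_add (hconts.intervalIntegrable _ _)
        (continuous_const.intervalIntegrable _ _), ← intervalIntegral.integral_const_mul]
    refine intervalIntegral.integral_mono_on (by linarith)
      ((continuous_norm_LFunction_sq _).intervalIntegrable _ _)
      ((continuous_const.mul (hconts.add continuous_const)).intervalIntegrable _ _) fun t ht => ?_
    refine (norm_LFunction_sq_le_sum_alternatingSum hq _ hk hM0 t).trans ?_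
    have h2 : 2 * ((|t| + k + 1) ^ k * (q : ℝ) ^ k) * (M : ℝ) ^ (2 - k : ℝ) ≤ R := by
      refine le_trans ?_ (truncation_error_le hk hX1 hu1 hM1 huk (by positivity : 0 ≤ (k + 3 : ℝ)))
      refine mul_le_mul_of_nonneg_right (mul_le_mul_of_nonneg_left ?_ zero_le_two) (by positivity)
      rw [← mul_pow, ← mul_pow]
      refine pow_le_pow_left₀ (by positivity) ?_ k
      have h3 : |t| ≤ 2 * T := by
        rw [abs_of_nonneg (by linarith [ht.1])]
        linarith [ht.2]
      have h4 : |t| + k + 1 ≤ (k + 3) * T := by nlinarith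
      calc (|t| + k + 1) * q ≤ ((k + 3) * T) * q := mul_le_mul_of_nonneg_right h4 (by linarith)
        _ = _ := by rw [hX]; ring
    have h3 := pow_le_pow_left₀ (by positivity) h2 2
    linarith
  have hcard : (Fintype.card (DirichletCharacter ℂ q₀) : ℝ) ≤ q₀ := by
    rw [← Nat.card_eq_fintype_card, DirichletCharacter.card_eq_totient_of_hasEnoughRootsOfUnity]
    exact_mod_cast Nat.totient_le q₀
  refine (Finset.sum_le_sum fun ψ _ => hpt ψ).trans ?_
  rw [← Finset.mul_sum, Finset.sum_add_distrib, Finset.sum_comm, Finset.sum_const,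
    Finset.card_univ, nsmul_eq_mul]
  have h1 : ∑ i ∈ Finset.range (k + 1), ∑ ψ : DirichletCharacter ℂ q₀, ∫ t in T..(T + T₀),
      ‖alternatingSum (χ * DirichletCharacter.changeLevel h ψ) 1 (M + i * q)
        (1 / 2 + t * Complex.I)‖ ^ 2 ≤ (k + 1) * (c * (c * CB) * (u ^ 15 * D)) := by
    refine (Finset.sum_le_card_nsmul _ _ _ fun i hi =>
      hS i (Nat.lt_succ_iff.1 (Finset.mem_range.1 hi))).trans (le_of_eq ?_)
    rw [Finset.card_range, nsmul_eq_mul]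
    push_cast
    ring
  have h2 : Fintype.card (DirichletCharacter ℂ q₀) * (T₀ * R ^ 2) ≤ R ^ 2 * (u ^ 15 * D) := by
    calc _ ≤ q₀ * (T₀ * R ^ 2) := mul_le_mul_of_nonneg_right hcard (by positivity)
      _ = R ^ 2 * (T₀ * q₀) := by ring
      _ ≤ R ^ 2 * (u ^ 15 * D) := by
        refine mul_le_mul_of_nonneg_left (hTD.trans ?_) (by positivity)
        exact le_mul_of_one_le_left hD0 (one_le_pow₀ hu1)
  calc _ ≤ 12 * ((k + 1) * (c * (c * CB) * (u ^ 15 * D)) + R ^ 2 * (u ^ 15 * D)) :=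
        mul_le_mul_of_nonneg_left (add_le_add h1 h2) (by norm_num)
    _ = _ := by ring

theorem Real.rpow_neg_half_mul_rpow_half {a b : ℝ} (ha : 0 ≤ a) (hb : 0 ≤ b) :
    a ^ (-(1 / 2 : ℝ)) * b ^ (1 / 2 : ℝ) = √(b / a) := by
  rw [Real.rpow_neg ha, ← Real.sqrt_eq_rpow, ← Real.sqrt_eq_rpow, Real.sqrt_div hb,
    div_eq_inv_mul]

open Complex MeasureTheory

/-- Hybrid second moment bound for Dirichlet `L`-functions along a coset
(Theorem 1.1, after Heath-Brown). -/
theorem hybrid_second_moment_coset :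
    ∀ ε : ℝ, 0 < ε → ∃ C : ℝ, 0 < C ∧
      ∀ (q q₀ : ℕ) (hq : Odd q) (hq₀ : q₀ ∣ q) (_ : 0 < q₀) (T T₀ : ℝ),
        1 ≤ T₀ → T₀ ≤ T →
        ∀ (χ : DirichletCharacter ℂ q), χ.IsPrimitive →
        haveI : NeZero q := ⟨hq.pos.ne'⟩
        (∫ t in T..(T + T₀), ∑ ψ : DirichletCharacter ℂ q₀,
            ‖(χ * DirichletCharacter.changeLevel hq₀ ψ).LFunction (1 / 2 + t * Complex.I)‖ ^ 2)
          ≤ C * ((q : ℝ) * T) ^ ε * (T₀ + T₀ ^ (-(1 / 2 : ℝ)) * T ^ (1 / 2 : ℝ)) *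
              ((q₀ : ℝ) + (q₀ : ℝ) ^ (-(1 / 2 : ℝ)) * (q : ℝ) ^ (1 / 2 : ℝ)) := by
  intro ε hε
  have hη : 0 < min ε 1 / 15 := by positivity
  have hη1 : min ε 1 / 15 ≤ 1 := by linarith [min_le_right ε 1]
  obtain ⟨C, hC, hbound⟩ := exists_sum_integral_LFunction_le hη hη1
  refine ⟨C, hC, ?_⟩
  intro q q₀ hq hq₀ hq₀0 T T₀ hT₀ hT χ hχ
  have : NeZero q := ⟨hq.pos.ne'⟩
  obtain ⟨r, hr⟩ := hq₀
  have hT1 : 1 ≤ T := hT₀.trans hT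
  have hq1 : (1 : ℝ) ≤ q := by exact_mod_cast hq.pos
  have hX : 1 ≤ (q : ℝ) * T := one_le_mul_of_one_le_of_one_le hq1 hT1
  have h1 := hbound hq hr.symm ⟨r, hr⟩ hχ.isLocallyPrimitive hT₀ hT
  rw [intervalIntegral.integral_finsetSum fun ψ _ =>
    (continuous_norm_LFunction_sq _).intervalIntegrable _ _]
  have h2 : (q : ℝ) / q₀ = r := by
    have : (q₀ : ℝ) ≠ 0 := by exact_mod_cast hq₀0.ne'
    rw [hr]
    push_cast
    field_simp
  have h3 : (((q : ℝ) * T) ^ (min ε 1 / 15)) ^ 15 ≤ ((q : ℝ) * T) ^ ε := by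
    rw [← Real.rpow_natCast, ← Real.rpow_mul (by linarith)]
    refine Real.rpow_le_rpow_of_exponent_le hX ?_
    push_cast
    linarith [min_le_left ε 1]
  rw [Real.rpow_neg_half_mul_rpow_half (by linarith) (by linarith),
    Real.rpow_neg_half_mul_rpow_half (Nat.cast_nonneg _) (Nat.cast_nonneg _), h2,
    mul_assoc _ _ (_ + _)]
  exact h1.trans (mul_le_mul_of_nonneg_right (mul_le_mul_of_nonneg_left h3 hC.le) (by positivity))
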